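/- Let X = A_{l+1} with l ≥ 3, let δ = ω_1 + ω_{l+1}, and let X be embedded in Y = SO(W) = SO_d via W = V_X(δ), where d = (l+2)^2 − 1 (so W is the adjoint module of X). Let λ ≠ 0, λ_1 be a dominant weight for Y. Then V_Y(λ)↓X is multiplicity-free if and only if λ = λ_2, 2λ_1, 3λ_1, or λ_3. -/

import Mathlib

noncomputable section
namespace MFPaper
inductive CType | B | C | D
deriving DecidableEq
abbrev CharRing (k : ℕ) : Type := AddMonoidAlgebra ℤ (Fin k → ℚ)
def mono {k : ℕ} (v : Fin k → ℚ) : CharRing k := AddMonoidAlgebra.single v 1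
def e (n k : ℕ) : Fin n → ℕ := fun i => if (i : ℕ) + 1 = k then 1 else 0
def partLift (r : ℕ) (d : Fin r → ℕ) : Fin (r + 1) → ℚ := fun i =>
  ∑ j ∈ Finset.univ.filter (fun j : Fin r => (i : ℕ) ≤ (j : ℕ)), (d j : ℚ)
def slWt (r : ℕ) (d : Fin r → ℕ) : Fin (r + 1) → ℚ := fun i =>
  partLift r d i - (∑ j : Fin r, (((j : ℕ) : ℚ) + 1) * (d j : ℚ)) / (r + 1)
def rhoA (r : ℕ) : Fin (r + 1) → ℚ := fun i => (r : ℚ) - (i : ℕ)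
def altA (r : ℕ) (v : Fin (r + 1) → ℚ) : CharRing (r + 1) :=
  ∑ σ : Equiv.Perm (Fin (r + 1)),
    ((Equiv.Perm.sign σ : ℤˣ) : ℤ) • mono (fun i => v (σ i))
def IsCharA (r : ℕ) (d : Fin r → ℕ) (f : CharRing (r + 1)) : Prop :=
  altA r (rhoA r) * f = altA r (slWt r d + rhoA r)
def Decomp (r : ℕ) (F : CharRing (r + 1)) (c : (Fin r → ℕ) →₀ ℕ) : Prop :=
  F * altA r (rhoA r) = c.sum fun μ k => (k : ℤ) • altA r (slWt r μ + rhoA r)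
def dimA (r : ℕ) (d : Fin r → ℕ) : ℚ :=
  ∏ p ∈ Finset.univ.filter (fun p : Fin (r + 1) × Fin (r + 1) => (p.1 : ℕ) < (p.2 : ℕ)),
    ((partLift r d p.1 - partLift r d p.2 + ((p.2 : ℕ) : ℚ) - ((p.1 : ℕ) : ℚ)) /
      (((p.2 : ℕ) : ℚ) - ((p.1 : ℕ) : ℚ)))
def IsSympWt (r : ℕ) (d : Fin r → ℕ) : Prop :=
  Odd (∑ i : Fin r, d i * ((i : ℕ) + 1) * (r - (i : ℕ)))
def cval {n : ℕ} (c : Fin n → ℕ) (k : ℕ) : ℚ := if h : k < n then (c ⟨k, h⟩ : ℚ) else 0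
def epsWt (t : CType) (n : ℕ) (c : Fin n → ℕ) : Fin n → ℚ := fun i =>
  (∑ k ∈ Finset.univ.filter (fun k : Fin n => (i : ℕ) ≤ (k : ℕ)), (c k : ℚ)) -
    (match t with
      | .C => 0
      | .B => cval c (n - 1) / 2
      | .D => (cval c (n - 2) + cval c (n - 1)) / 2)
def rhoY (t : CType) (n : ℕ) : Fin n → ℚ := fun i =>
  match t with
  | .C => (n : ℚ) - (i : ℕ)
  | .B => (n : ℚ) - (i : ℕ) - 1 / 2
  | .D => (n : ℚ) - 1 - (i : ℕ)
def altY (t : CType) (n : ℕ) (v : Fin n → ℚ) : CharRing n :=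
  ∑ σ : Equiv.Perm (Fin n), ∑ s : Fin n → Bool,
    if t = CType.D ∧ ¬ Even (Finset.univ.filter (fun i => s i = true)).card then 0
    else (((Equiv.Perm.sign σ : ℤˣ) : ℤ) *
          (-1) ^ (Finset.univ.filter (fun i => s i = true)).card) •
      mono (fun i => (if s i then -1 else 1) * v (σ i))
def IsCharY (t : CType) (n : ℕ) (c : Fin n → ℕ) (f : CharRing n) : Prop :=
  altY t n (rhoY t n) * f = altY t n (epsWt t n c + rhoY t n)
def WtSys (t : CType) (n r : ℕ) (δ : Fin r → ℕ)
    (w : Fin n → (Fin (r + 1) → ℚ)) : Prop :=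
  ((∑ i : Fin n, (mono (w i) + mono (-(w i)))) +
      (if t = CType.B then mono (0 : Fin (r + 1) → ℚ) else 0)) * altA r (rhoA r)
    = altA r (slWt r δ + rhoA r)
def resChar {n r : ℕ} (w : Fin n → (Fin (r + 1) → ℚ)) (F : CharRing n) :
    CharRing (r + 1) :=
  AddMonoidAlgebra.mapDomain (fun v : Fin n → ℚ => ∑ i : Fin n, v i • w i) F
def IsMFRes (t : CType) (n r : ℕ) (δ : Fin r → ℕ) (lam : Fin n → ℕ) : Prop :=
  ∀ w, WtSys t n r δ w → ∀ f, IsCharY t n lam f →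
    ∃ c : (Fin r → ℕ) →₀ ℕ, Decomp r (resChar w f) c ∧ ∀ μ, c μ ≤ 1
def pw {m : ℕ} (k : ℕ) (F : CharRing m) : CharRing m :=
  AddMonoidAlgebra.mapDomain (fun v : Fin m → ℚ => (k : ℚ) • v) F
def HasSymForm (r : ℕ) (d : Fin r → ℕ) : Prop :=
  ∀ f, IsCharA r d f →
    ∃ c : (Fin r → ℕ) →₀ ℕ,
      (f * f + pw 2 f) * altA r (rhoA r)
          = c.sum (fun μ k => ((2 * k : ℕ) : ℤ) • altA r (slWt r μ + rhoA r)) ∧ 1 ≤ c 0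
def HasAltForm (r : ℕ) (d : Fin r → ℕ) : Prop :=
  ∀ f, IsCharA r d f →
    ∃ c : (Fin r → ℕ) →₀ ℕ,
      (f * f - pw 2 f) * altA r (rhoA r)
          = c.sum (fun μ k => ((2 * k : ℕ) : ℤ) • altA r (slWt r μ + rhoA r)) ∧ 1 ≤ c 0
end MFPaper
open MFPaper
noncomputable section
namespace MFAux
local notation "bo" => by omega
local notation "bs" => by simp
local notation "bn" => by norm_num
local notation "bd" => by decide
local notation "mo" => (-1)
variable {q n m k K z N r : ℕ} {t : CType}
section
theorem mono_mul (u v : Fin k → ℚ) : mono u * mono v = mono (u + v) := by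
  simp [mono, AddMonoidAlgebra.single_mul_single]
theorem mono_zero : mono (0 : Fin k → ℚ) = 1 := rfl
theorem mono_coeff (u v : Fin k → ℚ) [Decidable (u = v)] :
    (mono u).coeff v = if u = v then 1 else 0 := by
  simp only [mono, AddMonoidAlgebra.coeff_single, Finsupp.single_apply]
theorem mono_mul_coeff (u v : Fin k → ℚ) (F : CharRing k) :
    (mono u * F).coeff (u + v) = F.coeff v := by
  simp [mono]
theorem cr_ind {P : CharRing k → Prop} (F : CharRing k) (h0 : P 0)
    (ha : ∀ F G, P F → P G → P (F + G)) (hm : ∀ v (c : ℤ), P (c • mono v)) : P F := by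
  refine AddMonoidAlgebra.induction_linear F h0 ha ?_
  intro v c
  have := hm v c
  simpa [mono, AddMonoidAlgebra.smul_single] using this
theorem add_ext {A : Type*} [AddCommGroup A] (f g : CharRing k →+ A)
    (h : ∀ v, f (mono v) = g (mono v)) (F : CharRing k) : f F = g F := by
  induction F using cr_ind with
  | h0 => simp
  | ha F G hF hG => simp [hF, hG]
  | hm v c => rw [map_zsmul, map_zsmul, h]
theorem ring_ext {A : Type*} [CommRing A] (f g : CharRing k →+* A)
    (h : ∀ v, f (mono v) = g (mono v)) (F : CharRing k) : f F = g F :=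
  add_ext f.toAddMonoidHom g.toAddMonoidHom h F
def ev {A : Type*} [AddCommGroup A] (f : (Fin k → ℚ) → A) : CharRing k →+ A where
  toFun F := F.coeff.sum fun u c => c • f u
  map_zero' := by simp
  map_add' F G := by
    rw [AddMonoidAlgebra.coeff_add, Finsupp.sum_add_index'] <;> simp [add_smul]
@[simp] theorem ev_mono {A : Type*} [AddCommGroup A] (f : (Fin k → ℚ) → A) (v) :
    ev f (mono v) = f v := by
  change ((mono v).coeff.sum fun u (c : ℤ) => c • f u) = _
  simp [mono]
def mp (T : (Fin k → ℚ) →+ (Fin m → ℚ)) : CharRing k →+* CharRing m :=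
  AddMonoidAlgebra.mapDomainRingHom ℤ T
@[simp] theorem mp_mono (T : (Fin k → ℚ) →+ (Fin m → ℚ)) (v) :
    mp T (mono v) = mono (T v) := by
  simp [mp, mono]
theorem mp_inj (T : (Fin k → ℚ) →+ (Fin m → ℚ)) (h : Function.Injective T) :
    Function.Injective (mp T) := AddMonoidAlgebra.mapDomain_injective h
abbrev GR (m : ℕ) : Type := AddMonoidAlgebra (CharRing m) ℚ
def gr (φ : (Fin k → ℚ) →+ ℚ) (T : (Fin k → ℚ) →+ (Fin m → ℚ)) :
    CharRing k →+* GR m :=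
  (AddMonoidAlgebra.lift ℤ (GR m) (Fin k → ℚ)
    { toFun := fun v => AddMonoidAlgebra.single (φ v.toAdd) (mono (T v.toAdd))
      map_one' := by simp [mono_zero]; rfl
      map_mul' := fun u v => by
        simp [AddMonoidAlgebra.single_mul_single, mono_mul] }).toRingHom
@[simp] theorem gr_mono (φ : (Fin k → ℚ) →+ ℚ) (T : (Fin k → ℚ) →+ (Fin m → ℚ)) (v) :
    gr φ T (mono v) = AddMonoidAlgebra.single (φ v) (mono (T v)) := by
  simp only [gr, mono]
  change (AddMonoidAlgebra.lift ℤ (GR m) (Fin k → ℚ) _) _ = _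
  rw [AddMonoidAlgebra.lift_single]
  simp [mono]
def cf {A M : Type*} [CommRing A] (v : M) : AddMonoidAlgebra A M →+ A :=
  AddMonoidHom.mk' (fun F => F.coeff v) (fun _ _ => rfl)
theorem cf_apply {A M : Type*} [CommRing A] (v : M) (F : AddMonoidAlgebra A M) :
    cf v F = F.coeff v := rfl
theorem gr_coeff (φ : (Fin k → ℚ) →+ ℚ) (T : (Fin k → ℚ) →+ (Fin m → ℚ))
    (F : CharRing k) (d : ℚ) :
    (gr φ T F).coeff d = ev (fun v => if φ v = d then mono (T v) else 0) F := by
  refine add_ext ((cf d).comp (gr φ T).toAddMonoidHom) _ ?_ F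
  intro v
  simp [cf_apply, Finsupp.single_apply]
theorem gr_coeff_coeff (φ : (Fin k → ℚ) →+ ℚ) (T : (Fin k → ℚ) →+ (Fin m → ℚ))
    (hinj : ∀ u v, φ u = φ v → T u = T v → u = v) (F : CharRing k) (v : Fin k → ℚ) :
    ((gr φ T F).coeff (φ v)).coeff (T v) = F.coeff v := by
  refine add_ext ((cf (T v)).comp ((cf (φ v)).comp (gr φ T).toAddMonoidHom)) (cf v) ?_ F
  intro u
  classical
  have h0 : ((cf (T v)).comp ((cf (φ v)).comp (gr φ T).toAddMonoidHom)) (mono u) =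
    ((gr φ T (mono u)).coeff (φ v)).coeff (T v) := rfl
  rw [h0, cf_apply, gr_mono, AddMonoidAlgebra.coeff_single, Finsupp.single_apply, mono_coeff]
  by_cases h : u = v
  · subst h; simp [mono_coeff]
  · rw [if_neg h]
    split_ifs with h1
    · rw [mono_coeff, if_neg (fun h2 => h (hinj _ _ h1 h2))]
    · simp
instance {k : ℕ} : IsDomain (CharRing k) := inferInstance
instance {k : ℕ} : IsDomain (GR k) := inferInstance
theorem mono_ne_zero (v : Fin k → ℚ) : mono v ≠ 0 := by
  simp [mono]
structure WS (k : ℕ) where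
  I : Type
  fin : Fintype I
  T : I → (Fin k → ℚ) →+ (Fin k → ℚ)
  ε : I → ℤ
  eps : ∀ i, ε i = 0 ∨ ε i = 1 ∨ ε i = -1
  R : ∀ j, ε j ≠ 0 → ∃ e : I ≃ I, ∀ i, T (e i) = (T i).comp (T j) ∧ ε (e i) = ε i * ε j
  L : ∀ j, ε j ≠ 0 → ∃ e : I ≃ I, ∀ i, T (e i) = (T j).comp (T i) ∧ ε (e i) = ε j * ε i
namespace WS
variable {k : ℕ} (S : WS k)
attribute [instance] WS.fin
def alt (v : Fin k → ℚ) : CharRing k := ∑ i, S.ε i • mono (S.T i v)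
theorem eps_sq (j) (h : S.ε j ≠ 0) : S.ε j * S.ε j = 1 := by
  rcases S.eps j with h1 | h1 | h1 <;> simp_all
theorem alt_T (j) (h : S.ε j ≠ 0) (v) : S.alt (S.T j v) = S.ε j • S.alt v := by
  obtain ⟨e, he⟩ := S.R j h
  unfold alt
  rw [← Equiv.sum_comp e (fun i => S.ε i • mono (S.T i v)), Finset.smul_sum]
  refine Finset.sum_congr rfl fun i _ => ?_
  rw [(he i).1, (he i).2, smul_smul, mul_comm (S.ε j), mul_assoc, S.eps_sq j h, mul_one]
  rfl
theorem alt_zero (j) (h : S.ε j = -1) (v) (hv : S.T j v = v) : S.alt v = 0 := by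
  have := S.alt_T j (by simp [h]) v
  rw [hv, h] at this
  have h2 : (2 : CharRing k) * S.alt v = 0 := by
    rw [two_mul]; nth_rewrite 1 [this]; simp
  have h3 : (2 : CharRing k) ≠ 0 := by
    have : (2 : CharRing k) = 2 • mono 0 := by simp [mono_zero]
    rw [this]; intro h
    have := congrArg (fun F => F.coeff 0) h
    simp [mono] at this
  rcases mul_eq_zero.1 h2 with h | h
  · exact absurd h h3
  · exact h
def Inv (G : CharRing k) : Prop := ∀ j, S.ε j ≠ 0 → mp (S.T j) G = G
theorem Inv.mul {S : WS k} {F G : CharRing k} (hF : S.Inv F) (hG : S.Inv G) : S.Inv (F * G) :=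
  fun j hj => by rw [map_mul, hF j hj, hG j hj]
theorem Inv.add {S : WS k} {F G : CharRing k} (hF : S.Inv F) (hG : S.Inv G) : S.Inv (F + G) :=
  fun j hj => by rw [map_add, hF j hj, hG j hj]
theorem mul_alt (G : CharRing k) (hG : S.Inv G) (v) :
    G * S.alt v = ev (fun u => S.alt (v + u)) G := by
  have h1 : G * S.alt v = ∑ i, S.ε i • (mp (S.T i) G * mono (S.T i v)) := by
    unfold alt
    rw [Finset.mul_sum]
    refine Finset.sum_congr rfl fun i _ => ?_
    by_cases h : S.ε i = 0
    · simp [h]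
    · rw [hG i h, mul_smul_comm]
  rw [h1]
  clear h1 hG
  induction G using cr_ind with
  | h0 => simp
  | ha F G hF hG => simp only [map_add, add_mul, smul_add, Finset.sum_add_distrib, hF, hG]
  | hm u c =>
    simp only [map_zsmul, mp_mono, ev_mono, smul_mul_assoc, mono_mul, alt, Finset.smul_sum]
    refine Finset.sum_congr rfl fun i _ => ?_
    rw [smul_comm, map_add, add_comm]
theorem mp_alt (j) (h : S.ε j ≠ 0) (v) : mp (S.T j) (S.alt v) = S.ε j • S.alt v := by
  obtain ⟨e, he⟩ := S.L j h
  unfold alt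
  conv_rhs => rw [← Equiv.sum_comp e (fun i => S.ε i • mono (S.T i v)), Finset.smul_sum]
  rw [map_sum]
  refine Finset.sum_congr rfl fun i _ => ?_
  rw [(he i).1, (he i).2, smul_smul, ← mul_assoc, S.eps_sq j h, one_mul, map_zsmul, mp_mono]
  rfl
end WS
end

section
def pre (σ : Equiv.Perm (Fin k)) : (Fin k → ℚ) →+ (Fin k → ℚ) where
  toFun v := fun i => v (σ i)
  map_zero' := rfl
  map_add' _ _ := rfl
@[simp] theorem pre_apply (σ : Equiv.Perm (Fin k)) (v : Fin k → ℚ) (i) :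
  pre σ v i = v (σ i) := rfl
def WA (q : ℕ) : WS q where
  I := Equiv.Perm (Fin q)
  fin := inferInstance
  T := pre
  ε σ := ((Equiv.Perm.sign σ : ℤˣ) : ℤ)
  eps σ := by rcases Int.units_eq_one_or (Equiv.Perm.sign σ) with h | h <;> simp [h]
  R τ _ := ⟨Equiv.mulLeft τ, fun σ => ⟨by ext; simp, by simp [mul_comm]⟩⟩
  L τ _ := ⟨Equiv.mulRight τ, fun σ => ⟨by ext; simp, by simp [mul_comm]⟩⟩
abbrev al (q : ℕ) (v : Fin q → ℚ) : CharRing q := (WA q).alt v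
theorem al_def (q : ℕ) (v : Fin q → ℚ) :
    al q v = ∑ σ : Equiv.Perm (Fin q), ((Equiv.Perm.sign σ : ℤˣ) : ℤ) • mono (pre σ v) := rfl
theorem altA_eq (r : ℕ) (v : Fin (r+1) → ℚ) : altA r v = al (r+1) v := rfl
theorem WA_eps_ne (σ : Equiv.Perm (Fin q)) : (WA q).ε σ ≠ 0 := by
  change ((Equiv.Perm.sign σ : ℤˣ) : ℤ) ≠ 0
  simp
theorem al_pre (σ : Equiv.Perm (Fin q)) (v : Fin q → ℚ) :
    al q (pre σ v) = ((Equiv.Perm.sign σ : ℤˣ) : ℤ) • al q v :=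
  (WA q).alt_T σ (WA_eps_ne σ) v
theorem al_swap (i j : Fin q) (h : i ≠ j) (v : Fin q → ℚ) :
    al q (pre (Equiv.swap i j) v) = - al q v := by
  rw [al_pre, Equiv.Perm.sign_swap h]; simp
theorem al_rep (i j : Fin q) (h : i ≠ j) (v : Fin q → ℚ) (hv : v i = v j) :
    al q v = 0 := by
  refine (WA q).alt_zero (Equiv.swap i j) ?_ v ?_
  · change ((Equiv.Perm.sign _ : ℤˣ) : ℤ) = -1
    rw [Equiv.Perm.sign_swap h]; simp
  · ext k
    change v (Equiv.swap i j k) = v k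
    rcases em (k = i) with h1 | h1
    · subst h1; simp [hv]
    · rcases em (k = j) with h2 | h2
      · subst h2; simp [hv]
      · rw [Equiv.swap_apply_of_ne_of_ne h1 h2]
def Sym (q : ℕ) (G : CharRing q) : Prop := ∀ σ : Equiv.Perm (Fin q), mp (pre σ) G = G
theorem Sym.inv {G : CharRing q} (h : Sym q G) : (WA q).Inv G := fun σ _ => h σ
theorem mul_al (G : CharRing q) (h : Sym q G) (v : Fin q → ℚ) :
    G * al q v = ev (fun u => al q (v + u)) G := (WA q).mul_alt G h.inv v
theorem al_coeff (v u : Fin q → ℚ) : (al q v).coeff u =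
    ∑ σ : Equiv.Perm (Fin q), if pre σ v = u then ((Equiv.Perm.sign σ : ℤˣ) : ℤ) else 0 := by
  rw [← cf_apply, al_def, map_sum]
  refine Finset.sum_congr rfl fun σ _ => ?_
  rw [map_zsmul, cf_apply, mono_coeff]
  split_ifs <;> simp
theorem pre_inj_of {v : Fin q → ℚ} (hv : Function.Injective v)
    {σ τ : Equiv.Perm (Fin q)} (h : pre σ v = pre τ v) : σ = τ := by
  ext i
  have := congrFun h i
  exact congrArg _ (hv this)
theorem al_coeff_perm (v : Fin q → ℚ) (hv : Function.Injective v)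
    (σ : Equiv.Perm (Fin q)) : (al q v).coeff (pre σ v) = ((Equiv.Perm.sign σ : ℤˣ) : ℤ) := by
  rw [al_coeff, Finset.sum_eq_single σ]
  · simp
  · intro τ _ h
    rw [if_neg (fun h' => h (pre_inj_of hv h'))]
  · simp
theorem al_coeff_self (v : Fin q → ℚ) (hv : Function.Injective v) :
    (al q v).coeff v = 1 := by
  have := al_coeff_perm v hv 1
  rw [show pre 1 v = v from rfl] at this
  simpa using this
theorem al_coeff_of_not (v u : Fin q → ℚ) (h : ∀ σ, pre σ v ≠ u) :
    (al q v).coeff u = 0 := by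
  rw [al_coeff]
  exact Finset.sum_eq_zero fun σ _ => by rw [if_neg (h σ)]
theorem al_ne_zero (v : Fin q → ℚ) (hv : Function.Injective v) : al q v ≠ 0 := by
  intro h
  have := al_coeff_self v hv
  rw [h] at this; simp at this
theorem al_coeff_abs (v u : Fin q → ℚ) : |(al q v).coeff u| ≤ 1 := by
  by_cases hv : Function.Injective v
  · by_cases h : ∃ σ, pre σ v = u
    · obtain ⟨σ, rfl⟩ := h
      rw [al_coeff_perm v hv]
      rcases Int.units_eq_one_or (Equiv.Perm.sign σ) with h | h <;> simp [h]
    · rw [al_coeff_of_not v u (by push Not at h; exact h)]; simp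
  · simp only [Function.Injective, not_forall] at hv
    obtain ⟨i, j, h1, h2⟩ := hv
    rw [al_rep i j h2 v h1]; simp
theorem anti_unique (u v : Fin q → ℚ) (hu : Antitone u) (hv : Antitone v)
    (σ : Equiv.Perm (Fin q)) (h : pre σ v = u) : u = v := by
  have hm : Monovary v u := fun i j hij => by
    rcases lt_or_ge i j with h | h
    · exact absurd (hu h.le) (not_le.2 hij)
    · exact hv h
  have h1 := hm.sum_mul_comp_perm_le_sum_mul (σ := σ⁻¹)
  have h2 : ∀ i, u (σ⁻¹ i) = v i := fun i => by rw [← h]; simp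
  simp only [h2] at h1
  have h3 : ∑ i, u i * u i = ∑ i, v i * v i := by
    rw [← Equiv.sum_comp σ (fun i => v i * v i)]
    refine Finset.sum_congr rfl fun i _ => by rw [← h]; rfl
  have h4 : ∑ i, (u i - v i)^2 ≤ 0 := by
    have : ∑ i, (u i - v i)^2 = ∑ i, u i * u i + ∑ i, v i * v i - 2 * ∑ i, v i * u i := by
      rw [Finset.mul_sum, ← Finset.sum_add_distrib, ← Finset.sum_sub_distrib]
      exact Finset.sum_congr rfl fun i _ => by ring
    rw [this, h3]; linarith
  have h5 := (Finset.sum_eq_zero_iff_of_nonneg (fun i _ => sq_nonneg (u i - v i))).1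
    (le_antisymm h4 (Finset.sum_nonneg fun i _ => sq_nonneg _))
  ext i
  have := h5 i (Finset.mem_univ _)
  rw [sq_eq_zero_iff] at this; linarith
theorem al_coeff_sa (v u : Fin q → ℚ) (hv : StrictAnti v) (hu : StrictAnti u) :
    (al q v).coeff u = if u = v then 1 else 0 := by
  split_ifs with h
  · rw [h]; exact al_coeff_self v hv.injective
  · exact al_coeff_of_not _ _ fun σ hσ => h (anti_unique u v hu.antitone hv.antitone σ hσ)
def ID (v : Fin q → ℚ) : Prop := ∀ i j, ∃ m : ℤ, v i - v j = m
theorem ID.add {u v : Fin q → ℚ} (hu : ID u) (hv : ID v) : ID (u + v) := fun i j => by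
  obtain ⟨a, ha⟩ := hu i j
  obtain ⟨b, hb⟩ := hv i j
  exact ⟨a + b, by push_cast; rw [← ha, ← hb]; simp; ring⟩
theorem ID.of_int (f : Fin q → ℤ) : ID (fun i => (f i : ℚ)) := fun i j =>
  ⟨f i - f j, by push_cast; rfl⟩
structure SD {q : ℕ} (v : Fin q → ℚ) : Prop where
  sa : StrictAnti v
  id : ID v
theorem int_lt_step {a b : ℚ} (h : a < b) (h' : ∃ m : ℤ, b - a = m) : a + 1 ≤ b := by
  obtain ⟨m, hm⟩ := h'
  have : (0 : ℚ) < m := by rw [← hm]; linarith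
  have : 0 < m := by exact_mod_cast this
  have : (1 : ℚ) ≤ m := by exact_mod_cast this
  linarith
theorem SD.gap {v : Fin q → ℚ} (h : SD v) {i j : Fin q} (hij : i < j) :
    v j + 1 ≤ v i := int_lt_step (h.sa hij) (h.id i j)
def KK (q : ℕ) : AddSubmonoid (CharRing q) := AddSubmonoid.closure {x | ∃ v, SD v ∧ x = al q v}
theorem al_mem {v : Fin q → ℚ} (h : SD v) : al q v ∈ KK q :=
  AddSubmonoid.subset_closure ⟨v, h, rfl⟩
theorem KK_nonneg {F : CharRing q} (hF : F ∈ KK q) {u : Fin q → ℚ} (hu : StrictAnti u) :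
    0 ≤ F.coeff u := by
  induction hF using AddSubmonoid.closure_induction with
  | mem x hx =>
    obtain ⟨v, hv, rfl⟩ := hx
    rw [al_coeff_sa v u hv.sa hu]; split_ifs <;> simp
  | zero => simp
  | add x y _ _ hx hy => simp; omega
theorem KK_pos {F : CharRing q} (hF : F ∈ KK q) (h : F ≠ 0) :
    ∃ u, SD u ∧ 1 ≤ F.coeff u := by
  have key : F = 0 ∨ ∃ u, SD u ∧ 1 ≤ F.coeff u := by
    clear h
    induction hF using AddSubmonoid.closure_induction with
    | mem x hx =>
      obtain ⟨v, hv, rfl⟩ := hx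
      exact Or.inr ⟨v, hv, by rw [al_coeff_self v hv.sa.injective]⟩
    | zero => exact Or.inl rfl
    | add x y hx' hy' hx hy =>
      rcases hx with rfl | ⟨u, hu, h1⟩
      · rw [zero_add]; exact hy
      · refine Or.inr ⟨u, hu, ?_⟩
        have := KK_nonneg hy' hu.sa
        simp; omega
  tauto
end

open Finset
open scoped Classical
section
def ind (C : Finset (Fin q)) : Fin q → ℚ := fun i => if i ∈ C then 1 else 0
def cnt (C : Finset (Fin q)) (k : ℕ) : ℕ := (C.filter (fun i => i.val < k)).card
def cle (C B : Finset (Fin q)) : Prop := ∀ k, cnt B k ≤ cnt C k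
theorem cnt_succ (C : Finset (Fin q)) (i : Fin q) :
    cnt C (i.val + 1) = cnt C i.val + if i ∈ C then 1 else 0 := by
  unfold cnt
  split_ifs with h
  · rw [← Finset.card_insert_of_notMem (a := i) bs]
    congr 1; ext x; simp only [mem_filter, mem_insert]
    constructor
    · rintro ⟨h1, h2⟩
      rcases Nat.lt_succ_iff_lt_or_eq.1 h2 with h3 | h3
      · exact Or.inr ⟨h1, h3⟩
      · exact Or.inl (Fin.ext h3)
    · rintro (rfl | ⟨h1, h2⟩)
      · exact ⟨h, bo⟩
      · exact ⟨h1, bo⟩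
  · rw [add_zero]
    congr 1; ext x; simp only [mem_filter]
    constructor
    · rintro ⟨h1, h2⟩
      refine ⟨h1, ?_⟩
      rcases Nat.lt_succ_iff_lt_or_eq.1 h2 with h3 | h3
      · exact h3
      · exact absurd (Fin.ext h3 ▸ h1) h
    · rintro ⟨h1, h2⟩; exact ⟨h1, bo⟩
def TG : List ℕ → Finset (Fin q) → CharRing q
  | [], _ => 1
  | p :: ps, B => ∑ C ∈ univ.filter (fun C : Finset (Fin q) => C.card = p ∧ cle C B),
      mono (ind C) * TG ps C
def flip (a b : Fin q) (C : Finset (Fin q)) : Finset (Fin q) :=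
  C.map (Equiv.swap a b).toEmbedding
theorem mem_flip (a b : Fin q) (C : Finset (Fin q)) (x) :
    x ∈ flip a b C ↔ Equiv.swap a b x ∈ C := by
  simp only [flip, mem_map_equiv, Equiv.symm_swap]
theorem flip_flip (a b : Fin q) (C : Finset (Fin q)) : flip a b (flip a b C) = C := by
  ext x; simp [mem_flip]
theorem card_flip (a b : Fin q) (C : Finset (Fin q)) : (flip a b C).card = C.card := by
  simp [flip]
theorem cnt_flip {a b : Fin q} (hab : a.val + 1 = b.val) (C : Finset (Fin q)) (k : ℕ)
    (hk : k ≠ b.val) : cnt (flip a b C) k = cnt C k := by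
  unfold cnt
  rw [← card_flip a b (C.filter _)]
  congr 1; ext x
  simp only [mem_filter, mem_flip]
  have : (Equiv.swap a b x).val < k ↔ x.val < k := by
    rcases Classical.em (x = a) with rfl | h1
    · simp; omega
    · rcases Classical.em (x = b) with rfl | h2
      · simp; omega
      · rw [Equiv.swap_apply_of_ne_of_ne h1 h2]
  rw [this]
theorem pre_ind (a b : Fin q) (C : Finset (Fin q)) :
    pre (Equiv.swap a b) (ind C) = ind (flip a b C) := by
  ext x; simp only [pre_apply, ind, mem_flip]
theorem flip_eq {a b : Fin q} {C : Finset (Fin q)} (h : a ∈ C ↔ b ∈ C) :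
    flip a b C = C := by
  ext x; rw [mem_flip]
  rcases Classical.em (x = a) with rfl | h1
  · simp [h]
  · rcases Classical.em (x = b) with rfl | h2
    · simp [h]
    · rw [Equiv.swap_apply_of_ne_of_ne h1 h2]
theorem mem_flip_a {a b : Fin q} {C : Finset (Fin q)} : a ∈ flip a b C ↔ b ∈ C := by
  simp [mem_flip]
theorem mem_flip_b {a b : Fin q} {C : Finset (Fin q)} : b ∈ flip a b C ↔ a ∈ C := by
  simp [mem_flip]
theorem cle_flip {a b : Fin q} (hab : a.val + 1 = b.val) {B C : Finset (Fin q)}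
    (hB : ¬ (a ∈ B ∧ b ∉ B)) (h : cle C B) : cle (flip a b C) B := by
  intro k
  rcases Classical.em (k = b.val) with rfl | hk
  · have h1 := cnt_succ B a
    have h2 := cnt_succ B b
    have h3 := cnt_succ (flip a b C) a
    have h4 := cnt_succ (flip a b C) b
    have h5 := cnt_flip hab C a.val bo
    have h6 := cnt_flip hab C (b.val + 1) bo
    have h7 := h a.val
    have h8 := h (b.val + 1)
    rw [hab] at h1 h3
    rw [h1, h3, h5]
    by_cases ha : a ∈ B
    · have hb : b ∈ B := by tauto
      simp only [ha, hb, if_true] at *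
      split_ifs at * <;> omega
    · simp only [ha, if_false] at *
      omega
  · rw [cnt_flip hab C k hk]; exact h k
theorem sum_pair {A : Type*} [AddCommGroup A] [IsAddTorsionFree A] (s : Finset (Finset (Fin q)))
    (a b : Fin q) (hs : ∀ C ∈ s, flip a b C ∈ s) (f : Finset (Fin q) → A) (φ : A →+ A)
    (h : ∀ C ∈ s, φ (f C + f (flip a b C)) = f C + f (flip a b C)) :
    φ (∑ C ∈ s, f C) = ∑ C ∈ s, f C := by
  have h1 : ∑ C ∈ s, f (flip a b C) = ∑ C ∈ s, f C :=
    Finset.sum_bij' (fun C _ => flip a b C) (fun C _ => flip a b C) (fun C h => hs C h)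
      (fun C h => hs C h) (fun C _ => flip_flip a b C) (fun C _ => flip_flip a b C)
      (fun C _ => rfl)
  have h2 : 2 • ∑ C ∈ s, f C = ∑ C ∈ s, (f C + f (flip a b C)) := by
    rw [Finset.sum_add_distrib, h1, two_nsmul]
  have h3 : 2 • φ (∑ C ∈ s, f C) = 2 • ∑ C ∈ s, f C := by
    rw [← map_nsmul, h2, map_sum]
    exact Finset.sum_congr rfl h
  exact nsmul_right_injective bn h3
theorem ind_erase {a : Fin q} {C : Finset (Fin q)} (h : a ∈ C) :
    mono (ind C) = mono (Pi.single a 1) * mono (ind (C.erase a)) := by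
  rw [mono_mul]; congr 1; ext x
  simp only [ind, Pi.add_apply, Pi.single_apply, mem_erase]
  by_cases hx : x = a
  · subst hx; simp [h]
  · simp [hx]
theorem pre_single (σ : Equiv.Perm (Fin q)) (a : Fin q) :
    pre σ (Pi.single a 1) = Pi.single (σ.symm a) 1 := by
  ext x; simp only [pre_apply, Pi.single_apply, Equiv.eq_symm_apply]
instance {k : ℕ} : IsAddTorsionFree (CharRing k) where
  nsmul_right_injective n hn x y h := by
    ext v
    have := congrArg (fun F => F.coeff v) h
    simp only [AddMonoidAlgebra.coeff_smul, Finsupp.smul_apply] at this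
    exact nsmul_right_injective hn this
theorem TG_sym {a b : Fin q} (hab : a.val + 1 = b.val) (ps : List ℕ) :
    ∀ B : Finset (Fin q),
    (¬ (a ∈ B ∧ b ∉ B) → mp (pre (Equiv.swap a b)) (TG ps B) = TG ps B) ∧
    ((a ∈ B ∧ b ∉ B) → mp (pre (Equiv.swap a b))
        (mono (Pi.single a 1) * TG ps B + mono (Pi.single b 1) * TG ps (flip a b B)) =
      mono (Pi.single a 1) * TG ps B + mono (Pi.single b 1) * TG ps (flip a b B)) := by
  have xa : mp (pre (Equiv.swap a b)) (mono (Pi.single a 1)) = mono (Pi.single b 1) := by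
    rw [mp_mono, pre_single]; simp
  have xb : mp (pre (Equiv.swap a b)) (mono (Pi.single b 1)) = mono (Pi.single a 1) := by
    rw [mp_mono, pre_single]; simp
  induction ps with
  | nil => intro B; simp only [TG, map_one, implies_true, mul_one, map_add, xa, xb, true_and];
           intro _; rw [add_comm]
  | cons p ps ih =>
    have pair : ∀ C : Finset (Fin q), mp (pre (Equiv.swap a b))
        (mono (ind C) * TG ps C + mono (ind (flip a b C)) * TG ps (flip a b C)) =
        mono (ind C) * TG ps C + mono (ind (flip a b C)) * TG ps (flip a b C) := by
      have main : ∀ C : Finset (Fin q), a ∈ C → b ∉ C → mp (pre (Equiv.swap a b))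
        (mono (ind C) * TG ps C + mono (ind (flip a b C)) * TG ps (flip a b C)) =
        mono (ind C) * TG ps C + mono (ind (flip a b C)) * TG ps (flip a b C) := by
        intro C ha hb
        have he : (flip a b C).erase b = C.erase a := by
          ext x; simp only [mem_erase, mem_flip]
          rcases Classical.em (x = a) with rfl | h1
          · simp [hb]
          · rcases Classical.em (x = b) with rfl | h2
            · simp [hb]
            · rw [Equiv.swap_apply_of_ne_of_ne h1 h2]; simp [h1, h2]
        have e2 := ind_erase ha
        have e3 := ind_erase (mem_flip_b (a := a) (b := b).2 ha)
        rw [he] at e3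
        have e4 : mp (pre (Equiv.swap a b)) (mono (ind (C.erase a))) = mono (ind (C.erase a)) := by
          rw [mp_mono, pre_ind, flip_eq]; simp [hb]
        have e5 : mono (ind C) * TG ps C + mono (ind (flip a b C)) * TG ps (flip a b C) =
          mono (ind (C.erase a)) * (mono (Pi.single a 1) * TG ps C +
            mono (Pi.single b 1) * TG ps (flip a b C)) := by
          rw [e2, e3]; ring
        rw [e5, map_mul, e4, (ih C).2 ⟨ha, hb⟩]
      intro C
      by_cases h1 : a ∈ C ↔ b ∈ C
      · have hf := flip_eq h1
        have e1 : mp (pre (Equiv.swap a b)) (mono (ind C)) = mono (ind C) := by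
          rw [mp_mono, pre_ind, hf]
        rw [hf, map_add, map_mul, e1, (ih C).1 (by tauto)]
      · by_cases ha : a ∈ C
        · exact main C ha (by tauto)
        · have := main (flip a b C) (mem_flip_a.2 (by tauto)) (by rw [mem_flip_b]; exact ha)
          rw [flip_flip] at this
          rw [add_comm]; exact this
    have part1 : ∀ B : Finset (Fin q), ¬ (a ∈ B ∧ b ∉ B) →
        mp (pre (Equiv.swap a b)) (TG (p :: ps) B) = TG (p :: ps) B := by
      intro B hB
      refine sum_pair _ a b ?_ _ (mp (pre (Equiv.swap a b))).toAddMonoidHom (fun C _ => pair C)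
      intro C hC
      simp only [mem_filter, mem_univ, true_and] at hC ⊢
      exact ⟨by rw [card_flip]; exact hC.1, cle_flip hab hB hC.2⟩
    intro B
    refine ⟨part1 B, ?_⟩
    rintro ⟨ha, hb⟩
    have hB' := part1 (flip a b B) (by rw [mem_flip_a, mem_flip_b]; tauto)
    have c1 := cnt_succ B a
    have c2 := cnt_succ B b
    have c3 := cnt_succ (flip a b B) a
    have c5 := cnt_flip hab B a.val bo
    rw [hab] at c1 c3
    simp only [mem_flip_a, ha, hb, if_true, if_false] at c1 c2 c3
    have sub : ∀ C, cle C B → cle C (flip a b B) := by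
      intro C hC k
      rcases Classical.em (k = b.val) with rfl | hk
      · have := hC b.val; omega
      · rw [cnt_flip hab B k hk]; exact hC k
    have dl : TG (p :: ps) (flip a b B) = TG (p :: ps) B +
        ∑ C ∈ univ.filter (fun C : Finset (Fin q) => (C.card = p ∧ cle C (flip a b B)) ∧ ¬ cle C B),
          mono (ind C) * TG ps C := by
      simp only [TG]
      rw [← Finset.sum_filter_add_sum_filter_not (univ.filter (fun C : Finset (Fin q) =>
        C.card = p ∧ cle C (flip a b B))) (fun C => cle C B), Finset.filter_filter,
        Finset.filter_filter]
      congr 1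
      refine Finset.sum_congr ?_ fun _ _ => rfl
      ext C; simp only [mem_filter, mem_univ, true_and]
      constructor
      · tauto
      · rintro ⟨h1, h2⟩; exact ⟨⟨h1, sub C h2⟩, h2⟩
    set Δ := ∑ C ∈ univ.filter (fun C : Finset (Fin q) => (C.card = p ∧ cle C (flip a b B)) ∧ ¬ cle C B),
          mono (ind C) * TG ps C with hΔ
    have hD : mp (pre (Equiv.swap a b)) (mono (Pi.single a 1) * Δ) = mono (Pi.single a 1) * Δ := by
      rw [hΔ, Finset.mul_sum, map_sum]
      refine Finset.sum_congr rfl fun C hC => ?_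
      simp only [mem_filter, mem_univ, true_and] at hC
      obtain ⟨⟨_, h1⟩, h2⟩ := hC
      have hk : cnt C b.val < cnt B b.val := by
        by_contra hcon
        apply h2
        intro k
        rcases Classical.em (k = b.val) with rfl | hk
        · omega
        · rw [← cnt_flip hab B k hk]; exact h1 k
      have d1 := cnt_succ C a
      have d2 := cnt_succ C b
      have d3 := h1 a.val
      have d4 := h1 (b.val + 1)
      rw [cnt_flip hab B _ bo] at d4
      rw [hab] at d1
      have haC : a ∉ C := by intro h; simp only [h, if_true] at d1; omega
      have hbC : b ∈ C := by
        by_contra h; simp only [h, haC, if_false] at d1 d2; omega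
      rw [ind_erase hbC, map_mul, map_mul, map_mul, xa, xb, (ih C).1 (by tauto), mp_mono, pre_ind,
        flip_eq (by simp [haC])]
      ring
    have hB2 : TG (p :: ps) B = TG (p :: ps) (flip a b B) - Δ := by rw [dl]; ring
    rw [hB2]
    have : mono (Pi.single a 1) * (TG (p :: ps) (flip a b B) - Δ) +
      mono (Pi.single b 1) * TG (p :: ps) (flip a b B) =
      (mono (Pi.single a 1) + mono (Pi.single b 1)) * TG (p :: ps) (flip a b B) -
        mono (Pi.single a 1) * Δ := by ring
    rw [this, map_sub, map_mul, map_add, xa, xb, hB', hD, add_comm (mono (Pi.single b 1))]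
theorem sym_of_adj (G : CharRing q)
    (h : ∀ a b : Fin q, a.val + 1 = b.val → mp (pre (Equiv.swap a b)) G = G) : Sym q G := by
  cases q with
  | zero =>
    intro σ
    have : pre σ = AddMonoidHom.id _ := AddMonoidHom.ext fun v => funext fun i => i.elim0
    rw [this]; exact ring_ext (mp _) (RingHom.id _) (fun v => by simp) G
  | succ n =>
    intro σ
    have hσ : σ ∈ Submonoid.closure (Set.range fun i : Fin n => Equiv.swap i.castSucc i.succ) := by
      rw [Equiv.Perm.mclosure_swap_castSucc_succ]; trivial
    induction hσ using Submonoid.closure_induction with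
    | mem x hx => obtain ⟨i, rfl⟩ := hx; exact h _ _ bs
    | one => exact ring_ext (mp _) (RingHom.id _) (fun v => by simp; rfl) G
    | mul x y _ _ hx hy =>
      have : mp (pre (x * y)) G = mp (pre y) (mp (pre x) G) :=
        ring_ext (mp _) ((mp (pre y)).comp (mp (pre x))) (fun v => by simp; rfl) G
      rw [this, hx, hy]
def Schur (ps : List ℕ) : CharRing q := TG ps ∅
theorem Schur_sym (ps : List ℕ) : Sym q (Schur ps) :=
  sym_of_adj _ fun _ _ hab => ((TG_sym hab ps) ∅).1 bs
def Alt (q : ℕ) : CharRing q →+ CharRing q := ev (al q)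
theorem Alt_mono (v : Fin q → ℚ) : Alt q (mono v) = al q v := ev_mono _ _
theorem Alt_pre (σ : Equiv.Perm (Fin q)) (F : CharRing q) :
    Alt q (mp (pre σ) F) = ((Equiv.Perm.sign σ : ℤˣ) : ℤ) • Alt q F := by
  induction F using cr_ind with
  | h0 => simp
  | ha F G hF hG => simp only [map_add, smul_add, hF, hG]
  | hm v c => rw [map_zsmul, map_zsmul, map_zsmul, mp_mono, Alt_mono, Alt_mono, al_pre, smul_comm]
theorem Alt_zero {a b : Fin q} (h : a ≠ b) (F : CharRing q)
    (hF : mp (pre (Equiv.swap a b)) F = F) : Alt q F = 0 := by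
  have := Alt_pre (Equiv.swap a b) F
  rw [hF, Equiv.Perm.sign_swap h] at this
  simp only [Units.val_neg, Units.val_one, neg_smul, one_smul] at this
  have h2 : 2 • Alt q F = 2 • 0 := by rw [two_nsmul]; nth_rewrite 1 [this]; simp
  exact nsmul_right_injective bn h2
theorem Alt_mul_sym (G : CharRing q) (hG : Sym q G) (v : Fin q → ℚ) :
    Alt q (mono v * G) = G * al q v := by
  rw [mul_al G hG]
  clear hG
  induction G using cr_ind with
  | h0 => simp
  | ha F G hF hG => simp only [map_add, mul_add, hF, hG]
  | hm u c => rw [mul_smul_comm, map_zsmul, map_zsmul, mono_mul, Alt_mono, ev_mono]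
theorem ind_ID (C : Finset (Fin q)) : ID (ind C) := by
  have := ID.of_int (fun i => if i ∈ C then 1 else 0)
  convert this using 2
  simp [ind]
theorem bad_zero (ps : List ℕ) {a b : Fin q} (hab : a.val + 1 = b.val) (v : Fin q → ℚ)
    (C : Finset (Fin q)) (ha : a ∉ C) (hv : v a = v b) : Alt q (mono v * TG ps C) = 0 := by
  have hne : a ≠ b := by rintro rfl; omega
  refine Alt_zero hne _ ?_
  rw [map_mul, mp_mono, ((TG_sym hab ps) C).1 (by tauto)]
  congr 2
  ext x
  rw [pre_apply]
  rcases Classical.em (x = a) with rfl | h1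
  · simp [hv]
  · rcases Classical.em (x = b) with rfl | h2
    · simp [hv]
    · rw [Equiv.swap_apply_of_ne_of_ne h1 h2]
theorem exists_adj (v : Fin q → ℚ) (h : ¬ StrictAnti v) :
    ∃ a b : Fin q, a.val + 1 = b.val ∧ v a ≤ v b := by
  by_contra hcon
  push Not at hcon
  apply h
  cases q with
  | zero => intro i; exact i.elim0
  | succ n => exact Fin.strictAnti_iff_succ_lt.2 fun i => hcon _ _ bs
theorem LR (ps : List ℕ) : ∀ (B : Finset (Fin q)) (v : Fin q → ℚ), SD v →
    Alt q (mono v * TG ps B) ∈ KK q := by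
  induction ps with
  | nil => intro B v hv; simp only [TG, mul_one, Alt_mono]; exact al_mem hv
  | cons p ps ih =>
    intro B v hv
    simp only [TG, Finset.mul_sum, map_sum]
    refine AddSubmonoid.sum_mem _ fun C hC => ?_
    rw [← mul_assoc, mono_mul]
    by_cases h : StrictAnti (v + ind C)
    · exact ih C _ ⟨h, hv.id.add (ind_ID C)⟩
    · obtain ⟨a, b, hab, hle⟩ := exists_adj _ h
      have hgap := hv.gap (i := a) (j := b) (by rw [Fin.lt_def]; omega)
      simp only [Pi.add_apply, ind] at hle
      have ha : a ∉ C := by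
        intro ha; simp only [ha, if_true] at hle
        split_ifs at hle <;> linarith
      have hb : b ∈ C := by
        by_contra hb; simp only [ha, hb, if_false] at hle; linarith
      rw [bad_zero ps hab _ C ha]
      · exact AddSubmonoid.zero_mem _
      · simp only [ha, hb, if_false, if_true] at hle
        simp only [Pi.add_apply, ind, ha, hb, if_false, if_true]; linarith
theorem Schur_KK (ps : List ℕ) (F : CharRing q) (hF : F ∈ KK q) : Schur ps * F ∈ KK q := by
  induction hF using AddSubmonoid.closure_induction with
  | mem x hx =>
    obtain ⟨v, hv, rfl⟩ := hx
    rw [← Alt_mul_sym _ (Schur_sym ps)]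
    exact LR ps _ v hv
  | zero => simp
  | add x y _ _ hx hy => rw [mul_add]; exact AddSubmonoid.add_mem _ hx hy
end

section
def seg (q p : ℕ) : Finset (Fin q) := univ.filter fun i => i.val < p
theorem cnt_seg (b k : ℕ) (hb : b ≤ q) : cnt (seg q b) k = min b k := by
  unfold cnt seg
  rw [filter_filter]
  have : (univ.filter fun i : Fin q => i.val < b ∧ i.val < k) = univ.filter fun i : Fin q => i.val < min b k := by
    ext i; simp
  rw [this, Fin.card_filter_val_lt]; omega
theorem card_seg (b : ℕ) (hb : b ≤ q) : (seg q b).card = b := by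
  unfold seg
  rw [Fin.card_filter_val_lt]; omega
theorem cnt_le_k (C : Finset (Fin q)) (k : ℕ) : cnt C k ≤ k := by
  unfold cnt
  calc _ ≤ (univ.filter fun i : Fin q => i.val < k).card := card_le_card (filter_subset_filter _ (subset_univ _))
    _ ≤ k := by rw [Fin.card_filter_val_lt]; omega
theorem seg_zero (q : ℕ) : seg q 0 = ∅ := by simp [seg]
def colsum (q : ℕ) (ps : List ℕ) : Fin q → ℚ := (ps.map fun p => ind (seg q p)).sum
theorem bialt_aux (ps : List ℕ) : ∀ (b : ℕ) (v : Fin q → ℚ), b ≤ q → SD v →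
    (∀ i j : Fin q, b ≤ i.val → i.val + 1 = j.val → v i = v j + 1) →
    (b :: ps).Pairwise (· ≤ ·) → (∀ p ∈ ps, p ≤ q) →
    Alt q (mono v * TG ps (seg q b)) = al q (v + colsum q ps) := by
  induction ps with
  | nil => intro b v _ _ _ _ _; simp [TG, Alt_mono, colsum]
  | cons p ps ih =>
    intro b v hb hv hst hs hq
    have hbp : b ≤ p := (List.pairwise_cons.1 hs).1 p bs
    have hpq : p ≤ q := hq p bs
    simp only [TG, Finset.mul_sum, map_sum]
    rw [Finset.sum_eq_single (seg q p)]
    · rw [← mul_assoc, mono_mul, ih p]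
      · congr 1; simp only [colsum, List.map_cons, List.sum_cons, add_assoc]
      · exact hpq
      · refine ⟨?_, hv.id.add (ind_ID _)⟩
        intro i j hij
        have := hv.gap hij
        simp only [Pi.add_apply, ind, seg, mem_filter, mem_univ, true_and]
        rw [Fin.lt_def] at hij
        split_ifs <;> linarith
      · intro i j hi hij
        have := hst i j bo hij
        simp only [Pi.add_apply, ind, seg, mem_filter, mem_univ, true_and]
        rw [if_neg bo, if_neg bo]; linarith
      · exact (List.pairwise_cons.1 hs).2
      · exact fun x hx => hq x (by simp [hx])
    · intro C hC hne
      simp only [mem_filter, mem_univ, true_and] at hC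
      rw [← mul_assoc, mono_mul]
      have : ∃ i j : Fin q, i.val + 1 = j.val ∧ i ∉ C ∧ j ∈ C := by
        by_contra hcon
        push Not at hcon
        apply hne
        have dn : ∀ (d : ℕ) (i j : Fin q), i.val + d = j.val → j ∈ C → i ∈ C := by
          intro d
          induction d with
          | zero => intro i j h hj; rwa [show i = j from Fin.ext bo]
          | succ d ihd =>
            intro i j h hj
            by_contra hi
            have := hcon i ⟨i.val + 1, bo⟩ rfl hi
            exact this (ihd _ j (by simp; omega) hj)
        refine (Finset.eq_of_subset_of_card_le ?_ ?_)
        · intro j hj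
          simp only [seg, mem_filter, mem_univ, true_and]
          have : (seg q (j.val + 1)).card ≤ C.card := by
            apply card_le_card
            intro i hi
            simp only [seg, mem_filter, mem_univ, true_and] at hi
            exact dn (j.val - i.val) i j bo hj
          rw [card_seg _ bo, hC.1] at this; omega
        · rw [card_seg _ hpq, hC.1]
      obtain ⟨i, j, hij, hi, hj⟩ := this
      have hbi : b ≤ i.val := by
        by_contra h
        have h1 := hC.2 (i.val + 1)
        rw [cnt_seg _ _ hb, cnt_succ] at h1
        simp only [hi, if_false] at h1
        have := cnt_le_k C i.val
        omega
      refine bad_zero ps hij _ C hi ?_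
      have := hst i j hbi hij
      simp only [Pi.add_apply, ind, hi, hj, if_true, if_false]; linarith
    · intro h
      exact absurd h (by
        simp only [mem_filter, mem_univ, true_and, not_not]
        refine ⟨card_seg _ hpq, fun k => ?_⟩
        rw [cnt_seg _ _ hb, cnt_seg _ _ hpq]; omega)
def rA (q : ℕ) : Fin q → ℚ := fun i => (q : ℚ) - 1 - i.val
theorem rA_step (i j : Fin q) (h : i.val + 1 = j.val) : rA q i = rA q j + 1 := by
  simp only [rA, ← h]; push_cast; ring
theorem rA_SD (q : ℕ) : SD (rA q) := by
  refine ⟨fun i j h => ?_, fun i j => ⟨(j.val : ℤ) - i.val, ?_⟩⟩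
  · simp only [rA]
    have : (i.val : ℚ) < j.val := by exact_mod_cast h
    linarith
  · simp only [rA]; push_cast; ring
structure AD {q : ℕ} (α : Fin q → ℚ) : Prop where
  anti : Antitone α
  id : ID α
theorem AD.sd {α : Fin q → ℚ} (h : AD α) : SD (α + rA q) :=
  ⟨fun i j hij => by
    have := h.anti hij.le
    have := (rA_SD q).sa hij
    simp only [Pi.add_apply]; linarith, h.id.add (rA_SD q).id⟩
theorem AD.cols {α : Fin q → ℚ} (h : AD α) : ∃ (c : ℚ) (ps : List ℕ),
    ps.Pairwise (· ≤ ·) ∧ (∀ p ∈ ps, p ≤ q) ∧ α = (fun _ => c) + colsum q ps := by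
  cases q with
  | zero => exact ⟨0, [], by simp, by simp, funext fun i => i.elim0⟩
  | succ q =>
    have h1 : ∀ i, ∃ m : ℕ, α i - α (Fin.last q) = m := fun i => by
      obtain ⟨m, hm⟩ := h.id i (Fin.last q)
      have h2 := h.anti (Fin.le_last i)
      have : (0:ℚ) ≤ m := by rw [← hm]; linarith
      lift m to ℕ using (by exact_mod_cast this)
      exact ⟨m, by rw [hm]; simp⟩
    choose a ha using h1
    have haa : ∀ i j, i ≤ j → a j ≤ a i := fun i j hij => by
      have h1 := h.anti hij
      have h2 := ha i
      have h3 := ha j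
      have : (a j : ℚ) ≤ a i := by rw [← h2, ← h3]; linarith
      exact_mod_cast this
    set K := a 0
    let pf : ℕ → ℕ := fun j => (univ.filter fun i : Fin (q+1) => K - 1 - j < a i).card
    have hseg : ∀ j, seg (q+1) (pf j) = univ.filter fun i : Fin (q+1) => K - 1 - j < a i := by
      intro j
      symm
      apply Finset.eq_of_subset_of_card_le
      · intro i hi
        simp only [mem_filter, mem_univ, true_and] at hi
        simp only [seg, mem_filter, mem_univ, true_and, pf]
        have : (seg (q+1) (i.val+1)).card ≤ (univ.filter fun i : Fin (q+1) => K - 1 - j < a i).card := by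
          apply card_le_card
          intro x hx
          simp only [seg, mem_filter, mem_univ, true_and] at hx ⊢
          have := haa x i (by rw [Fin.le_def]; omega)
          omega
        rw [card_seg _ bo] at this
        omega
      · rw [card_seg]
        exact (card_le_univ _).trans bs
    refine ⟨α (Fin.last q), (List.range K).map pf, ?_, ?_, ?_⟩
    · rw [List.pairwise_map]
      refine List.Pairwise.imp ?_ List.pairwise_lt_range
      intro x y hxy
      apply card_le_card
      intro i hi
      simp only [mem_filter, mem_univ, true_and] at hi ⊢
      omega
    · intro p hp
      simp only [List.mem_map] at hp
      obtain ⟨j, _, rfl⟩ := hp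
      exact (card_le_univ _).trans bs
    · ext i
      have hK : a i ≤ K := haa 0 i (Fin.zero_le i)
      have : colsum (q+1) ((List.range K).map pf) i = a i := by
        simp only [colsum, List.map_map]
        have e1 : ((List.range K).map ((fun p => ind (seg (q+1) p)) ∘ pf)).sum =
          ∑ j ∈ range K, ind (seg (q+1) (pf j)) := by
          exact (List.sum_toFinset _ List.nodup_range).symm.trans (by rw [List.toFinset_range]; rfl)
        rw [e1, Finset.sum_apply]
        simp only [ind, hseg, mem_filter, mem_univ, true_and]
        rw [← Finset.sum_range_reflect]
        have e2 : ∀ j ∈ range K, (if K - 1 - (K - 1 - j) < a i then (1:ℚ) else 0) = if j < a i then 1 else 0 := by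
          intro j hj
          rw [mem_range] at hj
          rw [show K - 1 - (K - 1 - j) = j by omega]
        rw [sum_congr rfl e2, ← Finset.sum_filter]
        have e3 : (range K).filter (fun j => j < a i) = range (a i) := by
          ext j; simp only [mem_filter, mem_range]; omega
        rw [e3]; simp
      simp only [Pi.add_apply, this, ← ha i]; ring
theorem al_const (c : ℚ) (v : Fin q → ℚ) : mono (fun _ => c) * al q v = al q (v + fun _ => c) := by
  simp only [al_def, Finset.mul_sum, mul_smul_comm, mono_mul]
  refine sum_congr rfl fun σ _ => ?_
  rw [map_add, add_comm]; rfl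
theorem schur_exists {α : Fin q → ℚ} (h : AD α) : ∃ (c : ℚ) (ps : List ℕ),
    (mono (fun _ => c) * Schur ps) * al q (rA q) = al q (α + rA q) := by
  obtain ⟨c, ps, h1, h2, h3⟩ := h.cols
  refine ⟨c, ps, ?_⟩
  have := bialt_aux ps 0 (rA q) (Nat.zero_le _) (rA_SD q) (fun i j _ hij => rA_step i j hij)
    (List.pairwise_cons.2 ⟨by simp, h1⟩) h2
  rw [seg_zero, show TG ps ∅ = Schur ps from rfl, Alt_mul_sym _ (Schur_sym ps)] at this
  rw [mul_assoc, this, al_const, h3]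
  congr 1; abel
end

section
def lastH (q : ℕ) : (Fin (q+1) → ℚ) →+ ℚ := Pi.evalAddMonoidHom (fun _ => ℚ) (Fin.last q)
def initH (q : ℕ) : (Fin (q+1) → ℚ) →+ (Fin q → ℚ) where
  toFun v := fun i => v i.castSucc
  map_zero' := rfl
  map_add' _ _ := rfl
@[simp] theorem lastH_apply (v : Fin (q+1) → ℚ) : lastH q v = v (Fin.last q) := rfl
@[simp] theorem initH_apply (v : Fin (q+1) → ℚ) (i) : initH q v i = v i.castSucc := rfl
theorem last_init_inj (u v : Fin (q+1) → ℚ) (h1 : lastH q u = lastH q v)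
    (h2 : initH q u = initH q v) : u = v := by
  ext i
  refine Fin.lastCases h1 (fun j => ?_) i
  exact congrFun h2 j
def Th (q : ℕ) : CharRing (q+1) →+* GR q := gr (lastH q) (initH q)
def up (C : Finset (Fin q)) : Finset (Fin (q+1)) := C.map Fin.castSuccEmb
def dn (C : Finset (Fin (q+1))) : Finset (Fin q) := univ.filter fun i => i.castSucc ∈ C
def ups (C : Finset (Fin q)) : Finset (Fin (q+1)) := insert (Fin.last q) (up C)
theorem mem_dn {C : Finset (Fin (q+1))} {i} : i ∈ dn C ↔ i.castSucc ∈ C := by simp [dn]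
theorem mem_up {C : Finset (Fin q)} {i : Fin q} : i.castSucc ∈ up C ↔ i ∈ C := by
  simp [up]
theorem last_up {C : Finset (Fin q)} : Fin.last q ∉ up C := by
  simp only [up, mem_map, not_exists]
  rintro x ⟨_, h⟩
  exact absurd h (Fin.castSucc_lt_last x).ne
theorem mem_ups {C : Finset (Fin q)} {i : Fin q} : i.castSucc ∈ ups C ↔ i ∈ C := by
  rw [ups, mem_insert, mem_up]
  simp [(Fin.castSucc_lt_last i).ne]
theorem dn_up (C : Finset (Fin q)) : dn (up C) = C := by ext i; rw [mem_dn, mem_up]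
theorem dn_ups (C : Finset (Fin q)) : dn (ups C) = C := by ext i; rw [mem_dn, mem_ups]
theorem up_dn (C : Finset (Fin (q+1))) (h : Fin.last q ∉ C) : up (dn C) = C := by
  ext i
  refine Fin.lastCases ?_ (fun j => ?_) i
  · simp [h, last_up]
  · rw [mem_up, mem_dn]
theorem ups_dn (C : Finset (Fin (q+1))) (h : Fin.last q ∈ C) : ups (dn C) = C := by
  ext i
  refine Fin.lastCases ?_ (fun j => ?_) i
  · simp [h, ups]
  · rw [mem_ups, mem_dn]
theorem card_up (C : Finset (Fin q)) : (up C).card = C.card := card_map _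
theorem card_ups (C : Finset (Fin q)) : (ups C).card = C.card + 1 := by
  rw [ups, card_insert_of_notMem last_up, card_up]
theorem sum_split {A : Type*} [AddCommMonoid A] (f : Finset (Fin (q+1)) → A) :
    ∑ C, f C = ∑ C, f (up C) + ∑ C, f (ups C) := by
  rw [← Finset.sum_filter_not_add_sum_filter univ (fun C => Fin.last q ∈ C)]
  congr 1
  · refine Finset.sum_bij' (fun C _ => dn C) (fun C _ => up C) ?_ ?_ ?_ ?_ ?_
    · simp
    · intro C _; simp [last_up]
    · intro C hC; exact up_dn C (by simpa using hC)
    · intro C _; exact dn_up C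
    · intro C hC; rw [up_dn C (by simpa using hC)]
  · refine Finset.sum_bij' (fun C _ => dn C) (fun C _ => ups C) ?_ ?_ ?_ ?_ ?_
    · simp
    · intro C _; simp [ups]
    · intro C hC; exact ups_dn C (by simpa using hC)
    · intro C _; exact dn_ups C
    · intro C hC; rw [ups_dn C (by simpa using hC)]
theorem cnt_dn (C : Finset (Fin (q+1))) (k : ℕ) (hk : k ≤ q) : cnt (dn C) k = cnt C k := by
  unfold cnt
  rw [← card_up]
  congr 1; ext i
  refine Fin.lastCases ?_ (fun j => ?_) i
  · simp [last_up]; omega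
  · rw [mem_up]; simp [mem_dn]
theorem cnt_big (C : Finset (Fin q)) (k : ℕ) (hk : q ≤ k) : cnt C k = C.card := by
  unfold cnt
  rw [filter_true_of_mem]
  intro i _; omega
theorem cle_dn (C B : Finset (Fin (q+1))) :
    cle C B ↔ cle (dn C) (dn B) ∧ B.card ≤ C.card := by
  constructor
  · intro h
    refine ⟨fun k => ?_, ?_⟩
    · rcases le_total k q with hk | hk
      · rw [cnt_dn _ _ hk, cnt_dn _ _ hk]; exact h k
      · rw [cnt_big _ _ hk, cnt_big _ _ hk, ← cnt_big _ q le_rfl, ← cnt_big _ q le_rfl,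
          cnt_dn _ _ le_rfl, cnt_dn _ _ le_rfl]; exact h q
    · have := h (q+1)
      rwa [cnt_big _ _ le_rfl, cnt_big _ _ le_rfl] at this
  · rintro ⟨h1, h2⟩ k
    rcases Nat.lt_or_ge q k with hk | hk
    · rwa [cnt_big _ _ hk, cnt_big _ _ hk]
    · rw [← cnt_dn _ _ hk, ← cnt_dn _ _ hk]; exact h1 k
def Lb : List ℕ → ℕ → ℚ → List (List ℕ)
  | [], _, d => if d = 0 then [[]] else []
  | p :: ps, b, d => if p < b then [] else
      (Lb ps p d).map (List.cons p) ++ (if p = 0 then [] else (Lb ps p (d-1)).map (List.cons (p-1)))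
theorem single_mul_coeff (e d : ℚ) (x : CharRing q) (F : GR q) :
    (AddMonoidAlgebra.single e x * F).coeff d = x * F.coeff (d - e) := by
  rw [AddMonoidAlgebra.coeff_single_mul_apply, neg_add_eq_sub]
theorem branch (ps : List ℕ) : ∀ (B : Finset (Fin (q+1))) (d : ℚ),
    (Th q (TG ps B)).coeff d = ((Lb ps B.card d).map fun ps' => TG ps' (dn B)).sum := by
  induction ps with
  | nil =>
    intro B d
    simp only [TG, map_one, Lb]
    rw [AddMonoidAlgebra.one_def, AddMonoidAlgebra.coeff_single, Finsupp.single_apply]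
    by_cases h : d = 0
    · simp [h, TG]
    · simp [h, Ne.symm h]
  | cons p ps ih =>
    intro B d
    have key : ∀ C, (Th q (mono (ind C) * TG ps C)).coeff d =
        mono (ind (dn C)) * (((Lb ps C.card (d - if Fin.last q ∈ C then 1 else 0)).map
          fun ps' => TG ps' (dn C)).sum) := by
      intro C
      rw [map_mul, ← ih C]
      have : Th q (mono (ind C)) = AddMonoidAlgebra.single (if Fin.last q ∈ C then 1 else 0) (mono (ind (dn C))) := by
        rw [Th, gr_mono]; congr 2
        ext i; simp [ind, mem_dn]
      rw [this, single_mul_coeff]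
    simp only [TG, map_sum]
    rw [← cf_apply, map_sum]
    simp only [cf_apply, key]
    rw [Finset.sum_filter, sum_split]
    simp only [dn_up, dn_ups, card_up, card_ups, cle_dn, last_up, if_false]
    simp only [show ∀ C : Finset (Fin q), Fin.last q ∈ ups C from fun C => by simp [ups], if_true, sub_zero]
    rw [← Finset.sum_filter, ← Finset.sum_filter, Lb]
    split_ifs with hp hp0
    · rw [sum_eq_zero, sum_eq_zero]; · simp
      · intro C hC; simp only [mem_filter] at hC; omega
      · intro C hC; simp only [mem_filter] at hC; omega
    · subst hp0
      rw [sum_eq_zero (s := filter (fun C : Finset (Fin q) => C.card + 1 = 0 ∧ _) _)]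
      · rw [add_zero, List.append_nil, List.map_map]
        have hB : B.card = 0 := by omega
        have : ∀ L : List (List ℕ), (L.map ((fun ps' => TG ps' (dn B)) ∘ List.cons 0)).sum =
          ∑ C ∈ univ.filter (fun C : Finset (Fin q) => C.card = 0 ∧ cle C (dn B)), mono (ind C) *
            (L.map fun ps' => TG ps' C).sum := by
          intro L
          induction L with
          | nil => simp
          | cons a L ihL => simp only [List.map_cons, List.sum_cons, ihL, mul_add, sum_add_distrib]; rfl
        rw [this]
        refine sum_congr ?_ fun C hC => ?_
        · ext C; simp only [mem_filter, mem_univ, true_and]; constructor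
          · tauto
          · rintro ⟨h1, h2⟩; exact ⟨h1, h2, bo⟩
        · simp only [mem_filter] at hC; rw [hC.2.1]
      · intro C hC; simp only [mem_filter] at hC; omega
    · have : ∀ (p : ℕ) (L : List (List ℕ)), (L.map ((fun ps' => TG ps' (dn B)) ∘ List.cons p)).sum =
          ∑ C ∈ univ.filter (fun C : Finset (Fin q) => C.card = p ∧ cle C (dn B)), mono (ind C) *
            (L.map fun ps' => TG ps' C).sum := by
        intro p L
        induction L with
        | nil => simp
        | cons a L ihL => simp only [List.map_cons, List.sum_cons, ihL, mul_add, sum_add_distrib]; rfl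
      rw [List.map_append, List.sum_append, List.map_map, List.map_map, this, this]
      congr 1
      · refine sum_congr ?_ fun C hC => ?_
        · ext C; simp only [mem_filter, mem_univ, true_and]; constructor
          · tauto
          · rintro ⟨h1, h2⟩; exact ⟨h1, h2, bo⟩
        · simp only [mem_filter] at hC; rw [hC.2.1]
      · refine sum_congr ?_ fun C hC => ?_
        · ext C; simp only [mem_filter, mem_univ, true_and]; constructor
          · rintro ⟨h1, h2, h3⟩; exact ⟨by omega, h2⟩
          · rintro ⟨h1, h2⟩; exact ⟨by omega, h2, bo⟩
        · simp only [mem_filter] at hC; rw [hC.2.1, Nat.sub_add_cancel bo]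
def Good : (q : ℕ) → CharRing q → Prop
  | 0, A => ∀ F ∈ KK 0, A * F ∈ KK 0
  | q+1, A => (∀ F ∈ KK (q+1), A * F ∈ KK (q+1)) ∧ ∀ d, Good q ((Th q A).coeff d)
theorem Good.kk {A : CharRing q} (h : Good q A) {F} (hF : F ∈ KK q) : A * F ∈ KK q := by
  cases q with
  | zero => exact h F hF
  | succ q => exact h.1 F hF
theorem Good.zero : ∀ q, Good q 0
  | 0 => fun F _ => by simp
  | q+1 => ⟨fun F _ => by simp, fun d => by simpa using Good.zero q⟩
theorem Good.add : ∀ {q} {A B : CharRing q}, Good q A → Good q B → Good q (A + B)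
  | 0, A, B, hA, hB => fun F hF => by rw [add_mul]; exact AddSubmonoid.add_mem _ (hA F hF) (hB F hF)
  | q+1, A, B, hA, hB => ⟨fun F hF => by
      rw [add_mul]; exact AddSubmonoid.add_mem _ (hA.1 F hF) (hB.1 F hF),
      fun d => by rw [map_add]; exact Good.add (hA.2 d) (hB.2 d)⟩
theorem Good.sum {q} {ι : Type*} (s : Finset ι) (f : ι → CharRing q) (h : ∀ i ∈ s, Good q (f i)) :
    Good q (∑ i ∈ s, f i) := by
  induction s using Finset.induction_on with
  | empty => simpa using Good.zero q
  | insert a s ha ih =>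
    rw [sum_insert ha]
    exact (h a bs).add (ih fun i hi => h i (by simp [hi]))
theorem Good.mul : ∀ {q} {A B : CharRing q}, Good q A → Good q B → Good q (A * B)
  | 0, A, B, hA, hB => fun F hF => by rw [mul_assoc]; exact hA _ (hB F hF)
  | q+1, A, B, hA, hB => ⟨fun F hF => by rw [mul_assoc]; exact hA.1 _ (hB.1 F hF), fun d => by
      rw [map_mul, AddMonoidAlgebra.coeff_mul]
      simp only [Finsupp.sum]
      refine Good.sum _ _ fun i _ => Good.sum _ _ fun j _ => ?_
      split_ifs
      · exact Good.mul (hA.2 _) (hB.2 _)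
      · exact Good.zero q⟩
theorem KK_const (c : ℚ) (F : CharRing q) (hF : F ∈ KK q) : mono (fun _ => c) * F ∈ KK q := by
  induction hF using AddSubmonoid.closure_induction with
  | mem x hx =>
    obtain ⟨v, hv, rfl⟩ := hx
    rw [al_const]
    refine al_mem ⟨fun i j h => ?_, fun i j => ?_⟩
    · have := hv.sa h; simp only [Pi.add_apply]; linarith
    · obtain ⟨m, hm⟩ := hv.id i j; exact ⟨m, by simp [← hm]⟩
  | zero => simp
  | add x y _ _ hx hy => rw [mul_add]; exact AddSubmonoid.add_mem _ hx hy
theorem Good.const : ∀ (q) (c : ℚ), Good q (mono fun _ => c)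
  | 0, c => fun F hF => KK_const c F hF
  | q+1, c => ⟨fun F hF => KK_const c F hF, fun d => by
      rw [Th, gr_mono, AddMonoidAlgebra.coeff_single, Finsupp.single_apply]
      split_ifs
      · exact Good.const q c
      · exact Good.zero q⟩
theorem Good.schur : ∀ (q) (ps : List ℕ), Good q (Schur ps)
  | 0, ps => fun F hF => Schur_KK ps F hF
  | q+1, ps => ⟨fun F hF => Schur_KK ps F hF, fun d => by
      rw [Schur, branch]
      have : dn (∅ : Finset (Fin (q+1))) = ∅ := by ext i; simp [mem_dn]
      rw [this]
      generalize Lb ps _ d = L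
      induction L with
      | nil => simpa using Good.zero q
      | cons a L ih =>
        simp only [List.map_cons, List.sum_cons]
        exact (Good.schur q a).add ih⟩
theorem good_schur {α : Fin q → ℚ} (h : AD α) :
    ∃ S, Good q S ∧ S * al q (rA q) = al q (α + rA q) := by
  obtain ⟨c, ps, h⟩ := schur_exists h
  exact ⟨_, (Good.const q c).mul (Good.schur q ps), h⟩
end

section
def sg (b : Bool) : ℤ := if b then -1 else 1
theorem sg_xor (a b : Bool) : sg (xor a b) = sg a * sg b := by cases a <;> cases b <;> simp [sg]
theorem sg_sq (a : Bool) : sg a * sg a = 1 := by cases a <;> simp [sg]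
theorem sg_sqQ (a : Bool) : (sg a : ℚ) * sg a = 1 := by exact_mod_cast sg_sq a
def par (s : Fin n → Bool) : ℤ := ∏ i, sg (s i)
theorem par_or (s : Fin n → Bool) : par s = 1 ∨ par s = -1 := by
  have : par s * par s = 1 := by
    simp only [par, ← prod_mul_distrib, sg_sq, prod_const_one]
  exact mul_self_eq_one_iff.1 this
theorem par_card (s : Fin n → Bool) : par s = mo ^ (univ.filter (fun i => s i = true)).card := by
  simp only [par, sg]
  rw [Finset.prod_ite]; simp
theorem par_comp (s r : Fin n → Bool) (σ : Equiv.Perm (Fin n)) :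
    par (fun i => xor (s i) (r (σ i))) = par s * par r := by
  simp only [par, sg_xor, prod_mul_distrib]
  congr 1
  exact Equiv.prod_comp σ (fun i => sg (r i))
def TY (p : Equiv.Perm (Fin n) × (Fin n → Bool)) : (Fin n → ℚ) →+ (Fin n → ℚ) where
  toFun v := fun i => (sg (p.2 i) : ℚ) * v (p.1 i)
  map_zero' := by ext; simp
  map_add' _ _ := by ext; simp [mul_add]
theorem TY_apply (p : Equiv.Perm (Fin n) × (Fin n → Bool)) (v : Fin n → ℚ) (i) :
    TY p v i = (sg (p.2 i) : ℚ) * v (p.1 i) := rfl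
def eY (t : CType) (p : Equiv.Perm (Fin n) × (Fin n → Bool)) : ℤ :=
  if t = CType.D ∧ par p.2 ≠ 1 then 0 else ((Equiv.Perm.sign p.1 : ℤˣ) : ℤ) * par p.2
theorem eY_ne {p : Equiv.Perm (Fin n) × (Fin n → Bool)} (h : eY t p ≠ 0) :
    t = CType.D → par p.2 = 1 := by
  intro ht; by_contra hp; exact h (by rw [eY, if_pos ⟨ht, hp⟩])
theorem eY_eq {p : Equiv.Perm (Fin n) × (Fin n → Bool)}
    (h : t = CType.D → par p.2 = 1) : eY t p = ((Equiv.Perm.sign p.1 : ℤˣ) : ℤ) * par p.2 := by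
  rw [eY, if_neg (by tauto)]
theorem sign_or (σ : Equiv.Perm (Fin n)) : ((Equiv.Perm.sign σ : ℤˣ) : ℤ) = 1 ∨
    ((Equiv.Perm.sign σ : ℤˣ) : ℤ) = -1 := by
  rcases Int.units_eq_one_or (Equiv.Perm.sign σ) with h | h <;> simp [h]
theorem eY_ne' {p : Equiv.Perm (Fin n) × (Fin n → Bool)}
    (h : t = CType.D → par p.2 = 1) : eY t p ≠ 0 := by
  rw [eY_eq h]
  rcases par_or p.2 with h | h <;> simp [h]
theorem eY_mul (t : CType) (p r : Equiv.Perm (Fin n) × (Fin n → Bool)) (hr : eY t r ≠ 0)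
    (x : Equiv.Perm (Fin n) × (Fin n → Bool))
    (h1 : Equiv.Perm.sign x.1 = Equiv.Perm.sign p.1 * Equiv.Perm.sign r.1)
    (h2 : par x.2 = par p.2 * par r.2) : eY t x = eY t p * eY t r := by
  have h3 := eY_ne hr
  by_cases hp : t = CType.D ∧ par p.2 ≠ 1
  · have : par x.2 ≠ 1 := by rw [h2, h3 hp.1, mul_one]; exact hp.2
    rw [eY, if_pos ⟨hp.1, this⟩, eY, if_pos hp, zero_mul]
  · have h4 : t = CType.D → par p.2 = 1 := by tauto
    rw [eY_eq h3, eY_eq h4, eY_eq (fun h => by rw [h2, h3 h, h4 h]; rfl), h1, h2]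
    push_cast; ring
def WY (t : CType) (n : ℕ) : WS n where
  I := Equiv.Perm (Fin n) × (Fin n → Bool)
  fin := inferInstance
  T := TY
  ε := eY t
  eps p := by
    by_cases h : t = CType.D ∧ par p.2 ≠ 1
    · left; rw [eY, if_pos h]
    · right; rw [eY, if_neg h]
      rcases par_or p.2 with h | h <;> rcases sign_or p.1 with h' | h' <;> simp [h, h']
  R r hr := by
    refine ⟨Equiv.ofBijective (fun p => (r.1 * p.1, fun i => xor (p.2 i) (r.2 (p.1 i))))
      (Finite.injective_iff_bijective.1 ?_), fun p => ⟨?_, ?_⟩⟩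
    · rintro ⟨σ, s⟩ ⟨τ, u⟩ h
      simp only [Prod.mk.injEq, mul_right_inj] at h
      obtain ⟨rfl, h⟩ := h
      congr 1; ext i
      have := congrFun h i
      revert this
      cases s i <;> cases u i <;> cases r.2 (σ i) <;> simp
    · ext v i
      simp only [AddMonoidHom.comp_apply, TY_apply, Equiv.ofBijective_apply, sg_xor]
      push_cast; rw [mul_assoc]; rfl
    · refine eY_mul t p r hr _ ?_ ?_
      · simp [mul_comm]
      · exact par_comp _ _ _
  L r hr := by
    refine ⟨Equiv.ofBijective (fun p => (p.1 * r.1, fun i => xor (r.2 i) (p.2 (r.1 i))))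
      (Finite.injective_iff_bijective.1 ?_), fun p => ⟨?_, ?_⟩⟩
    · rintro ⟨σ, s⟩ ⟨τ, u⟩ h
      simp only [Prod.mk.injEq, mul_left_inj] at h
      obtain ⟨rfl, h⟩ := h
      congr 1; ext i
      have := congrFun h (r.1⁻¹ i)
      revert this
      simp
    · ext v i
      simp only [AddMonoidHom.comp_apply, TY_apply, Equiv.ofBijective_apply, sg_xor]
      push_cast; rw [mul_assoc]; rfl
    · rw [mul_comm]
      refine eY_mul t p r hr _ ?_ ?_
      · simp
      · rw [mul_comm]; exact par_comp _ _ _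
abbrev AY (t : CType) (n : ℕ) (v : Fin n → ℚ) : CharRing n := (WY t n).alt v
theorem AY_def (t : CType) (n : ℕ) (v : Fin n → ℚ) :
    AY t n v = ∑ σ : Equiv.Perm (Fin n), ∑ s : Fin n → Bool, eY t (σ, s) • mono (TY (σ, s) v) := by
  rw [← Fintype.sum_prod_type' (f := fun σ s => eY t (σ, s) • mono (TY (σ, s) v))]
  rfl
theorem altY_eq (t : CType) (n : ℕ) (v : Fin n → ℚ) : altY t n v = AY t n v := by
  rw [AY_def, altY]
  refine sum_congr rfl fun σ _ => sum_congr rfl fun s _ => ?_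
  have hpar : par s = 1 ↔ Even (univ.filter (fun i => s i = true)).card := by
    rw [par_card, neg_one_pow_eq_one_iff_even bn]
  rw [eY]
  simp only [ne_eq, hpar]
  split_ifs with h
  · simp
  · rw [par_card]; congr 2; ext i; simp only [TY_apply]; congr 1; cases s i <;> simp [sg]
def HI (v : Fin n → ℚ) : Prop := ∃ e : ℤ, ∀ i, ∃ m : ℤ, v i = m + e / 2
theorem HI.add {u v : Fin n → ℚ} : HI u → HI v → HI (u + v) := by
  rintro ⟨e, h⟩ ⟨e', h'⟩
  refine ⟨e + e', fun i => ?_⟩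
  obtain ⟨a, ha⟩ := h i
  obtain ⟨b, hb⟩ := h' i
  exact ⟨a + b, by simp only [Pi.add_apply, ha, hb]; push_cast; ring⟩
theorem HI.sub {u v : Fin n → ℚ} : HI u → HI v → HI (u - v) := by
  rintro ⟨e, h⟩ ⟨e', h'⟩
  refine ⟨e - e', fun i => ?_⟩
  obtain ⟨a, ha⟩ := h i
  obtain ⟨b, hb⟩ := h' i
  exact ⟨a - b, by simp only [Pi.sub_apply, ha, hb]; push_cast; ring⟩
theorem HI.T {v : Fin n → ℚ} (h : HI v) (p) : HI (TY p v) := by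
  obtain ⟨e, h⟩ := h
  refine ⟨e, fun i => ?_⟩
  obtain ⟨a, ha⟩ := h (p.1 i)
  rw [TY_apply, ha]
  cases p.2 i
  · exact ⟨a, by simp [sg]⟩
  · exact ⟨-a - e, by simp [sg]; ring⟩
theorem HI.abs {v : Fin n → ℚ} (h : HI v) : HI (fun i => |v i|) := by
  obtain ⟨e, h⟩ := h
  refine ⟨e, fun i => ?_⟩
  obtain ⟨a, ha⟩ := h i
  rcases abs_choice (v i) with h' | h'
  · exact ⟨a, by change |v i| = _; rw [h', ha]⟩
  · exact ⟨-a - e, by change |v i| = _; rw [h', ha]; push_cast; ring⟩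
theorem HI.id {v : Fin n → ℚ} (h : HI v) : ID v := by
  obtain ⟨e, h⟩ := h
  intro i j
  obtain ⟨a, ha⟩ := h i
  obtain ⟨b, hb⟩ := h j
  exact ⟨a - b, by rw [ha, hb]; push_cast; ring⟩
theorem SD.gaps {v : Fin q → ℚ} (h : SD v) {i j : Fin q} (hij : i ≤ j) :
    v j + ((j.val : ℚ) - i.val) ≤ v i := by
  obtain ⟨d, hd⟩ : ∃ d, i.val + d = j.val := ⟨j.val - i.val, by rw [Fin.le_def] at hij; omega⟩
  induction d generalizing j with
  | zero => rw [show i = j from Fin.ext bo]; simp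
  | succ d ih =>
    have h1 := @ih ⟨i.val + d, bo⟩ (by rw [Fin.le_def]; simp) rfl
    have h2 := h.gap (i := ⟨i.val + d, bo⟩) (j := j) (by rw [Fin.lt_def]; simp; omega)
    have : (j.val : ℚ) = i.val + d + 1 := by rw [← hd]; push_cast; ring
    simp only [Nat.cast_add] at h1
    rw [this]; linarith
structure DomY (t : CType) {n : ℕ} (μ : Fin n → ℚ) : Prop where
  hi : HI μ
  ab : ∀ i j, i < j → |μ j| ≤ μ i
  nn : t ≠ CType.D → ∀ i, 0 ≤ μ i
abbrev rY := rhoY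
theorem rY_step (i j : Fin n) : rY t n i - rY t n j = (j.val : ℚ) - i.val := by
  cases t <;> simp only [rhoY] <;> ring
theorem rY_nonneg (i : Fin n) : 0 ≤ rY t n i := by
  have : (i.val : ℚ) + 1 ≤ n := by exact_mod_cast i.2
  cases t <;> simp only [rhoY] <;> linarith
theorem rY_pos (ht : t ≠ CType.D) (i : Fin n) : 0 < rY t n i := by
  have : (i.val : ℚ) + 1 ≤ n := by exact_mod_cast i.2
  cases t <;> simp only [rhoY] <;> first | linarith | exact absurd rfl ht
theorem rY_lt {i j : Fin n} (h : i < j) : rY t n j < rY t n i := by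
  have := rY_step (t := t) i j
  have : (i.val : ℚ) < j.val := by exact_mod_cast h
  linarith
theorem rY_HI (t : CType) (n : ℕ) : HI (rY t n) := by
  cases t
  · exact ⟨-1, fun i => ⟨n - i.val, by simp only [rhoY]; push_cast; ring⟩⟩
  · exact ⟨0, fun i => ⟨n - i.val, by simp only [rhoY]; push_cast; ring⟩⟩
  · exact ⟨0, fun i => ⟨n - 1 - i.val, by simp only [rhoY]; push_cast; ring⟩⟩
def single2 (i j : Fin n) : Fin n → Bool := fun x => decide (x = i ∨ x = j)
theorem par_single2 {i j : Fin n} (h : i ≠ j) : par (single2 i j) = 1 := by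
  rw [par_card, neg_one_pow_eq_one_iff_even bn]
  have : (univ.filter fun x => single2 i j x = true) = {i, j} := by
    ext x; simp [single2]
  rw [this, card_pair h]; exact even_two
theorem par_false : par (fun _ : Fin n => false) = 1 := by simp [par, sg]
theorem par_single (i : Fin n) : par (fun x => decide (x = i)) = -1 := by
  rw [par_card]
  have : (univ.filter fun x => decide (x = i) = true) = {i} := by ext x; simp
  rw [this]; simp
theorem AY_zero1 {i j : Fin n} (h : i ≠ j) {v : Fin n → ℚ} (hv : |v i| = |v j|) :
    AY t n v = 0 := by
  rcases abs_eq_abs.1 hv with hv | hv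
  · refine (WY t n).alt_zero (Equiv.swap i j, fun _ => false) ?_ v ?_
    · change eY t _ = -1
      rw [eY_eq (fun _ => par_false), par_false, Equiv.Perm.sign_swap h]; simp
    · ext x; change TY _ v x = v x; rw [TY_apply]
      simp only [sg, Bool.false_eq_true, if_false, Int.cast_one, one_mul]
      rw [Equiv.swap_apply_def]; split_ifs with h1 h2
      · rw [h1, hv]
      · rw [h2, hv]
      · rfl
  · refine (WY t n).alt_zero (Equiv.swap i j, single2 i j) ?_ v ?_
    · change eY t _ = -1
      rw [eY_eq (fun _ => par_single2 h), par_single2 h, Equiv.Perm.sign_swap h]; simp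
    · ext x; change TY _ v x = v x; rw [TY_apply]
      by_cases h1 : x = i
      · subst h1; simp [sg, single2, hv]
      · by_cases h2 : x = j
        · subst h2; simp [sg, single2, hv]
        · simp [sg, single2, h1, h2, Equiv.swap_apply_of_ne_of_ne h1 h2]
theorem AY_zero2 (ht : t ≠ CType.D) {i : Fin n} {v : Fin n → ℚ} (hv : v i = 0) :
    AY t n v = 0 := by
  refine (WY t n).alt_zero (1, fun x => decide (x = i)) ?_ v ?_
  · change eY t _ = -1
    rw [eY_eq (fun h => absurd h ht), par_single]; simp
  · ext x; change TY _ v x = v x; rw [TY_apply]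
    by_cases h : x = i
    · subst h; simp [hv]
    · simp [sg, h]
theorem max_dom {v : Fin n → ℚ} (hv : HI v)
    (hmax : ∀ p, eY t p ≠ 0 → ∑ i, rY t n i * TY p v i ≤ ∑ i, rY t n i * v i) : DomY t v := by
  have two : ∀ (i j : Fin n), i ≠ j → ∀ p, (∀ x, x ≠ i → x ≠ j → TY p v x = v x) → eY t p ≠ 0 →
      rY t n i * TY p v i + rY t n j * TY p v j ≤ rY t n i * v i + rY t n j * v j := by
    intro i j hij p hp h0
    have h := hmax p h0
    rw [← Finset.add_sum_erase _ _ (mem_univ i), ← Finset.add_sum_erase _ (fun x => rY t n x * v x) (mem_univ i),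
      ← Finset.add_sum_erase (univ.erase i) _ (show j ∈ univ.erase i by simp [hij.symm]),
      ← Finset.add_sum_erase (univ.erase i) (fun x => rY t n x * v x) (show j ∈ univ.erase i by simp [hij.symm])] at h
    have e : ∑ x ∈ (univ.erase i).erase j, rY t n x * TY p v x = ∑ x ∈ (univ.erase i).erase j, rY t n x * v x := by
      refine sum_congr rfl fun x hx => ?_
      simp only [mem_erase, mem_univ, and_true] at hx
      rw [hp x hx.2 hx.1]
    linarith
  refine ⟨hv, fun i j hij => ?_, fun ht i => ?_⟩
  · have hne : i ≠ j := hij.ne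
    have hlt := rY_lt (t := t) hij
    have hj := rY_nonneg (t := t) j
    have h1 := two i j hne (Equiv.swap i j, fun _ => false)
      (fun x h1 h2 => by rw [TY_apply]; simp [sg, Equiv.swap_apply_of_ne_of_ne h1 h2])
      (eY_ne' fun _ => par_false)
    have h2 := two i j hne (Equiv.swap i j, single2 i j)
      (fun x h1 h2 => by rw [TY_apply]; simp [sg, single2, h1, h2, Equiv.swap_apply_of_ne_of_ne h1 h2])
      (eY_ne' fun _ => par_single2 hne)
    simp only [TY_apply, sg, single2] at h1 h2
    simp at h1 h2
    rw [abs_le]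
    constructor
    · by_contra hc
      push Not at hc
      nlinarith
    · by_contra hc
      push Not at hc
      nlinarith
  · have h := hmax (1, fun x => decide (x = i)) (eY_ne' fun h => absurd h ht)
    rw [← Finset.add_sum_erase _ _ (mem_univ i), ← Finset.add_sum_erase _ (fun x => rY t n x * v x) (mem_univ i)] at h
    have e : ∑ x ∈ univ.erase i, rY t n x * TY (1, fun x => decide (x = i)) v x = ∑ x ∈ univ.erase i, rY t n x * v x := by
      refine sum_congr rfl fun x hx => ?_
      simp only [mem_erase, mem_univ, and_true] at hx
      rw [TY_apply]; simp [sg, hx]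
    rw [e, TY_apply] at h
    simp [sg] at h
    have := rY_pos ht i
    by_contra hc
    push Not at hc
    nlinarith
theorem exists_max (v : Fin n → ℚ) (hv : HI v) : ∃ p, eY t p ≠ 0 ∧ DomY t (TY p v) ∧
    ∀ p', eY t p' ≠ 0 → ∑ i, rY t n i * TY p' v i ≤ ∑ i, rY t n i * TY p v i := by
  have hne : (univ.filter fun p : Equiv.Perm (Fin n) × (Fin n → Bool) => eY t p ≠ 0).Nonempty :=
    ⟨(1, fun _ => false), by simp only [mem_filter, mem_univ, true_and]; exact eY_ne' fun _ => par_false⟩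
  obtain ⟨p, hp, hm⟩ := Finset.exists_max_image _ (fun p => ∑ i, rY t n i * TY p v i) hne
  simp only [mem_filter, mem_univ, true_and] at hp hm
  refine ⟨p, hp, max_dom (hv.T p) fun p' hp' => ?_, hm⟩
  obtain ⟨e, he⟩ := (WY t n).R p hp
  have h1 : TY (e p') = (TY p').comp (TY p) := (he p').1
  have h2 : eY t (e p') = eY t p' * eY t p := (he p').2
  have := hm (e p') (by rw [h2]; exact mul_ne_zero hp' hp)
  rw [h1] at this
  exact this
theorem dom_unique {u v : Fin n → ℚ} (hu : DomY t u) (hv : DomY t v) (p)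
    (hp : eY t p ≠ 0) (h : u = TY p v) : u = v := by
  have habs : (fun i => |u i|) = fun i => |v i| := by
    refine anti_unique _ _ ?_ ?_ p.1 ?_
    · intro i j hij
      rcases hij.eq_or_lt with rfl | hij
      · exact le_rfl
      · exact (hu.ab i j hij).trans (le_abs_self _)
    · intro i j hij
      rcases hij.eq_or_lt with rfl | hij
      · exact le_rfl
      · exact (hv.ab i j hij).trans (le_abs_self _)
    · ext i
      simp only [pre_apply, h, TY_apply]
      cases p.2 i <;> simp [sg]
  have key : ∀ i, 0 ≤ u i → 0 ≤ v i → u i = v i := fun i h1 h2 => by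
    have := congrFun habs i
    simpa only [abs_of_nonneg h1, abs_of_nonneg h2] using this
  by_cases ht : t = CType.D
  · cases n with
    | zero => exact funext fun i => i.elim0
    | succ n =>
      have h1 : ∀ i : Fin n, u i.castSucc = v i.castSucc := fun i =>
        key _ ((abs_nonneg _).trans (hu.ab _ (Fin.last n) (Fin.castSucc_lt_last i)))
          ((abs_nonneg _).trans (hv.ab _ (Fin.last n) (Fin.castSucc_lt_last i)))
      have h2 : u (Fin.last n) = v (Fin.last n) := by
        by_cases h0 : v (Fin.last n) = 0
        · have := congrFun habs (Fin.last n)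
          simp only [h0, abs_zero, abs_eq_zero] at this
          rw [this, h0]
        · have hpr : ∏ i, u i = ∏ i, v i := by
            rw [h]; simp only [TY_apply]
            rw [prod_mul_distrib, Equiv.prod_comp p.1 v]
            have : (∏ i, (sg (p.2 i) : ℚ)) = (par p.2 : ℤ) := by simp [par]
            rw [this, eY_ne hp ht]; simp
          rw [Fin.prod_univ_castSucc, Fin.prod_univ_castSucc, prod_congr rfl fun i _ => h1 i] at hpr
          refine mul_left_cancel₀ ?_ hpr
          rw [prod_ne_zero_iff]
          intro i _ h3
          have := hv.ab _ (Fin.last n) (Fin.castSucc_lt_last i)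
          rw [h3] at this
          exact h0 (abs_eq_zero.1 (le_antisymm this (abs_nonneg _)))
      ext i
      refine Fin.lastCases h2 h1 i
  · ext i; exact key i (hu.nn ht i) (hv.nn ht i)
theorem straight (ht : t ≠ CType.C) {v : Fin n → ℚ} (hv : HI v) : AY t n v = 0 ∨ ∃ μ p, DomY t μ ∧
    eY t p ≠ 0 ∧ rY t n + μ = TY p v := by
  obtain ⟨p, hp, hd, _⟩ := exists_max (t := t) v hv
  set u := TY p v with hu
  have hz : AY t n u = 0 → AY t n v = 0 := by
    intro h
    have h1 := (WY t n).alt_T p hp v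
    have h2 : (WY t n).alt ((WY t n).T p v) = 0 := h
    rw [h2] at h1
    have h3 := (WY t n).eps_sq p hp
    have : (WY t n).alt v = (WY t n).ε p • ((WY t n).ε p • (WY t n).alt v) := by
      rw [smul_smul, h3, one_smul]
    rw [← h1, smul_zero] at this
    exact this
  by_cases h1 : ∃ i j, i < j ∧ |u j| = u i
  · left
    obtain ⟨i, j, hij, h1⟩ := h1
    refine hz (AY_zero1 hij.ne (by rw [h1, ← h1, abs_abs]))
  by_cases h2 : t ≠ CType.D ∧ ∃ i, u i = 0
  · left; obtain ⟨h2, i, h3⟩ := h2; exact hz (AY_zero2 h2 h3)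
  right
  push Not at h1
  have hlt : ∀ i j, i < j → |u j| < u i := fun i j hij => lt_of_le_of_ne (hd.ab i j hij) (h1 i j hij)
  have hsd : SD (fun i => |u i|) := ⟨fun i j hij => (hlt i j hij).trans_le (le_abs_self _), hd.hi.abs.id⟩
  refine ⟨u - rY t n, p, ⟨hd.hi.sub (rY_HI t n), fun i j hij => ?_, fun ht' i => ?_⟩, hp, by abel⟩
  · have g1 := hsd.gaps hij.le
    have hui : |u i| = u i := abs_of_nonneg ((abs_nonneg _).trans (hd.ab i j hij))
    simp only [hui] at g1
    have s1 := rY_step (t := t) i j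
    simp only [Pi.sub_apply]
    rw [abs_le]
    have a1 := le_abs_self (u j)
    have a2 := neg_abs_le (u j)
    constructor
    ·
      have hn : j.val < n := j.2
      cases t with
      | C => exact absurd rfl ht
      | B =>
        have hB := fun i => hd.nn bs i
        have h3 : ∀ i, u i ≠ 0 := fun i hi => h2 ⟨by simp, i, hi⟩
        have hl : ∀ x : Fin n, rY CType.B n x ≤ u x := by
          intro x
          have g := hsd.gaps (i := x) (j := ⟨n-1, bo⟩) (by rw [Fin.le_def]; simp; omega)
          have hpos := lt_of_le_of_ne (hB ⟨n-1, bo⟩) (h3 ⟨n-1, bo⟩).symm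
          simp only [abs_of_nonneg (hB _)] at g
          have : (1:ℚ)/2 ≤ u ⟨n-1, bo⟩ := by
            obtain ⟨e, he⟩ := hd.hi
            obtain ⟨m, hm⟩ := he ⟨n-1, bo⟩
            rw [hm] at hpos ⊢
            have : (0:ℚ) < ((2*m+e : ℤ) : ℚ) := by push_cast; linarith
            have : (1:ℤ) ≤ 2*m+e := by exact_mod_cast this
            have : (1:ℚ) ≤ ((2*m+e : ℤ) : ℚ) := by exact_mod_cast this
            push_cast at this; linarith
          rw [Nat.cast_sub bo] at g
          simp only [rhoY]; push_cast at g; linarith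
        linarith [hl i, hl j]
      | D =>
        have hl : ∀ x : Fin n, x.val < n - 1 → rY CType.D n x + |u ⟨n-1, bo⟩| ≤ u x := by
          intro x hx
          have hxl : x < ⟨n-1, bo⟩ := by rw [Fin.lt_def]; exact hx
          have g := hsd.gaps (i := x) (j := ⟨n-1, bo⟩) hxl.le
          simp only [abs_of_nonneg ((abs_nonneg _).trans (hd.ab x _ hxl))] at g
          rw [Nat.cast_sub bo] at g
          simp only [rhoY]; push_cast at g; linarith
        have hij' : i.val < j.val := hij
        by_cases hj : j.val < n - 1
        · have := hl i bo
          have := hl j hj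
          have := abs_nonneg (u ⟨n-1, bo⟩)
          linarith
        · have hj' : j = ⟨n-1, bo⟩ := Fin.ext (by simp; omega)
          have := hl i bo
          have r0 : rY CType.D n j = 0 := by
            rw [hj']; simp only [rhoY]; rw [Nat.cast_sub bo]; push_cast; ring
          rw [← hj'] at this
          linarith
    · linarith
  · cases t with
    | C => exact absurd rfl ht
    | D => exact absurd rfl ht'
    | B =>
      have hB := fun i => hd.nn bs i
      have hn := i.2
      have g := hsd.gaps (i := i) (j := ⟨n-1, bo⟩) (by rw [Fin.le_def]; simp; omega)
      have hpos := lt_of_le_of_ne (hB ⟨n-1, bo⟩) (fun hi => h2 ⟨by simp, _, hi.symm⟩)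
      simp only [abs_of_nonneg (hB _)] at g
      have : (1:ℚ)/2 ≤ u ⟨n-1, bo⟩ := by
        obtain ⟨e, he⟩ := hd.hi
        obtain ⟨m, hm⟩ := he ⟨n-1, bo⟩
        rw [hm] at hpos ⊢
        have : (0:ℚ) < ((2*m+e : ℤ) : ℚ) := by push_cast; linarith
        have : (1:ℤ) ≤ 2*m+e := by exact_mod_cast this
        have : (1:ℚ) ≤ ((2*m+e : ℤ) : ℚ) := by exact_mod_cast this
        push_cast at this; linarith
      rw [Nat.cast_sub bo] at g
      simp only [rhoY, Pi.sub_apply]; push_cast at g; linarith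
end

section
theorem TY_inj (p) : Function.Injective (TY (n := n) p) := by
  intro u v h
  ext i
  have := congrFun h (p.1⁻¹ i)
  simp only [TY_apply] at this
  have hs : (sg (p.2 (p.1⁻¹ i)) : ℚ) ≠ 0 := by
    intro h0; have := sg_sqQ (p.2 (p.1⁻¹ i)); rw [h0] at this; simp at this
  simpa using mul_left_cancel₀ hs this
theorem TY_sq (p) (v : Fin n → ℚ) : ∑ i, (TY p v i) ^ 2 = ∑ i, (v i) ^ 2 := by
  simp only [TY_apply, mul_pow, pow_two (sg _ : ℚ), sg_sqQ, one_mul]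
  exact Equiv.sum_comp p.1 (fun i => v i ^ 2)
theorem HI.int {v : Fin n → ℚ} (h : HI v) : ∃ z : ℤ, 4 * ∑ i, v i ^ 2 = z := by
  obtain ⟨e, h⟩ := h
  choose m hm using h
  refine ⟨∑ i, (2 * m i + e) ^ 2, ?_⟩
  rw [mul_sum]; push_cast
  refine sum_congr rfl fun i _ => ?_
  rw [hm]; ring
theorem exY (ht : t ≠ CType.C) {lam : Fin n → ℚ} (hl : DomY t lam) :
    ∃ f, AY t n (rY t n) * f = AY t n (rY t n + lam) := by
  suffices H : ∀ N : ℕ, ∀ lam : Fin n → ℚ, DomY t lam → 4 * ∑ i, (rY t n + lam) i ^ 2 < N →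
      ∃ f, AY t n (rY t n) * f = AY t n (rY t n + lam) by
    obtain ⟨N, hN⟩ := exists_nat_gt (4 * ∑ i, (rY t n + lam) i ^ 2)
    exact H N lam hl hN
  intro N
  induction N with
  | zero =>
    intro lam _ h
    have : 0 ≤ ∑ i, (rY t n + lam) i ^ 2 := sum_nonneg fun i _ => sq_nonneg _
    push_cast at h; linarith
  | succ N ih =>
    intro lam hl hN
    set O := (univ.filter fun p : Equiv.Perm (Fin n) × (Fin n → Bool) => eY t p ≠ 0).image (fun p => TY p lam) with hO
    have hinv : (WY t n).Inv (∑ u ∈ O, mono u) := by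
      intro j hj
      rw [map_sum]
      simp only [mp_mono]
      have hsub : O.image (TY j) = O := by
        refine eq_of_subset_of_card_le ?_ (card_image_of_injective _ (TY_inj j)).ge
        intro x hx
        simp only [hO, mem_image, mem_filter, mem_univ, true_and] at hx ⊢
        obtain ⟨_, ⟨p, hp, rfl⟩, rfl⟩ := hx
        obtain ⟨e, he⟩ := (WY t n).L j hj
        refine ⟨e p, ?_, ?_⟩
        · have : eY t (e p) = eY t j * eY t p := (he p).2
          rw [this]; exact mul_ne_zero hj hp
        · have : TY (e p) = (TY j).comp (TY p) := (he p).1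
          rw [this]; rfl
      conv_rhs => rw [← hsub, sum_image fun x _ y _ h => TY_inj j h]
      rfl
    have hmul := (WY t n).mul_alt _ hinv (rY t n)
    rw [map_sum] at hmul
    simp only [ev_mono] at hmul
    have hmem : lam ∈ O := by
      simp only [hO, mem_image, mem_filter, mem_univ, true_and]
      refine ⟨(1, fun _ => false), eY_ne' fun _ => par_false, ?_⟩
      ext i; simp [TY_apply, sg]
    rw [← add_sum_erase O (fun u => (WY t n).alt (rY t n + u)) hmem] at hmul
    have hother : ∀ u ∈ O.erase lam, ∃ f, AY t n (rY t n) * f = AY t n (rY t n + u) := by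
      intro u hu
      rw [mem_erase] at hu
      obtain ⟨hne, hu⟩ := hu
      simp only [hO, mem_image, mem_filter, mem_univ, true_and] at hu
      obtain ⟨p, hp, rfl⟩ := hu
      have hHI := (rY_HI t n).add (hl.hi.T p)
      obtain ⟨pm, hpm, hdm, hmax⟩ := exists_max (t := t) lam hl.hi
      have e1 := dom_unique hdm hl pm hpm rfl
      have hlt : ∑ i, rY t n i * TY p lam i < ∑ i, rY t n i * lam i := by
        rw [e1] at hmax
        refine lt_of_le_of_ne (hmax p hp) fun heq => hne ?_
        have hd : DomY t (TY p lam) := by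
          refine max_dom (hl.hi.T p) fun p' hp' => ?_
          obtain ⟨e, he⟩ := (WY t n).R p hp
          have h1 : TY (e p') = (TY p').comp (TY p) := (he p').1
          have h2 : eY t (e p') = eY t p' * eY t p := (he p').2
          have := hmax (e p') (by rw [h2]; exact mul_ne_zero hp' hp)
          rw [h1] at this
          rw [heq]; exact this
        exact dom_unique hd hl p hp rfl
      have hsq : ∀ w : Fin n → ℚ, ∑ i, (rY t n + w) i ^ 2 =
          ∑ i, rY t n i ^ 2 + 2 * ∑ i, rY t n i * w i + ∑ i, w i ^ 2 := by
        intro w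
        rw [mul_sum, ← sum_add_distrib, ← sum_add_distrib]
        exact sum_congr rfl fun i _ => by simp only [Pi.add_apply]; ring
      have hlt2 : 4 * ∑ i, (rY t n + TY p lam) i ^ 2 < 4 * ∑ i, (rY t n + lam) i ^ 2 := by
        rw [hsq, hsq, TY_sq]; linarith
      rcases straight ht hHI with h0 | ⟨μ, p', hμ, hp', he⟩
      · exact ⟨0, by rw [h0, mul_zero]⟩
      · have hN2 : 4 * ∑ i, (rY t n + μ) i ^ 2 < N := by
          have e2 : ∑ i, (rY t n + μ) i ^ 2 = ∑ i, (rY t n + TY p lam) i ^ 2 := by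
            rw [he, TY_sq]
          rw [e2]
          obtain ⟨z, hz⟩ := hHI.int
          obtain ⟨z', hz'⟩ := ((rY_HI t n).add hl.hi).int
          rw [hz, hz'] at hlt2
          rw [hz'] at hN
          rw [hz]
          have a1 : z < z' := by exact_mod_cast hlt2
          have a2 : z' < N + 1 := by exact_mod_cast hN
          exact_mod_cast (show z < N by omega)
        obtain ⟨f, hf⟩ := ih μ hμ hN2
        have h3 := (WY t n).alt_T p' hp' (rY t n + TY p lam)
        have h4 : AY t n (rY t n + μ) = eY t p' • AY t n (rY t n + TY p lam) := by rw [he]; exact h3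
        refine ⟨eY t p' • f, ?_⟩
        rw [mul_smul_comm, hf, h4, smul_smul]
        have := (WY t n).eps_sq p' hp'
        change eY t p' * eY t p' = 1 at this
        rw [this, one_smul]
    choose! f hf using hother
    refine ⟨∑ u ∈ O, mono u - ∑ u ∈ O.erase lam, f u, ?_⟩
    rw [mul_sub, mul_comm, hmul, mul_sum, sum_congr rfl hf]
    exact add_sub_cancel_right _ _
def Ph (k : Fin n → ℕ) : CharRing n →+ ℚ := ev fun v => ∏ i, v i ^ k i
theorem Ph_mono (k : Fin n → ℕ) (v : Fin n → ℚ) : Ph k (mono v) = ∏ i, v i ^ k i := ev_mono _ _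
theorem Ph_T (k k' : Fin n → ℕ) (p) (c : ℚ) (h : ∀ v : Fin n → ℚ, ∏ i, (TY p v i) ^ k i = c * ∏ i, v i ^ k' i) (F) :
    Ph k (mp (TY p) F) = c * Ph k' F := by
  induction F using cr_ind with
  | h0 => simp
  | ha F G hF hG => simp only [map_add, hF, hG, mul_add]
  | hm v d => simp only [map_zsmul, mp_mono, Ph_mono, h]; simp; ring
theorem Ph_zero (k : Fin n → ℕ) (p) (hp : eY t p ≠ 0) (c : ℚ)
    (h : ∀ v : Fin n → ℚ, ∏ i, (TY p v i) ^ k i = c * ∏ i, v i ^ k i) (hc : c ≠ eY t p) (v) :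
    Ph k (AY t n v) = 0 := by
  have h1 := Ph_T k k p c h (AY t n v)
  have h2 : mp (TY p) (AY t n v) = eY t p • AY t n v := (WY t n).mp_alt p hp v
  rw [h2, map_zsmul] at h1
  have : ((eY t p : ℚ) - c) * Ph k (AY t n v) = 0 := by
    rw [sub_mul, ← h1]; simp
  rcases mul_eq_zero.1 this with h | h
  · exact absurd (sub_eq_zero.1 h).symm hc
  · exact h
def bt (t : CType) : ℕ := if t = CType.D then 0 else 1
def kt (t : CType) (n : ℕ) : Fin n → ℕ := fun i => 2 * i.val + bt t
theorem inj_le (m : Fin n → ℕ) (hi : Function.Injective m) (hle : ∀ i, m i ≤ i.val) (i : Fin n) : m i = i.val := by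
  obtain ⟨x, hx⟩ := i
  induction x using Nat.strong_induction_on with
  | _ x ih =>
    refine le_antisymm (hle _) ?_
    by_contra hc
    push Not at hc
    have h1 := ih (m ⟨x, hx⟩) hc (by simp at hc; omega)
    have := hi h1
    simp only [Fin.mk.injEq] at this
    simp at hc; omega
theorem Ph_low (k : Fin n → ℕ) (hk : ∀ i, k i ≤ kt t n i) (hne : k ≠ kt t n) (v) :
    Ph k (AY t n v) = 0 := by
  by_contra h0
  have hodd : ∀ i, k i % 2 = bt t % 2 := by
    intro i
    by_cases hD : t = CType.D
    · have hn : 0 < n := i.pos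
      have hk0 : k ⟨0, hn⟩ = 0 := by have := hk ⟨0, hn⟩; simp [kt, bt, hD] at this; exact this
      by_contra hc
      have hi : i ≠ ⟨0, hn⟩ := by rintro rfl; exact hc (by rw [hk0, bt, if_pos hD])
      refine h0 (Ph_zero k (1, single2 i ⟨0, hn⟩) (eY_ne' fun _ => par_single2 hi) mo ?_ ?_ v)
      · intro v
        rw [← mul_prod_erase _ _ (mem_univ i), ← mul_prod_erase univ (fun i => v i ^ k i) (mem_univ i)]
        have e : ∏ x ∈ univ.erase i, TY (1, single2 i ⟨0, hn⟩) v x ^ k x = ∏ x ∈ univ.erase i, v x ^ k x := by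
          refine prod_congr rfl fun x hx => ?_
          rw [TY_apply]
          by_cases hx0 : x = ⟨0, hn⟩
          · rw [hx0, hk0]; simp
          · have := (mem_erase.1 hx).1
            simp [sg, single2, this, hx0]
        have ho : Odd (k i) := by rw [Nat.odd_iff]; simp [bt, hD] at hc; omega
        rw [e, TY_apply]
        simp [sg, single2, ho.neg_pow]
      · rw [eY_eq (fun _ => par_single2 hi), par_single2 hi]; simp; norm_num
    · by_contra hc
      refine h0 (Ph_zero k (1, fun x => decide (x = i)) (eY_ne' fun h => absurd h hD) 1 ?_ ?_ v)
      · intro v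
        rw [one_mul]
        refine prod_congr rfl fun x _ => ?_
        rw [TY_apply]
        by_cases hx : x = i
        · have ho : Even (k x) := by rw [hx, Nat.even_iff]; simp [bt, hD] at hc; omega
          simp [sg, hx] ; rw [hx] at ho; exact ho.neg_pow _
        · simp [sg, hx]
      · rw [eY_eq (fun h => absurd h hD), par_single]; simp; norm_num
  have hinj : Function.Injective k := by
    intro i j hij
    by_contra hc
    refine h0 (Ph_zero k (Equiv.swap i j, fun _ => false) (eY_ne' fun _ => par_false) 1 ?_ ?_ v)
    · intro v
      rw [one_mul, ← Equiv.prod_comp (Equiv.swap i j) (fun x => v x ^ k x)]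
      refine prod_congr rfl fun x _ => ?_
      rw [TY_apply]
      have : k (Equiv.swap i j x) = k x := by
        rw [Equiv.swap_apply_def]; split_ifs with h1 h2
        · rw [h1, hij]
        · rw [h2, hij]
        · rfl
      simp [sg, this]
    · rw [eY_eq (fun _ => par_false), par_false, Equiv.Perm.sign_swap hc]; simp; norm_num
  apply hne
  ext i
  have hb : bt t ≤ 1 := by unfold bt; split_ifs <;> omega
  have key := inj_le (fun i => (k i - bt t) / 2) (fun i j h => hinj (by
    have := hodd i; have := hodd j; simp only at h
    by_cases h1 : bt t = 0
    · rw [h1] at *; omega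
    · have : bt t = 1 := by omega
      rw [this] at *; omega)) (fun i => by have := hk i; simp only [kt] at this; omega) i
  have h1 := hodd i
  have h2 := hk i
  simp only [kt] at h2 ⊢
  have key' : (k i - bt t) / 2 = i.val := key
  omega
def aug : CharRing n →+ ℤ := ev fun _ => 1
theorem Ph_mul (g : CharRing n) (v) :
    Ph (kt t n) (g * AY t n v) = aug g * Ph (kt t n) (AY t n v) := by
  induction g using cr_ind with
  | h0 => simp
  | ha F G hF hG => simp only [map_add, add_mul, hF, hG]; push_cast; ring
  | hm u d =>
    have key : ∀ F : CharRing n, Ph (kt t n) (mono u * F) =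
        ∑ k ∈ Fintype.piFinset (fun i => range (kt t n i + 1)), (∏ i, (u i ^ (kt t n i - k i) * (kt t n i).choose (k i))) * Ph k F := by
      intro F
      induction F using cr_ind with
      | h0 => simp
      | ha F G hF hG => simp only [map_add, mul_add, hF, hG, sum_add_distrib]
      | hm v d =>
        rw [mul_smul_comm, map_zsmul, mono_mul, Ph_mono]
        have e : ∏ i, (u + v) i ^ kt t n i = ∏ i, ∑ j ∈ range (kt t n i + 1), v i ^ j * u i ^ (kt t n i - j) * (kt t n i).choose j := by
          refine prod_congr rfl fun i _ => ?_
          rw [← add_pow, Pi.add_apply, add_comm]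
        rw [e, prod_univ_sum, smul_sum]
        refine sum_congr rfl fun k _ => ?_
        rw [map_zsmul, Ph_mono, mul_smul_comm, ← prod_mul_distrib]
        congr 1
        refine prod_congr rfl fun i _ => by ring
    rw [smul_mul_assoc, map_zsmul, key, sum_eq_single (kt t n)]
    · rw [aug, map_zsmul, ev_mono]; simp
    · intro k hk hne
      rw [Ph_low k (fun i => by have := Fintype.mem_piFinset.1 hk i; simp at this; omega) hne, mul_zero]
    · intro h; exfalso; apply h; simp [Fintype.mem_piFinset]
theorem Ph_val (t : CType) (n : ℕ) : ∃ C : ℚ, C ≠ 0 ∧ ∀ v, Ph (kt t n) (AY t n v) =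
    C * ((∏ i, v i ^ bt t) * ∏ i, ∏ j ∈ Ioi i, (v j ^ 2 - v i ^ 2)) := by
  refine ⟨((univ.filter fun s : Fin n → Bool => t = CType.D → par s = 1).card : ℚ), ?_, fun v => ?_⟩
  · have : 0 < (univ.filter fun s : Fin n → Bool => t = CType.D → par s = 1).card :=
      card_pos.2 ⟨fun _ => false, by simp [par_false]⟩
    exact_mod_cast this.ne'
  rw [← Matrix.det_vandermonde, Matrix.det_apply, AY_def, map_sum, mul_sum, mul_sum]
  refine sum_congr rfl fun σ _ => ?_
  rw [map_sum]
  have : ∀ s : Fin n → Bool, Ph (kt t n) (eY t (σ, s) • mono (TY (σ, s) v)) =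
      if (t = CType.D → par s = 1) then (((Equiv.Perm.sign σ : ℤˣ) : ℤ) : ℚ) * ((∏ i, v i ^ bt t) * ∏ i, (v (σ i) ^ 2) ^ i.val) else 0 := by
    intro s
    rw [map_zsmul, Ph_mono]
    split_ifs with h
    · rw [eY_eq h]
      have e : ∏ i, (TY (σ, s) v i) ^ kt t n i = (par s : ℚ) * ((∏ i, v i ^ bt t) * ∏ i, (v (σ i) ^ 2) ^ i.val) := by
        rw [← Equiv.prod_comp σ (fun i => v i ^ bt t), ← prod_mul_distrib]
        have e2 : (par s : ℚ) = ∏ i, ((sg (s i) : ℚ)) ^ bt t := by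
          rw [prod_pow]
          by_cases hD : t = CType.D
          · rw [h hD]; simp [bt, hD]
          · simp [bt, hD, par]
        rw [e2, ← prod_mul_distrib]
        refine prod_congr rfl fun i _ => ?_
        have := sg_sqQ (s i)
        rw [TY_apply, kt, mul_pow, pow_add, pow_mul, pow_two, this, one_pow, one_mul, pow_add, pow_mul]
        ring
      rw [e]
      have := par_or s
      have h2 : (par s : ℚ) * par s = 1 := by rcases this with h | h <;> rw [h] <;> norm_num
      rw [zsmul_eq_mul]; push_cast
      linear_combination (((Equiv.Perm.sign σ : ℤˣ) : ℤ) : ℚ) * ((∏ i, v i ^ bt t) * ∏ i, (v (σ i) ^ 2) ^ i.val) * h2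
    · rw [eY, if_pos (by tauto)]; simp
  rw [sum_congr rfl fun s _ => this s, ← sum_filter, sum_const, nsmul_eq_mul]
  simp only [Matrix.vandermonde_apply]
  rw [Units.smul_def, zsmul_eq_mul]
  ring
theorem Ph_factor {μ : Fin n → ℚ} (hμ : DomY t μ) (i j : Fin n) (hij : i < j) :
    0 < (rY t n i) ^ 2 - (rY t n j) ^ 2 ∧
    (rY t n i) ^ 2 - (rY t n j) ^ 2 + 2 * μ i * (rY t n i - rY t n j) ≤ ((rY t n + μ) i) ^ 2 - ((rY t n + μ) j) ^ 2 := by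
  have h1 := rY_lt (t := t) hij
  have h2 := rY_nonneg (t := t) j
  have h3 := abs_le.1 (hμ.ab i j hij)
  simp only [Pi.add_apply]
  constructor <;> nlinarith [mul_nonneg (sub_nonneg.2 h3.2) (by linarith [h3.1] : 0 ≤ μ j + μ i), mul_nonneg (sub_nonneg.2 h1.le) (by linarith [h3.1] : 0 ≤ μ j + μ i), mul_nonneg (sub_nonneg.2 h3.2) (by linarith [h3.1] : 0 ≤ 2 * rY t n j)]
theorem den_ne (t : CType) (n : ℕ) : AY t n (rY t n) ≠ 0 := by
  obtain ⟨C, hC, h⟩ := Ph_val t n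
  intro h0
  have := h (rY t n)
  rw [h0, map_zero] at this
  have h1 : (∏ i, rY t n i ^ bt t) ≠ 0 := prod_ne_zero_iff.2 fun i _ => by
    by_cases hD : t = CType.D
    · simp [bt, hD]
    · simp [bt, hD, (rY_pos hD i).ne']
  have h2 : ∏ i, ∏ j ∈ Ioi i, ((rY t n j) ^ 2 - rY t n i ^ 2) ≠ 0 :=
    prod_ne_zero_iff.2 fun i _ => prod_ne_zero_iff.2 fun j hj => by
      have := rY_lt (t := t) (mem_Ioi.1 hj)
      have := rY_nonneg (t := t) j
      nlinarith
  exact mul_ne_zero hC (mul_ne_zero h1 h2) this.symm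
theorem dim_ge (hn : 2 ≤ n) {μ : Fin n → ℚ} (hμ : DomY t μ) (h0 : μ ≠ 0) (g : CharRing n)
    (hg : AY t n (rY t n) * g = AY t n (rY t n + μ)) : 2 ≤ |aug g| := by
  obtain ⟨C, hC, h⟩ := Ph_val t n
  have h1 := Ph_mul (t := t) g (rY t n)
  rw [mul_comm, hg, h, h, mul_left_comm (_ : ℚ) C] at h1
  have h1 := mul_left_cancel₀ hC h1
  have h2 := congrArg abs h1
  simp only [abs_mul, abs_prod] at h2
  set i0 : Fin n := ⟨0, bo⟩
  set i1 : Fin n := ⟨1, bo⟩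
  have hpos : 0 < μ i0 := by
    by_contra hc
    push Not at hc
    apply h0
    have hz : μ i0 = 0 := le_antisymm hc ((abs_nonneg _).trans (hμ.ab i0 i1 (by simp [i0, i1])))
    ext j
    by_cases hj : j = i0
    · rw [hj, hz]; rfl
    · have := hμ.ab i0 j (by rw [Fin.lt_def]; simp [i0]; by_contra hc; exact hj (Fin.ext (by simp [i0]; omega)))
      rw [hz] at this; simpa using le_antisymm this (abs_nonneg _)
  have hA : ∏ i, |rY t n i ^ bt t| ≤ ∏ i, |(rY t n + μ) i ^ bt t| := by
    refine prod_le_prod (fun _ _ => abs_nonneg _) fun i _ => ?_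
    by_cases hD : t = CType.D
    · simp [bt, hD]
    · have := rY_pos hD i
      have := hμ.nn hD i
      simp only [bt, hD, if_false, pow_one, Pi.add_apply]
      rw [abs_of_pos (by assumption), abs_of_pos (by linarith)]; linarith
  have hA0 : 0 < ∏ i, |rY t n i ^ bt t| := prod_pos fun i _ => by
    by_cases hD : t = CType.D
    · simp [bt, hD]
    · simp [bt, hD, (rY_pos hD i).ne']
  have hnon : ∀ i, 0 ≤ μ i ∨ ∀ j, ¬ i < j := fun i => by
    by_cases h : ∃ j, i < j
    · obtain ⟨j, hj⟩ := h; exact Or.inl ((abs_nonneg _).trans (hμ.ab i j hj))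
    · right; push Not at h; intro j; exact not_lt.2 (h j)
  have hf : ∀ i j, i < j → 0 < |rY t n j ^ 2 - rY t n i ^ 2| ∧ |rY t n j ^ 2 - rY t n i ^ 2| ≤ |(rY t n + μ) j ^ 2 - (rY t n + μ) i ^ 2| ∧
      (0 < μ i → |rY t n j ^ 2 - rY t n i ^ 2| < |(rY t n + μ) j ^ 2 - (rY t n + μ) i ^ 2|) := by
    intro i j hij
    obtain ⟨a, b⟩ := Ph_factor hμ i j hij
    have h3 := rY_lt (t := t) hij
    have h4 : 0 ≤ μ i := (abs_nonneg _).trans (hμ.ab i j hij)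
    rw [abs_sub_comm, abs_sub_comm ((rY t n + μ) j ^ 2), abs_of_pos a, abs_of_pos (by nlinarith)]
    exact ⟨a, by nlinarith, fun h => by nlinarith⟩
  have hB : ∏ i, ∏ j ∈ Ioi i, |rY t n j ^ 2 - rY t n i ^ 2| < ∏ i, ∏ j ∈ Ioi i, |(rY t n + μ) j ^ 2 - (rY t n + μ) i ^ 2| := by
    refine prod_lt_prod (fun i _ => prod_pos fun j hj => (hf i j (mem_Ioi.1 hj)).1)
      (fun i _ => prod_le_prod (fun _ _ => abs_nonneg _) fun j hj => (hf i j (mem_Ioi.1 hj)).2.1) ⟨i0, mem_univ _, ?_⟩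
    refine prod_lt_prod (fun j hj => (hf i0 j (mem_Ioi.1 hj)).1) (fun j hj => (hf i0 j (mem_Ioi.1 hj)).2.1)
      ⟨i1, by simp [i0, i1], (hf i0 i1 (by simp [i0, i1])).2.2 hpos⟩
  have hB0 : 0 < ∏ i, ∏ j ∈ Ioi i, |rY t n j ^ 2 - rY t n i ^ 2| :=
    prod_pos fun i _ => prod_pos fun j hj => (hf i j (mem_Ioi.1 hj)).1
  have : (1 : ℚ) < |(aug g : ℚ)| := by
    by_contra hc
    push Not at hc
    have := mul_le_mul hc le_rfl (mul_pos hA0 hB0).le zero_le_one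
    have := mul_lt_mul' hA hB hB0.le (hA0.trans_le hA)
    linarith
  have : (1 : ℤ) < |aug g| := by exact_mod_cast this
  omega
end

section
theorem perm_inv_self (σ : Equiv.Perm (Fin q)) (x : Fin q) : σ (σ⁻¹ x) = x := by
  rw [← Equiv.Perm.mul_apply, mul_inv_cancel]; rfl
def phi (m k : ℕ) : (Fin (m + k) → ℚ) →+ ℚ where
  toFun v := - ∑ i : Fin m, v (Fin.castAdd k i)
  map_zero' := by simp
  map_add' u v := by simp [sum_add_distrib]; ring
theorem phi_apply (v : Fin (m + k) → ℚ) : phi m k v = - ∑ i : Fin m, v (Fin.castAdd k i) := rfl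
def i1 (m k : ℕ) : (Fin m → ℚ) →+ (Fin (m + k) → ℚ) where
  toFun v := Fin.append v 0
  map_zero' := by ext i; refine Fin.addCases (fun i => ?_) (fun i => ?_) i <;> simp
  map_add' u v := by ext i; refine Fin.addCases (fun i => ?_) (fun i => ?_) i <;> simp
def i2 (m k : ℕ) : (Fin k → ℚ) →+ (Fin (m + k) → ℚ) where
  toFun v := Fin.append 0 v
  map_zero' := by ext i; refine Fin.addCases (fun i => ?_) (fun i => ?_) i <;> simp
  map_add' u v := by ext i; refine Fin.addCases (fun i => ?_) (fun i => ?_) i <;> simp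
theorem app_ext {u v : Fin (m + k) → ℚ} (h1 : ∀ i : Fin m, u (Fin.castAdd k i) = v (Fin.castAdd k i))
    (h2 : ∀ j : Fin k, u (Fin.natAdd m j) = v (Fin.natAdd m j)) : u = v := by
  ext i; exact Fin.addCases h1 h2 i
theorem i1_inj (m k : ℕ) : Function.Injective (i1 m k) := fun u v h => by
  ext i; have := congrFun h (Fin.castAdd k i); simpa [i1] using this
theorem i2_inj (m k : ℕ) : Function.Injective (i2 m k) := fun u v h => by
  ext i; have := congrFun h (Fin.natAdd m i); simpa [i2] using this
abbrev J1 (m k : ℕ) : CharRing m →+* CharRing (m + k) := mp (i1 m k)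
abbrev J2 (m k : ℕ) : CharRing k →+* CharRing (m + k) := mp (i2 m k)
abbrev PS (n : ℕ) := Equiv.Perm (Fin n) × (Fin n → Bool)
def C0 (m k : ℕ) (p : PS (m + k)) : Prop :=
  (∀ i : Fin m, ∃ i' : Fin m, p.1 (Fin.castAdd k i) = Fin.castAdd k i') ∧ ∀ i : Fin m, p.2 (Fin.castAdd k i) = false
def mg (m k : ℕ) (x : Equiv.Perm (Fin m) × PS k) : PS (m + k) :=
  (finSumFinEquiv.permCongr (Equiv.sumCongr x.1 x.2.1), Fin.append (fun _ => false) x.2.2)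
theorem mg_l (x) (i : Fin m) : (mg m k x).1 (Fin.castAdd k i) = Fin.castAdd k (x.1 i) := by
  simp [mg, Equiv.permCongr_apply]
theorem mg_r (x) (i : Fin k) : (mg m k x).1 (Fin.natAdd m i) = Fin.natAdd m (x.2.1 i) := by
  simp [mg, Equiv.permCongr_apply]
theorem mg_sl (x) (i : Fin m) : (mg m k x).2 (Fin.castAdd k i) = false := by simp [mg]
theorem mg_sr (x) (i : Fin k) : (mg m k x).2 (Fin.natAdd m i) = x.2.2 i := by simp [mg]
theorem mg_eY (t : CType) (x) : eY t (mg m k x) = ((Equiv.Perm.sign x.1 : ℤˣ) : ℤ) * eY t x.2 := by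
  have h1 : par (mg m k x).2 = par x.2.2 := by
    rw [par, Fin.prod_univ_add]; simp only [mg_sl, mg_sr, par]; simp [sg]
  have h2 : Equiv.Perm.sign (mg m k x).1 = Equiv.Perm.sign x.1 * Equiv.Perm.sign x.2.1 := by
    simp only [mg]; rw [Equiv.Perm.sign_permCongr]; exact Equiv.Perm.sign_sumCongr _ _
  unfold eY
  rw [h1, h2]; split_ifs
  · simp
  · push_cast; ring
theorem mg_TY (x) (u : Fin m → ℚ) (v : Fin k → ℚ) :
    TY (mg m k x) (Fin.append u v) = i1 m k (pre x.1 u) + i2 m k (TY x.2 v) := by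
  refine app_ext (fun i => ?_) (fun i => ?_)
  · simp [TY_apply, mg_l, mg_sl, i1, i2, sg]
  · simp [TY_apply, mg_r, mg_sr, i1, i2]
theorem C0_sum (t : CType) (u : Fin m → ℚ) (v : Fin k → ℚ) :
    ∑ p ∈ univ.filter (C0 m k), eY t p • mono (TY p (Fin.append u v)) = J1 m k (al m u) * J2 m k (AY t k v) := by
  have : J1 m k (al m u) * J2 m k (AY t k v) = ∑ x : Equiv.Perm (Fin m) × PS k,
      eY t (mg m k x) • mono (TY (mg m k x) (Fin.append u v)) := by
    rw [Fintype.sum_prod_type]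
    have e : AY t k v = ∑ p : PS k, eY t p • mono (TY p v) := rfl
    rw [e, al_def, map_sum, map_sum, sum_mul_sum]
    refine sum_congr rfl fun σ _ => sum_congr rfl fun p _ => ?_
    rw [map_zsmul, map_zsmul, mp_mono, mp_mono, smul_mul_smul_comm, mono_mul, mg_eY, mg_TY]
  rw [this]
  symm
  refine sum_nbij (mg m k) (fun x _ => ?_) (fun x _ y _ h => ?_) (fun p hp => ?_) (fun _ _ => rfl)
  · simp only [mem_filter, mem_univ, true_and]
    exact ⟨fun i => ⟨_, mg_l x i⟩, mg_sl x⟩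
  · refine Prod.ext ?_ (Prod.ext ?_ ?_)
    · ext i; have := congrArg (fun z => z.1 (Fin.castAdd k i)) h
      simp only [mg_l] at this; simpa using congrArg Fin.val this
    · ext i; have := congrArg (fun z => z.1 (Fin.natAdd m i)) h
      simp only [mg_r] at this; simpa using congrArg Fin.val this
    · ext i; have := congrArg (fun z => z.2 (Fin.natAdd m i)) h
      simp only [mg_sr] at this; rw [this]
  · simp only [coe_filter, mem_univ, true_and, Set.mem_ofPred_eq] at hp
    obtain ⟨h1, h2⟩ := hp
    have h3 : finSumFinEquiv.symm.permCongr p.1 ∈ Set.range (Equiv.Perm.sumCongrHom (Fin m) (Fin k)) := by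
      apply Equiv.Perm.mem_sumCongrHom_range_of_perm_mapsTo_inl
      rintro _ ⟨i, rfl⟩
      obtain ⟨i', hi'⟩ := h1 i
      refine ⟨i', ?_⟩
      rw [Equiv.permCongr_apply, Equiv.symm_symm, finSumFinEquiv_apply_left, hi', finSumFinEquiv_symm_apply_castAdd]
    obtain ⟨⟨σ1, σ2⟩, hs⟩ := h3
    refine ⟨(σ1, (σ2, fun j => p.2 (Fin.natAdd m j))), by simp, ?_⟩
    refine Prod.ext ?_ ?_
    · ext i
      have : p.1 = finSumFinEquiv.permCongr (Equiv.Perm.sumCongrHom (Fin m) (Fin k) (σ1, σ2)) := by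
        rw [hs]; ext j; simp [Equiv.permCongr_apply]
      rw [this]; rfl
    · funext i
      refine Fin.addCases (fun i => ?_) (fun i => ?_) i
      · rw [mg_sl, h2]
      · rw [mg_sr]
def sw (i : Fin m) (j : Fin k) : Equiv.Perm (Fin (m + k)) := Equiv.swap (Fin.castAdd k i) (Fin.natAdd m j)
theorem ca_ne_na (i : Fin m) (j : Fin k) : Fin.castAdd k i ≠ Fin.natAdd m j := by
  intro h; have := congrArg Fin.val h; simp at this; omega
theorem app_sw (i : Fin m) (j : Fin k) (x : Fin m → ℚ) (y : Fin k → ℚ) (J) :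
    Fin.append x y (sw i j J) = Fin.append (x - Pi.single i (x i - y j)) (y + Pi.single j (x i - y j)) J := by
  refine Fin.addCases (fun i' => ?_) (fun j' => ?_) J
  · by_cases h : i' = i
    · subst h; simp [sw]
    · rw [sw, Equiv.swap_apply_of_ne_of_ne (by simpa using h) (ca_ne_na _ _)]; simp [h]
  · by_cases h : j' = j
    · subst h; simp [sw]
    · rw [sw, Equiv.swap_apply_of_ne_of_ne (ca_ne_na _ _).symm (by simpa using h)]; simp [h]
def Cs (i : Fin m) (j : Fin k) (p : PS (m + k)) : Prop := C0 m k (sw i j * p.1, p.2)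
theorem Cs_sum (t : CType) (i : Fin m) (j : Fin k) (x : Fin m → ℚ) (y : Fin k → ℚ) :
    ∑ p ∈ univ.filter (Cs i j), eY t p • mono (TY p (Fin.append x y)) =
     - (J1 m k (al m (x - Pi.single i (x i - y j))) * J2 m k (AY t k (y + Pi.single j (x i - y j)))) := by
  rw [← C0_sum, ← sum_neg_distrib]
  refine sum_nbij' (fun p => (sw i j * p.1, p.2)) (fun p => (sw i j * p.1, p.2)) ?_ ?_ ?_ ?_ ?_
  · intro p hp; simpa [Cs] using hp
  · intro p hp; simpa [Cs, ← mul_assoc, sw] using hp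
  · intro p _; simp [← mul_assoc, sw]
  · intro p _; simp [← mul_assoc, sw]
  · intro p _
    have e1 : eY t (sw i j * p.1, p.2) = - eY t p := by
      unfold eY
      split_ifs
      · simp
      · rw [Equiv.Perm.sign_mul, sw, Equiv.Perm.sign_swap (ca_ne_na i j)]; push_cast; ring
    rw [e1, neg_smul, neg_neg]
    congr 2
    ext J
    rw [TY_apply, TY_apply, ← app_sw]
    simp [sw]
theorem C0_phi {p : PS (m + k)} (h : C0 m k p) (v) : phi m k (TY p v) = phi m k v := by
  choose f hf using h.1
  have hi : Function.Injective f := fun a b hab => by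
    have := (hf a).trans ((congrArg (Fin.castAdd k) hab).trans (hf b).symm)
    simpa using p.1.injective this
  rw [phi_apply, phi_apply]
  simp only [TY_apply, h.2, hf]
  simp only [sg, Bool.false_eq_true, if_false, Int.cast_one, one_mul]
  rw [Function.Bijective.sum_comp (Finite.injective_iff_bijective.1 hi) (fun i => v (Fin.castAdd k i))]
theorem Cs_phi {p : PS (m + k)} {i : Fin m} {j : Fin k} (h : Cs i j p) (x : Fin m → ℚ) (y : Fin k → ℚ) :
    phi m k (TY p (Fin.append x y)) = phi m k (Fin.append x y) + (x i - y j) := by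
  have e : TY p (Fin.append x y) = TY (sw i j * p.1, p.2) (Fin.append (x - Pi.single i (x i - y j)) (y + Pi.single j (x i - y j))) := by
    ext J; rw [TY_apply, TY_apply, ← app_sw]; simp [sw]
  rw [e, C0_phi h, phi_apply, phi_apply]
  simp [sum_sub_distrib]; ring
structure Low (m k K : ℕ) (x : Fin m → ℚ) (y : Fin k → ℚ) (b : ℚ) : Prop where
  hK : K ≤ 2
  hx : ∀ i : Fin m, b + 1/2 + ((m : ℚ) - 1 - i.val) ≤ x i
  hy : ∀ j : Fin k, |y j| ≤ b - 1/2 - j.val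
  hn : ∀ i j, (K : ℚ) < x i + y j
  hf : ∀ i, (K : ℚ) < 2 * x i
theorem low_char {x : Fin m → ℚ} {y : Fin k → ℚ} {b : ℚ} (H : Low m k K x y b) (p : PS (m + k))
    (hp : phi m k (TY p (Fin.append x y)) ≤ phi m k (Fin.append x y) + K) :
    (if C0 m k p then (1 : ℤ) else 0) + ∑ i : Fin m, ∑ j : Fin k, (if Cs i j p then (1 : ℤ) else 0) = 1 := by
  have hK2 : (K : ℚ) ≤ 2 := by exact_mod_cast H.hK
  set v := Fin.append x y with hv
  set pos : Fin (m + k) → Prop := fun J => (p.1⁻¹ J).val < m with hpos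
  set s : Fin (m + k) → ℚ := fun J => (sg (p.2 (p.1⁻¹ J)) : ℚ) with hs
  have hsor : ∀ J, (p.2 (p.1⁻¹ J) = false ∧ s J = 1) ∨ (p.2 (p.1⁻¹ J) = true ∧ s J = -1) := fun J => by
    simp only [hs]; cases p.2 (p.1⁻¹ J) <;> simp [sg]
  set l1 : Fin m → ℚ := fun i => if pos (Fin.castAdd k i) then (1 - s (Fin.castAdd k i)) * x i else x i - b with hl1
  set l2 : Fin k → ℚ := fun j => if pos (Fin.natAdd m j) then b - s (Fin.natAdd m j) * y j else 0 with hl2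
  have hfirst : ∀ I : Fin (m + k), I.val < m → ∃ i : Fin m, I = Fin.castAdd k i := fun I h => ⟨⟨I.val, h⟩, rfl⟩
  have hloss : ∑ i, l1 i + ∑ j, l2 j ≤ K := by
    have e1 : ∑ I : Fin (m + k), (if I.val < m then (sg (p.2 I) : ℚ) * v (p.1 I) - b else 0) =
        ∑ J : Fin (m + k), (if pos J then s J * v J - b else 0) := by
      rw [← Equiv.sum_comp p.1⁻¹ (fun I : Fin (m + k) => if I.val < m then (sg (p.2 I) : ℚ) * v (p.1 I) - b else 0)]
      refine sum_congr rfl fun J _ => ?_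
      simp [hpos, hs]
    rw [Fin.sum_univ_add, Fin.sum_univ_add] at e1
    simp only [Fin.val_castAdd, Fin.is_lt, if_true, Fin.val_natAdd, add_lt_iff_neg_left, not_lt_zero, if_false, sum_const_zero, add_zero] at e1
    have e2 : ∑ i, l1 i + ∑ j, l2 j = ∑ i : Fin m, (x i - b) - ∑ i : Fin m, ((sg (p.2 (Fin.castAdd k i)) : ℚ) * v (p.1 (Fin.castAdd k i)) - b) := by
      rw [e1, sub_add_eq_sub_sub, ← sum_sub_distrib, sub_eq_add_neg, ← sum_neg_distrib]
      congr 1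
      · refine sum_congr rfl fun i _ => ?_
        simp only [hl1, hv, Fin.append_left]; split_ifs <;> ring
      · refine sum_congr rfl fun i _ => ?_
        simp only [hl2, hv, Fin.append_right]; split_ifs <;> ring
    rw [e2, sum_sub_distrib, sum_sub_distrib]
    rw [phi_apply, phi_apply] at hp
    simp only [TY_apply] at hp
    simp only [hv, Fin.append_left] at hp ⊢
    linarith
  have hcnt : ∑ i : Fin m, (if pos (Fin.castAdd k i) then (0:ℚ) else 1) = ∑ j : Fin k, (if pos (Fin.natAdd m j) then (1:ℚ) else 0) := by
    have e1 : ∑ I : Fin (m + k), (if I.val < m then (1 : ℚ) else 0) = ∑ J : Fin (m + k), (if pos J then 1 else 0) := by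
      rw [← Equiv.sum_comp p.1⁻¹ (fun I : Fin (m + k) => if I.val < m then (1 : ℚ) else 0)]
    rw [Fin.sum_univ_add, Fin.sum_univ_add] at e1
    simp only [Fin.val_castAdd, Fin.is_lt, if_true, Fin.val_natAdd, add_lt_iff_neg_left, not_lt_zero, if_false, sum_const_zero, add_zero] at e1
    have e2 : ∑ i : Fin m, (if pos (Fin.castAdd k i) then (0:ℚ) else 1) = ∑ i : Fin m, (1:ℚ) - ∑ i : Fin m, (if pos (Fin.castAdd k i) then (1:ℚ) else 0) := by
      rw [← sum_sub_distrib]; exact sum_congr rfl fun i _ => by split_ifs <;> norm_num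
    rw [e2, e1]; ring
  have hxb : ∀ i, b + 1/2 ≤ x i := fun i => by
    have := H.hx i
    have : (i.val : ℚ) + 1 ≤ m := by exact_mod_cast i.2
    linarith
  have hx0 : ∀ i, 0 ≤ x i := fun i => by have := H.hf i; have : (0:ℚ) ≤ K := Nat.cast_nonneg _; linarith
  have l1n : ∀ i, 0 ≤ l1 i := fun i => by
    simp only [hl1]
    split_ifs
    · rcases hsor (Fin.castAdd k i) with h | h <;> rw [h.2] <;> nlinarith [hx0 i]
    · linarith [hxb i]
  have l2b : ∀ j, pos (Fin.natAdd m j) → 1/2 ≤ l2 j := fun j h => by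
    have := H.hy j
    have h1 := abs_le.1 this
    have : (0:ℚ) ≤ j.val := Nat.cast_nonneg _
    simp only [hl2, if_pos h]
    rcases hsor (Fin.natAdd m j) with h | h <;> rw [h.2] <;> linarith
  have l2n : ∀ j, 0 ≤ l2 j := fun j => by
    by_cases h : pos (Fin.natAdd m j)
    · linarith [l2b j h]
    · simp only [hl2, if_neg h]; exact le_rfl
  have s1n : 0 ≤ ∑ i, l1 i := sum_nonneg fun i _ => l1n i
  have s2n : 0 ≤ ∑ j, l2 j := sum_nonneg fun i _ => l2n i
  have hs1 : ∀ i, pos (Fin.castAdd k i) → p.2 (p.1⁻¹ (Fin.castAdd k i)) = false := fun i h => by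
    rcases hsor (Fin.castAdd k i) with h' | h'
    · exact h'.1
    · exfalso
      have := single_le_sum (fun i _ => l1n i) (mem_univ i)
      simp only [hl1, if_pos h, h'.2] at this
      have := H.hf i
      linarith
  by_cases hm : ∀ i : Fin m, pos (Fin.castAdd k i)
  · have hno : ∀ j : Fin k, ¬ pos (Fin.natAdd m j) := by
      intro j hj
      simp only [hm, if_true, sum_const_zero] at hcnt
      have := (sum_eq_zero_iff_of_nonneg (fun j _ => by split_ifs <;> norm_num)).1 hcnt.symm j (mem_univ j)
      rw [if_pos hj] at this; norm_num at this
    have hC : C0 m k p := by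
      refine ⟨fun i => ?_, fun i => ?_⟩
      · rcases Fin.addCases (motive := fun J => (∃ i', J = Fin.castAdd k i') ∨ ∃ j, J = Fin.natAdd m j)
          (fun i' => Or.inl ⟨i', rfl⟩) (fun j => Or.inr ⟨j, rfl⟩) (p.1 (Fin.castAdd k i)) with h | ⟨j, hj⟩
        · exact h
        · exfalso; apply hno j; simp [hpos, ← hj]
      · rcases Fin.addCases (motive := fun J => (∃ i', J = Fin.castAdd k i') ∨ ∃ j, J = Fin.natAdd m j)
          (fun i' => Or.inl ⟨i', rfl⟩) (fun j => Or.inr ⟨j, rfl⟩) (p.1 (Fin.castAdd k i)) with ⟨i', h⟩ | ⟨j, hj⟩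
        · have := hs1 i' (hm i'); rw [← h] at this; simpa using this
        · exfalso; apply hno j; simp [hpos, ← hj]
    rw [if_pos hC, sum_eq_zero, add_zero]
    intro i _
    refine sum_eq_zero fun j _ => if_neg fun hc => ?_
    obtain ⟨I, hI⟩ := hfirst _ (hm i)
    obtain ⟨i', hi'⟩ := hc.1 I
    simp only [← hI, Equiv.Perm.coe_mul, Function.comp_apply, perm_inv_self] at hi'
    rw [sw, Equiv.swap_apply_left] at hi'
    exact ca_ne_na _ _ hi'.symm
  · push Not at hm
    obtain ⟨i0, hi0⟩ := hm
    obtain ⟨j0, hj0⟩ : ∃ j, pos (Fin.natAdd m j) := by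
      by_contra hc
      push Not at hc
      simp only [hc, if_false, sum_const_zero] at hcnt
      have := (sum_eq_zero_iff_of_nonneg (fun j _ => by split_ifs <;> norm_num)).1 hcnt i0 (mem_univ i0)
      rw [if_neg hi0] at this; norm_num at this
    have hl20 := single_le_sum (fun i _ => l2n i) (mem_univ j0)
    have hl10 := single_le_sum (fun i _ => l1n i) (mem_univ i0)
    have hu1 : ∀ i, i ≠ i0 → pos (Fin.castAdd k i) := by
      intro i hi
      by_contra hc
      have h2 := add_le_sum (fun i _ => l1n i) (mem_univ i) (mem_univ i0) hi
      have e1 : l1 i = x i - b := by simp only [hl1, if_neg hc]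
      have e2 : l1 i0 = x i0 - b := by simp only [hl1, if_neg hi0]
      have g1 := H.hx i
      have g2 := H.hx i0
      have b1 : i.val < m := i.2
      have b2 : i0.val < m := i0.2
      have b3 : i.val ≠ i0.val := fun h => hi (Fin.ext h)
      have b4 : (i.val : ℚ) + i0.val + 3 ≤ 2 * m := by exact_mod_cast (by omega : i.val + i0.val + 3 ≤ 2 * m)
      have := l2b j0 hj0
      linarith
    have hu2 : ∀ j, j ≠ j0 → ¬ pos (Fin.natAdd m j) := by
      intro j hj hc
      have e1 : ∑ i : Fin m, (if pos (Fin.castAdd k i) then (0:ℚ) else 1) = 1 := by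
        rw [sum_eq_single i0 (fun i _ hi => if_pos (hu1 i hi)) bs, if_neg hi0]
      rw [e1] at hcnt
      have := add_le_sum (f := fun j : Fin k => if pos (Fin.natAdd m j) then (1:ℚ) else 0) (fun i _ => by split_ifs <;> norm_num) (mem_univ j) (mem_univ j0) hj
      simp only [if_pos hc, if_pos hj0] at this
      linarith
    have hs2 : p.2 (p.1⁻¹ (Fin.natAdd m j0)) = false := by
      rcases hsor (Fin.natAdd m j0) with h' | h'
      · exact h'.1
      · exfalso
        simp only [hl2, if_pos hj0, h'.2] at hl20
        simp only [hl1, if_neg hi0] at hl10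
        have := H.hn i0 j0
        linarith
    have hC : Cs i0 j0 p := by
      have key : ∀ i : Fin m, (p.1 (Fin.castAdd k i) = Fin.natAdd m j0) ∨ ∃ i', i' ≠ i0 ∧ p.1 (Fin.castAdd k i) = Fin.castAdd k i' := by
        intro i
        rcases Fin.addCases (motive := fun J => (∃ i', J = Fin.castAdd k i') ∨ ∃ j, J = Fin.natAdd m j)
          (fun i' => Or.inl ⟨i', rfl⟩) (fun j => Or.inr ⟨j, rfl⟩) (p.1 (Fin.castAdd k i)) with ⟨i', h⟩ | ⟨j, hj⟩
        · right
          refine ⟨i', ?_, h⟩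
          rintro rfl
          apply hi0; simp [hpos, ← h]
        · left
          by_cases h : j = j0
          · rw [hj, h]
          · exfalso; apply hu2 j h; simp [hpos, ← hj]
      refine ⟨fun i => ?_, fun i => ?_⟩
      · rcases key i with h | ⟨i', h1, h⟩
        · exact ⟨i0, by simp [h, sw]⟩
        · refine ⟨i', ?_⟩
          simp only [Equiv.Perm.coe_mul, Function.comp_apply, h, sw]
          exact Equiv.swap_apply_of_ne_of_ne (by simpa using h1) (ca_ne_na _ _)
      · rcases key i with h | ⟨i', h1, h⟩
        · rw [← h] at hs2; simpa using hs2
        · have := hs1 i' (hu1 i' h1); rw [← h] at this; simpa using this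
    have hC0 : ¬ C0 m k p := by
      intro hc
      obtain ⟨I, hI⟩ := hfirst _ hj0
      obtain ⟨i', hi'⟩ := hc.1 I
      rw [← hI] at hi'; simp only [perm_inv_self] at hi'
      exact ca_ne_na _ _ hi'.symm
    have hun : ∀ i j, Cs i j p → i = i0 ∧ j = j0 := by
      intro i j hc
      have h1 : i = i0 := by
        by_contra hne
        obtain ⟨I, hI⟩ := hfirst _ (hu1 i hne)
        obtain ⟨i', hi'⟩ := hc.1 I
        simp only [← hI, Equiv.Perm.coe_mul, Function.comp_apply, perm_inv_self] at hi'
        rw [sw, Equiv.swap_apply_left] at hi'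
        exact ca_ne_na _ _ hi'.symm
      refine ⟨h1, ?_⟩
      by_contra hne
      obtain ⟨I, hI⟩ := hfirst _ hj0
      obtain ⟨i', hi'⟩ := hc.1 I
      simp only [← hI, Equiv.Perm.coe_mul, Function.comp_apply, perm_inv_self] at hi'
      rw [sw, Equiv.swap_apply_of_ne_of_ne (ca_ne_na _ _).symm (by simpa using fun h => hne h.symm)] at hi'
      exact ca_ne_na _ _ hi'.symm
    rw [if_neg hC0, zero_add, sum_eq_single i0, sum_eq_single j0, if_pos hC]
    · intro j _ hj; exact if_neg fun hc => hj (hun _ _ hc).2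
    · simp
    · intro i _ hi; exact sum_eq_zero fun j _ => if_neg fun hc => hi (hun _ _ hc).1
    · simp
abbrev GY (m k : ℕ) : CharRing (m + k) →+* GR (m + k) := gr (phi m k) (AddMonoidHom.id _)
theorem low_slices (t : CType) {x : Fin m → ℚ} {y : Fin k → ℚ} {b : ℚ} (H : Low m k K x y b) (d : ℚ)
    (hd : d ≤ phi m k (Fin.append x y) + K) :
    (GY m k (AY t (m + k) (Fin.append x y))).coeff d =
      (if d = phi m k (Fin.append x y) then J1 m k (al m x) * J2 m k (AY t k y) else 0) -
      ∑ i : Fin m, ∑ j : Fin k, (if d = phi m k (Fin.append x y) + (x i - y j) then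
        J1 m k (al m (x - Pi.single i (x i - y j))) * J2 m k (AY t k (y + Pi.single j (x i - y j))) else 0) := by
  set v := Fin.append x y with hv
  have e1 : (GY m k (AY t (m + k) v)).coeff d = ∑ p : PS (m + k), if phi m k (TY p v) = d then eY t p • mono (TY p v) else 0 := by
    rw [gr_coeff]
    have e : AY t (m + k) v = ∑ p : PS (m + k), eY t p • mono (TY p v) := rfl
    rw [e, map_sum]
    refine sum_congr rfl fun p _ => ?_
    rw [map_zsmul, ev_mono]; split_ifs
    · rfl
    · simp
  rw [e1]
  have e2 : ∀ p : PS (m + k), (if phi m k (TY p v) = d then eY t p • mono (TY p v) else 0) =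
      (if d = phi m k v then (if C0 m k p then eY t p • mono (TY p v) else 0) else 0) +
      ∑ i : Fin m, ∑ j : Fin k, (if d = phi m k v + (x i - y j) then (if Cs i j p then eY t p • mono (TY p v) else 0) else 0) := by
    intro p
    have hA : ∀ z : CharRing (m + k), (if d = phi m k v then (if C0 m k p then z else 0) else 0) = if phi m k (TY p v) = d then (if C0 m k p then (1 : ℤ) else 0) • z else 0 := by
      intro z
      by_cases hc : C0 m k p
      · simp only [if_pos hc, one_smul, C0_phi hc, eq_comm]
      · simp [if_neg hc]
    have hB : ∀ i j, ∀ z : CharRing (m + k), (if d = phi m k v + (x i - y j) then (if Cs i j p then z else 0) else 0) = if phi m k (TY p v) = d then (if Cs i j p then (1 : ℤ) else 0) • z else 0 := by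
      intro i j z
      by_cases hc : Cs i j p
      · simp only [if_pos hc, one_smul, hv, Cs_phi hc, eq_comm]
      · simp [if_neg hc]
    simp only [hA, hB]
    by_cases hp : phi m k (TY p v) = d
    · simp only [if_pos hp, ← sum_smul, ← add_smul]
      rw [low_char H p (by rw [hp]; exact hd), one_smul]
    · simp [if_neg hp]
  rw [sum_congr rfl fun p _ => e2 p, sum_add_distrib, sub_eq_add_neg, ← sum_neg_distrib]
  congr 1
  · split_ifs with h
    · rw [← sum_filter, C0_sum]
    · simp
  · rw [sum_comm]
    refine sum_congr rfl fun i _ => ?_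
    rw [sum_comm, ← sum_neg_distrib]
    refine sum_congr rfl fun j _ => ?_
    split_ifs with h
    · rw [← sum_filter, Cs_sum]
    · simp
end

section
def Ex (F : GR q) (d : ℚ) (c : ℕ → CharRing q) (K : ℕ) : Prop :=
  ∀ e ≤ d + K, F.coeff e = ∑ i ∈ range (K+1), if e = d + i then c i else 0
theorem sum_pick {A : Type*} [AddCommMonoid A] (K n : ℕ) (h : n ≤ K) (d : ℚ) (c : ℕ → A) :
    (∑ i ∈ range (K+1), if d + (n : ℚ) = d + i then c i else 0) = c n := by
  rw [sum_eq_single n]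
  · simp
  · intro b _ hb; rw [if_neg]; intro h; exact hb (by exact_mod_cast (add_left_cancel h).symm)
  · intro h'; exact absurd (mem_range.2 bo) h'
theorem Ex.at {F : GR q} {d : ℚ} {c : ℕ → CharRing q} (h : Ex F d c K) (hn : n ≤ K) :
    F.coeff (d + n) = c n := by
  rw [h _ (by have : (n : ℚ) ≤ K := by exact_mod_cast hn
              linarith), sum_pick K n hn]
theorem Ex.lt {F : GR q} {d : ℚ} {c : ℕ → CharRing q} (h : Ex F d c K) {e : ℚ} (he : e < d) :
    F.coeff e = 0 := by
  have hK : (0 : ℚ) ≤ K := Nat.cast_nonneg K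
  rw [h e (by linarith)]
  refine sum_eq_zero fun i _ => if_neg fun h => ?_
  have : (0 : ℚ) ≤ i := Nat.cast_nonneg i
  linarith
theorem mul_low {P Q : GR q} {d dP : ℚ} {p : ℕ → CharRing q} (hQ : ∀ e < d, Q.coeff e = 0)
    (hP : Ex P dP p K) (e : ℚ) (he : e ≤ d + K) :
    (Q * P).coeff (dP + e) = ∑ i ∈ range (K+1), Q.coeff (e - i) * p i := by
  set S : GR q := ∑ i ∈ range (K+1), AddMonoidAlgebra.single (dP + i) (p i) with hS
  have hR : ∀ x ≤ dP + K, (P - S).coeff x = 0 := by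
    intro x hx
    have : S.coeff x = P.coeff x := by
      rw [hP x hx, hS, ← cf_apply, map_sum]
      refine sum_congr rfl fun i _ => ?_
      rw [cf_apply, AddMonoidAlgebra.coeff_single, Finsupp.single_apply]
      simp only [eq_comm]
    rw [AddMonoidAlgebra.coeff_sub, Finsupp.sub_apply, this, sub_self]
  have h0 : (Q * (P - S)).coeff (dP + e) = 0 := by
    rw [AddMonoidAlgebra.coeff_mul]
    simp only [Finsupp.sum]
    refine sum_eq_zero fun a ha => sum_eq_zero fun b hb => ?_
    rw [if_neg]
    intro hab
    have h1 : d ≤ a := by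
      by_contra h; exact Finsupp.mem_support_iff.1 ha (hQ a (not_le.1 h))
    have h2 : dP + K < b := by
      by_contra h; exact Finsupp.mem_support_iff.1 hb (hR b (not_lt.1 h))
    linarith
  have h1 : Q * P = Q * (P - S) + S * Q := by ring
  rw [h1, AddMonoidAlgebra.coeff_add, Finsupp.add_apply, h0, zero_add, hS, sum_mul, ← cf_apply, map_sum]
  refine sum_congr rfl fun i _ => ?_
  rw [cf_apply, single_mul_coeff, mul_comm]
  congr 2; ring
theorem div_ex {P Q R : GR q} {dP dR : ℚ} {p r : ℕ → CharRing q} (hPQ : P * Q = R)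
    (hP : Ex P dP p K) (hR : Ex R dR r K) (h0 : p 0 ≠ 0) :
    ∃ c : ℕ → CharRing q, Ex Q (dR - dP) c K ∧ ∀ n ≤ K, r n = ∑ i ∈ range (n+1), c (n - i) * p i := by
  set d := dR - dP with hd
  have hQ : ∀ e < d, Q.coeff e = 0 := by
    by_contra hcon
    push Not at hcon
    obtain ⟨e, he, hne⟩ := hcon
    obtain ⟨e0, he0, hmin⟩ := Q.coeff.support.exists_min_image id ⟨e, Finsupp.mem_support_iff.2 hne⟩
    have hQ0 : ∀ x < e0, Q.coeff x = 0 := by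
      intro x hx; by_contra h
      exact absurd (hmin x (Finsupp.mem_support_iff.2 h)) (not_le.2 hx)
    have hee : e0 ≤ e := hmin e (Finsupp.mem_support_iff.2 hne)
    have := mul_low hQ0 hP e0 bs
    rw [mul_comm, hPQ, hR.lt (by linarith), sum_range_succ'] at this
    rw [sum_eq_zero, zero_add] at this
    · simp only [Nat.cast_zero, sub_zero] at this
      exact mul_ne_zero (Finsupp.mem_support_iff.1 he0) h0 this.symm
    · intro i _
      rw [hQ0 _ (by push_cast; have : (0 : ℚ) ≤ i := Nat.cast_nonneg i
                    linarith), zero_mul]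
  have key : ∀ e ≤ d + K, R.coeff (dP + e) = ∑ i ∈ range (K+1), Q.coeff (e - i) * p i := by
    intro e he; rw [← hPQ, mul_comm]; exact mul_low hQ hP e he
  refine ⟨fun n => Q.coeff (d + n), ?_, ?_⟩
  · intro e he
    by_cases hn : ∃ n ≤ K, e = d + n
    · obtain ⟨n, hn, rfl⟩ := hn
      rw [sum_pick K n hn]
    · rw [sum_eq_zero]
      swap
      · intro i hi; rw [if_neg]; intro h; exact hn ⟨i, by simpa [Nat.lt_succ_iff] using hi, h⟩
      by_contra hne
      obtain ⟨e0, he0, hmin⟩ := (Q.coeff.support.filter fun e => e ≤ d + K ∧ ¬ ∃ n ≤ K, e = d + (n : ℕ)).exists_min_image id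
        ⟨e, by simp only [mem_filter, Finsupp.mem_support_iff]; exact ⟨hne, he, hn⟩⟩
      simp only [mem_filter, Finsupp.mem_support_iff, id] at he0 hmin
      obtain ⟨h1, h2, h3⟩ := he0
      have h4 := key e0 h2
      rw [hR _ (by linarith), sum_eq_zero, sum_range_succ', sum_eq_zero, zero_add] at h4
      · simp only [Nat.cast_zero, sub_zero] at h4
        exact mul_ne_zero h1 h0 h4.symm
      · intro i hi
        have hi0 : (0 : ℚ) ≤ i := Nat.cast_nonneg i
        by_contra h5
        have h6 := hmin (e0 - ((i + 1 : ℕ) : ℚ)) ⟨fun h => h5 (by rw [h, zero_mul]), by push_cast; linarith, ?_⟩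
        · push_cast at h6; linarith
        · rintro ⟨n, hn, h⟩
          refine h3 ⟨n + (i + 1), ?_, by push_cast at h ⊢; linarith⟩
          have : ((n + (i + 1) : ℕ) : ℚ) ≤ K := by push_cast at h ⊢; linarith
          exact_mod_cast this
      · intro i hi; rw [if_neg]; intro h
        exact h3 ⟨i, by simpa [Nat.lt_succ_iff] using hi, by linarith⟩
  · intro n hn
    have hnK : (n : ℚ) ≤ K := by exact_mod_cast hn
    have h4 := key (d + n) (by linarith)
    rw [show dP + (d + n) = dR + n by rw [hd]; ring, hR.at hn] at h4
    rw [h4]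
    refine Eq.symm (sum_subset_zero_on_sdiff (range_mono bo) ?_ ?_)
    · intro i hi
      simp only [mem_sdiff, mem_range] at hi
      have : (n : ℚ) + 1 ≤ i := by exact_mod_cast (by omega : n + 1 ≤ i)
      rw [hQ _ (by linarith), zero_mul]
    · intro i hi
      beta_reduce
      rw [Nat.cast_sub (by simpa [Nat.lt_succ_iff] using hi), add_sub_assoc]
theorem Ex.mul {P Q : GR q} {dP dQ : ℚ} {p r : ℕ → CharRing q} 
    (hP : Ex P dP p K) (hQ : Ex Q dQ r K) (n : ℕ) (hn : n ≤ K) :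
    (P * Q).coeff (dP + dQ + n) = ∑ i ∈ range (n+1), p (n - i) * r i := by
  have hnK : (n : ℚ) ≤ K := by exact_mod_cast hn
  have := mul_low (fun e he => hP.lt he) hQ (dP + n) (by linarith)
  rw [show dP + dQ + n = dQ + (dP + n) by ring, this]
  refine Eq.symm (sum_subset_zero_on_sdiff (range_mono bo) ?_ ?_)
  · intro i hi
    simp only [mem_sdiff, mem_range] at hi
    have : (n : ℚ) + 1 ≤ i := by exact_mod_cast (by omega : n + 1 ≤ i)
    rw [hP.lt (by linarith), zero_mul]
  · intro i hi
    have hi := mem_range_succ_iff.1 hi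
    rw [add_sub_assoc, ← Nat.cast_sub hi, hP.at bo]
theorem Ex.map {φ : (Fin n → ℚ) →+ ℚ} {F : CharRing n} {d : ℚ} {c : ℕ → CharRing n} 
    (h : Ex (gr φ (AddMonoidHom.id _) F) d c K) (T : (Fin n → ℚ) →+ (Fin q → ℚ)) :
    Ex (gr φ T F) d (fun i => mp T (c i)) K := by
  intro e he
  have : (gr φ T F).coeff e = mp T ((gr φ (AddMonoidHom.id _) F).coeff e) := by
    refine add_ext ((cf e).comp (gr φ T).toAddMonoidHom)
      ((mp T).toAddMonoidHom.comp ((cf e).comp (gr φ (AddMonoidHom.id _)).toAddMonoidHom)) ?_ F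
    intro v
    simp only [AddMonoidHom.comp_apply, RingHom.toAddMonoidHom_eq_coe, AddMonoidHom.coe_coe, gr_mono, cf_apply,
      AddMonoidAlgebra.coeff_single, Finsupp.single_apply]
    split_ifs <;> simp
  rw [this, h e he, map_sum]
  refine sum_congr rfl fun i _ => ?_
  split_ifs <;> simp
end

section
def kap (t : CType) (k : ℕ) : ℚ := match t with
  | .B => k + 1/2
  | .C => k + 1
  | .D => k
theorem kap_rY (t : CType) (k : ℕ) (j : Fin k) : kap t k - rY t k j = 1 + j.val := by
  cases t <;> simp [kap, rhoY] <;> ring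
theorem kap_ge (t : CType) (k : ℕ) : (k : ℚ) ≤ kap t k := by
  cases t <;> simp [kap]
theorem rY_app (t : CType) (m k : ℕ) : rY t (m + k) = Fin.append (rA m + fun _ => kap t k) (rY t k) := by
  ext i
  refine Fin.addCases (fun i => ?_) (fun i => ?_) i
  · rw [Fin.append_left]; cases t <;> simp [kap, rhoY, rA] <;> ring
  · rw [Fin.append_right]; cases t <;> simp [rhoY] <;> ring
theorem app_add (x x' : Fin m → ℚ) (y y' : Fin k → ℚ) :
    Fin.append x y + Fin.append x' y' = Fin.append (x + x') (y + y') := by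
  ext i
  refine Fin.addCases (fun i => ?_) (fun i => ?_) i <;> simp
def sl (t : CType) (m k : ℕ) (α : Fin m → ℚ) (η : Fin k → ℚ) (n : ℕ) : CharRing (m + k) :=
  (if n = 0 then J1 m k (al m (rA m + α)) * J2 m k (AY t k (rY t k + η)) else 0) -
  ∑ i : Fin m, ∑ j : Fin k, if α i - η j + ((m : ℚ) - i.val + j.val) = n then
    J1 m k (al m (rA m + α - Pi.single i (n : ℚ))) * J2 m k (AY t k (rY t k + η + Pi.single j (n : ℚ))) else 0
structure AP {m k : ℕ} (K : ℕ) (α : Fin m → ℚ) (η : Fin k → ℚ) : Prop where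
  K2 : K ≤ 2
  Kk : K < k
  h : ∃ h, (∀ j, |η j| ≤ h) ∧ ∀ i, h ≤ α i
  int : ∀ i j, ∃ z : ℤ, α i - η j = z
theorem AP.le {α : Fin m → ℚ} {η : Fin k → ℚ} (H : AP K α η) (i j) : η j ≤ α i := by
  obtain ⟨h, h1, h2⟩ := H.h
  exact (le_abs_self _).trans ((h1 j).trans (h2 i))
theorem AP.zero (h2 : K ≤ 2) (hk : K < k) : AP K (0 : Fin m → ℚ) (0 : Fin k → ℚ) :=
  ⟨h2, hk, ⟨0, by simp, by simp⟩, fun i j => ⟨0, by simp⟩⟩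
theorem sl_ex (t : CType) {α : Fin m → ℚ} {η : Fin k → ℚ} (H : AP K α η) :
    Ex (GY m k (AY t (m + k) (rY t (m + k) + Fin.append α η))) (phi m k (rY t (m + k) + Fin.append α η))
      (fun n => J1 m k (mono fun _ => kap t k) * sl t m k α η n) K := by
  intro d hd
  obtain ⟨h, h1, h2⟩ := H.h
  rw [rY_app, app_add] at hd ⊢
  set x : Fin m → ℚ := (rA m + fun _ => kap t k) + α with hx
  set y : Fin k → ℚ := rY t k + η with hy
  have hkk : (K : ℚ) < k := by exact_mod_cast H.Kk
  have hkap := kap_ge t k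
  have xa : ∀ i, x i = (m : ℚ) - 1 - i.val + kap t k + α i := fun i => by simp [hx, rA]
  have im : ∀ i : Fin m, (i.val : ℚ) + 1 ≤ m := fun i => by exact_mod_cast i.isLt
  have xy : ∀ i j, x i - y j = α i - η j + ((m : ℚ) - i.val + j.val) := by
    intro i j
    have := kap_rY t k j
    rw [xa, hy, Pi.add_apply]; linarith
  have L : Low m k K x y (h + kap t k - 1/2) := by
    refine ⟨H.K2, fun i => ?_, fun j => ?_, fun i j => ?_, fun i => ?_⟩
    · rw [xa]; linarith [h2 i]
    · have h3 := kap_rY t k j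
      have h4 := rY_nonneg (t := t) j
      have h5 := abs_le.1 (h1 j)
      rw [hy, Pi.add_apply, abs_le]; constructor <;> linarith
    · have h4 := rY_nonneg (t := t) j
      have h5 := abs_le.1 (h1 j)
      rw [xa, hy, Pi.add_apply]; linarith [h2 i, im i]
    · have h5 : 0 ≤ h := (abs_nonneg _).trans (h1 ⟨0, by have := H.Kk; omega⟩)
      have : (0 : ℚ) ≤ k := Nat.cast_nonneg k
      rw [xa]; linarith [h2 i, im i]
  rw [low_slices t L d hd]
  have alc : ∀ v : Fin m → ℚ, al m (v + fun _ => kap t k) = mono (fun _ => kap t k) * al m v := fun v => (al_const _ _).symm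
  have hx' : x = (rA m + α) + fun _ => kap t k := by rw [hx]; abel
  by_cases hn : ∃ n ≤ K, d = phi m k (Fin.append x y) + (n : ℕ)
  · obtain ⟨n, hn, rfl⟩ := hn
    rw [sum_pick K n hn, sl, mul_sub, mul_sum]
    congr 1
    · simp only [add_eq_left, Nat.cast_eq_zero]
      split_ifs
      · rw [hx', alc, map_mul, mul_assoc]
      · simp
    · refine sum_congr rfl fun i _ => ?_
      rw [mul_sum]
      refine sum_congr rfl fun j _ => ?_
      by_cases he : α i - η j + ((m : ℚ) - i.val + j.val) = n
      · rw [if_pos (by rw [xy, he]), if_pos he, xy, he, hx', show (rA m + α + fun _ => kap t k) - Pi.single i (n : ℚ) = (rA m + α - Pi.single i (n:ℚ)) + fun _ => kap t k by abel,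
          alc, map_mul, mul_assoc]
      · rw [if_neg (fun h => he (by rw [← xy]; exact (add_left_cancel h).symm)), if_neg he, mul_zero]
  · have hr : (∑ i ∈ range (K + 1), if d = phi m k (Fin.append x y) + (i : ℚ) then J1 m k (mono fun _ => kap t k) * sl t m k α η i else 0) = 0 :=
      sum_eq_zero fun i hi => if_neg fun h => hn ⟨i, mem_range_succ_iff.1 hi, h⟩
    rw [hr, if_neg (fun h => hn ⟨0, bo, by simpa using h⟩), zero_sub, neg_eq_zero]
    refine sum_eq_zero fun i _ => sum_eq_zero fun j _ => if_neg fun he => ?_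
    obtain ⟨z, hz⟩ := H.int i j
    have h3 : x i - y j = ((z + (m - i.val + j.val) : ℤ) : ℚ) := by rw [xy, hz]; push_cast; ring
    have h4 := H.le i j
    have h5 : 0 ≤ z := by
      have : (0 : ℚ) ≤ z := by linarith
      exact_mod_cast this
    obtain ⟨n, hn'⟩ := Int.eq_ofNat_of_zero_le (show 0 ≤ z + (m - i.val + j.val : ℤ) by have := i.isLt; omega)
    rw [hn'] at h3
    refine hn ⟨n, ?_, by rw [he, h3]; simp⟩
    rw [he, h3] at hd
    have : (n : ℚ) ≤ K := by simpa using hd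
    exact_mod_cast this
theorem sl_zero (t : CType) {α : Fin m → ℚ} {η : Fin k → ℚ} (H : AP K α η) :
    sl t m k α η 0 = J1 m k (al m (rA m + α)) * J2 m k (AY t k (rY t k + η)) := by
  rw [sl, if_pos rfl, sub_eq_self]
  refine sum_eq_zero fun i _ => sum_eq_zero fun j _ => if_neg fun he => ?_
  have h4 := H.le i j
  have im : (i.val : ℚ) + 1 ≤ m := by exact_mod_cast i.isLt
  have : (0 : ℚ) ≤ j.val := Nat.cast_nonneg _
  push_cast at he; linarith
theorem J1_inj : Function.Injective (J1 m k) := mp_inj _ (i1_inj _ _)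
theorem J2_inj : Function.Injective (J2 m k) := mp_inj _ (i2_inj _ _)
theorem al_rA_ne (m : ℕ) : al m (rA m) ≠ 0 := al_ne_zero _ (rA_SD m).sa.injective
theorem Yg (t : CType) {α : Fin m → ℚ} {η : Fin k → ℚ} (H : AP K α η) {g : CharRing (m + k)}
    (hg : AY t (m + k) (rY t (m + k)) * g = AY t (m + k) (rY t (m + k) + Fin.append α η)) :
    ∃ c, Ex (GY m k g) (- ∑ i, α i) c K ∧
      ∀ n ≤ K, sl t m k α η n = ∑ i ∈ range (n+1), c (n - i) * sl t m k 0 0 i := by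
  have H0 : AP K (0 : Fin m → ℚ) (0 : Fin k → ℚ) := AP.zero H.K2 H.Kk
  have z : Fin.append (0 : Fin m → ℚ) (0 : Fin k → ℚ) = 0 := by
    ext i; refine Fin.addCases (fun i => ?_) (fun i => ?_) i <;> simp
  have e0 := sl_ex t H0
  rw [z, add_zero] at e0
  have hc : J1 m k (mono fun _ => kap t k) ≠ 0 := fun h => mono_ne_zero _ (J1_inj (h.trans (map_zero _).symm))
  obtain ⟨c, h1, h2⟩ := div_ex (by rw [← map_mul, hg]) e0 (sl_ex t H) (by
    rw [sl_zero t H0]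
    refine mul_ne_zero hc (mul_ne_zero (fun h => ?_) (fun h => ?_))
    · rw [add_zero] at h; exact al_rA_ne m (J1_inj (h.trans (map_zero _).symm))
    · rw [add_zero] at h; exact den_ne t k (J2_inj (h.trans (map_zero _).symm)))
  refine ⟨c, ?_, fun n hn => ?_⟩
  · convert h1 using 1
    rw [map_add, add_sub_cancel_left, phi_apply]; simp
  · apply mul_left_cancel₀ hc
    rw [h2 n hn, mul_sum]
    exact sum_congr rfl fun i _ => by ring
end

section
def pA (q : ℕ) (c : ℚ) : CharRing q := ∑ i, mono (Pi.single i c)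
theorem pre_single' (σ : Equiv.Perm (Fin q)) (a : Fin q) (c : ℚ) :
    pre σ (Pi.single a c) = Pi.single (σ.symm a) c := by
  ext i
  change (Pi.single a c : Fin q → ℚ) (σ i) = _
  rw [Pi.single_apply, Pi.single_apply]
  simp [Equiv.eq_symm_apply]
theorem pA_sym (q : ℕ) (c : ℚ) : Sym q (pA q c) := by
  intro σ
  rw [pA, map_sum]
  simp only [mp_mono, pre_single']
  exact Equiv.sum_comp σ.symm (fun i => mono (Pi.single i c))
theorem pA_al (c : ℚ) (v : Fin q → ℚ) : pA q c * al q v = ∑ i, al q (v + Pi.single i c) := by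
  rw [mul_al _ (pA_sym q c), pA, map_sum]
  simp only [ev_mono]
def ZY (t : CType) (k : ℕ) (c : ℚ) : CharRing k :=
  ∑ i, (mono (Pi.single i c) + mono (Pi.single i (-c))) + if t = CType.B then 1 else 0
theorem TY_single (p : PS k) (i : Fin k) (c : ℚ) :
    TY p (Pi.single i c) = Pi.single (p.1.symm i) c ∨ TY p (Pi.single i c) = Pi.single (p.1.symm i) (-c) := by
  rcases h : p.2 (p.1.symm i) with _ | _
  · left; ext j; rw [TY_apply, Pi.single_apply, Pi.single_apply]
    by_cases hj : j = p.1.symm i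
    · rw [hj, h]; simp [sg]
    · rw [if_neg hj, if_neg (fun e => hj (by simp [← e])), mul_zero]
  · right; ext j; rw [TY_apply, Pi.single_apply, Pi.single_apply]
    by_cases hj : j = p.1.symm i
    · rw [hj, h]; simp [sg]
    · rw [if_neg hj, if_neg (fun e => hj (by simp [← e])), mul_zero]
theorem ZY_inv (t : CType) (k : ℕ) (c : ℚ) : (WY t k).Inv (ZY t k c) := by
  rintro ⟨σ, s⟩ _
  set p : PS k := (σ, s)
  change mp (TY p) _ = _
  rw [ZY, map_add, map_sum]
  congr 1
  · rw [← Equiv.sum_comp p.1.symm (fun i => mono (Pi.single i c) + mono (Pi.single i (-c)))]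
    refine sum_congr rfl fun i _ => ?_
    rw [map_add, mp_mono, mp_mono]
    have e : TY p (Pi.single i (-c)) = - TY p (Pi.single i c) := by rw [← map_neg, Pi.single_neg]
    rw [e]
    rcases TY_single p i c with h | h <;> rw [h] <;> simp [← Pi.single_neg, add_comm]
  · split_ifs <;> simp
theorem ZY_AY (t : CType) (k : ℕ) (c : ℚ) (v : Fin k → ℚ) : ZY t k c * AY t k v =
    ∑ i, AY t k (v + Pi.single i c) + (∑ i, AY t k (v + Pi.single i (-c)) + if t = CType.B then AY t k v else 0) := by
  have h : (1 : CharRing k) = mono 0 := rfl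
  rw [(WY t k).mul_alt _ (ZY_inv t k c), ZY, map_add, map_sum, ← add_assoc, ← sum_add_distrib]
  congr 1
  · simp only [map_add, ev_mono]
  · split_ifs
    · rw [h, ev_mono, add_zero]
    · simp
theorem AY_T (p : PS n) (hp : eY t p ≠ 0) (v : Fin n → ℚ) :
    AY t n (TY p v) = eY t p • AY t n v := (WY t n).alt_T p hp v
theorem AY_sw {a b : Fin n} (h : a ≠ b) (v : Fin n → ℚ) (c : ℚ) :
    AY t n (v + Pi.single b c) = - AY t n (v + Pi.single a (c - (v a - v b)) + Pi.single b (v a - v b)) := by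
  have hp : t = CType.D → par (fun _ : Fin n => false) = 1 := fun _ => par_false
  have e := AY_T (t := t) (Equiv.swap a b, fun _ => false) (eY_ne' hp) (v + Pi.single b c)
  rw [eY_eq hp, par_false, Equiv.Perm.sign_swap h] at e
  have e2 : TY (Equiv.swap a b, fun _ => false) (v + Pi.single b c) = v + Pi.single a (c - (v a - v b)) + Pi.single b (v a - v b) := by
    ext j
    rw [TY_apply]
    by_cases ja : j = a
    · subst ja; simp [sg, h]; ring
    · by_cases jb : j = b
      · subst jb; simp [sg, h, ja]
      · simp [sg, ja, jb, Equiv.swap_apply_of_ne_of_ne]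
  rw [← e2, e]; simp
theorem al_sw {a b : Fin n} (h : a ≠ b) (v : Fin n → ℚ) (c : ℚ) :
    al n (v + Pi.single b c) = - al n (v + Pi.single a (c - (v a - v b)) + Pi.single b (v a - v b)) := by
  have e := al_swap a b h (v + Pi.single b c)
  have e2 : pre (Equiv.swap a b) (v + Pi.single b c) = v + Pi.single a (c - (v a - v b)) + Pi.single b (v a - v b) := by
    ext j
    change (v + Pi.single b c : Fin n → ℚ) (Equiv.swap a b j) = _
    by_cases ja : j = a
    · subst ja; simp [h]; ring
    · by_cases jb : j = b
      · subst jb; simp [h, ja]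
      · simp [ja, jb, Equiv.swap_apply_of_ne_of_ne]
  rw [← e2, e]; simp
theorem Yred (ht : t ≠ CType.C) {n s c : ℕ} (hc : 1 ≤ c) (hn : s + c < n) {μ : Fin n → ℚ}
    (hμ : ∀ j : Fin n, s ≤ j.val → μ j = 0) :
    ZY t n c * AY t n (rY t n + μ) = ∑ i : Fin n, (if i.val < s + c then AY t n (rY t n + μ + Pi.single i (c : ℚ)) else 0)
      + (∑ i : Fin n, (if i.val < s then AY t n (rY t n + μ + Pi.single i (-(c : ℚ))) else 0)
      + if Even c then AY t n (rY t n + μ) else 0) := by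
  set v := rY t n + μ with hv
  have vt : ∀ j : Fin n, s ≤ j.val → v j = rY t n j := fun j hj => by rw [hv, Pi.add_apply, hμ j hj, add_zero]
  have z : ∀ (i j : Fin n) (x : ℚ), i ≠ j → |v i + x| = |v j| → AY t n (v + Pi.single i x) = 0 := by
    intro i j x hij h
    refine AY_zero1 hij ?_
    simpa [hij.symm] using h
  rw [ZY_AY]
  congr 1
  · refine sum_congr rfl fun i _ => ?_
    split_ifs with hi
    · rfl
    · refine z i ⟨i.val - c, bo⟩ _ (fun h => ?_) ?_
      · have := congrArg Fin.val h; simp at this; omega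
      · rw [vt i bo, vt _ (by simp; omega)]
        have := rY_step (t := t) ⟨i.val - c, bo⟩ i
        simp only [Nat.cast_sub (show c ≤ i.val by omega)] at this
        congr 1; linarith
  · have hs : ∀ i : Fin n, AY t n (v + Pi.single i (-(c : ℚ))) = (if i.val < s then AY t n (v + Pi.single i (-(c : ℚ))) else 0)
        + if s ≤ i.val then AY t n (v + Pi.single i (-(c : ℚ))) else 0 := by
      intro i; by_cases h : i.val < s
      · rw [if_pos h, if_neg bo, add_zero]
      · rw [if_neg h, if_pos bo, zero_add]
    rw [sum_congr rfl fun i _ => hs i, sum_add_distrib, add_assoc]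
    congr 1
    have step : ∀ i : Fin n, s ≤ i.val → 2 * rY t n i ≠ c → AY t n (v + Pi.single i (-(c : ℚ))) = 0 := by
      intro i hi hne
      by_cases hic : i.val + c < n
      · refine z i ⟨i.val + c, hic⟩ _ (fun h => ?_) ?_
        · have := congrArg Fin.val h; simp at this; omega
        · rw [vt i bo, vt _ (by simp; omega)]
          have := rY_step (t := t) i ⟨i.val + c, bo⟩
          push_cast at this
          congr 1; linarith
      · obtain ⟨j, hj, hjs⟩ : ∃ j : Fin n, rY t n j = c - rY t n i ∧ s ≤ j.val := by
          cases t with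
          | C => exact absurd rfl ht
          | B =>
            refine ⟨⟨2 * n - 1 - c - i.val, bo⟩, ?_, by simp; omega⟩
            simp only [rhoY]; rw [Nat.cast_sub bo, Nat.cast_sub bo, Nat.cast_sub bo]; push_cast; ring
          | D =>
            refine ⟨⟨2 * n - 2 - c - i.val, bo⟩, ?_, by simp; omega⟩
            simp only [rhoY]; rw [Nat.cast_sub bo, Nat.cast_sub bo, Nat.cast_sub bo]; push_cast; ring
        refine z i j _ (fun h => hne ?_) ?_
        · rw [← h] at hj; linarith
        · rw [vt i hi, vt j hjs, hj, ← abs_neg]; congr 1; ring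
    cases t with
    | C => exact absurd rfl ht
    | B =>
      by_cases he : Even c
      · rw [sum_eq_zero, if_pos rfl, if_pos he, zero_add]
        intro i _; split_ifs with hi
        · refine step i hi fun h => ?_
          simp only [rhoY] at h
          have : (2 * n : ℚ) = c + 2 * i.val + 1 := by linarith
          have : 2 * n = c + 2 * i.val + 1 := by exact_mod_cast this
          obtain ⟨d, rfl⟩ := he; omega
        · rfl
      · obtain ⟨d, rfl⟩ := Nat.not_even_iff_odd.1 he
        rw [if_pos rfl, if_neg he]
        set i0 : Fin n := ⟨n - 1 - d, bo⟩ with hi0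
        have r0 : 2 * rY CType.B n i0 = ((2 * d + 1 : ℕ) : ℚ) := by
          simp only [rhoY, hi0]; rw [Nat.cast_sub bo, Nat.cast_sub bo]; push_cast; ring
        rw [sum_eq_single i0]
        · rw [if_pos (by simp [hi0]; omega)]
          have hp : CType.B = CType.D → par (fun x => decide (x = i0)) = 1 := fun h => by cases h
          have e := AY_T (t := CType.B) (1, fun x => decide (x = i0)) (eY_ne' hp) v
          rw [eY_eq hp, par_single] at e
          have e2 : TY (1, fun x => decide (x = i0)) v = v + Pi.single i0 (-((2 * d + 1 : ℕ) : ℚ)) := by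
            ext j; rw [TY_apply]
            by_cases hj : j = i0
            · subst hj; simp only [decide_true, sg, Pi.add_apply, Pi.single_eq_same, ← r0, Equiv.Perm.one_apply, vt i0 (by simp [hi0]; omega)]; push_cast; simp; ring
            · simp [sg, hj]
          rw [← e2, e]; simp
        · intro i _ hi
          split_ifs with his
          · refine step i his fun h => hi ?_
            rw [← r0] at h
            simp only [rhoY] at h
            have : (i.val : ℚ) = i0.val := by linarith
            exact Fin.ext (by exact_mod_cast this)
          · rfl
        · simp
    | D =>
      by_cases he : Even c
      · obtain ⟨d, rfl⟩ := he
        rw [if_neg bs, if_pos ⟨d, rfl⟩, add_zero]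
        set i0 : Fin n := ⟨n - 1 - d, bo⟩ with hi0
        set l0 : Fin n := ⟨n - 1, bo⟩ with hl0
        have r0 : 2 * rY CType.D n i0 = ((d + d : ℕ) : ℚ) := by
          simp only [rhoY, hi0]; rw [Nat.cast_sub bo, Nat.cast_sub bo]; push_cast; ring
        have r1 : rY CType.D n l0 = 0 := by
          simp only [rhoY, hl0]; rw [Nat.cast_sub bo]; push_cast; ring
        have hil : i0 ≠ l0 := fun h => by have := congrArg Fin.val h; simp [hi0, hl0] at this; omega
        rw [sum_eq_single i0]
        · rw [if_pos (by simp [hi0]; omega)]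
          have hp : CType.D = CType.D → par (single2 i0 l0) = 1 := fun _ => par_single2 hil
          have e := AY_T (t := CType.D) (1, single2 i0 l0) (eY_ne' hp) v
          rw [eY_eq hp, par_single2 hil] at e
          have e2 : TY (1, single2 i0 l0) v = v + Pi.single i0 (-((d + d : ℕ) : ℚ)) := by
            ext j; rw [TY_apply]
            by_cases hj : j = i0
            · subst hj; simp only [single2, sg, Pi.add_apply, Pi.single_eq_same, ← r0, Equiv.Perm.one_apply, vt i0 (by simp [hi0]; omega)]; push_cast; simp; ring
            · by_cases hj2 : j = l0
              · subst hj2; simp [vt l0 (by simp [hl0]; omega), r1, hj]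
              · simp [sg, single2, hj, hj2]
          rw [← e2, e]; simp
        · intro i _ hi
          split_ifs with his
          · refine step i his fun h => hi ?_
            rw [← r0] at h
            simp only [rhoY] at h
            have : (i.val : ℚ) = i0.val := by linarith
            exact Fin.ext (by exact_mod_cast this)
          · rfl
        · simp
      · rw [sum_eq_zero, if_neg bs, if_neg he, zero_add]
        intro i _; split_ifs with hi
        · refine step i hi fun h => ?_
          simp only [rhoY] at h
          have : (2 * n : ℚ) = c + 2 * i.val + 2 := by linarith
          have : 2 * n = c + 2 * i.val + 2 := by exact_mod_cast this
          exact he (by rw [Nat.even_iff]; omega)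
        · rfl
end

section
theorem sum_lt0 {A : Type*} [AddCommMonoid A] (f : Fin n → A) : (∑ i : Fin n, if i.val < 0 then f i else 0) = 0 := by simp
theorem sum_lt {A : Type*} [AddCommMonoid A] (h : r < n) (f : Fin n → A) :
    (∑ i : Fin n, if i.val < r + 1 then f i else 0) = (∑ i : Fin n, if i.val < r then f i else 0) + f ⟨r, h⟩ := by
  have : f ⟨r, h⟩ = ∑ i : Fin n, if i = ⟨r, h⟩ then f i else 0 := by simp
  rw [this, ← sum_add_distrib]
  refine sum_congr rfl fun i _ => ?_
  by_cases h1 : i.val < r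
  · rw [if_pos h1, if_pos bo, if_neg (fun e => by rw [e] at h1; simp at h1), add_zero]
  · by_cases h2 : i = ⟨r, h⟩
    · rw [if_neg h1, if_pos h2, if_pos (by rw [h2]; simp), zero_add]
    · rw [if_neg h1, if_neg h2, if_neg, zero_add]
      intro h3; exact h2 (Fin.ext (by simp; omega))
def sY (n : ℕ) (a b c : ℚ) : Fin n → ℚ := fun i => if i.val = 0 then a else if i.val = 1 then b else if i.val = 2 then c else 0
theorem sY0 (h : 0 < n) (a b c x : ℚ) : sY n a b c + Pi.single ⟨0, h⟩ x = sY n (a + x) b c := by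
  ext i; simp only [sY, Pi.add_apply, Pi.single_apply, Fin.ext_iff]; split_ifs <;> simp
theorem sY1 (h : 1 < n) (a b c x : ℚ) : sY n a b c + Pi.single ⟨1, h⟩ x = sY n a (b + x) c := by
  ext i; simp only [sY, Pi.add_apply, Pi.single_apply, Fin.ext_iff]; split_ifs <;> simp <;> omega
theorem sY2 (h : 2 < n) (a b c x : ℚ) : sY n a b c + Pi.single ⟨2, h⟩ x = sY n a b (c + x) := by
  ext i; simp only [sY, Pi.add_apply, Pi.single_apply, Fin.ext_iff]; split_ifs <;> simp <;> omega
theorem sYz : sY n 0 0 0 = 0 := by ext i; simp [sY]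
def BY (t : CType) (n : ℕ) (a b c : ℚ) : CharRing n := AY t n (rY t n + sY n a b c)
theorem BY_0 (t : CType) (n : ℕ) : BY t n 0 0 0 = AY t n (rY t n) := by rw [BY, sYz, add_zero]
section
variable {t : CType} {n : ℕ}
theorem BY_s01 (h : 1 < n) (a b c : ℚ) : BY t n a b c = - BY t n (b - 1) (a + 1) c := by
  have h0 : 0 < n := by omega
  have hne : (⟨0, h0⟩ : Fin n) ≠ ⟨1, h⟩ := by simp
  have r := rY_step (t := t) (⟨0, h0⟩ : Fin n) ⟨1, h⟩
  have e1 := AY_sw (t := t) hne (rY t n + sY n a 0 c) b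
  rw [add_assoc, sY1, zero_add] at e1
  rw [BY, e1, BY, add_assoc, add_assoc (rY t n), ← add_assoc (sY n a 0 c), sY0, sY1]
  congr 4 <;> simp [sY] at r ⊢ <;> linarith
theorem BY_s12 (h : 2 < n) (a b c : ℚ) : BY t n a b c = - BY t n a (c - 1) (b + 1) := by
  have h0 : 1 < n := by omega
  have hne : (⟨1, h0⟩ : Fin n) ≠ ⟨2, h⟩ := by simp
  have r := rY_step (t := t) (⟨1, h0⟩ : Fin n) ⟨2, h⟩
  have e1 := AY_sw (t := t) hne (rY t n + sY n a b 0) c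
  rw [add_assoc, sY2, zero_add] at e1
  rw [BY, e1, BY, add_assoc, add_assoc (rY t n), ← add_assoc (sY n a b 0), sY1, sY2]
  congr 4 <;> simp [sY] at r ⊢ <;> linarith
theorem self_neg {x : CharRing k} (h : x = - x) : x = 0 := self_eq_neg.1 h
theorem BY_z01 (h : 1 < n) (a c : ℚ) : BY t n a (a + 1) c = 0 := by
  have := BY_s01 (t := t) h a (a+1) c
  rw [add_sub_cancel_right] at this; exact self_neg this
theorem Yrel1 (ht : t ≠ CType.C) (hn : 2 ≤ n) : ZY t n 1 * BY t n 0 0 0 = BY t n 1 0 0 := by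
  have h := Yred ht (n := n) (s := 0) (c := 1) le_rfl bo (μ := sY n 0 0 0) (by simp [sYz])
  rw [sum_lt0, sum_lt bo, sum_lt0, if_neg bd] at h
  simp only [add_assoc, sY0] at h
  simpa [BY] using h
theorem Yrel_a (ht : t ≠ CType.C) (hn : 3 ≤ n) (a : ℚ) : ZY t n 1 * BY t n a 0 0 = BY t n (a+1) 0 0 + BY t n a 1 0 + BY t n (a - 1) 0 0 := by
  have h := Yred ht (n := n) (s := 1) (c := 1) le_rfl bo (μ := sY n a 0 0) (by
    intro j hj; simp [sY]; omega)
  rw [sum_lt bo, sum_lt bo, sum_lt0, sum_lt bo, sum_lt0, if_neg bd] at h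
  simp only [add_assoc, sY0, sY1] at h
  simpa [BY, sub_eq_add_neg, add_assoc] using h
theorem Yrel_b (ht : t ≠ CType.C) (hn : 4 ≤ n) (a b : ℚ) : ZY t n 1 * BY t n a b 0 = BY t n (a+1) b 0 + BY t n a (b+1) 0
    + BY t n a b 1 + BY t n (a - 1) b 0 + BY t n a (b - 1) 0 := by
  have h := Yred ht (n := n) (s := 2) (c := 1) le_rfl bo (μ := sY n a b 0) (by
    intro j hj; unfold sY; split_ifs <;> first | omega | rfl)
  rw [sum_lt bo, sum_lt bo, sum_lt bo, sum_lt0, sum_lt bo, sum_lt bo, sum_lt0, if_neg bd] at h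
  simp only [add_assoc, sY0, sY1, sY2] at h
  simpa [BY, sub_eq_add_neg, add_assoc] using h
theorem Yrel2 (ht : t ≠ CType.C) (hn : 3 ≤ n) : ZY t n 1 * BY t n 1 0 0 = BY t n 2 0 0 + BY t n 1 1 0 + BY t n 0 0 0 := by
  rw [Yrel_a ht hn]; norm_num
theorem Yrel3 (ht : t ≠ CType.C) (hn : 3 ≤ n) : ZY t n 2 * BY t n 0 0 0 = BY t n 2 0 0 - BY t n 1 1 0 + BY t n 0 0 0 := by
  have h := Yred ht (n := n) (s := 0) (c := 2) bn bo (μ := sY n 0 0 0) (by simp [sYz])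
  rw [zero_add, sum_lt bo, sum_lt bo, sum_lt0, sum_lt0, if_pos bd] at h
  simp only [add_assoc, sY0, sY1, zero_add, Nat.cast_ofNat] at h
  have e := BY_s01 (t := t) (show 1 < n by omega) 0 2 0
  norm_num at e
  rw [BY] at e
  rw [e] at h
  simpa [BY, sub_eq_add_neg, add_assoc] using h
theorem Yrel4 (ht : t ≠ CType.C) (hn : 3 ≤ n) : ZY t n 1 * BY t n 2 0 0 = BY t n 3 0 0 + BY t n 2 1 0 + BY t n 1 0 0 := by
  rw [Yrel_a ht hn]; norm_num
theorem Yrel5 (ht : t ≠ CType.C) (hn : 4 ≤ n) : ZY t n 1 * BY t n 1 1 0 = BY t n 2 1 0 + BY t n 1 1 1 + BY t n 1 0 0 := by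
  rw [Yrel_b ht hn, BY_z01 bo]
  have := BY_z01 (t := t) (show 1 < n by omega) 0 0
  norm_num at this ⊢
  rw [this]
theorem Yrel6 (ht : t ≠ CType.C) (hn : 4 ≤ n) : ZY t n 3 * BY t n 0 0 0 = BY t n 3 0 0 - BY t n 2 1 0 + BY t n 1 1 1 := by
  have h := Yred ht (n := n) (s := 0) (c := 3) bn bo (μ := sY n 0 0 0) (by simp [sYz])
  rw [zero_add, sum_lt bo, sum_lt bo, sum_lt bo, sum_lt0, sum_lt0, if_neg bd] at h
  simp only [add_assoc, sY0, sY1, sY2, zero_add, Nat.cast_ofNat] at h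
  have e := BY_s01 (t := t) (show 1 < n by omega) 0 3 0
  have e2 := BY_s12 (t := t) (show 2 < n by omega) 0 0 3
  have e3 := BY_s01 (t := t) (show 1 < n by omega) 0 2 1
  norm_num at e e2 e3
  rw [e3, neg_neg] at e2
  rw [BY] at e e2
  rw [e, e2] at h
  simpa [BY, sub_eq_add_neg, add_assoc] using h
end
end

section
theorem mono_sum {ι : Type*} (s : Finset ι) (f : ι → Fin q → ℚ) : mono (∑ i ∈ s, f i) = ∏ i ∈ s, mono (f i) := by
  induction s using Finset.induction_on with
  | empty => simp [mono_zero]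
  | insert a s ha ih => rw [sum_insert ha, prod_insert ha, ← mono_mul, ih]
theorem al_det (v : Fin q → ℚ) :
    al q v = (Matrix.of fun i j => mono (Pi.single j (v i)) : Matrix (Fin q) (Fin q) (CharRing q)).det := by
  rw [al_def, Matrix.det_apply]
  refine sum_congr rfl fun σ _ => ?_
  rw [Units.smul_def]
  congr 1
  simp only [Matrix.of_apply]
  rw [← mono_sum]
  congr 1; ext j
  simp [Finset.sum_apply, Pi.single_apply, pre]
theorem Th_al (v : Fin (q+1) → ℚ) : Th q (al (q+1) v) =
    ∑ i : Fin (q+1), AddMonoidAlgebra.single (v i) (mo^(i.val + q) * al q (fun j => v (i.succAbove j))) := by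
  rw [al_det, RingHom.map_det, Matrix.det_succ_column _ (Fin.last q)]
  refine sum_congr rfl fun i _ => ?_
  have e1 : ((Th q).mapMatrix (Matrix.of fun i j => mono (Pi.single j (v i)))) i (Fin.last q) = AddMonoidAlgebra.single (v i) 1 := by
    rw [RingHom.mapMatrix_apply, Matrix.map_apply, Matrix.of_apply, Th, gr_mono]
    congr 1
    · simp
    · rw [← mono_zero]; congr 1; ext j; simp [initH, Fin.castSucc_ne_last]
  have e2 : (((Th q).mapMatrix (Matrix.of fun i j => mono (Pi.single j (v i)))).submatrix i.succAbove (Fin.last q).succAbove)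
      = (AddMonoidAlgebra.singleZeroRingHom (R := CharRing q) (M := ℚ)).mapMatrix
        (Matrix.of fun a j => mono (Pi.single j (v (i.succAbove a)))) := by
    ext a j : 1
    simp only [Matrix.submatrix_apply, RingHom.mapMatrix_apply, Matrix.map_apply, Matrix.of_apply, Th, gr_mono,
      AddMonoidAlgebra.singleZeroRingHom_apply]
    congr 1
    · simp [(Fin.castSucc_ne_last _).symm]
    · congr 1; ext b; simp [initH, Pi.single_apply]
  rw [e1, e2, ← RingHom.map_det, ← al_det, Fin.val_last]
  have e3 : ((-1 : GR q) ^ (i.val + q)) = AddMonoidAlgebra.singleZeroRingHom (R := CharRing q) (M := ℚ) (mo ^ (i.val + q)) := by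
    rw [map_pow, map_neg, map_one]
  rw [e3]
  change AddMonoidAlgebra.single 0 _ * _ * AddMonoidAlgebra.single 0 _ = _
  rw [AddMonoidAlgebra.single_mul_single, AddMonoidAlgebra.single_mul_single]
  simp
def aN (q : ℕ) (f : ℕ → ℤ) : CharRing q := al q (fun i => (f i.val : ℚ))
theorem aN_zero {f : ℕ → ℤ} (i j : ℕ) (hi : i < q) (hj : j < q) (h : i ≠ j) (hf : f i = f j) : aN q f = 0 :=
  al_rep ⟨i, hi⟩ ⟨j, hj⟩ (by simpa using h) _ (by simp [hf])
theorem aN_congr {f g : ℕ → ℤ} (h : ∀ n < q, f n = g n) : aN q f = aN q g := by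
  unfold aN; congr 1; ext i; rw [h _ i.2]
theorem aN_swap {f g : ℕ → ℤ} (i j : ℕ) (hi : i < q) (hj : j < q) (hij : i ≠ j)
    (h : ∀ n < q, g n = if n = i then f j else if n = j then f i else f n) : aN q f = - aN q g := by
  rw [aN, ← neg_neg (al q _), ← al_swap ⟨i, hi⟩ ⟨j, hj⟩ (by simpa using hij)]
  unfold aN
  congr 2; ext n
  change ((f (Equiv.swap (⟨i, hi⟩ : Fin q) ⟨j, hj⟩ n).val : ℤ) : ℚ) = _
  rw [h _ n.2, Equiv.swap_apply_def]
  split_ifs with h1 h2 h3 h4 h5 h6 <;> simp_all [Fin.ext_iff]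
def bp (i : ℕ) (c : ℤ) (n : ℕ) : ℤ := if n = i then c else 0
def cK (k n : ℕ) : ℤ := if n < k then 1 else 0
theorem sgm {P : Prop} (h : P := by intros; simp only [cK, bp, Pi.add_apply]; split_ifs <;> first | omega | contradiction) : P := h
theorem bp_single (f : ℕ → ℤ) (i : Fin q) (c : ℤ) :
    ((fun i => (f i.val : ℚ)) + Pi.single i (c : ℚ) : Fin q → ℚ) = fun j => (((f + bp i.val c) j.val : ℤ) : ℚ) := by
  ext j; simp only [Pi.add_apply, Pi.single_apply, bp, Fin.ext_iff]; split_ifs <;> simp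
theorem pN (c : ℤ) (f : ℕ → ℤ) : pA q c * aN q f = ∑ i ∈ range q, aN q (f + bp i c) := by
  rw [aN, pA_al, ← Fin.sum_univ_eq_sum_range (fun i => aN q (f + bp i c))]
  exact sum_congr rfl fun i _ => by rw [bp_single]; rfl
theorem pNs (c : ℤ) (f : ℕ → ℤ) (s : Finset ℕ) (hs : ∀ i ∈ s, i < q)
    (h : ∀ i < q, i ∉ s → ∃ j < q, j ≠ i ∧ f j = f i + c) : pA q c * aN q f = ∑ i ∈ s, aN q (f + bp i c) := by
  rw [pN]
  refine Eq.symm (sum_subset (fun i hi => mem_range.2 (hs i hi)) fun i hi hs' => ?_)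
  obtain ⟨j, hj, hij, e⟩ := h i (mem_range.1 hi) hs'
  exact aN_zero j i hj (mem_range.1 hi) hij (by simp [bp, hij, e])
def eA (q : ℕ) (c : ℚ) : CharRing q := ∑ i, ∑ j, if i < j then mono (Pi.single i c + Pi.single j c) else 0
def hA (q : ℕ) (c : ℚ) : CharRing q := eA q c + pA q (2 * c)
theorem pA_sq (q : ℕ) (c : ℚ) : pA q c * pA q c = 2 * eA q c + pA q (2 * c) := by
  have e1 : pA q c * pA q c = ∑ i, ∑ j, mono (Pi.single i c + Pi.single j c : Fin q → ℚ) := by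
    rw [pA, sum_mul_sum]; simp only [mono_mul]
  have e2 : eA q c = ∑ i, ∑ j, if j < i then mono (Pi.single i c + Pi.single j c : Fin q → ℚ) else 0 := by
    rw [eA, sum_comm]; simp only [add_comm]
  have e3 : pA q (2 * c) = ∑ i, ∑ j, if i = j then mono (Pi.single i c + Pi.single j c : Fin q → ℚ) else 0 := by
    simp only [sum_ite_eq, mem_univ, if_true, pA, two_mul, Pi.single_add]
  rw [two_mul, e1]; nth_rw 2 [e2]; rw [e3, eA]
  simp only [← sum_add_distrib]
  refine sum_congr rfl fun i _ => sum_congr rfl fun j _ => ?_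
  rcases lt_trichotomy i j with h | h | h
  · simp [h, h.ne, not_lt.2 h.le]
  · simp [h]
  · simp [h, h.ne', not_lt.2 h.le]
theorem pA_he (q : ℕ) (c : ℚ) : pA q c * pA q c = hA q c + eA q c := by rw [pA_sq, hA]; ring
theorem pA_hme (q : ℕ) (c : ℚ) : pA q (2 * c) = hA q c - eA q c := by rw [hA]; ring
theorem two_cancel {x y : CharRing q} (h : 2 * x = 2 * y) : x = y := by
  rw [two_mul, two_mul] at h
  exact AddMonoidAlgebra.ext <| Finsupp.ext fun v => by
    have := congrArg (fun z : CharRing q => z.coeff v) h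
    simp only [AddMonoidAlgebra.coeff_add, Finsupp.add_apply] at this
    omega
theorem eA_sym (q : ℕ) (c : ℚ) : Sym q (eA q c) := by
  intro σ
  refine two_cancel ?_
  have h := pA_sq q c
  have h2 := congrArg (mp (pre σ)) h
  rw [map_add, map_mul, map_mul, map_ofNat, pA_sym, pA_sym, h] at h2
  exact (add_right_cancel h2).symm
theorem eA_al (c : ℚ) (v : Fin q → ℚ) :
    eA q c * al q v = ∑ i, ∑ j, if i < j then al q (v + Pi.single i c + Pi.single j c) else 0 := by
  rw [mul_al _ (eA_sym q c), eA, map_sum]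
  refine sum_congr rfl fun i _ => ?_
  rw [map_sum]
  refine sum_congr rfl fun j _ => ?_
  split_ifs
  · rw [ev_mono, ← add_assoc]
  · simp
def DN (q n : ℕ) : CharRing q :=
  if n ≤ q then mo^n * al q (rA q - fun j => if q ≤ j.val + n then 1 else 0) else 0
theorem DN_ex (q K : ℕ) : Ex (Th q (mono (fun _ => -1) * al (q+1) (rA (q+1)))) mo (DN q) K := by
  intro e he
  rw [al_const, Th_al, AddMonoidAlgebra.coeff_sum, Finset.sum_apply']
  simp only [AddMonoidAlgebra.coeff_single, Finsupp.single_apply]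
  have hv : ∀ i : Fin (q+1), (rA (q+1) + (fun _ => (-1:ℚ)) : Fin (q+1) → ℚ) i = -1 + ((q - i.val : ℕ) : ℚ) := by
    intro i; rw [Nat.cast_sub bo]; simp [rA]; ring
  by_cases H : ∃ n : ℕ, n ≤ K ∧ e = -1 + n
  · obtain ⟨n, hn, rfl⟩ := H
    rw [sum_pick K n hn, DN]
    by_cases hq : n ≤ q
    · rw [if_pos hq, sum_eq_single (⟨q - n, bo⟩ : Fin (q+1))]
      · rw [if_pos (by rw [hv]; simp only; rw [Nat.sub_sub_self hq]), show q - n + q = n + 2 * (q - n) by omega, pow_add, pow_mul]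
        simp only [even_two, Even.neg_pow, one_pow, mul_one]
        congr 2; ext j
        simp only [rA, Pi.add_apply, Pi.sub_apply, Fin.succAbove, Fin.lt_def, Fin.val_castSucc]
        by_cases hj : j.val < q - n
        · rw [if_pos hj, if_neg bo, Fin.val_castSucc]; push_cast; ring
        · rw [if_neg hj, if_pos bo, Fin.val_succ]; push_cast; ring
      · intro i _ hi
        rw [if_neg]; rw [hv]; intro h
        have h' : q - i.val = n := by exact_mod_cast (add_left_cancel h)
        exact hi (Fin.ext (by simp; omega))
      · simp
    · rw [if_neg hq]
      refine sum_eq_zero fun i _ => ?_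
      rw [if_neg]; rw [hv]; intro h
      have h' : q - i.val = n := by exact_mod_cast (add_left_cancel h)
      omega
  · push Not at H
    rw [sum_eq_zero, sum_eq_zero]
    · intro n hn; rw [if_neg]; exact H n (by simpa [Nat.lt_succ_iff] using hn)
    · intro i _
      rw [if_neg]; rw [hv]; intro h
      refine H (q - i.val) ?_ h.symm
      rw [← h] at he
      exact_mod_cast (add_le_add_iff_left (-1:ℚ)).1 he
theorem rA_aN (q : ℕ) (κ : ℕ → ℤ) : al q (rA q + fun i => (κ i.val : ℚ)) = mono (fun _ => (q:ℚ) - 1) * aN q (fun n => κ n - n) := by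
  rw [aN, al_const]; congr 1; ext i; simp [rA]; ring
theorem DN0 (q : ℕ) : DN q 0 = al q (rA q) := by
  rw [DN, if_pos bo, pow_zero, one_mul]; congr 1; ext j; simp
theorem DN1 (q : ℕ) : DN q 1 = - (pA q mo * al q (rA q)) := by
  rcases q with _ | q
  · simp [DN, pA]
  · rw [DN, if_pos bo, pow_one, neg_one_mul, pA_al, sum_eq_single (Fin.last q)]
    · congr 2; ext j; simp only [Pi.sub_apply, Pi.add_apply, Pi.single_apply, Fin.ext_iff, Fin.val_last]
      split_ifs <;> first | omega | ring
    · intro i _ hi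
      have hi' : i.val ≠ q := fun h => hi (Fin.ext h)
      refine al_rep i ⟨i.val + 1, bo⟩ (by simp [Fin.ext_iff]) _ ?_
      simp [rA, Fin.ext_iff]; ring
    · simp
theorem DN2 (q : ℕ) : DN q 2 = eA q mo * al q (rA q) := by
  rw [eA_al]
  rcases lt_or_ge q 2 with h | h
  · rw [DN, if_neg bo]
    refine (sum_eq_zero fun i _ => sum_eq_zero fun j _ => ?_).symm
    rw [if_neg]; intro h'; have := Fin.lt_def.1 h'; omega
  obtain ⟨q, rfl⟩ : ∃ p, q = p + 2 := ⟨q - 2, bo⟩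
  rw [DN, if_pos h, neg_one_sq, one_mul, sum_eq_single (⟨q, bo⟩ : Fin (q+2)), sum_eq_single (⟨q+1, bo⟩ : Fin (q+2))]
  · rw [if_pos bs]; congr 1; ext j; simp only [Pi.sub_apply, Pi.add_apply, Pi.single_apply, Fin.ext_iff]
    split_ifs <;> first | omega | ring
  · intro j _ hj; rw [if_neg]; intro h'; have := Fin.lt_def.1 h'; simp [Fin.ext_iff] at hj this; omega
  · simp
  · intro i _ hi
    refine sum_eq_zero fun j _ => ?_
    split_ifs with hij
    · have hij' := Fin.lt_def.1 hij
      have hi' : i.val ≠ q := fun h => hi (Fin.ext h)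
      by_cases h1 : j.val = i.val + 1
      · refine al_rep j ⟨j.val + 1, bo⟩ (by simp [Fin.ext_iff]) _ ?_
        simp only [rA, Pi.add_apply, Pi.single_apply, Fin.ext_iff]; rw [if_neg (show ¬ j.val = i.val by omega), if_neg (show ¬ j.val + 1 = i.val by omega)]; simp; ring
      · refine al_rep i ⟨i.val + 1, bo⟩ (by simp [Fin.ext_iff]) _ ?_
        simp only [rA, Pi.add_apply, Pi.single_apply, Fin.ext_iff]; rw [if_neg (show ¬ i.val = j.val by omega), if_neg (show ¬ i.val + 1 = i.val by omega), if_neg (show ¬ i.val + 1 = j.val by omega)]; simp; ring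
    · rfl
  · simp
end

section
def resH (w : Fin n → Fin m → ℚ) : (Fin n → ℚ) →+ (Fin m → ℚ) where
  toFun v := ∑ i, v i • w i
  map_zero' := by simp
  map_add' u v := by simp [add_smul, sum_add_distrib]
theorem resH_apply (w : Fin n → Fin m → ℚ) (v) : resH w v = ∑ i, v i • w i := rfl
def RT (w : Fin k → Fin m → ℚ) : (Fin (m + k) → ℚ) →+ (Fin m → ℚ) where
  toFun v := (fun i => v (Fin.castAdd k i)) + ∑ j, v (Fin.natAdd m j) • w j
  map_zero' := by ext; simp
  map_add' u v := by ext i; simp [add_mul, sum_add_distrib]; ring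
theorem RT_apply (w : Fin k → Fin m → ℚ) (v) :
    RT w v = (fun i => v (Fin.castAdd k i)) + ∑ j, v (Fin.natAdd m j) • w j := rfl
theorem RT_J1 (w : Fin k → Fin m → ℚ) (a : CharRing m) : mp (RT w) (J1 m k a) = a :=
  ring_ext ((mp (RT w)).comp (J1 m k)) (RingHom.id _) (fun v => by
    simp only [RingHom.comp_apply, mp_mono, RingHom.id_apply]
    congr 1; ext i; simp [RT_apply, i1]) a
theorem RT_J2 (w : Fin k → Fin m → ℚ) (a : CharRing k) : mp (RT w) (J2 m k a) = mp (resH w) a :=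
  ring_ext ((mp (RT w)).comp (J2 m k)) (mp (resH w)) (fun v => by
    simp only [RingHom.comp_apply, mp_mono]
    congr 1; ext i; simp [RT_apply, i2, resH_apply]) a
def wext (w : Fin k → Fin m → ℚ) : Fin (m + k) → Fin (m + 1) → ℚ :=
  Fin.append (fun j => Pi.single j.castSucc 1 - Pi.single (Fin.last m) 1) (fun i => Fin.snoc (w i) 0)
theorem Th_res (w : Fin k → Fin m → ℚ) (F : CharRing (m + k)) :
    Th m (mp (resH (wext w)) F) = gr (phi m k) (RT w) F := by
  refine ring_ext ((Th m).comp (mp (resH (wext w)))) (gr (phi m k) (RT w)) (fun v => ?_) F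
  simp only [RingHom.comp_apply, mp_mono, Th, gr_mono, resH_apply, Fin.sum_univ_add, wext, Fin.append_left, Fin.append_right]
  congr 1
  · simp [lastH, phi_apply, Finset.sum_apply, Pi.single_apply, Fin.ext_iff]
    rw [← sum_neg_distrib]
    refine sum_congr rfl fun x _ => ?_
    rw [if_neg (by have := x.2; omega)]; ring
  · congr 1; ext i
    simp [initH, RT_apply, Finset.sum_apply, Pi.single_apply, Fin.ext_iff, i.2.ne]
    simp [Fin.val_inj]
def nn (z : ℕ) : ℕ → ℕ
  | 0 => z
  | q+1 => q + nn z q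
def wq (z : ℕ) : (q : ℕ) → Fin (nn z q) → Fin q → ℚ
  | 0 => fun _ _ => 0
  | q+1 => wext (wq z q)
theorem nn_ge (z q : ℕ) : z + (q - 1) ≤ nn z q := by
  induction q with
  | zero => simp [nn]
  | succ q ih => simp only [nn]; omega
def snocH (q : ℕ) : (Fin q → ℚ) →+ (Fin (q+1) → ℚ) where
  toFun v := Fin.snoc v 0
  map_zero' := by ext i; refine Fin.lastCases ?_ (fun i => ?_) i <;> simp
  map_add' u v := by ext i; refine Fin.lastCases ?_ (fun i => ?_) i <;> simp
def mult (t : CType) (z : ℕ) : ℕ := 2 * z + if t = CType.B then 1 else 0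
theorem resH_single (w : Fin n → Fin m → ℚ) (i) (c : ℚ) : resH w (Pi.single i c) = c • w i := by
  rw [resH_apply, sum_eq_single i]
  · simp
  · intro j _ hj; simp [hj]
  · simp
theorem res_ZY (w : Fin n → Fin m → ℚ) (t c) : mp (resH w) (ZY t n c) =
    ∑ i, (mono (c • w i) + mono ((-c) • w i)) + if t = CType.B then 1 else 0 := by
  rw [ZY, map_add, map_sum]
  simp only [map_add, mp_mono, resH_single]
  split_ifs <;> simp
theorem pA_snoc (q : ℕ) (c : ℚ) : pA (q+1) c = mp (snocH q) (pA q c) + mono (Pi.single (Fin.last q) c) := by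
  rw [pA, Fin.sum_univ_castSucc, pA, map_sum]
  congr 1
  refine sum_congr rfl fun i _ => ?_
  rw [mp_mono]; congr 1; ext j
  refine Fin.lastCases ?_ (fun j => ?_) j
  · simp [snocH, Pi.single_apply, Fin.ext_iff]; intro; have := i.2; omega
  · simp [snocH, Pi.single_apply, Fin.ext_iff]
theorem Zq (t : CType) (z q : ℕ) (c : ℚ) :
    mp (resH (wq z q)) (ZY t (nn z q) c) + (q : CharRing q) = pA q c * pA q (-c) + (mult t z : CharRing q) := by
  rw [res_ZY]
  induction q with
  | zero =>
    have : ∀ v : Fin 0 → ℚ, mono v = 1 := fun v => by rw [← mono_zero]; congr 1; ext i; exact i.elim0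
    simp only [this, mult, pA]
    have hc : (univ : Finset (Fin (nn z 0))).card = z := Fintype.card_fin z
    simp [hc]; ring
  | succ q ih =>
    have h := congrArg (mp (snocH q)) ih
    rw [map_add, map_add, map_add, map_mul, map_sum] at h
    simp only [map_add, mp_mono, map_natCast] at h
    have hif : (mp (snocH q)) (if t = CType.B then 1 else 0) = if t = CType.B then 1 else 0 := by split_ifs <;> simp
    rw [hif] at h
    rw [pA_snoc, pA_snoc]
    change (∑ i : Fin (q + nn z q), (mono (c • wext (wq z q) i) + mono ((-c) • wext (wq z q) i)) + _) + _ = _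
    rw [Fin.sum_univ_add]
    simp only [wext, Fin.append_left, Fin.append_right]
    have e1 : ∀ (c : ℚ) (i : Fin (nn z q)), c • (Fin.snoc (wq z q i) 0 : Fin (q+1) → ℚ) = snocH q (c • wq z q i) := by
      intro c i; ext j; refine Fin.lastCases ?_ (fun j => ?_) j <;> simp [snocH]
    have e2 : ∀ (c : ℚ) (j : Fin q), (mono (c • (Pi.single j.castSucc 1 - Pi.single (Fin.last q) 1) : Fin (q+1) → ℚ)) =
        mp (snocH q) (mono (Pi.single j c)) * mono (Pi.single (Fin.last q) (-c)) := by
      intro c j; rw [mp_mono, mono_mul]; congr 1; ext a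
      refine Fin.lastCases ?_ (fun a => ?_) a
      · simp [snocH, Pi.single_apply, Fin.ext_iff, j.2.ne']
      · simp [snocH, Pi.single_apply, Fin.ext_iff, a.2.ne]
    simp only [e1, e2]
    have e3 : mono (Pi.single (Fin.last q) c : Fin (q+1) → ℚ) * mono (Pi.single (Fin.last q) (-c)) = 1 := by
      rw [mono_mul, ← Pi.single_add, add_neg_cancel, Pi.single_zero, mono_zero]
    rw [sum_add_distrib, ← sum_mul, ← sum_mul, ← map_sum, ← map_sum, neg_neg]
    change _ + _ + _ + _ = (mp (snocH q) (pA q c) + _) * (mp (snocH q) (pA q (-c)) + _) + _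
    rw [show ∑ i, mono (Pi.single i c) = pA q c from rfl, show ∑ i, mono (Pi.single i (-c)) = pA q (-c) from rfl]
    push_cast
    linear_combination h - e3
theorem dsum {A : Type*} [AddCommMonoid A] (f : Fin m → Fin k → A) (i0 : Fin m) (j0 : Fin k)
    (h : ∀ i j, f i j ≠ 0 → i = i0 ∧ j = j0) : ∑ i, ∑ j, f i j = f i0 j0 := by
  rw [sum_eq_single i0, sum_eq_single j0]
  · intro j _ hj; by_contra h'; exact hj (h _ _ h').2
  · simp
  · intro i _ hi; refine sum_eq_zero fun j _ => ?_; by_contra h'; exact hi (h _ _ h').1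
  · simp
section
variable {t : CType} {m k : ℕ}
theorem sl_one (ht : t ≠ CType.C) (hk : 2 ≤ k) {α : Fin (m+1) → ℚ} (hα : ∀ i, 0 ≤ α i) :
    sl t (m+1) k α 0 1 = (if α (Fin.last m) = 0 then - J1 (m+1) k (al (m+1) (rA (m+1) + α - Pi.single (Fin.last m) 1)) else 0)
      * J2 (m+1) k (ZY t k 1) * J2 (m+1) k (AY t k (rY t k)) := by
  rw [sl, if_neg one_ne_zero, dsum _ (Fin.last m) (⟨0, bo⟩ : Fin k), mul_assoc, ← map_mul, ← BY_0, Yrel1 ht hk, BY,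
    ← zero_add (1:ℚ), ← sY0 (by omega : 0 < k), sYz]
  · simp
    split_ifs <;> simp
  · intro i j h
    have h1 := (ite_ne_right_iff.1 h).1
    simp only [Pi.zero_apply, sub_zero] at h1
    have h2 : (i.val : ℚ) ≤ m := by exact_mod_cast Nat.lt_succ_iff.1 i.2
    have h3 := hα i
    push_cast at h1
    have h4 : (0:ℚ) ≤ j.val := by positivity
    have h5 : (i.val : ℚ) = m := by linarith
    have h6 : (j.val : ℚ) = 0 := by linarith
    exact ⟨Fin.ext (by exact_mod_cast h5), Fin.ext (by exact_mod_cast h6)⟩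
theorem sl_two (hk : 3 ≤ k) {α : Fin (m+2) → ℚ} (hα : ∀ i, 0 ≤ α i) (hz : ∀ i, ∃ z : ℤ, α i = z) :
    sl t (m+2) k α 0 2 = J1 (m+2) k (if α (Fin.last (m+1)) = 0 then al (m+2) (rA (m+2) + α - Pi.single (Fin.last (m+1)) 2) else 0)
      * J2 (m+2) k (BY t k 1 1 0) -
     J1 (m+2) k ((if α (Fin.last (m+1)) = 1 then al (m+2) (rA (m+2) + α - Pi.single (Fin.last (m+1)) 2) else 0) +
       (if α ⟨m, bo⟩ = 0 then al (m+2) (rA (m+2) + α - Pi.single (⟨m, bo⟩ : Fin (m+2)) 2) else 0))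
      * J2 (m+2) k (BY t k 2 0 0) := by
  have key : ∀ (i : Fin (m+2)) (j : Fin k), (α i - (0 : Fin k → ℚ) j + (((m+2:ℕ) : ℚ) - i.val + j.val) = (2:ℕ)) ↔
      (i = Fin.last (m+1) ∧ j = ⟨1, bo⟩ ∧ α i = 0) ∨ (i = Fin.last (m+1) ∧ j = ⟨0, bo⟩ ∧ α i = 1) ∨
      (i = ⟨m, bo⟩ ∧ j = ⟨0, bo⟩ ∧ α i = 0) := by
    intro i j
    obtain ⟨z, hz⟩ := hz i
    have h0 := hα i
    rw [hz] at h0 ⊢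
    have h0' : 0 ≤ z := by exact_mod_cast h0
    have : ((z : ℚ) - (0 : Fin k → ℚ) j + (((m+2:ℕ) : ℚ) - i.val + j.val) = (2:ℕ)) ↔ z + (((m+2 : ℕ) : ℤ) - i.val + j.val) = 2 := by
      rw [Pi.zero_apply, sub_zero]; exact_mod_cast Iff.rfl
    rw [this]
    have a0 : ((z:ℚ) = 0) ↔ z = 0 := by exact_mod_cast Iff.rfl
    have a1 : ((z:ℚ) = 1) ↔ z = 1 := by exact_mod_cast Iff.rfl
    rw [a0, a1]
    simp only [Fin.ext_iff, Fin.val_last]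
    have := i.2; omega
  rw [sl, if_neg two_ne_zero]
  have split : ∀ (i : Fin (m+2)) (j : Fin k) (x : CharRing (m+2+k)), (if (α i - (0 : Fin k → ℚ) j + (((m+2:ℕ) : ℚ) - i.val + j.val) = (2:ℕ)) then x else 0)
      = (if (i = Fin.last (m+1) ∧ j = ⟨1, bo⟩ ∧ α i = 0) then x else 0) + ((if (i = Fin.last (m+1) ∧ j = ⟨0, bo⟩ ∧ α i = 1) then x else 0) +
      (if (i = ⟨m, bo⟩ ∧ j = ⟨0, bo⟩ ∧ α i = 0) then x else 0)) := by
    intro i j x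
    rw [if_congr (key i j) rfl rfl]
    have hne : Fin.last (m+1) ≠ (⟨m, bo⟩ : Fin (m+2)) := by simp [Fin.ext_iff]
    have hne' : (⟨0, bo⟩ : Fin k) ≠ ⟨1, bo⟩ := by simp [Fin.ext_iff]
    by_cases c1 : i = Fin.last (m+1) <;> by_cases c2 : j = ⟨1, bo⟩
    · have : ¬ j = ⟨0, bo⟩ := fun h => hne' (h.symm.trans c2)
      simp [c1, c2, hne, this]
    · simp [c1, c2, hne]
    · have : ¬ j = ⟨0, bo⟩ := fun h => hne' (h.symm.trans c2)
      simp [c1, c2]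
    · simp [c1, c2]
  simp only [split, sum_add_distrib]
  rw [dsum _ (Fin.last (m+1)) (⟨1, bo⟩ : Fin k), dsum _ (Fin.last (m+1)) (⟨0, bo⟩ : Fin k), dsum _ (⟨m, bo⟩ : Fin (m+2)) (⟨0, bo⟩ : Fin k)]
  rotate_left
  · intro i j h; have h1 := (ite_ne_right_iff.1 h).1; exact ⟨h1.1, h1.2.1⟩
  · intro i j h; have h1 := (ite_ne_right_iff.1 h).1; exact ⟨h1.1, h1.2.1⟩
  · intro i j h; have h1 := (ite_ne_right_iff.1 h).1; exact ⟨h1.1, h1.2.1⟩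
  have b0 : AY t k (rY t k + 0 + Pi.single (⟨0, bo⟩ : Fin k) ((2:ℕ):ℚ)) = BY t k 2 0 0 := by
    rw [BY, add_zero, ← zero_add (2:ℚ), ← sY0 (by omega : 0 < k), sYz]; simp
  have b1 : AY t k (rY t k + 0 + Pi.single (⟨1, bo⟩ : Fin k) ((2:ℕ):ℚ)) = - BY t k 1 1 0 := by
    have : BY t k 0 2 0 = - BY t k (2-1) (0+1) 0 := BY_s01 bo _ _ _
    norm_num at this
    rw [← this, BY, add_zero, ← zero_add (2:ℚ), ← sY1 (by omega : 1 < k), sYz]; simp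
  rw [b0, b1]
  simp only [true_and]
  split_ifs <;> simp <;> ring
end
end

section
theorem pst_rho (q : ℕ) : pA (q+1) mo * al (q+1) (rA (q+1)) = al (q+1) (rA (q+1) - Pi.single (Fin.last q) 1) := by
  rw [← neg_neg (pA _ _ * _), ← DN1, DN, if_pos bo, pow_one, neg_one_mul, neg_neg]
  congr 2; ext j; simp only [Pi.single_apply, Fin.ext_iff, Fin.val_last]
  have := j.2; split_ifs <;> first | omega | rfl
theorem est_rho (q : ℕ) : eA (q+2) mo * al (q+2) (rA (q+2)) = - al (q+2) (rA (q+2) - Pi.single (⟨q, bo⟩ : Fin (q+2)) 2) := by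
  have h := al_sw (a := (Fin.last (q+1))) (b := ⟨q, bo⟩) (by simp [Fin.ext_iff]) (rA (q+2)) (-2)
  rw [Pi.single_neg, ← sub_eq_add_neg] at h
  rw [h, neg_neg, ← DN2, DN, if_pos bo, neg_one_sq, one_mul]
  congr 1; ext j; simp only [rA, Pi.add_apply, Pi.sub_apply, Pi.single_apply, Fin.ext_iff, Fin.val_last]
  have := j.2; split_ifs <;> first | omega | (push_cast; ring)
theorem hst_rho (q : ℕ) : hA (q+2) mo * al (q+2) (rA (q+2)) = al (q+2) (rA (q+2) - Pi.single (Fin.last (q+1)) 2) := by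
  rw [hA, add_mul, est_rho, pA_al, Fin.sum_univ_castSucc, Fin.sum_univ_castSucc, sum_eq_zero]
  · have e1 : ((Fin.last q).castSucc : Fin (q+2)) = ⟨q, bo⟩ := rfl
    rw [e1, show (2 * -1 : ℚ) = -2 by norm_num, Pi.single_neg, Pi.single_neg, ← sub_eq_add_neg, ← sub_eq_add_neg]; ring
  · intro i _
    have := i.2
    refine al_rep i.castSucc.castSucc ⟨i.val + 2, bo⟩ (by simp [Fin.ext_iff]) _ ?_
    simp [rA, Fin.ext_iff]; ring
section
variable {t : CType} {m k K : ℕ}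
theorem sl_one0 (ht : t ≠ CType.C) (hk : 2 ≤ k) : sl t (m+1) k 0 0 1 =
    - J1 (m+1) k (pA (m+1) mo * al (m+1) (rA (m+1))) * J2 (m+1) k (ZY t k 1) * J2 (m+1) k (AY t k (rY t k)) := by
  have h := sl_one (m := m) ht hk (α := 0) bs
  simp only [Pi.zero_apply, if_true, add_zero] at h
  rw [h, pst_rho]
theorem sl_two0 (hk : 3 ≤ k) : sl t (m+2) k 0 0 2 = J1 (m+2) k (hA (m+2) mo * al (m+2) (rA (m+2))) * J2 (m+2) k (BY t k 1 1 0)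
    + J1 (m+2) k (eA (m+2) mo * al (m+2) (rA (m+2))) * J2 (m+2) k (BY t k 2 0 0) := by
  have h := sl_two (t := t) (m := m) hk (α := 0) bs (fun i => ⟨0, by simp⟩)
  simp only [Pi.zero_apply, if_true, add_zero, zero_ne_one, if_false, zero_add] at h
  rw [h, hst_rho, est_rho, map_neg]; ring
theorem J2_ne : J2 m k (AY t k (rY t k)) ≠ 0 := fun h => den_ne t k (J2_inj (h.trans (map_zero _).symm))
theorem Y0 {α : Fin m → ℚ} {η : Fin k → ℚ} (H : AP K α η) {gη : CharRing k}
    (hη : AY t k (rY t k) * gη = AY t k (rY t k + η)) {c : ℕ → CharRing (m+k)}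
    (hc : ∀ n ≤ K, sl t m k α η n = ∑ i ∈ range (n+1), c (n - i) * sl t m k 0 0 i) :
    c 0 * J1 m k (al m (rA m)) = J1 m k (al m (rA m + α)) * J2 m k gη := by
  have h := hc 0 bo
  rw [zero_add, sum_range_one, sl_zero t H, sl_zero t (AP.zero H.K2 H.Kk), add_zero, add_zero, ← hη, map_mul] at h
  refine mul_right_cancel₀ (J2_ne (t := t) (m := m) (k := k)) ?_
  rw [mul_assoc, ← h]; ring
theorem Y1 (ht : t ≠ CType.C) {α : Fin (m+1) → ℚ} {η : Fin k → ℚ} (H : AP K α η) (hK : 1 ≤ K) {gη : CharRing k}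
    (hη : AY t k (rY t k) * gη = AY t k (rY t k + η)) {c : ℕ → CharRing (m+1+k)}
    (hc : ∀ n ≤ K, sl t (m+1) k α η n = ∑ i ∈ range (n+1), c (n - i) * sl t (m+1) k 0 0 i)
    {s1} (hs : sl t (m+1) k α η 1 = s1 * J2 (m+1) k (AY t k (rY t k))) :
    c 1 * J1 (m+1) k (al (m+1) (rA (m+1))) = s1 + J1 (m+1) k (pA (m+1) mo * al (m+1) (rA (m+1) + α)) * J2 (m+1) k (ZY t k 1 * gη) := by
  have h0 := Y0 H hη hc
  have h := hc 1 hK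
  have hk := H.Kk
  rw [sum_range_succ, sum_range_one, sl_zero t (AP.zero H.K2 H.Kk), add_zero, add_zero, hs,
    sl_one0 ht bo, map_mul] at h
  refine mul_right_cancel₀ (J2_ne (t := t) (m := m+1) (k := k)) ?_
  rw [map_mul, map_mul]
  simp only [Nat.sub_zero, Nat.sub_self] at h
  linear_combination -h + h0 * (J1 (m+1) k (pA (m+1) mo) * J2 (m+1) k (ZY t k 1) * J2 (m+1) k (AY t k (rY t k)))
theorem Y2 (ht : t ≠ CType.C) {α : Fin (m+2) → ℚ} (H : AP 2 α (0 : Fin k → ℚ)) (hα : ∀ i, 0 ≤ α i) (hz : ∀ i, ∃ z : ℤ, α i = z)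
    {c : ℕ → CharRing (m+2+k)}
    (hc : ∀ n ≤ 2, sl t (m+2) k α 0 n = ∑ i ∈ range (n+1), c (n - i) * sl t (m+2) k 0 0 i)
    {b11 b2 : CharRing k} (h11 : AY t k (rY t k) * b11 = BY t k 1 1 0) (h2 : AY t k (rY t k) * b2 = BY t k 2 0 0) :
    c 2 * J1 (m+2) k (al (m+2) (rA (m+2))) =
     J1 (m+2) k (if α (Fin.last (m+1)) = 0 then al (m+2) (rA (m+2) + α - Pi.single (Fin.last (m+1)) 2) else 0) * J2 (m+2) k b11 -
     J1 (m+2) k ((if α (Fin.last (m+1)) = 1 then al (m+2) (rA (m+2) + α - Pi.single (Fin.last (m+1)) 2) else 0) +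
       (if α ⟨m, bo⟩ = 0 then al (m+2) (rA (m+2) + α - Pi.single (⟨m, bo⟩ : Fin (m+2)) 2) else 0)) * J2 (m+2) k b2
     + J1 (m+2) k (pA (m+2) mo) * J2 (m+2) k (ZY t k 1) * (c 1 * J1 (m+2) k (al (m+2) (rA (m+2))))
     - c 0 * J1 (m+2) k (al (m+2) (rA (m+2))) * (J1 (m+2) k (hA (m+2) mo) * J2 (m+2) k b11 + J1 (m+2) k (eA (m+2) mo) * J2 (m+2) k b2) := by
  have h := hc 2 le_rfl
  have hk := H.Kk
  rw [sum_range_succ, sum_range_succ, sum_range_one, sl_zero t (AP.zero H.K2 H.Kk), sl_two bo hα hz,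
    sl_one0 ht bo, sl_two0 bo, add_zero, add_zero, ← h11, ← h2] at h
  refine mul_right_cancel₀ (J2_ne (t := t) (m := m+2) (k := k)) ?_
  simp only [map_mul, map_neg, Nat.sub_zero, Nat.sub_self, Nat.reduceSub] at h ⊢
  linear_combination -h
end
def Bd (F : CharRing q) : Prop := ∀ u, |F.coeff u| ≤ 1
theorem Bd.slice {F : CharRing (q+1)} (h : Bd F) (d : ℚ) : Bd ((Th q F).coeff d) := by
  intro u
  have := gr_coeff_coeff (lastH q) (initH q) last_init_inj F (Fin.snoc u d)
  have e1 : lastH q (Fin.snoc u d) = d := by simp [lastH]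
  have e2 : initH q (Fin.snoc u d) = u := by ext i; simp [initH]
  rw [e1, e2] at this
  rw [Th, this]; exact h _
theorem Bd.const {F : CharRing q} (h : Bd F) (c : ℚ) : Bd (mono (fun _ => c) * F) := by
  intro u
  have := mono_mul_coeff (fun _ => c) (u - fun _ => c) F
  rw [add_sub_cancel] at this
  rw [this]; exact h _
theorem Bd.two {F : CharRing q} (h : Bd F) {u} (hu : 2 ≤ F.coeff u) : False := by
  have := h u; rw [abs_le] at this; omega
theorem low_ex {A : GR q} (hA : A ≠ 0) : ∃ d, A.coeff d ≠ 0 ∧ ∀ e < d, A.coeff e = 0 := by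
  have hs : A.coeff.support.Nonempty := by
    rw [Finset.nonempty_iff_ne_empty]; intro h; exact hA (AddMonoidAlgebra.ext (Finsupp.support_eq_empty.1 h))
  refine ⟨A.coeff.support.min' hs, Finsupp.mem_support_iff.1 (min'_mem _ hs), fun e he => ?_⟩
  by_contra h'
  exact absurd (min'_le _ e (Finsupp.mem_support_iff.2 h')) (not_le.2 he)
theorem Th_inj (q : ℕ) {A : CharRing (q+1)} (h : Th q A = 0) : A = 0 :=
  AddMonoidAlgebra.ext <| Finsupp.ext fun v => by
    rw [← gr_coeff_coeff (lastH q) (initH q) last_init_inj A v]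
    change ((Th q A).coeff _).coeff _ = _; rw [h]; simp
theorem step_low {A G : CharRing (q+1)} (hA : Good (q+1) A) (hA0 : A ≠ 0) {d : ℚ} {C : ℕ → CharRing q}
    (hC : Ex (Th q G) d C 1) (hb : Bd (A * G * al (q+1) (rA (q+1)))) :
    ∃ A0 A1, Good q A0 ∧ A0 ≠ 0 ∧ Good q A1 ∧ Bd (A0 * (C 0 * al q (rA q))) ∧
      Bd (A0 * (C 1 * al q (rA q) - pA q mo * (C 0 * al q (rA q))) + A1 * (C 0 * al q (rA q))) := by
  obtain ⟨a, ha, hlt⟩ := low_ex (A := Th q A) (fun h => hA0 (Th_inj q h))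
  have hb' := hb.const mo
  rw [show mono (fun _ => (-1:ℚ)) * (A * G * al (q+1) (rA (q+1))) = A * G * (mono (fun _ => (-1:ℚ)) * al (q+1) (rA (q+1))) by ring] at hb'
  have hQ : ∀ e < a + d, (Th q A * Th q G).coeff e = 0 := by
    intro e he
    have := mul_low hlt hC (e - d) (by push_cast; linarith)
    rw [add_sub_cancel] at this
    rw [this, sum_range_succ, sum_range_one, hlt _ (by push_cast; linarith), hlt _ (by push_cast; linarith)]; simp
  have m0 := mul_low hlt hC a (by push_cast; linarith)
  have m1 := mul_low hlt hC (a+1) (by push_cast; linarith)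
  have n0 := mul_low hQ (DN_ex q 1) (a+d) (by push_cast; linarith)
  have n1 := mul_low hQ (DN_ex q 1) (a+d+1) (by push_cast; linarith)
  rw [sum_range_succ, sum_range_one] at m0 m1 n0 n1
  simp only [Nat.cast_zero, Nat.cast_one, sub_zero, add_sub_cancel_right] at m0 m1 n0 n1
  rw [hlt (a-1) (by linarith), zero_mul, add_zero] at m0
  rw [hQ (a+d-1) (by linarith), zero_mul, add_zero, add_comm a d, m0, DN0, ← map_mul, ← map_mul] at n0
  rw [add_comm a d, m0, add_assoc d, m1, DN0, DN1, ← map_mul, ← map_mul] at n1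
  refine ⟨(Th q A).coeff a, (Th q A).coeff (a+1), hA.2 _, ha, hA.2 _, ?_, ?_⟩
  · have := hb'.slice (-1 + (d + a))
    rw [n0, mul_assoc] at this; exact this
  · have := hb'.slice (-1 + (d + (a+1)))
    rw [n1] at this
    convert this using 1; ring
end

section
theorem strip {v κ : Fin q → ℚ} (hv : SD v) {c : ℚ} (hc : c = 1 ∨ c = -1) (hκ : ∀ i, κ i = 0 ∨ κ i = c) :
    al q (v + κ) ∈ KK q := by
  by_cases hi : Function.Injective (v + κ)
  · refine al_mem ⟨fun a b hab => lt_of_le_of_ne ?_ fun h => hab.ne' (hi h), hv.id.add ?_⟩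
    · have := hv.gap hab
      simp only [Pi.add_apply]
      rcases hc with rfl | rfl <;> rcases hκ a with h | h <;> rcases hκ b with h' | h' <;> rw [h, h'] <;> linarith
    · intro i j
      rcases hc with rfl | rfl <;> rcases hκ i with h | h <;> rcases hκ j with h' | h' <;> rw [h, h']
      exacts [⟨0, by simp⟩, ⟨-1, by simp⟩, ⟨1, by simp⟩, ⟨0, by simp⟩, ⟨0, by simp⟩, ⟨1, by simp⟩, ⟨-1, by simp⟩, ⟨0, by simp⟩]
  · rw [Function.Injective] at hi; push Not at hi
    obtain ⟨a, b, h, hab⟩ := hi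
    rw [al_rep a b hab _ h]; exact zero_mem _
theorem strip1 {v : Fin q → ℚ} (hv : SD v) {c : ℚ} (hc : c = 1 ∨ c = -1) (i : Fin q) :
    al q (v + Pi.single i c) ∈ KK q :=
  strip hv hc fun j => by rw [Pi.single_apply]; split_ifs <;> simp
theorem KK_pA {c : ℚ} (hc : c = 1 ∨ c = -1) {F : CharRing q} (hF : F ∈ KK q) : pA q c * F ∈ KK q := by
  induction hF using AddSubmonoid.closure_induction with
  | mem x hx =>
    obtain ⟨v, hv, rfl⟩ := hx
    rw [pA_al]; exact sum_mem fun i _ => strip1 hv hc i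
  | zero => simp
  | add x y _ _ hx hy => rw [mul_add]; exact add_mem hx hy
theorem pA_sub {c : ℚ} (hc : c = 1 ∨ c = -1) {v : Fin q → ℚ} (hv : SD v) (s : Finset (Fin q)) :
    pA q c * al q v - ∑ i ∈ s, al q (v + Pi.single i c) ∈ KK q := by
  rw [pA_al, ← sum_sdiff (subset_univ s), add_sub_cancel_right]
  exact sum_mem fun i _ => strip1 hv hc i
def G1 (α : Fin (m+1) → ℚ) : CharRing (m+1) := pA (m+1) mo * al (m+1) (rA (m+1) + α) -
  if α (Fin.last m) = 0 then al (m+1) (rA (m+1) + α - Pi.single (Fin.last m) 1) else 0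
theorem AD.sd' {α : Fin q → ℚ} (h : AD α) : SD (rA q + α) := by rw [add_comm]; exact h.sd
theorem G1_sub {α : Fin (m+1) → ℚ} (h : AD α) (s : Finset (Fin (m+1))) (hs : ∀ i ∈ s, α i ≠ 0) :
    G1 α - ∑ i ∈ s, al (m+1) (rA (m+1) + α + Pi.single i mo) ∈ KK (m+1) := by
  rw [G1]
  split_ifs with h0
  · have hl : Fin.last m ∉ s := fun h' => hs _ h' h0
    have := pA_sub (Or.inr rfl) h.sd' (insert (Fin.last m) s) (c := -1)
    rw [sum_insert hl, Pi.single_neg, ← sub_eq_add_neg, ← sub_sub] at this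
    exact this
  · rw [sub_zero]; exact pA_sub (Or.inr rfl) h.sd' s
theorem SD_corner {α : Fin q → ℚ} (h : AD α) (i : Fin q) (hi : ∀ j > i, α j < α i) :
    AD (α + Pi.single i mo) := by
  refine ⟨fun a b hab => ?_, h.id.add fun a b => ?_⟩
  · have h1 := h.anti hab
    simp only [Pi.add_apply, Pi.single_apply]
    split_ifs with h2 h3 h3
    · linarith
    · linarith
    · have := hi b (lt_of_le_of_ne (h3 ▸ hab) (fun h => h2 h.symm))
      have := int_lt_step this (h.id i b)
      rw [h3]; linarith
    · linarith
  · simp only [Pi.single_apply]; split_ifs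
    exacts [⟨0, by simp⟩, ⟨-1, by simp⟩, ⟨1, by simp⟩, ⟨0, by simp⟩]
theorem SD_add {α : Fin q → ℚ} (h : AD α) (i : Fin q) (hi : ∀ j < i, α i < α j) :
    AD (α + Pi.single i 1) := by
  refine ⟨fun a b hab => ?_, h.id.add fun a b => ?_⟩
  · have h1 := h.anti hab
    simp only [Pi.add_apply, Pi.single_apply]
    split_ifs with h2 h3 h3
    · linarith
    · have := hi a (lt_of_le_of_ne (h2 ▸ hab) h3)
      have := int_lt_step this (h.id a i)
      rw [h2]; linarith
    · linarith
    · linarith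
  · simp only [Pi.single_apply]; split_ifs
    exacts [⟨0, by simp⟩, ⟨1, by simp⟩, ⟨-1, by simp⟩, ⟨0, by simp⟩]
theorem corner_ex {α : Fin q → ℚ} (h : AD α) (h0 : ∀ i, 0 ≤ α i) (hne : α ≠ 0) :
    ∃ i, 0 < α i ∧ ∀ j > i, α j = 0 := by
  have hs : (univ.filter fun i => α i ≠ 0).Nonempty := by
    obtain ⟨i, hi⟩ := Function.ne_iff.1 hne
    exact ⟨i, by simpa using hi⟩
  refine ⟨_, lt_of_le_of_ne (h0 _) (Ne.symm (mem_filter.1 (max'_mem _ hs)).2), fun j hj => ?_⟩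
  by_contra h'
  exact absurd (le_max' _ j (by simpa using h')) (not_le.2 hj)
section
variable {t : CType} {m k K : ℕ}
theorem dom_tail {μ : Fin (m+k) → ℚ} (h : DomY t μ) : DomY t (fun j : Fin k => μ (Fin.natAdd m j)) := by
  refine ⟨?_, fun i j hij => h.ab _ _ (by rw [Fin.lt_def] at *; simpa using hij), fun ht i => h.nn ht _⟩
  obtain ⟨e, he⟩ := h.hi
  exact ⟨e, fun i => he _⟩
theorem dom_AD {μ : Fin (m+k) → ℚ} (h : DomY t μ) : AD (fun j : Fin m => μ (Fin.castAdd k j)) := by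
  refine ⟨fun a b hab => ?_, fun a b => h.hi.id _ _⟩
  rcases eq_or_lt_of_le hab with rfl | hab
  · rfl
  · exact (le_abs_self _).trans (h.ab (Fin.castAdd k a) (Fin.castAdd k b) (by rw [Fin.lt_def] at *; simpa using hab))
theorem dom_AP (hK : K ≤ 2) (hk : K < k) {μ : Fin (m+k) → ℚ} (h : DomY t μ) :
    AP K (fun j : Fin m => μ (Fin.castAdd k j)) (fun j : Fin k => μ (Fin.natAdd m j)) := by
  refine ⟨hK, hk, ⟨|μ (Fin.natAdd m ⟨0, bo⟩)|, fun j => ?_, fun i => ?_⟩, fun i j => h.hi.id _ _⟩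
  · by_cases hj : j.val = 0
    · rw [show j = ⟨0, bo⟩ from Fin.ext hj]
    · exact (h.ab (Fin.natAdd m ⟨0, bo⟩) (Fin.natAdd m j) (by rw [Fin.lt_def]; simp; omega)).trans (le_abs_self _)
  · exact h.ab _ _ (by rw [Fin.lt_def]; simp)
theorem app_self (μ : Fin (m+k) → ℚ) : Fin.append (fun j : Fin m => μ (Fin.castAdd k j)) (fun j : Fin k => μ (Fin.natAdd m j)) = μ :=
  app_ext bs bs
theorem lift0 {α : Fin m → ℚ} {η : Fin k → ℚ} (H : AP K α η) {gη : CharRing k}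
    (hη : AY t k (rY t k) * gη = AY t k (rY t k + η)) {g : CharRing (m+k)}
    (hg : AY t (m+k) (rY t (m+k)) * g = AY t (m+k) (rY t (m+k) + Fin.append α η)) (w : Fin k → Fin m → ℚ) :
    ∃ C, Ex (Th m (mp (resH (wext w)) g)) (-∑ i, α i) C K ∧ C 0 * al m (rA m) = al m (rA m + α) * mp (resH w) gη := by
  obtain ⟨c, hE, hc⟩ := Yg t H hg
  refine ⟨_, by rw [Th_res]; exact hE.map _, ?_⟩
  have := congrArg (mp (RT w)) (Y0 H hη hc)
  rwa [map_mul, map_mul, RT_J1, RT_J1, RT_J2] at this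
theorem lift1 (ht : t ≠ CType.C) {α : Fin (m+1) → ℚ} {η : Fin k → ℚ} (H : AP K α η) (hK : 1 ≤ K) {gη : CharRing k}
    (hη : AY t k (rY t k) * gη = AY t k (rY t k + η)) {g : CharRing (m+1+k)}
    (hg : AY t (m+1+k) (rY t (m+1+k)) * g = AY t (m+1+k) (rY t (m+1+k) + Fin.append α η)) (w : Fin k → Fin (m+1) → ℚ)
    {s1} (hs : sl t (m+1) k α η 1 = s1 * J2 (m+1) k (AY t k (rY t k))) :
    ∃ C, Ex (Th (m+1) (mp (resH (wext w)) g)) (-∑ i, α i) C K ∧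
      C 0 * al (m+1) (rA (m+1)) = al (m+1) (rA (m+1) + α) * mp (resH w) gη ∧
      C 1 * al (m+1) (rA (m+1)) = mp (RT w) s1 + pA (m+1) mo * al (m+1) (rA (m+1) + α) * mp (resH w) (ZY t k 1) * mp (resH w) gη := by
  obtain ⟨c, hE, hc⟩ := Yg t H hg
  refine ⟨_, by rw [Th_res]; exact hE.map _, ?_, ?_⟩
  · have := congrArg (mp (RT w)) (Y0 H hη hc)
    rwa [map_mul, map_mul, RT_J1, RT_J1, RT_J2] at this
  · have := congrArg (mp (RT w)) (Y1 ht H hK hη hc hs)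
    rw [map_mul, map_add, map_mul, RT_J1, RT_J1, RT_J2, map_mul] at this
    rw [this]; ring
theorem lift1z (ht : t ≠ CType.C) {α : Fin (m+1) → ℚ} (H : AP K α (0 : Fin k → ℚ)) (hK : 1 ≤ K) (hα : ∀ i, 0 ≤ α i) {g : CharRing (m+1+k)}
    (hg : AY t (m+1+k) (rY t (m+1+k)) * g = AY t (m+1+k) (rY t (m+1+k) + Fin.append α 0)) (w : Fin k → Fin (m+1) → ℚ) :
    ∃ C, Ex (Th (m+1) (mp (resH (wext w)) g)) (-∑ i, α i) C K ∧
      C 0 * al (m+1) (rA (m+1)) = al (m+1) (rA (m+1) + α) ∧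
      C 1 * al (m+1) (rA (m+1)) = G1 α * mp (resH w) (ZY t k 1) := by
  have hk := H.Kk
  obtain ⟨C, h, h0, h1⟩ := lift1 ht H hK (gη := 1) bs hg w (sl_one ht bo hα)
  refine ⟨C, h, by rw [h0, map_one, mul_one], ?_⟩
  rw [h1, map_one, mul_one, map_mul, RT_J2, G1]
  split_ifs
  · rw [map_neg, RT_J1]; ring
  · rw [map_zero]; ring
end
theorem stage (ht : t ≠ CType.C) (hz : 2 ≤ z) : ∀ q, q + 1 ≤ mult t z → ∀ A, Good q A → A ≠ 0 →
    ∀ μ : Fin (nn z q) → ℚ, DomY t μ → μ ≠ 0 → ∀ g, AY t (nn z q) (rY t (nn z q)) * g = AY t (nn z q) (rY t (nn z q) + μ) →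
    Bd (A * mp (resH (wq z q)) g * al q (rA q)) → False
  | 0, _, A, hA, hA0, μ, hμ, hμ0, g, hg, hb => by
    have h2 := dim_ge hz hμ hμ0 g hg
    have hag : ∀ g, aug g = (mp (resH (wq z 0)) g).coeff 0 := fun g => by
      refine add_ext aug ((cf 0).comp (mp (resH (wq z 0))).toAddMonoidHom) (fun v => ?_) g
      rw [aug, ev_mono]; change 1 = (mp (resH (wq z 0)) (mono v)).coeff 0
      rw [mp_mono, mono_coeff, if_pos (Subsingleton.elim _ _)]
    have hmul : ∀ F G : CharRing 0, (F * G).coeff 0 = F.coeff 0 * G.coeff 0 := fun F G => by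
      have e : ∀ F : CharRing 0, F = AddMonoidAlgebra.single 0 (F.coeff 0) := fun F =>
        AddMonoidAlgebra.ext <| Finsupp.ext fun v => by
          rw [Subsingleton.elim v 0]; simp
      rw [e F, e G, AddMonoidAlgebra.single_mul_single]; simp
    have h3 := hb 0
    rw [hmul, hmul, abs_mul, abs_mul, ← hag] at h3
    have ha : A.coeff 0 ≠ 0 := fun h => hA0 (AddMonoidAlgebra.ext <| Finsupp.ext fun v => by rw [Subsingleton.elim v 0, h]; rfl)
    have h4 : (al 0 (rA 0)).coeff 0 = 1 := by
      rw [Subsingleton.elim 0 (rA 0)]; exact al_coeff_self _ (rA_SD 0).sa.injective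
    rw [h4] at h3
    have := Int.one_le_abs ha
    rw [abs_one, mul_one] at h3
    exact absurd (le_trans (mul_le_mul this h2 bn (abs_nonneg _)) h3) bn
  | q+1, hq, A, hA, hA0, μ', hμ', hμ0', g', hg', hb' => by
    suffices key : ∀ μ : Fin (q + nn z q) → ℚ, DomY t μ → μ ≠ 0 → ∀ g : CharRing (q + nn z q), AY t (q + nn z q) (rY t (q + nn z q)) * g = AY t (q + nn z q) (rY t (q + nn z q) + μ) →
        Bd (A * mp (resH (wext (wq z q))) g * al (q+1) (rA (q+1))) → False from key μ' hμ' hμ0' g' hg' hb'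
    intro μ hμ hμ0 g hg hb
    have hnz := nn_ge z q
    have hk : 1 < nn z q := by omega
    set α : Fin q → ℚ := fun j => μ (Fin.castAdd (nn z q) j) with hα
    set η : Fin (nn z q) → ℚ := fun j => μ (Fin.natAdd q j) with hη
    have H : AP 1 α η := dom_AP bo hk hμ
    have hAD : AD α := dom_AD hμ
    have hμe : μ = Fin.append α η := (app_self _).symm
    have hdη : DomY t η := dom_tail hμ
    rw [hμe] at hg
    by_cases h0 : η = 0
    · cases q with
      | zero => exact hμ0 (by rw [hμe, h0]; exact app_ext (fun i => i.elim0) (fun j => by rw [Fin.append_right]; rfl))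
      | succ m =>
      have hα0 : ∀ i, 0 ≤ α i := fun i => by have := H.le i ⟨0, bo⟩; rwa [h0] at this
      have hne : α ≠ 0 := fun h => hμ0 (by rw [hμe, h, h0]; exact app_ext bs bs)
      rw [h0] at hg H
      obtain ⟨C, hE, hC0, hC1⟩ := lift1z ht H le_rfl hα0 hg (wq z (m+1))
      obtain ⟨A0, A1, gA0, nA0, gA1, -, hB⟩ := step_low hA hA0 hE hb
      rw [hC0, hC1] at hB
      have hZ := Zq t z (m+1) 1
      obtain ⟨τ, hτ⟩ : ∃ τ, mult t z = m + 1 + 2 + τ := ⟨mult t z - (m+1+2), bo⟩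
      rw [hτ] at hZ
      obtain ⟨i, hi, hij⟩ := corner_ex hAD hα0 hne
      have hc := SD_corner hAD i (fun j hj => by rw [hij j hj]; exact hi)
      have hG := G1_sub hAD {i} (by simpa using hi.ne')
      rw [sum_singleton] at hG
      have hP := pA_sub (c := 1) (Or.inl rfl) hc.sd' {i}
      rw [sum_singleton, add_assoc, add_assoc, ← Pi.single_add, neg_add_cancel, Pi.single_zero, add_zero, ← add_assoc] at hP
      have hv : al (m+1) (rA (m+1) + α + Pi.single i mo) ∈ KK (m+1) := by rw [add_assoc]; exact al_mem hc.sd'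
      have hv0 : al (m+1) (rA (m+1) + α + Pi.single i mo) ≠ 0 := by rw [add_assoc]; exact al_ne_zero _ hc.sd'.sa.injective
      set V := al (m+1) (rA (m+1) + α + Pi.single i mo) with hV
      obtain ⟨u, hu, hu1⟩ := KK_pos (gA0.kk hv) (mul_ne_zero nA0 hv0)
      have hGK : G1 α ∈ KK (m+1) := by have := add_mem hG hv; rwa [sub_add_cancel] at this
      have e1 : A0 * (G1 α * mp (resH (wq z (m+1))) (ZY t (nn z (m+1)) 1) - pA (m+1) mo * al (m+1) (rA (m+1) + α))
          + A1 * al (m+1) (rA (m+1) + α) = A0 * V + (A0 * V + (A0 * (pA (m+1) mo * (pA (m+1) 1 * (G1 α - V) + (pA (m+1) 1 * V - al (m+1) (rA (m+1) + α)))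
            + ((G1 α - V) + (G1 α - V) + τ • G1 α)) + A1 * al (m+1) (rA (m+1) + α))) := by
        push_cast at hZ
        rw [nsmul_eq_mul]
        linear_combination A0 * G1 α * hZ
      rw [e1] at hB
      refine hB.two (u := u) ?_
      have h5 := KK_nonneg (add_mem (gA0.kk (add_mem (KK_pA (c := -1) (Or.inr rfl) (add_mem (KK_pA (Or.inl rfl) hG) hP))
        (add_mem (add_mem hG hG) (nsmul_mem hGK τ)))) (gA1.kk (al_mem hAD.sd'))) hu.sa
      simp only [AddMonoidAlgebra.coeff_add, Finsupp.add_apply] at h5 ⊢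
      omega
    · obtain ⟨gη, hgη⟩ := exY ht hdη
      obtain ⟨C, hE, hC⟩ := lift0 H hgη hg (wq z q)
      obtain ⟨A0, A1, gA0, nA0, -, hB, -⟩ := step_low hA hA0 hE hb
      obtain ⟨S, hS, hSa⟩ := good_schur hAD
      refine stage ht hz q bo (A0 * S) (gA0.mul hS) (mul_ne_zero nA0 ?_) η hdη h0 gη hgη ?_
      · rintro rfl
        rw [zero_mul] at hSa
        exact al_ne_zero _ hAD.sd.sa.injective hSa.symm
      · rw [hC, add_comm (rA q), ← hSa] at hB
        convert hB using 1; ring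
end

section
def kle (F G : CharRing q) : Prop := G - F ∈ KK q
section cone
variable {q : ℕ} {F G H F' G' : CharRing q} {c : ℚ} {v : Fin q → ℚ}
theorem kle.trans (h : kle F G) (h' : kle G H) : kle F H := by
  have := add_mem h h'; rwa [sub_add_sub_cancel'] at this
theorem kle.add (h : kle F G) (h' : kle F' G') : kle (F + F') (G + G') := by
  have := add_mem h h'; rwa [sub_add_sub_comm] at this
theorem kle.p (hc : c = 1 ∨ c = -1) (h : kle F G) : kle (pA q c * F) (pA q c * G) := by
  have := KK_pA hc h; rwa [mul_sub] at this
theorem kle.good {A : CharRing q} (hA : Good q A) (h : kle F G) : kle (A * F) (A * G) := by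
  have := hA.kk h; rwa [mul_sub] at this
theorem kle.add_r (h : kle F G) (h' : H ∈ KK q) : kle F (G + H) := by
  have := add_mem h h'; rwa [sub_add_eq_add_sub] at this
theorem kle.kk (h : kle F G) (hF : F ∈ KK q) : G ∈ KK q := by
  have := add_mem h hF; rwa [sub_add_cancel] at this
theorem kle_pA (hc : c = 1 ∨ c = -1) (hv : SD v) (s : Finset (Fin q)) :
    kle (∑ i ∈ s, al q (v + Pi.single i c)) (pA q c * al q v) := pA_sub hc hv s
theorem kle_pA1 (hc : c = 1 ∨ c = -1) (hv : SD v) (i : Fin q) :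
    kle (al q (v + Pi.single i c)) (pA q c * al q v) := by
  simpa using kle_pA hc hv {i}
theorem kle_pA2 (hc : c = 1 ∨ c = -1) (hv : SD v) {i j : Fin q} (h : i ≠ j) :
    kle (al q (v + Pi.single i c) + al q (v + Pi.single j c)) (pA q c * al q v) := by
  have := kle_pA hc hv {i, j}
  rwa [Finset.sum_pair h] at this
theorem kle_back (hc : c = 1 ∨ c = -1) {i : Fin q} (hv : SD (v + Pi.single i (-c))) :
    kle (al q v) (pA q c * al q (v + Pi.single i (-c))) := by
  have := kle_pA1 hc hv i
  rwa [add_assoc, ← Pi.single_add, neg_add_cancel, Pi.single_zero, add_zero] at this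
theorem Bd.kle2 (h : Bd G) (hF : F ∈ KK q) (h0 : F ≠ 0) (hl : kle (F + F) G) : False := by
  obtain ⟨u, hu, hu1⟩ := KK_pos hF h0
  refine h.two (u := u) ?_
  have h5 := KK_nonneg hl hu.sa
  rw [AddMonoidAlgebra.coeff_sub, Finsupp.sub_apply, AddMonoidAlgebra.coeff_add, Finsupp.add_apply] at h5
  omega
theorem SD.ne (h : SD v) : al q v ≠ 0 := al_ne_zero _ h.sa.injective
theorem pp_two {α : Fin (q+1) → ℚ} (h : AD α) {j : Fin (q+1)} (hj : α j < α 0) :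
    kle (al (q+1) (rA (q+1) + α) + al (q+1) (rA (q+1) + α)) (pA (q+1) mo * (pA (q+1) 1 * al (q+1) (rA (q+1) + α))) := by
  obtain ⟨i, hi, hmin⟩ := WellFounded.has_min (wellFounded_lt (α := Fin (q+1))) {i | α i < α 0} ⟨j, hj⟩
  have h1 : AD (α + Pi.single i 1) := SD_add h i fun a ha => by
    by_contra h'
    exact hmin a (lt_of_le_of_lt (not_lt.1 h') hi) ha
  have h0 : AD (α + Pi.single 0 1) := SD_add h 0 fun a ha => absurd ha (Fin.not_lt_zero a)
  have hne : (0 : Fin (q+1)) ≠ i := fun h => by rw [← h] at hi; exact lt_irrefl _ (show α 0 < α 0 from hi)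
  refine kle.trans ?_ ((kle_pA2 (c := 1) (Or.inl rfl) h.sd' hne).p (c := -1) (Or.inr rfl))
  rw [mul_add]
  have a0 := h0.sd'; rw [← add_assoc] at a0
  have a1 := h1.sd'; rw [← add_assoc] at a1
  have b0 := kle_back (c := -1) (Or.inr rfl) (v := rA (q+1) + α) (i := 0) (by rwa [neg_neg])
  have b1 := kle_back (c := -1) (Or.inr rfl) (v := rA (q+1) + α) (i := i) (by rwa [neg_neg])
  rw [neg_neg] at b0 b1
  exact kle.add b0 b1
end cone
theorem top {G : CharRing (q+1)} {d : ℚ} {C : ℕ → CharRing q}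
    (hC : Ex (Th q G) d C K) (hb : Bd (G * al (q+1) (rA (q+1)))) (hn : n ≤ K) :
    Bd (∑ i ∈ range (n+1), C (n - i) * DN q i) := by
  have hb' := (hb.const mo).slice (d + -1 + n)
  rw [show mono (fun _ => (-1:ℚ)) * (G * al (q+1) (rA (q+1))) = G * (mono (fun _ => (-1:ℚ)) * al (q+1) (rA (q+1))) by ring, map_mul,
    Ex.mul hC (DN_ex q K) n hn] at hb'
  exact hb'
theorem top0 {G : CharRing (q+1)} {d : ℚ} {C : ℕ → CharRing q}
    (hC : Ex (Th q G) d C K) (hb : Bd (G * al (q+1) (rA (q+1)))) : Bd (C 0 * al q (rA q)) := by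
  simpa [DN0] using top hC hb (Nat.zero_le K)
theorem top1 {G : CharRing (q+1)} {d : ℚ} {C : ℕ → CharRing q}
    (hC : Ex (Th q G) d C K) (hb : Bd (G * al (q+1) (rA (q+1)))) (hK : 1 ≤ K) :
    Bd (C 1 * al q (rA q) - pA q mo * (C 0 * al q (rA q))) := by
  have := top hC hb hK
  rw [sum_range_succ, sum_range_one, DN0, DN1] at this
  convert this using 1; simp only [Nat.sub_self, Nat.sub_zero]; ring
theorem top2 {G : CharRing (q+1)} {d : ℚ} {C : ℕ → CharRing q}
    (hC : Ex (Th q G) d C K) (hb : Bd (G * al (q+1) (rA (q+1)))) (hK : 2 ≤ K) :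
    Bd (C 2 * al q (rA q) - pA q mo * (C 1 * al q (rA q)) + eA q mo * (C 0 * al q (rA q))) := by
  have := top hC hb hK
  rw [sum_range_succ, sum_range_succ, sum_range_one, DN0, DN1, DN2] at this
  convert this using 1; simp only [Nat.sub_self, Nat.sub_zero, show 2 - 1 = 1 from rfl]; ring
section
variable {t : CType} {z : ℕ}
theorem ZqX (hm : mult t z = q) (c : ℚ) : mp (resH (wq z q)) (ZY t (nn z q) c) = pA q c * pA q (-c) := by
  have := Zq t z q c
  rw [hm] at this
  exact add_right_cancel this
theorem tail_nat (ht : t ≠ CType.C) (hz : 2 ≤ z) (hm1 : 1 ≤ m) (hm : mult t z = m + 1 + 1) {A : CharRing (m+1+1)} (hA : Good (m+1+1) A) (hA0 : A ≠ 0)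
    (μ : Fin (m + 1 + nn z (m+1)) → ℚ) (hμ : DomY t μ) (hμ0 : μ ≠ 0) (g : CharRing (m + 1 + nn z (m+1)))
    (hg : AY t _ (rY t _) * g = AY t (m + 1 + nn z (m+1)) (rY t _ + μ))
    (hb : Bd (A * mp (resH (wext (wq z (m+1)))) g * al _ (rA _))) : μ = sY _ 1 0 0 := by
  have hnz := nn_ge z (m+1)
  have hk : 1 < nn z (m+1) := by omega
  set α : Fin (m+1) → ℚ := fun j => μ (Fin.castAdd (nn z (m+1)) j) with hα
  set η : Fin (nn z (m+1)) → ℚ := fun j => μ (Fin.natAdd (m+1) j) with hη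
  have H : AP 1 α η := dom_AP bo hk hμ
  have hAD : AD α := dom_AD hμ
  have hμe : μ = Fin.append α η := (app_self _).symm
  have hdη : DomY t η := dom_tail hμ
  rw [hμe] at hg
  by_cases h0 : η = 0
  · have hα0 : ∀ i, 0 ≤ α i := fun i => by have := H.le i ⟨0, bo⟩; rwa [h0] at this
    have hne : α ≠ 0 := fun h => hμ0 (by rw [hμe, h, h0]; exact app_ext bs bs)
    rw [h0] at hg H
    obtain ⟨C, hE, hC0, hC1⟩ := lift1z ht H le_rfl hα0 hg (wq z (m+1))
    obtain ⟨A0, A1, gA0, nA0, gA1, -, hB⟩ := step_low hA hA0 hE hb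
    rw [hC0, hC1] at hB
    have hZ := Zq t z (m+1) 1
    rw [hm] at hZ
    obtain ⟨i, hi, hij⟩ := corner_ex hAD hα0 hne
    have hc := SD_corner hAD i (fun j hj => by rw [hij j hj]; exact hi)
    by_contra hμ1
    obtain ⟨j, hji, hj⟩ : ∃ j, j ≠ i ∧ AD (α + Pi.single i mo + Pi.single j 1) := by
      by_cases hi0 : i = 0
      · subst hi0
        have hx : α 0 ≠ 1 := fun h => hμ1 (by
          rw [hμe, h0]
          refine app_ext (fun a => ?_) fun a => by simp [sY]
          by_cases ha : a = 0
          · subst ha; simp [sY, h]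
          · have := hij a (Fin.pos_of_ne_zero ha)
            have h3 : (a : ℕ) ≠ 0 := fun h => ha (Fin.ext h)
            simp [sY, this, h3])
        have h10 : (⟨1, bo⟩ : Fin (m+1)) ≠ 0 := by simp [Fin.ext_iff]
        refine ⟨⟨1, bo⟩, h10, SD_add hc _ fun a ha => ?_⟩
        have ha0 : a = 0 := Fin.ext (by have : (a : ℕ) < 1 := ha; rw [Fin.val_zero]; omega)
        subst ha0
        have h1 := hij ⟨1, bo⟩ (Fin.pos_of_ne_zero h10)
        have h2 : α 0 = 0 ∨ 1 < α 0 := by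
          have := int_lt_step hi (by obtain ⟨w, hw⟩ := hAD.id 0 ⟨1, bo⟩; exact ⟨w, by rw [← hw, h1]⟩)
          right; exact lt_of_le_of_ne (by linarith) (Ne.symm hx)
        simp [h1, Pi.single_apply, h10]
        rcases h2 with h2 | h2 <;> linarith
      · exact ⟨0, fun h => hi0 h.symm, SD_add hc 0 fun a ha => absurd ha (Fin.not_lt_zero a)⟩
    set V := al (m+1) (rA (m+1) + α + Pi.single i mo) with hV
    have hv : SD (rA (m+1) + α + Pi.single i mo) := by rw [add_assoc]; exact hc.sd'
    have hG : kle V (G1 α) := by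
      have := G1_sub hAD {i} (by simpa using hi.ne'); rwa [sum_singleton] at this
    have h1 : kle (al (m+1) (rA (m+1) + α) + al (m+1) (rA (m+1) + α + Pi.single i mo + Pi.single j 1)) (pA _ 1 * G1 α) := by
      refine kle.trans ?_ (hG.p (Or.inl rfl))
      have := kle_pA2 (c := 1) (Or.inl rfl) hv hji.symm
      rwa [add_assoc (rA (m+1) + α), ← Pi.single_add, neg_add_cancel, Pi.single_zero, add_zero] at this
    have h2 : kle V (pA _ mo * (pA _ 1 * G1 α - al (m+1) (rA (m+1) + α))) := by
      have h3 : kle (al (m+1) (rA (m+1) + α + Pi.single i mo + Pi.single j 1)) (pA _ 1 * G1 α - al (m+1) (rA (m+1) + α)) := by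
        rw [kle, sub_sub]; exact h1
      refine kle.trans ?_ (h3.p (Or.inr rfl))
      have := kle_back (c := -1) (Or.inr rfl) (v := rA (m+1) + α + Pi.single i mo) (i := j) (by
        rw [neg_neg, add_assoc, add_assoc, ← add_assoc α]; exact hj.sd')
      rwa [neg_neg] at this
    refine hB.kle2 (gA0.kk (al_mem hv)) (mul_ne_zero nA0 hv.ne) ?_
    have := ((hG.add h2).good gA0).add_r (gA1.kk (al_mem hAD.sd'))
    rw [mul_add] at this
    convert this using 1
    push_cast at hZ
    linear_combination A0 * G1 α * hZ
  · exfalso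
    obtain ⟨gη, hgη⟩ := exY ht hdη
    obtain ⟨C, hE, hC⟩ := lift0 H hgη hg (wq z (m+1))
    obtain ⟨A0, A1, gA0, nA0, -, hB, -⟩ := step_low hA hA0 hE hb
    obtain ⟨S, hS, hSa⟩ := good_schur hAD
    refine stage ht hz (m+1) bo (A0 * S) (gA0.mul hS) (mul_ne_zero nA0 ?_) η hdη h0 gη hgη ?_
    · rintro rfl
      rw [zero_mul] at hSa
      exact al_ne_zero _ hAD.sd.sa.injective hSa.symm
    · rw [hC, add_comm (rA _), ← hSa] at hB
      convert hB using 1; ring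
end
end

section
theorem al_const' (x : ℚ) : al q (rA q + fun _ => x) = mono (fun _ => x) * al q (rA q) := (al_const _ _).symm
theorem Bd.unconst {F : CharRing q} {c : ℚ} (h : Bd (mono (fun _ => c) * F)) : Bd F := by
  have := h.const (-c)
  rwa [← mul_assoc, mono_mul, show ((fun _ => -c) + fun _ => c : Fin q → ℚ) = 0 from funext fun _ => by simp, show mono (0 : Fin q → ℚ) = 1 from rfl, one_mul] at this
theorem ppm_rho (m : ℕ) : pA (m+2) 1 * (pA (m+2) mo * al (m+2) (rA (m+2))) =
    al (m+2) (rA (m+2)) + al (m+2) (rA (m+2) + (Pi.single 0 1 + Pi.single (Fin.last (m+1)) mo)) := by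
  have h1 := pst_rho (m+1)
  have h2 := rA_aN (m+2) (fun n => - bp (m+1) 1 n)
  have h3 := rA_aN (m+2) (fun n => bp 0 1 n - bp (m+1) 1 n)
  have h4 := rA_aN (m+2) (fun n => 0)
  have e2 : (rA (m+2) + fun i : Fin (m+2) => ((- bp (m+1) 1 i.val : ℤ) : ℚ)) = rA (m+2) - Pi.single (Fin.last (m+1)) 1 := by
    ext i; simp [bp, Pi.single_apply, Fin.ext_iff, sub_eq_add_neg]
  have e3 : (rA (m+2) + fun i : Fin (m+2) => ((bp 0 1 i.val - bp (m+1) 1 i.val : ℤ) : ℚ)) = rA (m+2) + (Pi.single 0 1 + Pi.single (Fin.last (m+1)) mo) := by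
    ext i; simp only [bp, Pi.add_apply, Pi.single_apply, Fin.ext_iff, Fin.val_zero, Fin.val_last]; split_ifs <;> push_cast <;> ring
  have e4 : (rA (m+2) + fun i : Fin (m+2) => (((fun _ => 0 : ℕ → ℤ) i.val : ℤ) : ℚ)) = rA (m+2) := by ext i; simp
  rw [e2] at h2; rw [e3] at h3; rw [e4] at h4
  have hp := pNs (q := m+2) 1 (fun n => - bp (m+1) 1 n - n) {0, m+1} (by intro i hi; simp at hi; omega) (fun i hi hi' => ⟨i-1, bo, by simp at hi'; omega, by
    simp at hi'; simp only [bp]; split_ifs <;> omega⟩)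
  rw [Finset.sum_pair bo] at hp
  rw [h1, h2, h3, h4, mul_left_comm, show pA (m+2) 1 = pA (m+2) ((1:ℤ):ℚ) by norm_num, hp, mul_add,
    aN_congr (f := (fun n => - bp (m+1) 1 n - (n:ℤ)) + bp 0 1) (g := fun n => bp 0 1 n - bp (m+1) 1 n - n) fun n hn => by simp only [Pi.add_apply]; ring,
    aN_congr (f := (fun n => - bp (m+1) 1 n - (n:ℤ)) + bp (m+1) 1) (g := fun n => 0 - n) fun n hn => by simp only [Pi.add_apply]; ring]
  exact add_comm _ _
section
variable {t : CType} {z m : ℕ}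
theorem sl_nontie {α : Fin (m+1) → ℚ} {η : Fin k → ℚ} (h : ∀ i j, η j + 1 ≤ α i) : sl t (m+1) k α η 1 = 0 := by
  rw [sl, if_neg one_ne_zero, zero_sub, neg_eq_zero]
  refine sum_eq_zero fun i _ => sum_eq_zero fun j _ => if_neg fun h1 => ?_
  have h2 : (i.val : ℚ) ≤ m := by exact_mod_cast Nat.lt_succ_iff.1 i.2
  have h3 := h i j
  have h4 : (0:ℚ) ≤ j.val := by positivity
  push_cast at h1; linarith
theorem sl_tie (hk : 2 ≤ k) : sl t (m+1) k (fun _ => 1) (sY k 1 0 0) 1 =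
    - J1 (m+1) k (al (m+1) (rA (m+1) + (fun _ => 1) - Pi.single (Fin.last m) 1)) * J2 (m+1) k (BY t k 2 0 0) := by
  rw [sl, if_neg one_ne_zero, dsum _ (Fin.last m) (⟨0, bo⟩ : Fin k), zero_sub, neg_mul, if_pos (by simp [sY]), BY,
    show sY k 2 0 0 = sY k 1 0 0 + Pi.single ⟨0, bo⟩ 1 by rw [sY0]; norm_num]
  · simp only [Nat.cast_one, add_assoc]
  · intro i j h
    have h1 := (ite_ne_right_iff.1 h).1
    have h2 : (i.val : ℚ) ≤ m := by exact_mod_cast Nat.lt_succ_iff.1 i.2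
    have h3 : j.val = 0 ∨ (sY k 1 0 0 j ≤ 0 ∧ (1:ℚ) ≤ j.val) := by
      by_cases hj : j.val = 0
      · exact Or.inl hj
      · exact Or.inr ⟨by simp [sY, hj], by exact_mod_cast Nat.one_le_iff_ne_zero.2 hj⟩
    push_cast at h1
    rcases h3 with h3 | ⟨h3, h4⟩
    · have h5 : (i.val : ℚ) = m := by simp [sY, h3] at h1; linarith
      exact ⟨Fin.ext (by exact_mod_cast h5), Fin.ext h3⟩
    · linarith
theorem case_eta (ht : t ≠ CType.C) (hz : 2 ≤ z) (hm1 : 1 ≤ m) (hm : mult t z = m + 2)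
    {α : Fin (m+2) → ℚ} {η : Fin (nn z (m+2)) → ℚ} (H : AP 1 α η) (hAD : AD α) (hη : DomY t η) (hη0 : η ≠ 0) {g : CharRing (m + 2 + nn z (m+2))}
    (hg : AY t (m+2+nn z (m+2)) (rY t _) * g = AY t (m+2+nn z (m+2)) (rY t _ + Fin.append α η))
    (hb : Bd (mp (resH (wext (wq z (m+2)))) g * al (m+2+1) (rA (m+2+1)))) : (α = fun _ => 1) ∧ η = sY _ 1 0 0 := by
  have hk := nn_ge z (m+2)
  have hη1 : η = sY _ 1 0 0 := by
    obtain ⟨gη, hgη⟩ := exY ht hη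
    obtain ⟨C, hE, hC⟩ := lift0 H hgη hg (wq z (m+2))
    have hB := top0 hE hb
    obtain ⟨S, hS, hSa⟩ := good_schur hAD
    refine tail_nat ht hz hm1 hm hS ?_ η hη hη0 gη hgη ?_
    · rintro rfl
      rw [zero_mul] at hSa
      exact hAD.sd.ne hSa.symm
    · rw [hC, add_comm (rA _), ← hSa] at hB
      convert hB using 1; exact mul_right_comm _ _ _
  refine ⟨?_, hη1⟩
  have hgη : AY t (nn z (m+2)) (rY t _) * ZY t (nn z (m+2)) 1 = AY t (nn z (m+2)) (rY t _ + η) := by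
    rw [hη1, mul_comm, ← BY_0, Yrel1 ht bo, BY]
  have hZ := ZqX hm 1
  have h1 : ∀ i, 1 ≤ α i := fun i => by
    have := H.le i ⟨0, bo⟩; rwa [hη1] at this
  obtain ⟨C, hE, hC⟩ := lift0 H hgη hg (wq z (m+2))
  have hB := top0 hE hb
  rw [hC, hZ] at hB
  by_cases hc : ∃ j, α j < α 0
  · obtain ⟨j, hj⟩ := hc
    have := pp_two hAD hj
    exact (hB.kle2 (al_mem hAD.sd') hAD.sd'.ne (by convert this using 1; ring)).elim
  push Not at hc
  have hαc : α = fun _ => α 0 := funext fun j => le_antisymm (hAD.anti (Fin.zero_le j)) (hc j)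
  by_cases hx : α 0 = 1
  · rw [hαc, hx]
  exfalso
  have hx2 : 2 ≤ α 0 := by
    have := int_lt_step (lt_of_le_of_ne (h1 0) (Ne.symm hx)) (by
      obtain ⟨w, hw⟩ := H.int 0 ⟨1, bo⟩
      rw [hη1] at hw; simp [sY] at hw; exact ⟨w - 1, by push_cast; rw [hw]⟩)
    linarith
  obtain ⟨C, hE, hC0, hC1⟩ := lift1 ht H le_rfl hgη hg (wq z (m+2)) (s1 := 0) (by
    rw [zero_mul]; refine sl_nontie fun i j => ?_
    rw [hαc, hη1]; simp only [sY]; split_ifs <;> linarith)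
  have hB := top1 hE hb le_rfl
  rw [hC0, hC1, hZ, map_zero, zero_add, hαc, al_const'] at hB
  have hβ : AD ((Pi.single 0 1 + Pi.single (Fin.last (m+1)) mo) + Pi.single (Fin.last (m+1)) mo : Fin (m+2) → ℚ) := by
    have h0 : AD (0 : Fin (m+2) → ℚ) := ⟨fun _ _ _ => le_rfl, fun _ _ => ⟨0, by simp⟩⟩
    have h1 := SD_add h0 0 fun a ha => absurd ha (Fin.not_lt_zero a)
    have hl : ∀ j > Fin.last (m+1), False := fun j hj => absurd (Fin.le_last j) (not_le.2 hj)
    have h2 := SD_corner h1 (Fin.last _) fun j hj => (hl j hj).elim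
    have h3 := SD_corner h2 (Fin.last _) fun j hj => (hl j hj).elim
    rwa [zero_add] at h3
  set β : Fin (m+2) → ℚ := Pi.single 0 1 + Pi.single (Fin.last (m+1)) mo + Pi.single (Fin.last (m+1)) mo with hβd
  have hβ' : SD (rA (m+2) + (Pi.single 0 1 + Pi.single (Fin.last (m+1)) mo)) := by
    refine AD.sd' (SD_corner ?_ (Fin.last _) fun j hj => absurd (Fin.le_last j) (not_le.2 hj))
    have h0 : AD (0 : Fin (m+2) → ℚ) := ⟨fun _ _ _ => le_rfl, fun _ _ => ⟨0, by simp⟩⟩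
    have h1 := SD_add h0 0 fun a ha => absurd ha (Fin.not_lt_zero a)
    rwa [zero_add] at h1
  have k1 := kle_pA1 (c := -1) (Or.inr rfl) hβ' (Fin.last (m+1))
  rw [add_assoc, ← hβd] at k1
  have hl0 : (0 : Fin (m+2)) ≠ Fin.last (m+1) := by simp [Fin.ext_iff]
  have k2 := (pp_two hβ (j := Fin.last (m+1)) (by rw [hβd]; simp [hl0, hl0.symm]; norm_num)).trans ((k1.p (c := 1) (Or.inl rfl)).p (c := -1) (Or.inr rfl))
  refine Bd.kle2 (Bd.unconst (c := α 0) (F := pA (m+2) mo * (pA (m+2) 1 * (pA (m+2) mo * al (m+2) (rA (m+2) + (Pi.single 0 1 + Pi.single (Fin.last (m+1)) mo))))) ?_) (al_mem hβ.sd') hβ.sd'.ne k2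
  convert hB using 1
  linear_combination (-(mono fun _ => α 0) * pA (m+2) mo * pA (m+2) 1 * pA (m+2) mo) * ppm_rho m
theorem case_one (ht : t ≠ CType.C) (hz : 2 ≤ z) (hm : mult t z = m + 2)
    {α : Fin (m+2) → ℚ} (H : AP 2 α (0 : Fin (nn z (m+2)) → ℚ)) (hAD : AD α) (hα0 : ∀ i, 0 ≤ α i) {g : CharRing (m + 2 + nn z (m+2))}
    (hg : AY t (m+2+nn z (m+2)) (rY t _) * g = AY t (m+2+nn z (m+2)) (rY t _ + Fin.append α 0))
    (hb : Bd (mp (resH (wext (wq z (m+2)))) g * al (m+2+1) (rA (m+2+1)))) {i : Fin (m+2)} (hi : 0 < α i) (hij : ∀ j > i, α j = 0) :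
    (∀ j ≤ i, α j = α i) ∧ (i = 0 ∨ α i = 1 ∨ i = Fin.last (m+1)) := by
  obtain ⟨C, hE, hC0, hC1⟩ := lift1z ht H bn hα0 hg (wq z (m+2))
  have hB := top1 hE hb bn
  rw [hC0, hC1, ZqX hm 1] at hB
  have hB' : Bd (pA (m+2) mo * (pA (m+2) 1 * G1 α - al (m+2) (rA (m+2) + α))) := by convert hB using 1; ring
  have hc := SD_corner hAD i (fun j hj => by rw [hij j hj]; exact hi)
  have hv : SD (rA (m+2) + α + Pi.single i mo) := by rw [add_assoc]; exact hc.sd'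
  have back : ∀ j, AD (α + Pi.single i mo + Pi.single j 1) →
      kle (al (m+2) (rA (m+2) + α + Pi.single i mo)) (pA (m+2) mo * al (m+2) (rA (m+2) + α + Pi.single i mo + Pi.single j 1)) := fun j hj => by
    have := kle_back (c := -1) (Or.inr rfl) (v := rA (m+2) + α + Pi.single i mo) (i := j) (by
      rw [neg_neg, add_assoc, add_assoc, ← add_assoc α]; exact hj.sd')
    rwa [neg_neg] at this
  have fwd : ∀ i, rA (m+2) + α + Pi.single i mo + Pi.single i 1 = rA (m+2) + α := fun i => by
    rw [add_assoc, ← Pi.single_add, neg_add_cancel, Pi.single_zero, add_zero]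
  have add0 := SD_add hc 0 fun a ha => absurd ha (Fin.not_lt_zero a)
  have hall : ∀ j ≤ i, α j = α i := by
    by_contra hcon
    push Not at hcon
    obtain ⟨j0, hj0, hne⟩ := hcon
    obtain ⟨j, hj, hmax⟩ := WellFounded.has_min (wellFounded_gt (α := Fin (m+2))) {j | α i < α j} ⟨j0, lt_of_le_of_ne (hAD.anti hj0) (Ne.symm hne)⟩
    have hj : α i < α j := hj
    have hji : j < i := by by_contra h; exact absurd (hAD.anti (not_lt.1 h)) (not_le.2 hj)
    have hcj := SD_corner hAD j fun a ha => lt_of_le_of_lt (not_lt.1 fun h => hmax a h ha) hj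
    have hvj : SD (rA (m+2) + α + Pi.single j mo) := by rw [add_assoc]; exact hcj.sd'
    have hG : kle (al (m+2) (rA (m+2) + α + Pi.single i mo) + al (m+2) (rA (m+2) + α + Pi.single j mo)) (G1 α) := by
      have := G1_sub hAD {i, j} (by simp; exact ⟨hi.ne', (hi.trans hj).ne'⟩)
      rwa [Finset.sum_pair hji.ne'] at this
    have i0 : i ≠ 0 := fun h => by rw [h] at hji; exact absurd hji (Fin.not_lt_zero j)
    have h1 := kle_pA2 (c := 1) (Or.inl rfl) hv i0
    have h2 := kle_pA1 (c := 1) (Or.inl rfl) hvj j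
    rw [fwd] at h1 h2
    have h3 := (h1.add h2).trans (by rw [← mul_add]; exact hG.p (Or.inl rfl))
    have h4 : kle (al (m+2) (rA (m+2) + α) + al (m+2) (rA (m+2) + α + Pi.single i mo + Pi.single 0 1)) (pA (m+2) 1 * G1 α - al (m+2) (rA (m+2) + α)) := by
      rw [kle] at h3 ⊢; convert h3 using 1; ring
    have h5 := h4.p (c := -1) (Or.inr rfl)
    rw [mul_add] at h5
    exact hB'.kle2 (al_mem hv) hv.ne (((kle_pA1 (Or.inr rfl) hAD.sd' i).add (back 0 add0)).trans h5)
  refine ⟨hall, ?_⟩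
  by_contra hcon
  push Not at hcon
  obtain ⟨i0, i1, il⟩ := hcon
  have hlt : i.val + 1 < m + 2 := by
    have := i.2; have : i.val ≠ m + 1 := fun h => il (Fin.ext h); omega
  set j : Fin (m+2) := ⟨i.val + 1, hlt⟩ with hj
  have hij' : i < j := by rw [Fin.lt_def]; simp [hj]
  have hx : 1 < α i := by
    have := int_lt_step hi (by obtain ⟨w, hw⟩ := hAD.id i j; exact ⟨w, by rw [← hw, hij j hij']⟩)
    exact lt_of_le_of_ne (by linarith) (Ne.symm i1)
  have addj := SD_add hc j fun a ha => by
    have hai : a ≤ i := by rw [Fin.lt_def] at ha; rw [Fin.le_def]; simp [hj] at ha; omega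
    have := hall a hai
    have h1 := hij j hij'
    simp only [Pi.add_apply, Pi.single_apply, h1, this, hij'.ne', if_false]
    split_ifs <;> linarith
  have j0 : (0 : Fin (m+2)) ≠ j := fun h => by have := congrArg Fin.val h; simp [hj] at this
  have hG : kle (al (m+2) (rA (m+2) + α + Pi.single i mo)) (G1 α) := by
    have := G1_sub hAD {i} (by simpa using hi.ne'); rwa [sum_singleton] at this
  have h1 := (kle_pA (c := 1) (Or.inl rfl) hv {i, 0, j}).trans (hG.p (Or.inl rfl))
  rw [Finset.sum_insert (by simp [i0, hij'.ne]), Finset.sum_pair j0, fwd] at h1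
  have h4 : kle (al (m+2) (rA (m+2) + α + Pi.single i mo + Pi.single 0 1) + al (m+2) (rA (m+2) + α + Pi.single i mo + Pi.single j 1))
      (pA (m+2) 1 * G1 α - al (m+2) (rA (m+2) + α)) := by
    rw [kle, sub_sub]; exact h1
  have h5 := h4.p (c := -1) (Or.inr rfl)
  rw [mul_add] at h5
  exact hB'.kle2 (al_mem hv) hv.ne (((back 0 add0).add (back j addj)).trans h5)
end
end

section
section
variable {t : CType} {z m : ℕ}
theorem dom_s {a b c : ℚ} (t : CType) (h : HI (sY n a b c)) (hc : 0 ≤ c) (hb : c ≤ b) (ha : b ≤ a) : DomY t (sY n a b c) := by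
  have nn : ∀ i, 0 ≤ sY n a b c i := fun i => by unfold sY; split_ifs <;> linarith
  refine ⟨h, fun i j hij => ?_, fun _ => nn⟩
  rw [abs_of_nonneg (nn j)]
  have := Fin.lt_def.1 hij
  unfold sY; split_ifs <;> first | linarith | omega
theorem HI_s (n : ℕ) (a b c : ℕ) : HI (sY n a b c) := ⟨0, fun i => by
  unfold sY; split_ifs <;> [exact ⟨a, by simp⟩; exact ⟨b, by simp⟩; exact ⟨c, by simp⟩; exact ⟨0, by simp⟩]⟩
theorem bex (ht : t ≠ CType.C) (hk : 3 ≤ k) (w : Fin k → Fin q → ℚ) (hZ : ∀ c, mp (resH w) (ZY t k c) = pA q c * pA q (-c)) :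
    ∃ b11 b2, AY t k (rY t k) * b11 = BY t k 1 1 0 ∧ AY t k (rY t k) * b2 = BY t k 2 0 0 ∧
      mp (resH w) b11 = hA q 1 * eA q mo + eA q 1 * hA q mo ∧ mp (resH w) b2 = hA q 1 * hA q mo + eA q 1 * eA q mo - 1 := by
  obtain ⟨b11, h11⟩ := exY ht (dom_s t (n := k) (a := 1) (b := 1) (c := 0) (by exact_mod_cast HI_s k 1 1 0) bn bn bn)
  obtain ⟨b2, h2⟩ := exY ht (dom_s t (n := k) (a := 2) (b := 0) (c := 0) (by exact_mod_cast HI_s k 2 0 0) bn bn bn)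
  refine ⟨b11, b2, h11, h2, ?_⟩
  have r1 := Yrel1 ht (n := k) bo
  have r2 := Yrel2 ht hk
  have r3 := Yrel3 ht hk
  rw [← r1] at r2
  change _ = BY t k 1 1 0 at h11
  change _ = BY t k 2 0 0 at h2
  rw [← h11, ← h2, BY_0] at r2 r3
  have e1 : ZY t k 1 * ZY t k 1 = b2 + b11 + 1 := mul_left_cancel₀ (den_ne t k) (by linear_combination r2)
  have e2 : ZY t k 2 = b2 - b11 + 1 := mul_left_cancel₀ (den_ne t k) (by linear_combination r3)
  have f1 := congrArg (mp (resH w)) e1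
  have f2 := congrArg (mp (resH w)) e2
  simp only [map_mul, map_add, map_sub, map_one, hZ] at f1 f2
  have g1 := pA_he q 1
  have g2 := pA_he q mo
  have g3 := pA_hme q 1
  have g4 := pA_hme q mo
  norm_num at g3 g4
  rw [g3, g4] at f2
  constructor <;> apply two_cancel
  · linear_combination f2 - f1 + (hA q mo + eA q mo) * g1 + pA q 1 * pA q 1 * g2
  · linear_combination (hA q mo + eA q mo) * g1 + pA q 1 * pA q 1 * g2 - f1 - f2
def sN (q : ℕ) (κ : ℕ → ℤ) : CharRing q := aN q (fun n => κ n - n)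
def vN (q : ℕ) (κ : ℕ → ℤ) : Fin q → ℚ := fun i => ((κ i.val - i.val : ℤ) : ℚ)
theorem sN_al (q κ) : sN q κ = al q (vN q κ) := rfl
theorem sN_eq {f g : ℕ → ℤ} (h : ∀ n < q, f n = g n) : sN q f = sN q g := aN_congr fun n hn => by rw [h n hn]
theorem sN_zero {f : ℕ → ℤ} (i j : ℕ) (hi : i < q) (hj : j < q) (h : i ≠ j) (hf : f i - i = f j - j) : sN q f = 0 :=
  aN_zero i j hi hj h hf
theorem sN_swap {f g : ℕ → ℤ} (i j : ℕ) (hi : i < q) (hj : j < q) (hij : i ≠ j)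
    (h : ∀ n < q, g n = if n = i then f j - j + i else if n = j then f i - i + j else f n) : sN q f = - sN q g :=
  aN_swap i j hi hj hij fun n hn => by rw [h n hn]; split_ifs with h1 h2 <;> subst_vars <;> ring
theorem p1 {c : ℤ} {c' : ℚ} (hc : c' = c) {f : ℕ → ℤ} (i : ℕ) (hi : i < q)
    (h : ∀ n < q, n ≠ i → ∃ j < q, j ≠ n ∧ f j - j = f n - n + c) : pA q c' * sN q f = sN q (f + bp i c) := by
  rw [hc, sN, pNs c _ {i} (by simpa using hi) (fun n hn hn' => h n hn (by simpa using hn')), sum_singleton]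
  exact aN_congr fun n _ => by simp only [Pi.add_apply]; ring
theorem p2 {c : ℤ} {c' : ℚ} (hc : c' = c) {f : ℕ → ℤ} (i j : ℕ) (hi : i < q) (hj : j < q) (hij : i ≠ j)
    (h : ∀ n < q, n ≠ i → n ≠ j → ∃ j < q, j ≠ n ∧ f j - j = f n - n + c) :
    pA q c' * sN q f = sN q (f + bp i c) + sN q (f + bp j c) := by
  rw [hc, sN, pNs c _ {i, j} (by simp [hi, hj]) (fun n hn hn' => by simp at hn'; exact h n hn hn'.1 hn'.2), Finset.sum_pair hij]
  congr 1 <;> exact aN_congr fun n _ => by simp only [Pi.add_apply]; ring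
theorem p3 {c : ℤ} {c' : ℚ} (hc : c' = c) {f : ℕ → ℤ} (i j k : ℕ) (hi : i < q) (hj : j < q) (hk : k < q) (hij : i ≠ j) (hik : i ≠ k) (hjk : j ≠ k)
    (h : ∀ n < q, n ≠ i → n ≠ j → n ≠ k → ∃ j < q, j ≠ n ∧ f j - j = f n - n + c) :
    pA q c' * sN q f = sN q (f + bp i c) + sN q (f + bp j c) + sN q (f + bp k c) := by
  rw [hc, sN, pNs c _ {i, j, k} (by simp [hi, hj, hk]) (fun n hn hn' => by simp at hn'; exact h n hn hn'.1 hn'.2.1 hn'.2.2),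
    sum_insert (by simp [hij, hik]), Finset.sum_pair hjk, ← add_assoc]
  congr 1; congr 1
  all_goals exact aN_congr fun n _ => by simp only [Pi.add_apply]; ring
theorem rA_sN (q : ℕ) (κ : ℕ → ℤ) : al q (rA q + fun i => (κ i.val : ℚ)) = mono (fun _ => (q:ℚ) - 1) * sN q κ := rA_aN q κ
theorem rA_sN' (q : ℕ) (κ : ℕ → ℤ) (i : Fin q) (c : ℤ) : al q ((rA q + fun i => (κ i.val : ℚ)) - Pi.single i (c:ℚ)) = mono (fun _ => (q:ℚ) - 1) * sN q (κ + bp i (-c)) := by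
  rw [← rA_sN]; congr 1; ext j; simp [bp, Pi.single_apply, Fin.ext_iff, sub_eq_add_neg, add_assoc]; split_ifs <;> simp
theorem D2 (ht : t ≠ CType.C) (hz : 2 ≤ z) (hm : mult t z = m + 2) {κ : ℕ → ℤ} {a P H E : CharRing (m+2)} (hκ : ∀ i < m + 2, 0 ≤ κ i)
    {g : CharRing (m + 2 + nn z (m+2))} (hm0 : 0 < m)
    (hg : AY t (m+2+nn z (m+2)) (rY t _) * g = AY t (m+2+nn z (m+2)) (rY t _ + Fin.append (fun i : Fin (m+2) => (κ i.val : ℚ)) 0))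
    (hb : Bd (mp (resH (wext (wq z (m+2)))) g * al (m+2+1) (rA (m+2+1))))
    (ha : a = sN (m+2) κ)
    (hP : P = pA (m+2) mo * a - if κ (m+1) = 0 then sN (m+2) (κ + bp (m+1) mo) else 0)
    (hH : H = if κ (m+1) = 0 then sN (m+2) (κ + bp (m+1) (-2)) else 0)
    (hE : E = (if κ (m+1) = 1 then sN (m+2) (κ + bp (m+1) (-2)) else 0) + if κ m = 0 then sN (m+2) (κ + bp m (-2)) else 0) :
    Bd (H * (hA (m+2) 1 * eA (m+2) mo + eA (m+2) 1 * hA (m+2) mo) - E * (hA (m+2) 1 * hA (m+2) mo + eA (m+2) 1 * eA (m+2) mo - 1)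
      + pA (m+2) mo * P * (pA (m+2) 1 * pA (m+2) mo) * (pA (m+2) 1 * pA (m+2) mo)
      - a * (hA (m+2) mo * (hA (m+2) 1 * eA (m+2) mo + eA (m+2) 1 * hA (m+2) mo) + eA (m+2) mo * (hA (m+2) 1 * hA (m+2) mo + eA (m+2) 1 * eA (m+2) mo - 1))
      - pA (m+2) mo * P * (pA (m+2) 1 * pA (m+2) mo) + eA (m+2) mo * a) := by
  have hk := nn_ge z (m+2)
  set w := wq z (m+2)
  set α : Fin (m+2) → ℚ := fun i => (κ i.val : ℚ) with hα
  have hα0 : ∀ i, 0 ≤ α i := fun i => by simp only [hα]; exact_mod_cast hκ _ i.2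
  have Hap : AP 2 α (0 : Fin (nn z (m+2)) → ℚ) := ⟨le_rfl, bo, ⟨0, by simp, hα0⟩, fun i j => ⟨κ i, by simp [hα]⟩⟩
  have hZ : ∀ c, mp (resH w) (ZY t (nn z (m+2)) c) = pA (m+2) c * pA (m+2) (-c) := fun c => ZqX hm c
  obtain ⟨b11, b2, h11, h2, r11, r2⟩ := bex ht bo w hZ
  obtain ⟨c, hE', hc⟩ := Yg t Hap hg
  have k0 := congrArg (mp (RT w)) (Y0 (gη := 1) Hap bs hc)
  have k1 := congrArg (mp (RT w)) (Y1 ht (gη := 1) Hap bn bs hc (sl_one ht bo hα0))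
  have k2 := congrArg (mp (RT w)) (Y2 ht Hap hα0 (fun i => ⟨κ i, rfl⟩) hc h11 h2)
  simp only [map_mul, map_sub, map_add, map_one, mul_one, RT_J1, RT_J2, r11, r2, hZ] at k0 k1 k2
  have hB := top2 (by rw [Th_res]; exact hE'.map _) hb le_rfl
  rw [k2, k1, k0] at hB
  have q1 := rA_sN' (m+2) κ (Fin.last (m+1)) 1
  have q2 := rA_sN' (m+2) κ (Fin.last (m+1)) 2
  have q3 := rA_sN' (m+2) κ ⟨m, bo⟩ 2
  have i0 : (α (Fin.last (m+1)) = 0) = (κ (m+1) = 0) := by simp [hα]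
  have i1 : (α (Fin.last (m+1)) = 1) = (κ (m+1) = 1) := by simp [hα]
  have i2 : (α ⟨m, bo⟩ = 0) = (κ m = 0) := by simp [hα]
  push_cast at q1 q2 q3
  simp only [i0, i1, i2] at hB
  simp only [q1, q2, q3, hα, rA_sN] at hB
  refine Bd.unconst (c := ((m+2:ℕ):ℚ) - 1) ?_
  convert hB using 1
  rw [hP, hE, hH, ha]
  simp only [apply_ite (mp (RT w)), map_neg, map_zero, RT_J1]
  split_ifs <;> push_cast <;> ring_nf
end
end

section
theorem strip2 {v : Fin q → ℚ} (hv : SD v) {c : ℚ} (hc : c = 1 ∨ c = -1) {a b : Fin q} (h : a < b) :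
    al q (v + Pi.single a c + Pi.single b c) ∈ KK q := by
  rw [add_assoc]
  refine strip hv hc fun i => ?_
  simp only [Pi.add_apply, Pi.single_apply]
  split_ifs with h1 h2
  · exact absurd (h1.symm.trans h2) h.ne
  all_goals simp
theorem kle_eA {v : Fin q → ℚ} (hv : SD v) {c : ℚ} (hc : c = 1 ∨ c = -1) {a b : Fin q} (h : a < b) :
    kle (al q (v + Pi.single a c + Pi.single b c)) (eA q c * al q v) := by
  rw [kle, eA_al, ← Finset.sum_product', ← Finset.add_sum_erase (univ ×ˢ univ) _ (a := (a, b)) bs, if_pos h, add_sub_cancel_left]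
  refine sum_mem fun p _ => ?_
  split_ifs with h
  · exact strip2 hv hc h
  · exact zero_mem _
theorem KK_eA {c : ℚ} (hc : c = 1 ∨ c = -1) {F : CharRing q} (hF : F ∈ KK q) : eA q c * F ∈ KK q := by
  induction hF using AddSubmonoid.closure_induction with
  | mem x hx =>
    obtain ⟨v, hv, rfl⟩ := hx
    rw [eA_al]; refine sum_mem fun i _ => sum_mem fun j _ => ?_
    split_ifs with h
    · exact strip2 hv hc h
    · exact zero_mem _
  | zero => simp
  | add x y _ _ hx hy => rw [mul_add]; exact add_mem hx hy
theorem kle.coeff {F : CharRing q} {u : Fin q → ℚ} (h : kle (al q u) F) (hu : StrictAnti u) : 1 ≤ F.coeff u := by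
  have := KK_nonneg h hu
  rw [AddMonoidAlgebra.coeff_sub, Finsupp.sub_apply, al_coeff_self _ hu.injective] at this
  linarith
theorem hcoef {v : Fin q → ℚ} (hv : SD v) {a b : Fin q} (h : a < b) (hab : v b + 1 < v a)
    (hu : StrictAnti (v + Pi.single a mo + Pi.single b mo)) :
    1 ≤ (hA q mo * al q v).coeff (v + Pi.single a mo + Pi.single b mo) := by
  have h1 := (kle_eA hv (Or.inr rfl) h).coeff hu
  rw [hA, add_mul, pA_al, AddMonoidAlgebra.coeff_add, Finsupp.add_apply]
  set u := v + Pi.single a mo + Pi.single b mo with hudef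
  have h0 : (∑ i, al q (v + Pi.single i (2 * mo))).coeff u = 0 := by
    rw [← cf_apply, map_sum]
    refine sum_eq_zero fun i _ => al_coeff_of_not _ _ fun σ hσ => ?_
    have ua : u a = v a - 1 := by simp [hudef, h.ne, sub_eq_add_neg]
    have ub : u b = v b - 1 := by simp [hudef, h.ne', sub_eq_add_neg]
    have uo : ∀ j, j ≠ a → j ≠ b → u j = v j := fun j h1 h2 => by simp [hudef, h1, h2]
    have ev : ∀ x, v (σ x) + (if σ x = i then -2 else 0) = u x := fun x => by
      have := congrFun hσ x
      rw [← this]; change _ = (v + Pi.single i (2 * mo) : Fin q → ℚ) (σ x)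
      simp only [Pi.add_apply, Pi.single_apply]; norm_num
    have ka : σ a = i := by
      by_contra hi
      have e := ev a; rw [if_neg hi, add_zero, ua] at e
      by_cases hb : σ a = b
      · rw [hb] at e; linarith
      · by_cases ha : σ a = a
        · rw [ha] at e; linarith
        · exact ha (hu.injective ((uo _ ha hb).trans (e.trans ua.symm)))
    have kb : σ b = i := by
      by_contra hi
      have e := ev b; rw [if_neg hi, add_zero, ub] at e
      by_cases hb : σ b = b
      · rw [hb] at e; linarith
      · by_cases ha : σ b = a
        · rw [ha] at e; linarith
        · exact hb (hu.injective ((uo _ ha hb).trans (e.trans ub.symm)))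
    exact h.ne (σ.injective (ka.trans kb.symm))
  rw [h0, add_zero]; exact h1
theorem sdN {κ : ℕ → ℤ} (h : ∀ i j, i < j → j < q → κ j ≤ κ i) : SD (vN q κ) :=
  ⟨fun i j hij => by
    have := h i j (Fin.lt_def.1 hij) j.2
    have h2 := Fin.lt_def.1 hij
    simp only [vN]; exact_mod_cast (by omega : κ j - j < κ i - i), ID.of_int _⟩
theorem vN_add (κ : ℕ → ℤ) (i : Fin q) (c : ℤ) : vN q κ + Pi.single i (c:ℚ) = vN q (κ + bp i c) := by
  ext j; simp only [vN, Pi.add_apply, Pi.single_apply, bp, Fin.ext_iff]; split_ifs <;> push_cast <;> ring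
theorem vN_add2 {κ κ' : ℕ → ℤ} (a b : ℕ) (ha : a < q) (hb : b < q) (c : ℤ) (h : ∀ n < q, κ' n = κ n + bp a c n + bp b c n) :
    vN q κ + Pi.single ⟨a, ha⟩ (c:ℚ) + Pi.single ⟨b, hb⟩ (c:ℚ) = vN q κ' := by
  rw [vN_add, vN_add]; ext j; simp only [vN, Pi.add_apply, h j j.2]
theorem eN {κ κ' : ℕ → ℤ} (a b : ℕ) (hab : a < b) (hb : b < q) (hκ : ∀ i j, i < j → j < q → κ j ≤ κ i)
    (c : ℤ) (hc : c = 1 ∨ c = -1) (h : ∀ n < q, κ' n = κ n + bp a c n + bp b c n) : kle (sN q κ') (eA q c * sN q κ) := by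
  have := kle_eA (sdN hκ) (c := c) (by exact_mod_cast hc) (a := ⟨a, bo⟩) (b := ⟨b, hb⟩) hab
  rwa [vN_add2 a b _ _ c h] at this
theorem hN {κ κ' : ℕ → ℤ} (a b : ℕ) (hab : a < b) (hb : b < q) (hκ : ∀ i j, i < j → j < q → κ j ≤ κ i)
    (hκ' : ∀ i j, i < j → j < q → κ' j ≤ κ' i) (h1 : κ b - b + 1 < κ a - a)
    (h : ∀ n < q, κ' n = κ n + bp a mo n + bp b mo n) : 1 ≤ (hA q mo * sN q κ).coeff (vN q κ') := by
  have e := vN_add2 a b bo hb mo h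
  push_cast at e
  have := hcoef (sdN hκ) (a := ⟨a, bo⟩) (b := ⟨b, hb⟩) hab (by simp only [vN]; exact_mod_cast h1) (by rw [e]; exact (sdN hκ').sa)
  rwa [e] at this
theorem colF {m j : ℕ} (hj : j + 3 ≤ m + 2) (hm : 2 ≤ m)
    (hb : Bd ((hA (m+2) 1 * eA (m+2) mo + eA (m+2) 1 * hA (m+2) mo) * sN (m+2) (cK (j+2)) + pA (m+2) mo * sN (m+2) (cK (j+3))
      - pA (m+2) 1 * pA (m+2) mo * (pA (m+2) mo * sN (m+2) (cK (j+3))) + eA (m+2) mo * if j + 4 ≤ m + 2 then sN (m+2) (cK (j+4)) else 0)) : False := by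
  set q := m + 2 with hq
  set c0 := if j + 4 ≤ q then sN q (cK (j+4)) else 0 with hc0
  have e1 : pA q 1 * sN q (cK (j+2)) = sN q (cK (j+2) + bp 0 1) + sN q (cK (j+3)) := by
    rw [p2 (c := 1) bn 0 (j+2) bo bo bo fun n hn h1 h2 => ⟨n-1, bo, bo, sgm⟩]
    congr 1; exact sN_eq sgm
  have e2 : pA q 1 * sN q (cK (j+2) + bp 0 1) = sN q (cK (j+2) + bp 0 1 + bp 0 1) + sN q (cK (j+2) + bp 0 1 + bp 1 1) + sN q (cK (j+3) + bp 0 1) := by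
    rw [p3 (c := 1) bn 0 1 (j+2) bo bo bo bo bo bo fun n hn h1 h2 h3 =>
      ⟨n-1, bo, bo, sgm⟩]
    congr 1; exact sN_eq sgm
  have e3 : pA q 1 * sN q (cK (j+3)) = sN q (cK (j+3) + bp 0 1) + c0 := by
    rw [hc0]; split_ifs with h
    · rw [p2 (c := 1) bn 0 (j+3) bo bo bo fun n hn h1 h2 => ⟨n-1, bo, bo, sgm⟩]
      congr 1; exact sN_eq sgm
    · rw [p1 (c := 1) bn 0 bo fun n hn h1 => ⟨n-1, bo, bo, sgm⟩, add_zero]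
  have e4 : pA q 2 * sN q (cK (j+2)) = sN q (cK (j+2) + bp 0 1 + bp 0 1) - sN q (cK (j+2) + bp 0 1 + bp 1 1) - c0 := by
    have f1 : sN q (cK (j+2) + bp 0 2) = sN q (cK (j+2) + bp 0 1 + bp 0 1) := sN_eq sgm
    have f2 : sN q (cK (j+2) + bp 1 2) = - sN q (cK (j+2) + bp 0 1 + bp 1 1) :=
      sN_swap 0 1 bo bo bo sgm
    have hw : ∀ n < q, n ≠ 0 → n ≠ 1 → n ≠ j + 3 → ∃ i < q, i ≠ n ∧ cK (j+2) i - (i:ℤ) = cK (j+2) n - n + 2 := fun n hn h1 h2 h3 => by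
      by_cases h4 : n = j + 2
      · exact ⟨n-1, bo, bo, sgm⟩
      · exact ⟨n-2, bo, bo, sgm⟩
    rw [hc0]; split_ifs with h
    · rw [p3 (c := 2) bn 0 1 (j+3) bo bo bo bo bo bo hw, f1, f2,
        sN_swap (f := cK (j+2) + bp (j+3) 2) (g := cK (j+4)) (j+2) (j+3) bo bo bo sgm]
      ring
    · rw [p2 (c := 2) bn 0 1 bo bo bo fun n hn h1 h2 => hw n hn h1 h2 bo, f1, f2]; ring
  have g1 := pA_he q 1
  have g2 := pA_he q mo
  have g3 := pA_hme q 1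
  norm_num at g3
  rw [g3] at e4
  set A := sN q (cK (j+2) + bp 0 1 + bp 0 1) with hA'
  set B := sN q (cK (j+2) + bp 0 1 + bp 1 1) with hB'
  have h1 : hA q 1 * sN q (cK (j+2)) = A + sN q (cK (j+3) + bp 0 1) := two_cancel (by
    linear_combination e4 + pA q 1 * e1 + e2 + e3 - sN q (cK (j+2)) * g1)
  have h2 : eA q 1 * sN q (cK (j+2)) = B + sN q (cK (j+3) + bp 0 1) + c0 := two_cancel (by
    linear_combination - e4 + pA q 1 * e1 + e2 + e3 - sN q (cK (j+2)) * g1)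
  have main : (hA q 1 * eA q mo + eA q 1 * hA q mo) * sN q (cK (j+2)) + pA q mo * sN q (cK (j+3))
      - pA q 1 * pA q mo * (pA q mo * sN q (cK (j+3))) + eA q mo * c0 = eA q mo * A + hA q mo * B + pA q mo * sN q (cK (j+3)) := by
    linear_combination eA q mo * h1 + hA q mo * h2 - pA q mo * pA q mo * e3 - (sN q (cK (j+3) + bp 0 1) + c0) * g2
  rw [main] at hb
  set u : ℕ → ℤ := cK (j+2) + bp 0 1 + bp (q-1) mo with hu
  have uA : ∀ i j, i < j → j < q → u j ≤ u i := fun a b h1 h2 => by simp only [hu, cK, bp, Pi.add_apply]; split_ifs <;> omega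
  have k1 : 1 ≤ (eA q mo * A).coeff (vN q u) := by
    have := eN (q := q) (κ := cK (j+2) + bp 0 1 + bp 0 1) (κ' := u) 0 (q-1) bo bo
      (fun a b h1 h2 => sgm) mo bs fun n _ => by simp only [hu, cK, bp, Pi.add_apply]; split_ifs <;> omega
    push_cast at this
    exact this.coeff (sdN uA).sa
  have k2 : 1 ≤ (hA q mo * B).coeff (vN q u) := hN 1 (q-1) bo bo
      (fun a b h1 h2 => sgm) uA sgm
      fun n _ => by simp only [hu, cK, bp, Pi.add_apply]; split_ifs <;> omega
  have k3 : 0 ≤ (pA q mo * sN q (cK (j+3))).coeff (vN q u) :=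
    KK_nonneg (KK_pA (Or.inr rfl) (al_mem (sdN fun a b h1 h2 => sgm))) (sdN uA).sa
  refine hb.two (u := vN q u) ?_
  rw [AddMonoidAlgebra.coeff_add, AddMonoidAlgebra.coeff_add, Finsupp.add_apply, Finsupp.add_apply]
  linarith
theorem starA {a P W V H E d s : CharRing q} (h2 : pA q (-2) * a = s + H + E) (ha : pA q mo * a = P + W)
    (hW : pA q mo * W = V + H - E) (hP : pA q mo * P = d + V) :
    2 * (hA q mo * a) = 2 * (pA q mo * P) - d + s + 2 * H ∧ 2 * (eA q mo * a) = 2 * (pA q mo * P) - d - s - 2 * E := by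
  have g2 := pA_he q mo
  have g3 := pA_hme q mo
  norm_num at g3
  rw [g3] at h2
  constructor
  · linear_combination h2 - a * g2 + pA q mo * ha + hW - hP
  · linear_combination - h2 - a * g2 + pA q mo * ha + hW - hP
end

section
section
variable {t : CType} {z m : ℕ}
theorem ZZ (q : ℕ) : (pA q 1 * pA q mo) * (pA q 1 * pA q mo) = (hA q 1 * eA q mo + eA q 1 * hA q mo) + (hA q 1 * hA q mo + eA q 1 * eA q mo - 1) + 1 := by
  linear_combination (pA q mo * pA q mo) * pA_he q 1 + (hA q 1 + eA q 1) * pA_he q mo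
theorem col_no (ht : t ≠ CType.C) (hz : 2 ≤ z) (hm2 : 2 ≤ m) (hm : mult t z = m + 2) {j : ℕ} (hj : j + 4 ≤ m + 2)
    {g : CharRing (m + 2 + nn z (m+2))}
    (hg : AY t (m+2+nn z (m+2)) (rY t _) * g = AY t (m+2+nn z (m+2)) (rY t _ + Fin.append (fun i : Fin (m+2) => (cK (j+4) i.val : ℚ)) 0))
    (hb : Bd (mp (resH (wext (wq z (m+2)))) g * al (m+2+1) (rA (m+2+1)))) : False := by
  have hB := D2 ht hz hm (κ := cK (j+4)) (fun i _ => sgm) bo hg hb rfl rfl rfl rfl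
  set a := sN (m+2) (cK (j+4)) with ha
  set W := if cK (j+4) (m+1) = 0 then sN (m+2) (cK (j+4) + bp (m+1) mo) else 0 with hW
  set H := if cK (j+4) (m+1) = 0 then sN (m+2) (cK (j+4) + bp (m+1) (-2)) else 0 with hH
  set E := (if cK (j+4) (m+1) = 1 then sN (m+2) (cK (j+4) + bp (m+1) (-2)) else 0) + if cK (j+4) m = 0 then sN (m+2) (cK (j+4) + bp m (-2)) else 0 with hE
  set d := sN (m+2) (cK (j+2)) with hd
  set P := sN (m+2) (cK (j+3)) with hP
  set V := sN (m+2) (cK (j+3) + bp (m+1) mo) with hV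
  have s1 : sN (m+2) (cK (j+4) + bp (j+3) mo) = P := sN_eq sgm
  have t1 : sN (m+2) (cK (j+4) + bp (m+1) mo + bp (j+3) mo) = V := sN_eq sgm
  have t2 : sN (m+2) (cK (j+4) + bp (m+1) mo + bp (m+1) mo) = sN (m+2) (cK (j+4) + bp (m+1) (-2)) :=
    sN_eq sgm
  have s2 : sN (m+2) (cK (j+4) + bp (j+2) (-2)) = -d := sN_swap (j+2) (j+3) bo bo bo sgm
  have rP : pA (m+2) mo * P = d + V := by
    rw [p2 (c := -1) bn (j+2) (m+1) bo bo bo fun n hn h1 h2 => ⟨n+1, bo, bo, sgm⟩]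
    congr 1; exact sN_eq sgm
  have hz1 : ∀ n < m+2, n ≠ j + 3 → n ≠ m + 1 → ∃ i < m+2, i ≠ n ∧ cK (j+4) i - (i:ℤ) = cK (j+4) n - n + mo := fun n hn h1 h2 =>
    ⟨n+1, bo, bo, sgm⟩
  have hz2 : ∀ n < m+2, n ≠ j + 2 → n ≠ m → n ≠ m + 1 → ∃ i < m+2, i ≠ n ∧ cK (j+4) i - (i:ℤ) = cK (j+4) n - n + (-2) := fun n hn h1 h2 h3 => by
    by_cases h : n = j + 3
    · exact ⟨n+1, bo, bo, sgm⟩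
    · exact ⟨n+2, bo, bo, sgm⟩
  have key : pA (m+2) (-2) * a = -d + H + E ∧ pA (m+2) mo * a = P + W ∧ pA (m+2) mo * W = V + H - E := by
    rcases (by omega : j + 4 = m + 2 ∨ j + 4 = m + 1 ∨ j + 4 ≤ m) with h | h | h
    · have c1 : cK (j+4) (m+1) = 1 := if_pos bo
      have c2 : cK (j+4) m = 1 := if_pos bo
      rw [c1, if_neg bn] at hW hH
      rw [c1, c2, if_pos rfl, if_neg bn, add_zero] at hE
      have eE : E = V := hE.trans (sN_eq sgm)
      refine ⟨?_, ?_, by rw [hW, hH, eE]; ring⟩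
      · rw [p2 (c := -2) bn (j+2) (m+1) bo bo bo fun n hn h1 h2 => hz2 n hn h1 bo h2, s2, hH, hE, add_zero]
      · rw [p1 (c := -1) bn (j+3) bo fun n hn h1 => hz1 n hn h1 bo, s1, hW, add_zero]
    · have c1 : cK (j+4) (m+1) = 0 := if_neg bo
      have c2 : cK (j+4) m = 1 := if_pos bo
      rw [c1, if_pos rfl] at hW hH
      rw [c1, c2, if_neg bn, if_neg bn, add_zero] at hE
      refine ⟨?_, ?_, ?_⟩
      · rw [p2 (c := -2) bn (j+2) (m+1) bo bo bo fun n hn h1 h2 => by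
          by_cases h3 : n = m
          · exact ⟨n+1, bo, bo, sgm⟩
          · exact hz2 n hn h1 h3 h2, s2, hH, hE, add_zero]
      · rw [p2 (c := -1) bn (j+3) (m+1) bo bo bo hz1, s1, hW]
      · rw [hW, p2 (c := -1) bn (j+3) (m+1) bo bo bo fun n hn h1 h2 =>
          ⟨n+1, bo, bo, sgm⟩, hE, sub_zero, hH, t1, t2]
    · have c1 : cK (j+4) (m+1) = 0 := if_neg bo
      have c2 : cK (j+4) m = 0 := if_neg bo
      rw [c1, if_pos rfl] at hW hH
      rw [c1, c2, if_neg bn, if_pos rfl, zero_add] at hE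
      refine ⟨?_, ?_, ?_⟩
      · rw [p3 (c := -2) bn (j+2) (m+1) m bo bo bo bo bo bo fun n hn h1 h2 h3 => hz2 n hn h1 h3 h2, s2, hH, hE]
      · rw [p2 (c := -1) bn (j+3) (m+1) bo bo bo hz1, s1, hW]
      · rw [hW, p3 (c := -1) bn (j+3) (m+1) m bo bo bo bo bo bo fun n hn h1 h2 h3 =>
          ⟨n+1, bo, bo, sgm⟩, hE, sub_eq_add_neg, hH, t1, t2,
          sN_swap (f := cK (j+4) + bp m (-2)) (g := cK (j+4) + bp (m+1) mo + bp m mo) m (m+1) bo bo bo sgm, neg_neg]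
  obtain ⟨k2, k1, kW⟩ := key
  obtain ⟨g1, g2⟩ := starA k2 k1 kW rP
  have h1 : hA (m+2) mo * a = pA (m+2) mo * P - d + H := two_cancel (by linear_combination g1)
  have h2 : eA (m+2) mo * a = pA (m+2) mo * P - E := two_cancel (by linear_combination g2)
  have hWP : pA (m+2) mo * a - W = P := by rw [k1]; ring
  rw [hWP] at hB
  refine colF (j := j) bo hm2 ?_
  rw [if_pos hj]
  convert hB using 1
  set b11 := hA (m+2) 1 * eA (m+2) mo + eA (m+2) 1 * hA (m+2) mo
  set b2 := hA (m+2) 1 * hA (m+2) mo + eA (m+2) 1 * eA (m+2) mo - 1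
  linear_combination - pA (m+2) mo * P * ZZ (m+2) + b11 * h1 + b2 * h2
theorem tie_no (ht : t ≠ CType.C) (hz : 2 ≤ z) (hm2 : 2 ≤ m) (hm : mult t z = m + 2)
    {g : CharRing (m + 2 + nn z (m+2))} (H : AP 1 (fun _ : Fin (m+2) => (1:ℚ)) (sY (nn z (m+2)) 1 0 0))
    (hg : AY t (m+2+nn z (m+2)) (rY t _) * g = AY t (m+2+nn z (m+2)) (rY t _ + Fin.append (fun _ : Fin (m+2) => (1:ℚ)) (sY _ 1 0 0)))
    (hb : Bd (mp (resH (wext (wq z (m+2)))) g * al (m+2+1) (rA (m+2+1)))) : False := by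
  have hk := nn_ge z (m+2)
  set w := wq z (m+2)
  have hZ : ∀ c, mp (resH w) (ZY t (nn z (m+2)) c) = pA (m+2) c * pA (m+2) (-c) := fun c => ZqX hm c
  obtain ⟨b11, b2, h11, h2, r11, r2⟩ := bex ht bo w hZ
  obtain ⟨C, hC, c0, c1⟩ := lift1 ht H le_rfl (gη := ZY t _ 1) (by
      have := Yrel1 ht (n := nn z (m+2)) bo
      rw [BY_0, mul_comm] at this; exact this) hg w (s1 := - J1 (m+2) _ (al (m+2) (rA (m+2) + (fun _ => 1) - Pi.single (Fin.last (m+1)) 1)) * J2 (m+2) _ b2) (by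
      rw [sl_tie bo, ← h2, map_mul]; ring)
  have hB := top1 hC hb le_rfl
  rw [c0, c1, map_mul, map_neg, RT_J1, RT_J2, hZ, r2] at hB
  have e1 : (fun _ : Fin (m+2) => (1:ℚ)) = fun i => ((cK (m+2) i.val : ℤ) : ℚ) := by
    ext i; rw [cK, if_pos i.2]; simp
  have q1 := rA_sN' (m+2) (cK (m+2)) (Fin.last (m+1)) 1
  push_cast at q1
  rw [e1, rA_sN, q1] at hB
  have e2 : pA (m+2) mo * sN (m+2) (cK (m+2)) = sN (m+2) (cK (m+1)) := by
    rw [p1 (c := -1) bn (m+1) bo fun n hn h1 => ⟨n+1, bo, bo, sgm⟩]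
    exact sN_eq sgm
  have e3 : sN (m+2) (cK (m+2) + bp (m+1) mo) = sN (m+2) (cK (m+1)) :=
    sN_eq sgm
  rw [e3] at hB
  obtain ⟨j, rfl⟩ : ∃ j, m = j + 1 := ⟨m-1, bo⟩
  refine colF (j := j) bo hm2 (Bd.unconst (c := ((j+1:ℕ):ℚ) + 2 - 1) ?_)
  rw [if_neg bo, e2]
  convert hB using 1
  push_cast
  rw [show ((j:ℚ)+1+1+1-1) = j+1+2-1 by ring]
  linear_combination (- (mono fun _ => (j:ℚ) + 1 + 2 - 1) * sN (j+1+2) (cK (j+1+1))) * ZZ (j+1+2)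
    - ((mono fun _ => (j:ℚ) + 1 + 2 - 1) * ((pA (j+1+2) 1 * pA (j+1+2) mo) * (pA (j+1+2) 1 * pA (j+1+2) mo) - pA (j+1+2) 1 * pA (j+1+2) mo)) * e2
end
end

section
section
variable {t : CType} {z m : ℕ}
theorem row_no (ht : t ≠ CType.C) (hz : 2 ≤ z) (hm2 : 2 ≤ m) (hm : mult t z = m + 2) {k : ℤ} (hk : 4 ≤ k)
    {g : CharRing (m + 2 + nn z (m+2))}
    (hg : AY t (m+2+nn z (m+2)) (rY t _) * g = AY t (m+2+nn z (m+2)) (rY t _ + Fin.append (fun i : Fin (m+2) => (bp 0 k i.val : ℚ)) 0))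
    (hb : Bd (mp (resH (wext (wq z (m+2)))) g * al (m+2+1) (rA (m+2+1)))) : False := by
  have hB := D2 ht hz hm (κ := bp 0 k) (fun i _ => sgm) bo hg hb rfl rfl rfl rfl
  have c1 : bp 0 k (m+1) = 0 := if_neg bo
  have c2 : bp 0 k m = 0 := if_neg bo
  simp only [c1, c2, if_true, if_neg (show ¬ (0:ℤ) = 1 by norm_num), zero_add] at hB
  set q := m + 2 with hq
  set a := sN q (bp 0 k) with ha
  set W := sN q (bp 0 k + bp (m+1) mo) with hW
  set H := sN q (bp 0 k + bp (m+1) (-2)) with hH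
  set E := sN q (bp 0 k + bp m (-2)) with hE
  set d := sN q (bp 0 (k-2)) with hd
  set P := sN q (bp 0 (k-1)) with hP
  set V := sN q (bp 0 (k-1) + bp (m+1) mo) with hV
  set S := sN q (bp 0 (k-2) + bp 1 2) with hS
  set R := sN q (bp 0 (k-2) + bp 1 1 + bp 2 1) with hR
  set Y := sN q (bp 0 (k-1) + bp 1 1) with hY
  set T := sN q (bp 0 (k-2) + bp 1 1) with hT
  have rP : pA q mo * P = d + V := by
    rw [p2 (c := -1) bn 0 (m+1) bo bo bo fun n hn h1 h2 => ⟨n+1, bo, bo, sgm⟩]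
    exact congrArg₂ _ (sN_eq sgm) rfl
  have k1 : pA q mo * a = P + W := by
    rw [p2 (c := -1) bn 0 (m+1) bo bo bo fun n hn h1 h2 => ⟨n+1, bo, bo, sgm⟩]
    exact congrArg₂ _ (sN_eq sgm) rfl
  have k2 : pA q (-2) * a = d + H + E := by
    rw [p3 (c := -2) bn 0 (m+1) m bo bo bo bo bo bo fun n hn h1 h2 h3 =>
      ⟨n+2, bo, bo, sgm⟩]
    exact congrArg₂ _ (congrArg₂ _ (sN_eq sgm) rfl) rfl
  have kW : pA q mo * W = V + H - E := by
    rw [p3 (c := -1) bn 0 (m+1) m bo bo bo bo bo bo fun n hn h1 h2 h3 =>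
      ⟨n+1, bo, bo, sgm⟩, hE, sub_eq_add_neg,
      sN_swap (f := bp 0 k + bp m (-2)) (g := bp 0 k + bp (m+1) mo + bp m mo) m (m+1) bo bo bo sgm, neg_neg,
      sN_eq (q := q) (f := bp 0 k + bp (m+1) mo + bp 0 mo) (g := bp 0 (k-1) + bp (m+1) mo) sgm,
      sN_eq (q := q) (f := bp 0 k + bp (m+1) mo + bp (m+1) mo) (g := bp 0 k + bp (m+1) (-2)) sgm]
  obtain ⟨g1, g2⟩ := starA k2 k1 kW rP
  have h1 : hA q mo * a = pA q mo * P + H := two_cancel (by linear_combination g1)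
  have h2 : eA q mo * a = pA q mo * P - d - E := two_cancel (by linear_combination g2)
  have hWP : pA q mo * a - W = P := by rw [k1]; ring
  rw [hWP] at hB
  have e1 : pA q 1 * d = P + T := by
    rw [p2 (c := 1) bn 0 1 bo bo bo fun n hn h1 h2 => ⟨n-1, bo, bo, sgm⟩]
    exact congrArg₂ _ (sN_eq sgm) rfl
  have e2 : pA q 1 * P = a + Y := by
    rw [p2 (c := 1) bn 0 1 bo bo bo fun n hn h1 h2 => ⟨n-1, bo, bo, sgm⟩]
    exact congrArg₂ _ (sN_eq sgm) rfl
  have e3 : pA q 1 * T = Y + S + R := by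
    rw [p3 (c := 1) bn 0 1 2 bo bo bo bo bo bo fun n hn h1 h2 h3 =>
      ⟨n-1, bo, bo, sgm⟩,
      sN_eq (q := q) (f := bp 0 (k-2) + bp 1 1 + bp 0 1) (g := bp 0 (k-1) + bp 1 1) sgm,
      sN_eq (q := q) (f := bp 0 (k-2) + bp 1 1 + bp 1 1) (g := bp 0 (k-2) + bp 1 2) sgm]
  have e4 : pA q 2 * d = a + S - R := by
    rw [p3 (c := 2) bn 0 1 2 bo bo bo bo bo bo fun n hn h1 h2 h3 =>
      ⟨n-2, bo, bo, sgm⟩,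
      sN_eq (q := q) (f := bp 0 (k-2) + bp 0 2) (g := bp 0 k) sgm,
      sN_swap (f := bp 0 (k-2) + bp 2 2) (g := bp 0 (k-2) + bp 1 1 + bp 2 1) 1 2 bo bo bo sgm, ← sub_eq_add_neg]
  have f1 := pA_he q 1
  have f2 := pA_he q mo
  have f3 := pA_hme q 1
  norm_num at f3
  rw [f3] at e4
  have h3 : hA q 1 * d = a + Y + S := two_cancel (by linear_combination e4 + pA q 1 * e1 + e2 + e3 - d * f1)
  have h4 : eA q 1 * d = Y + R := two_cancel (by linear_combination - e4 + pA q 1 * e1 + e2 + e3 - d * f1)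
  have hB' : Bd (V + hA q mo * S + eA q mo * R) := by
    convert hB using 1
    set b11 := hA q 1 * eA q mo + eA q 1 * hA q mo
    set b2 := hA q 1 * hA q mo + eA q 1 * eA q mo - 1 with hb2
    linear_combination - pA q mo * P * ZZ q + b11 * h1 + b2 * h2 - hA q mo * h3 - eA q mo * h4 + pA q mo * pA q mo * e2
      + (a + Y) * f2 - rP - d * hb2 + E * hb2
  set u : ℕ → ℤ := bp 0 (k-2) + bp 1 1 + bp (q-1) mo with hu
  have uA : ∀ i j, i < j → j < q → u j ≤ u i := fun a b h1 h2 => by simp only [hu, bp, Pi.add_apply]; split_ifs <;> first | omega | contradiction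
  have k1 : 1 ≤ (eA q mo * R).coeff (vN q u) := by
    have := eN (q := q) (κ := bp 0 (k-2) + bp 1 1 + bp 2 1) (κ' := u) 2 (q-1) bo bo
      (fun a b h1 h2 => sgm) mo bs fun n _ => by simp only [hu, bp, Pi.add_apply]; split_ifs <;> first | omega | contradiction
    push_cast at this
    exact this.coeff (sdN uA).sa
  have k2 : 1 ≤ (hA q mo * S).coeff (vN q u) := hN 1 (q-1) bo bo
      (fun a b h1 h2 => sgm) uA sgm
      fun n _ => by simp only [hu, bp, Pi.add_apply]; split_ifs <;> first | omega | contradiction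
  have k3 : 0 ≤ V.coeff (vN q u) :=
    KK_nonneg (al_mem (sdN fun a b h1 h2 => sgm)) (sdN uA).sa
  refine hB'.two (u := vN q u) ?_
  rw [AddMonoidAlgebra.coeff_add, AddMonoidAlgebra.coeff_add, Finsupp.add_apply, Finsupp.add_apply]
  linarith
theorem h_good (m : ℕ) {c : ℤ} (hc : c = 1 ∨ c = -1) : Good (m+2) (hA (m+2) c) := by
  obtain ⟨κ, hκ, e⟩ : ∃ κ : ℕ → ℤ, (∀ i j, i < j → j < m+2 → κ j ≤ κ i) ∧ hA (m+2) c * sN (m+2) 0 = sN (m+2) κ := by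
    have f1 := pA_he (m+2) c
    have f2 := pA_hme (m+2) c
    rcases hc with rfl | rfl
    · push_cast at *
      have e1 : pA (m+2) 1 * sN (m+2) 0 = sN (m+2) (0 + bp 0 1) :=
        p1 (c := 1) bn 0 bo fun n hn h1 => ⟨n-1, bo, bo, by simp only [Pi.zero_apply]; omega⟩
      have e2 : pA (m+2) 1 * sN (m+2) (0 + bp 0 1) = sN (m+2) (0 + bp 0 1 + bp 0 1) + sN (m+2) (0 + bp 0 1 + bp 1 1) :=
        p2 (c := 1) bn 0 1 bo bo bo fun n hn h1 h2 => ⟨n-1, bo, bo, by simp only [Pi.add_apply, Pi.zero_apply, bp]; split_ifs <;> first | omega | contradiction⟩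
      have e3 : pA (m+2) (2*1) * sN (m+2) 0 = sN (m+2) (0 + bp 0 1 + bp 0 1) - sN (m+2) (0 + bp 0 1 + bp 1 1) := by
        rw [p2 (c := 2) bn 0 1 bo bo bo fun n hn h1 h2 => ⟨n-2, bo, bo, by simp only [Pi.zero_apply]; omega⟩,
          sN_swap (f := 0 + bp 1 2) (g := 0 + bp 0 1 + bp 1 1) 0 1 bo bo bo fun n _ => by
            simp only [bp, Pi.add_apply, Pi.zero_apply]; split_ifs <;> first | omega | contradiction, sub_eq_add_neg]
        exact congrArg₂ _ (sN_eq fun n _ => by simp only [bp, Pi.add_apply, Pi.zero_apply]; split_ifs <;> first | omega | contradiction) rfl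
      refine ⟨_, ?_, two_cancel (y := sN (m+2) (0 + bp 0 1 + bp 0 1)) (by linear_combination pA (m+2) 1 * e1 + e2 + e3 - sN (m+2) 0 * f2 - sN (m+2) 0 * f1)⟩
      intro i j h1 h2; simp only [bp, Pi.add_apply, Pi.zero_apply]; split_ifs <;> first | omega | contradiction
    · have h := hst_rho m
      have q1 := rA_sN' (m+2) 0 (Fin.last (m+1)) 2
      have q2 := rA_sN (m+2) 0
      simp only [Pi.zero_apply, Int.cast_zero] at q1 q2
      change al _ (_ + 0) = _ at q2
      rw [show (fun _ => 0 : Fin (m+2) → ℚ) = 0 from rfl] at q1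
      rw [add_zero] at q1 q2
      push_cast at *
      rw [q1, q2] at h
      refine ⟨_, ?_, mul_left_cancel₀ (mono_ne_zero (fun _ => (m:ℚ)+2-1)) (by rw [← h]; ring)⟩
      intro i j h1 h2; simp only [bp, Pi.add_apply, Pi.zero_apply]; split_ifs <;> first | omega | contradiction
  obtain ⟨S, hS, e2⟩ := good_schur (q := m+2) (α := fun i => (κ i : ℚ)) ⟨fun i j hij => by
    rcases hij.eq_or_lt with rfl | h
    · exact le_rfl
    · exact_mod_cast hκ i j (Fin.lt_def.1 h) j.2, ID.of_int _⟩
  have q2 := rA_sN (m+2) 0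
  simp only [Pi.zero_apply, Int.cast_zero] at q2
  change al _ (_ + 0) = _ at q2
  rw [add_zero] at q2
  rw [add_comm _ (rA (m+2)), rA_sN, q2] at e2
  have : sN (m+2) 0 ≠ 0 := (sdN (q := m+2) (κ := 0) fun _ _ _ _ => le_rfl).ne
  have e3 : S = hA (m+2) c := mul_right_cancel₀ this (mul_left_cancel₀ (mono_ne_zero (fun _ => (((m+2:ℕ):ℚ))-1)) (by rw [e, ← e2]; ring))
  rw [← e3]; exact hS
end
end

section
section
variable {t : CType} {z m : ℕ}
theorem p_co {f u : ℕ → ℤ} (hf : ∀ n, f n ≤ -n) (h1 : 1 < q) (u0 : u 0 = 1) (u1 : u 1 = 1) :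
    (pA q 1 * aN q f).coeff (vN q u) = 0 := by
  have := pN (q := q) 1 f
  push_cast at this
  rw [this, ← cf_apply, map_sum]
  refine sum_eq_zero fun i hi => al_coeff_of_not _ _ fun σ hσ => ?_
  have ev : ∀ x : Fin q, f (σ x).val + (if (σ x).val = i then (1:ℤ) else 0) = u x.val - x.val := fun x => by
    have := congrFun hσ x
    change (((f + bp i 1) (σ x).val : ℤ) : ℚ) = ((_ : ℤ) : ℚ) at this
    exact Int.cast_injective (α := ℚ) this
  have a0 := ev ⟨0, bo⟩
  have a1 := ev ⟨1, h1⟩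
  have b0 := hf (σ ⟨0, bo⟩).val
  have b1 := hf (σ ⟨1, h1⟩).val
  simp only [u0, u1] at a0 a1
  have : σ ⟨0, bo⟩ = σ ⟨1, h1⟩ := Fin.ext (by split_ifs at a0 a1 <;> omega)
  simpa using σ.injective this
theorem kle.e {F G : CharRing q} {c : ℚ} (hc : c = 1 ∨ c = -1) (h : kle F G) : kle (eA q c * F) (eA q c * G) := by
  rw [kle, ← mul_sub]; exact KK_eA hc h
theorem const_no (ht : t ≠ CType.C) (hz : 2 ≤ z) (hm2 : 2 ≤ m) (hm : mult t z = m + 2) {x : ℤ} (hx : 2 ≤ x)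
    {g : CharRing (m + 2 + nn z (m+2))}
    (hg : AY t (m+2+nn z (m+2)) (rY t _) * g = AY t (m+2+nn z (m+2)) (rY t _ + Fin.append (fun _ : Fin (m+2) => (x : ℚ)) 0))
    (hb : Bd (mp (resH (wext (wq z (m+2)))) g * al (m+2+1) (rA (m+2+1)))) : False := by
  have hB := D2 ht hz hm (κ := fun _ => x) (fun i _ => by omega) bo hg hb rfl rfl rfl rfl
  simp only [if_neg (show ¬ x = 0 by omega), if_neg (show ¬ x = 1 by omega)] at hB
  have e0 : sN (m+2) (fun _ => x) = mono (fun _ => (x:ℚ)) * sN (m+2) 0 := by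
    rw [sN_al, sN_al, al_const]; congr 1; ext i; simp [vN]; ring
  rw [e0] at hB
  set q := m + 2 with hq
  set a := sN q 0 with ha
  have hB' : Bd (hA q 1 * (hA q mo * (hA q mo * a)) + 2 * (eA q 1 * (eA q mo * (hA q mo * a))) + hA q 1 * (eA q mo * (eA q mo * a))
      + 2 * (eA q mo * a) - pA q 1 * (pA q mo * (pA q mo * (pA q mo * a)))) := by
    refine Bd.unconst (c := x) ?_
    convert hB using 1
    linear_combination - (mono (fun _ => (x:ℚ)) * a) * (pA q mo * pA q mo * ZZ q + (hA q 1 * eA q mo + eA q 1 * hA q mo + (hA q 1 * hA q mo + eA q 1 * eA q mo)) * pA_he q mo)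
  have gh := h_good m (c := 1) (Or.inl rfl)
  have gh' := h_good m (c := -1) (Or.inr rfl)
  push_cast at gh gh'
  have ka : a ∈ KK q := al_mem (sdN (q := q) (κ := 0) fun _ _ _ _ => le_rfl)
  set u : ℕ → ℤ := bp 0 1 + bp 1 1 + bp m mo + bp (m+1) (-3) with hu
  have uA : ∀ i j, i < j → j < q → u j ≤ u i := fun a b h1 h2 => by simp only [hu, bp, Pi.add_apply]; split_ifs <;> omega
  have hS := (sdN uA).sa
  have hh : hA q mo * a = sN q (bp (m+1) (-2)) := by
    have h := hst_rho m
    have q1 := rA_sN' (m+2) 0 (Fin.last (m+1)) 2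
    have q2 := rA_sN (m+2) 0
    simp only [Pi.zero_apply, Int.cast_zero] at q1 q2
    change al _ (_ + 0) = _ at q2
    rw [show (fun _ => 0 : Fin (m+2) → ℚ) = 0 from rfl] at q1
    rw [add_zero] at q1 q2
    push_cast at *
    rw [q1, q2, zero_add] at h
    exact mul_left_cancel₀ (mono_ne_zero (fun _ => (m:ℚ)+2-1)) (by rw [← h]; ring)
  have n1 : kle (sN q (bp m mo + bp (m+1) (-3))) (eA q mo * (hA q mo * a)) := by
    rw [hh]
    have := eN (q := q) (κ := bp (m+1) (-2)) (κ' := bp m mo + bp (m+1) (-3)) m (m+1) bo bo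
      (fun a b h1 h2 => sgm) mo bs sgm
    push_cast at this
    exact this
  have n2 : kle (sN q u) (eA q 1 * sN q (bp m mo + bp (m+1) (-3))) := by
    have := eN (q := q) (κ := bp m mo + bp (m+1) (-3)) (κ' := u) 0 1 bo bo
      (fun a b h1 h2 => sgm) 1 bs fun n _ => by simp only [hu, bp, Pi.add_apply]; split_ifs <;> first | omega | contradiction
    push_cast at this
    exact this
  have n3 : 1 ≤ (eA q 1 * (eA q mo * (hA q mo * a))).coeff (vN q u) := (n2.trans (n1.e (Or.inl rfl))).coeff hS
  have n4 : 0 ≤ (hA q 1 * (hA q mo * (hA q mo * a))).coeff (vN q u) := KK_nonneg (gh.kk (gh'.kk (gh'.kk ka))) hS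
  have n5 : 0 ≤ (hA q 1 * (eA q mo * (eA q mo * a))).coeff (vN q u) := KK_nonneg (gh.kk (KK_eA (Or.inr rfl) (KK_eA (Or.inr rfl) ka))) hS
  have n6 := KK_nonneg (KK_eA (c := -1) (Or.inr rfl) ka) hS
  have n7 : (pA q 1 * (pA q mo * (pA q mo * (pA q mo * a)))).coeff (vN q u) = 0 := by
    have hp := fun f => pN (q := q) mo f
    push_cast at hp
    rw [ha, sN, hp, mul_sum, mul_sum, mul_sum, ← cf_apply, map_sum]
    refine sum_eq_zero fun i _ => ?_
    rw [hp, mul_sum, mul_sum, map_sum]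
    refine sum_eq_zero fun j _ => ?_
    rw [hp, mul_sum, map_sum]
    refine sum_eq_zero fun k _ => ?_
    exact p_co (fun n => by simp only [bp, Pi.add_apply, Pi.zero_apply]; split_ifs <;> omega) bo
      (by simp only [hu, bp, Pi.add_apply]; split_ifs <;> first | omega | contradiction) (by simp only [hu, bp, Pi.add_apply]; split_ifs <;> first | omega | contradiction)
  refine hB'.two (u := vN q u) ?_
  simp only [two_mul, AddMonoidAlgebra.coeff_add, AddMonoidAlgebra.coeff_sub, Finsupp.add_apply, Finsupp.sub_apply]
  linarith
theorem notMF (ht : t ≠ CType.C) (hz : 2 ≤ z) (hm2 : 2 ≤ m) (hm : mult t z = m + 2)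
    {μ : Fin (m + 2 + nn z (m+2)) → ℚ} (hμ : DomY t μ) {g : CharRing (m + 2 + nn z (m+2))}
    (hg : AY t (m+2+nn z (m+2)) (rY t _) * g = AY t (m+2+nn z (m+2)) (rY t _ + μ))
    (hb : Bd (mp (resH (wext (wq z (m+2)))) g * al (m+2+1) (rA (m+2+1)))) :
    μ = 0 ∨ μ = sY _ 1 0 0 ∨ μ = sY _ 2 0 0 ∨ μ = sY _ 3 0 0 ∨ μ = sY _ 1 1 0 ∨ μ = sY _ 1 1 1 := by
  have hk := nn_ge z (m+2)
  have hAD := dom_AD hμ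
  have H1 := dom_AP (K := 1) bo bo hμ
  have H2 := dom_AP (K := 2) bo bo hμ
  have hη := dom_tail hμ
  have hs := app_self μ
  rw [← hs] at hg
  set α := fun j : Fin (m+2) => μ (Fin.castAdd _ j) with hα
  set η := fun j => μ (Fin.natAdd (m+2) j) with hηd
  by_cases hη0 : η = 0
  swap
  · obtain ⟨h1, h2⟩ := case_eta ht hz bo hm H1 hAD hη hη0 hg hb
    rw [h1, h2] at hg H1
    exact (tie_no ht hz hm2 hm H1 hg hb).elim
  rw [hη0] at hg H2
  have j0 : Fin (nn z (m+2)) := ⟨0, bo⟩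
  have hα0 : ∀ i, 0 ≤ α i := fun i => by simpa using H2.le i j0
  by_cases ha0 : α = 0
  · left; rw [← hs, ha0, hη0]; ext i; exact Fin.addCases (fun i => by simp) (fun i => by simp) i
  right
  obtain ⟨i, hi, hij⟩ := corner_ex hAD hα0 ha0
  obtain ⟨c1, c2⟩ := case_one ht hz hm H2 hAD hα0 hg hb hi hij
  obtain ⟨x, hx⟩ : ∃ x : ℤ, α i = x := by
    obtain ⟨x, hx⟩ := H2.int i j0
    exact ⟨x, by simpa using hx⟩
  have hx0 : 0 < x := by rw [hx] at hi; exact_mod_cast hi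
  have hαe : ∀ j, α j = if j ≤ i then (x:ℚ) else 0 := fun j => by
    split_ifs with h
    · rw [c1 j h, hx]
    · exact hij j (not_le.1 h)
  have hμe : ∀ j : Fin (m+2+nn z (m+2)), μ j = if j.val ≤ i.val then (x:ℚ) else 0 := fun j => by
    rw [← hs]
    refine Fin.addCases (fun j => ?_) (fun j => ?_) j
    · rw [Fin.append_left, hαe]; rfl
    · rw [Fin.append_right, hη0, if_neg (by simp; omega)]; rfl
  rcases c2 with h0 | h1 | h1
  · by_cases h4 : 4 ≤ x
    · refine (row_no ht hz hm2 hm h4 (g := g) ?_ hb).elim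
      rw [hg]; congr 3; ext j; rw [hαe, h0, bp]; simp only [Fin.le_zero_iff, Fin.ext_iff, Fin.val_zero]; split_ifs <;> simp
    have hmu : μ = sY _ x 0 0 := by
      ext j; rw [hμe, h0, sY]; simp
    interval_cases x
    · left; simpa using hmu
    · right; left; simpa using hmu
    · right; right; left; simpa using hmu
  · have hx1 : x = 1 := by rw [h1] at hx; exact_mod_cast hx.symm
    subst hx1
    by_cases h3 : 3 ≤ i.val
    · obtain ⟨j, hj⟩ : ∃ j, i.val = j + 3 := ⟨i.val - 3, bo⟩
      have := i.2
      refine (col_no ht hz hm2 hm (j := j) bo (g := g) ?_ hb).elim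
      rw [hg]; congr 3; ext l; rw [hαe, cK]; simp only [Fin.le_def, hj, Nat.lt_succ_iff.symm]; split_ifs <;> simp_all
    have e : ∀ a b c : ℚ, (∀ j : ℕ, (if j ≤ i.val then ((1:ℤ):ℚ) else 0) = if j = 0 then a else if j = 1 then b else if j = 2 then c else 0) → μ = sY _ a b c :=
      fun a b c h => by ext j; rw [hμe, h]; rfl
    rcases (by omega : i.val = 0 ∨ i.val = 1 ∨ i.val = 2) with h | h | h
    · left; exact e _ _ _ fun j => by rw [h]; split_ifs <;> first | omega | simp
    · right; right; right; left; exact e _ _ _ fun j => by rw [h]; split_ifs <;> first | omega | simp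
    · right; right; right; right; exact e _ _ _ fun j => by rw [h]; split_ifs <;> first | omega | simp
  · by_cases h2 : 2 ≤ x
    · refine (const_no ht hz hm2 hm h2 (g := g) ?_ hb).elim
      rw [hg]; congr 3; ext l; rw [hαe, h1, if_pos (Fin.le_last l)]
    have hx1 : x = 1 := by omega
    subst hx1
    refine (col_no ht hz hm2 hm (j := m-2) bo (g := g) ?_ hb).elim
    rw [hg]; congr 3; ext l; rw [hαe, cK, h1, if_pos (Fin.le_last l), if_pos bo]
end
end

section
def K6 (N : ℕ) (a b c d e f : ℤ) : ℕ → ℤ := fun n =>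
  bp 0 a n + bp 1 b n + bp 2 c n + bp (N-1) d n + bp (N-2) e n + bp (N-3) f n
def V6 (N : ℕ) (a b c d e f : ℤ) : CharRing N := sN N (K6 N a b c d e f)
section
variable {N : ℕ} {a b c d e f : ℤ}
theorem pS {c : ℤ} {c' : ℚ} (hc : c' = c) {f : ℕ → ℤ} (s : Finset ℕ) (hs : ∀ i ∈ s, i < q)
    (h : ∀ n < q, n ∉ s → ∃ j < q, j ≠ n ∧ f j - j = f n - n + c) :
    pA q c' * sN q f = ∑ i ∈ s, sN q (f + bp i c) := by
  rw [hc, sN, pNs c _ s hs h]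
  exact sum_congr rfl fun i _ => aN_congr fun n _ => by simp only [Pi.add_apply]; ring
theorem bp_add (i n : ℕ) (x y : ℤ) : bp i (x + y) n = bp i x n + bp i y n := by simp only [bp]; split_ifs <;> simp
theorem bp_same (i : ℕ) (x : ℤ) : bp i x i = x := if_pos rfl
theorem bp_ne {i n : ℕ} (h : n ≠ i) (x : ℤ) : bp i x n = 0 := if_neg h
theorem k0 (h : 5 ≤ N) : K6 N a b c d e f 0 = a := by
  simp only [K6]; rw [bp_same, bp_ne bo, bp_ne bo, bp_ne bo, bp_ne bo, bp_ne bo]; ring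
theorem k1 (h : 5 ≤ N) : K6 N a b c d e f 1 = b := by
  simp only [K6]; rw [bp_same, bp_ne bo, bp_ne bo, bp_ne bo, bp_ne bo, bp_ne bo]; ring
theorem k2 (h : 5 ≤ N) : K6 N a b c d e f 2 = c + bp (N-3) f 2 := by
  simp only [K6]; rw [bp_same, bp_ne bo, bp_ne bo, bp_ne bo, bp_ne bo]; ring
theorem k5 (h : 5 ≤ N) : K6 N a b c d e f (N-1) = d := by
  simp only [K6]; rw [bp_same, bp_ne bo, bp_ne bo, bp_ne bo, bp_ne bo, bp_ne bo]; ring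
theorem k4 (h : 5 ≤ N) : K6 N a b c d e f (N-2) = e := by
  simp only [K6]; rw [bp_same, bp_ne bo, bp_ne bo, bp_ne bo, bp_ne bo, bp_ne bo]; ring
theorem k3 (h : 5 ≤ N) : K6 N a b c d e f (N-3) = bp 2 c (N-3) + f := by
  simp only [K6]; rw [bp_same, bp_ne (i := 0) bo, bp_ne (i := 1) bo, bp_ne (i := N-1) bo, bp_ne (i := N-2) bo]; ring
theorem km (n : ℕ) (h : 3 ≤ n) (h' : n + 3 < N) : K6 N a b c d e f n = 0 := by
  simp only [K6]; rw [bp_ne bo, bp_ne bo, bp_ne bo, bp_ne bo, bp_ne bo, bp_ne bo]; ring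
theorem up1 (hN : 5 ≤ N) (ha : b ≤ a) (hb : 0 ≤ b) (hd : d ≤ e) (he : e ≤ f) (hf : f ≤ 0) (h5 : N = 5 → b = 0 ∨ f = 0) :
    pA N 1 * V6 N a b 0 d e f = V6 N (a+1) b 0 d e f + ((if b < a then V6 N a (b+1) 0 d e f else 0)
      + ((if 0 < b then V6 N a b 1 d e f else 0) + ((if d < e then V6 N a b 0 (d+1) e f else 0)
      + ((if e < f then V6 N a b 0 d (e+1) f else 0) + if f < 0 then V6 N a b 0 d e (f+1) else 0)))) := by
  have z : ∀ i j, i = j + 1 → i < N → K6 N a b 0 d e f j = K6 N a b 0 d e f i → sN N (K6 N a b 0 d e f + bp i 1) = 0 := fun i j hij hi h =>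
    sN_zero j i bo hi bo (by simp only [Pi.add_apply, h, bp_same]; rw [bp_ne bo]; omega)
  have r0 : sN N (K6 N a b 0 d e f + bp 0 1) = V6 N (a+1) b 0 d e f := sN_eq fun n _ => by
    simp only [K6, Pi.add_apply, bp_add]; ring
  have r1 : sN N (K6 N a b 0 d e f + bp 1 1) = if b < a then V6 N a (b+1) 0 d e f else 0 := by
    split_ifs
    · exact sN_eq fun n _ => by simp only [K6, Pi.add_apply, bp_add]; ring
    · exact z 1 0 rfl bo (by rw [k0 hN, k1 hN]; omega)
  have r5 : sN N (K6 N a b 0 d e f + bp (N-1) 1) = if d < e then V6 N a b 0 (d+1) e f else 0 := by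
    split_ifs
    · exact sN_eq fun n _ => by simp only [K6, Pi.add_apply, bp_add]; ring
    · exact z (N-1) (N-2) bo bo (by rw [k4 hN, k5 hN]; omega)
  have r4 : sN N (K6 N a b 0 d e f + bp (N-2) 1) = if e < f then V6 N a b 0 d (e+1) f else 0 := by
    split_ifs
    · exact sN_eq fun n _ => by simp only [K6, Pi.add_apply, bp_add]; ring
    · exact z (N-2) (N-3) bo bo (by rw [k4 hN, k3 hN]; simp only [bp]; split_ifs <;> omega)
  have r3 : f < 0 → sN N (K6 N a b 0 d e f + bp (N-3) 1) = V6 N a b 0 d e (f+1) := fun h =>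
    sN_eq fun n _ => by simp only [K6, Pi.add_apply, bp_add]; ring
  have r2 : 0 < b → sN N (K6 N a b 0 d e f + bp 2 1) = V6 N a b 1 d e f := fun h =>
    sN_eq fun n _ => by simp only [K6, Pi.add_apply, bp]; split_ifs <;> ring
  by_cases h6 : N = 5
  · have e5 := pS (q := N) (c := 1) (c' := 1) bs (f := K6 N a b 0 d e f) {0, 1, 2, N-1, N-2} (by simp; omega) (by
      intro n hn h; simp at h; omega)
    rw [V6, e5, sum_insert (by simp; omega), sum_insert (by simp; omega), sum_insert (by simp; omega), Finset.sum_pair bo, r0, r1, r4, r5]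
    congr 2
    rcases h5 h6 with h | h
    · rw [if_neg (show ¬ 0 < b by omega)]
      by_cases hf0 : f < 0
      · rw [if_pos hf0, ← r3 hf0, show N - 3 = 2 by omega]; ring
      · rw [if_neg hf0, z 2 1 rfl bo (by rw [k1 hN, k2 hN]; simp only [bp]; split_ifs <;> omega)]; ring
    · rw [if_neg (show ¬ f < 0 by omega)]
      by_cases hb0 : 0 < b
      · rw [r2 hb0, if_pos hb0, add_zero]
      · rw [if_neg hb0, z 2 1 rfl bo (by rw [k1 hN, k2 hN]; simp only [bp]; split_ifs <;> omega), add_zero]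
  · have e5 := pS (q := N) (c := 1) (c' := 1) bs (f := K6 N a b 0 d e f) {0, 1, 2, N-1, N-2, N-3} (by simp; omega) (by
      intro n hn h; simp at h; refine ⟨n-1, bo, bo, ?_⟩
      rw [km n bo bo]
      by_cases h3 : n = 3
      · rw [h3, k2 hN, bp_ne bo]; omega
      · rw [km _ bo bo]; omega)
    rw [V6, e5, sum_insert (by simp; omega), sum_insert (by simp; omega), sum_insert (by simp; omega), sum_insert (by simp; omega), Finset.sum_pair bo, r0, r1, r4, r5]
    have q2 : sN N (K6 N a b 0 d e f + bp 2 1) = if 0 < b then V6 N a b 1 d e f else 0 := by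
      split_ifs with h
      · exact r2 h
      · exact z 2 1 rfl bo (by rw [k1 hN, k2 hN]; simp only [bp]; split_ifs <;> omega)
    have q3 : sN N (K6 N a b 0 d e f + bp (N-3) 1) = if f < 0 then V6 N a b 0 d e (f+1) else 0 := by
      split_ifs with h
      · exact r3 h
      · refine z (N-3) (N-4) bo bo ?_
        by_cases h7 : N = 6
        · subst h7; rw [k3 hN, k2 hN]; simp [bp]; omega
        · rw [k3 hN, km _ bo bo, bp_ne bo]; omega
    rw [q2, q3]
end
end

section
section
variable {N : ℕ} {d e f : ℤ}
theorem tp (hN : 5 ≤ N) (a b x : ℤ) (i : ℕ) (hi : i < 2) {f₁ g : ℕ → ℤ} (hf : ∀ n, f₁ n = K6 N a b x d e f n)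
    {a' b' x' : ℤ} (h : i = 0 ∧ a' = b - 1 ∧ b' = a + 1 ∧ x' = x ∨ i = 1 ∧ N ≠ 5 ∧ a' = a ∧ b' = x - 1 ∧ x' = b + 1)
    (hg : ∀ n, g n = K6 N a' b' x' d e f n) : sN N f₁ = - sN N g := by
  refine sN_swap i (i+1) bo bo bo fun n hn => ?_
  rw [hg, hf, hf, hf]
  rcases h with ⟨rfl, rfl, rfl, rfl⟩ | ⟨rfl, h5, rfl, rfl, rfl⟩
  · simp only [zero_add, k0 hN, k1 hN]
    split_ifs with h0 h1
    · rw [h0, k0 hN]; push_cast; ring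
    · rw [h1, k1 hN]; push_cast; ring
    · simp only [K6]; rw [bp_ne h0, bp_ne h0, bp_ne h1, bp_ne h1]
  · simp only [show 1 + 1 = 2 from rfl, k2 hN, k1 hN]
    rw [bp_ne bo]
    split_ifs with h0 h1
    · rw [h0, k1 hN]; push_cast; ring
    · rw [h1, k2 hN, bp_ne bo]; push_cast; ring
    · simp only [K6]; rw [bp_ne h0, bp_ne h0, bp_ne h1, bp_ne h1]
theorem bt6 (hN : 5 ≤ N) (i : ℕ) (hi : i < 2) {f₁ g : ℕ → ℤ} (hf : ∀ n, f₁ n = K6 N 0 0 0 d e f n)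
    {d' e' f' : ℤ} (h : i = 0 ∧ d' = e + 1 ∧ e' = d - 1 ∧ f' = f ∨ i = 1 ∧ d' = d ∧ e' = f + 1 ∧ f' = e - 1)
    (hg : ∀ n, g n = K6 N 0 0 0 d' e' f' n) : sN N f₁ = - sN N g := by
  refine sN_swap (N - 2 - i) (N - 1 - i) bo bo bo fun n hn => ?_
  rw [hg, hf, hf, hf]
  rcases h with ⟨rfl, rfl, rfl, rfl⟩ | ⟨rfl, rfl, rfl, rfl⟩
  · simp only [Nat.sub_zero, k4 hN, k5 hN]
    split_ifs with h0 h1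
    · rw [h0, k4 hN]; omega
    · rw [h1, k5 hN]; omega
    · simp only [K6]; rw [bp_ne h0, bp_ne h0, bp_ne h1, bp_ne h1]
  · simp only [show N - 1 - 1 = N - 2 by omega, show N - 2 - 1 = N - 3 by omega, k3 hN, k4 hN]
    rw [show bp 2 0 (N-3) = 0 by simp [bp]]
    split_ifs with h0 h1
    · rw [h0, k3 hN, show bp 2 0 (N-3) = 0 by simp [bp]]; omega
    · rw [h1, k4 hN]; omega
    · simp only [K6]; rw [bp_ne h0, bp_ne h0, bp_ne h1, bp_ne h1]
theorem add0 (a b c d e f x : ℤ) (n : ℕ) : (K6 N a b c d e f + bp 0 x) n = K6 N (a+x) b c d e f n := by simp only [K6, Pi.add_apply, bp_add]; ring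
theorem add1 (a b c d e f x : ℤ) (n : ℕ) : (K6 N a b c d e f + bp 1 x) n = K6 N a (b+x) c d e f n := by simp only [K6, Pi.add_apply, bp_add]; ring
theorem add2 (a b c d e f x : ℤ) (n : ℕ) : (K6 N a b c d e f + bp 2 x) n = K6 N a b (c+x) d e f n := by simp only [K6, Pi.add_apply, bp_add]; ring
theorem add5 (a b c d e f x : ℤ) (n : ℕ) : (K6 N a b c d e f + bp (N-1) x) n = K6 N a b c (d+x) e f n := by simp only [K6, Pi.add_apply, bp_add]; ring
theorem add4 (a b c d e f x : ℤ) (n : ℕ) : (K6 N a b c d e f + bp (N-2) x) n = K6 N a b c d (e+x) f n := by simp only [K6, Pi.add_apply, bp_add]; ring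
theorem add3 (a b c d e f x : ℤ) (n : ℕ) : (K6 N a b c d e f + bp (N-3) x) n = K6 N a b c d e (f+x) n := by simp only [K6, Pi.add_apply, bp_add]; ring
theorem dn1 (hN : 5 ≤ N) : pA N mo * V6 N 0 0 0 0 0 0 = V6 N 0 0 0 mo 0 0 := by
  rw [V6, p1 (c := -1) bs (N-1) bo fun n hn h => ⟨n+1, bo, bo, by simp only [K6, bp, ite_self]; push_cast; ring⟩]
  exact sN_eq fun n _ => by rw [add5]; rfl
theorem dn2 (hN : 5 ≤ N) : pA N mo * V6 N 0 0 0 mo 0 0 = V6 N 0 0 0 (-2) 0 0 + V6 N 0 0 0 mo mo 0 := by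
  rw [V6, p2 (c := -1) bs (N-1) (N-2) bo bo bo fun n hn h h' => ⟨n+1, bo, bo, by
    simp only [K6, bp, ite_self]; push_cast; split_ifs <;> omega⟩]
  exact congrArg₂ _ (sN_eq fun n _ => by rw [add5]; rfl) (sN_eq fun n _ => by rw [add4]; rfl)
theorem dn3 (hN : 5 ≤ N) : pA N mo * V6 N 0 0 0 (-2) 0 0 = V6 N 0 0 0 (-3) 0 0 + V6 N 0 0 0 (-2) mo 0 := by
  rw [V6, p2 (c := -1) bs (N-1) (N-2) bo bo bo fun n hn h h' => ⟨n+1, bo, bo, by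
    simp only [K6, bp, ite_self]; push_cast; split_ifs <;> omega⟩]
  exact congrArg₂ _ (sN_eq fun n _ => by rw [add5]; rfl) (sN_eq fun n _ => by rw [add4]; rfl)
theorem dn4 (hN : 5 ≤ N) : pA N mo * V6 N 0 0 0 mo mo 0 = V6 N 0 0 0 (-2) mo 0 + V6 N 0 0 0 mo mo mo := by
  rw [V6, p2 (c := -1) bs (N-1) (N-3) bo bo bo fun n hn h h' => ⟨n+1, bo, bo, by
    simp only [K6, bp, ite_self]; push_cast; split_ifs <;> omega⟩]
  exact congrArg₂ _ (sN_eq fun n _ => by rw [add5]; rfl) (sN_eq fun n _ => by rw [add3]; rfl)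
theorem dn5 (hN : 5 ≤ N) : pA N (-2) * V6 N 0 0 0 0 0 0 = V6 N 0 0 0 (-2) 0 0 - V6 N 0 0 0 mo mo 0 := by
  rw [V6, p2 (c := -2) bs (N-1) (N-2) bo bo bo fun n hn h h' => ⟨n+2, bo, bo, by
    simp only [K6, bp, ite_self]; push_cast; ring⟩, sub_eq_add_neg]
  exact congrArg₂ _ (sN_eq fun n _ => by rw [add5]; rfl) (bt6 hN 0 bo (add4 _ _ _ _ _ _ _) bs fun _ => rfl)
theorem dn6 (hN : 5 ≤ N) : pA N (-2) * V6 N 0 0 0 mo 0 0 = V6 N 0 0 0 (-3) 0 0 - V6 N 0 0 0 mo mo mo := by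
  rw [V6, p2 (c := -2) bs (N-1) (N-3) bo bo bo fun n hn h h' => by
    by_cases h2 : n = N - 2
    · exact ⟨N-1, bo, bo, by rw [h2, k5 hN, k4 hN]; omega⟩
    · exact ⟨n+2, bo, bo, by simp only [K6, bp, ite_self]; push_cast; split_ifs <;> omega⟩, sub_eq_add_neg]
  exact congrArg₂ _ (sN_eq fun n _ => by rw [add5]; rfl) (bt6 hN 1 bo (add3 _ _ _ _ _ _ _) bs fun _ => rfl)
theorem dn7 (hN : 5 ≤ N) : pA N (-3) * V6 N 0 0 0 0 0 0 = V6 N 0 0 0 (-3) 0 0 - V6 N 0 0 0 (-2) mo 0 + V6 N 0 0 0 mo mo mo := by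
  rw [V6, p3 (c := -3) bs (N-1) (N-2) (N-3) bo bo bo bo bo bo fun n hn h h' h'' => ⟨n+3, bo, bo, by
    simp only [K6, bp, ite_self]; push_cast; ring⟩, sub_eq_add_neg]
  refine congrArg₂ _ (congrArg₂ _ (sN_eq fun n _ => by rw [add5]; rfl) (bt6 hN 0 bo (add4 _ _ _ _ _ _ _) bs fun _ => rfl)) ?_
  rw [bt6 hN 1 bo (add3 _ _ _ _ _ _ _) (d' := 0) (e' := 1 - 3 + 0) (f' := -1) bs fun _ => rfl, bt6 hN 0 bo (fun _ => rfl) (d' := -1) (e' := -1) (f' := -1) bs fun _ => rfl, neg_neg]; rfl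
def E6 (N : ℕ) : CharRing N := if N = 5 then 0 else V6 N 1 1 1 mo mo mo
theorem u2a (hN : 5 ≤ N) (hd : d ≤ -2) : pA N 2 * V6 N 0 0 0 d 0 0 = V6 N 2 0 0 d 0 0 - V6 N 1 1 0 d 0 0 + V6 N 0 0 0 (d+2) 0 0 := by
  rw [V6, p3 (c := 2) bs 0 1 (N-1) bo bo bo bo bo bo fun n hn h h' h'' => ⟨n-2, bo, bo, by
    simp only [K6, bp, ite_self]; split_ifs <;> omega⟩, sub_eq_add_neg]
  exact congrArg₂ _ (congrArg₂ _ (sN_eq fun n _ => by rw [add0]; rfl) (tp hN _ _ _ 0 bo (add1 _ _ _ _ _ _ _) bs fun _ => rfl))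
    (sN_eq fun n _ => by rw [add5])
theorem u2b (hN : 5 ≤ N) : pA N 2 * V6 N 0 0 0 mo mo 0 = V6 N 2 0 0 mo mo 0 - V6 N 1 1 0 mo mo 0 - V6 N 0 0 0 0 0 0 := by
  rw [V6, p3 (c := 2) bs 0 1 (N-1) bo bo bo bo bo bo fun n hn h h' h'' => by
    by_cases h2 : n = N - 2
    · exact ⟨N-3, bo, bo, by rw [h2, k3 hN, k4 hN]; simp only [bp, ite_self]; omega⟩
    · exact ⟨n-2, bo, bo, by simp only [K6, bp, ite_self]; split_ifs <;> omega⟩, sub_eq_add_neg, sub_eq_add_neg]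
  exact congrArg₂ _ (congrArg₂ _ (sN_eq fun n _ => by rw [add0]; rfl) (tp hN _ _ _ 0 bo (add1 _ _ _ _ _ _ _) bs fun _ => rfl))
    (bt6 hN 0 bo (add5 _ _ _ _ _ _ _) bs fun _ => rfl)
theorem u2c (hN : 5 ≤ N) : pA N 2 * V6 N 0 0 0 mo mo mo = V6 N 2 0 0 mo mo mo - V6 N 1 1 0 mo mo mo - V6 N 0 0 0 mo 0 0 := by
  rw [V6, p3 (c := 2) bs 0 1 (N-2) bo bo bo bo bo bo fun n hn h h' h'' => by
    by_cases h2 : n = N - 3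
    · exact ⟨N-4, bo, bo, by rw [h2]; simp only [K6, bp, ite_self]; split_ifs <;> omega⟩
    · exact ⟨n-2, bo, bo, by simp only [K6, bp, ite_self]; split_ifs <;> omega⟩, sub_eq_add_neg, sub_eq_add_neg]
  exact congrArg₂ _ (congrArg₂ _ (sN_eq fun n _ => by rw [add0]; rfl) (tp hN _ _ _ 0 bo (add1 _ _ _ _ _ _ _) bs fun _ => rfl))
    (bt6 hN 1 bo (add4 _ _ _ _ _ _ _) bs fun _ => rfl)
theorem p4 {c : ℤ} {c' : ℚ} (hc : c' = c) {f : ℕ → ℤ} (hN : 5 ≤ N)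
    (h : ∀ n < N, n ≠ 0 → n ≠ 1 → n ≠ 2 → n ≠ N-1 → ∃ j < N, j ≠ n ∧ f j - j = f n - n + c) :
    pA N c' * sN N f = sN N (f + bp 0 c) + sN N (f + bp 1 c) + sN N (f + bp 2 c) + sN N (f + bp (N-1) c) := by
  rw [pS hc {0, 1, 2, N-1} (by simp; omega) (fun n hn hn' => by simp at hn'; exact h n hn hn'.1 hn'.2.1 hn'.2.2.1 hn'.2.2.2),
    sum_insert (by simp; omega), sum_insert (by simp; omega), Finset.sum_pair bo, ← add_assoc, ← add_assoc]
theorem t3 (h5 : N ≠ 5) (hN : 5 ≤ N) : sN N (K6 N 0 0 0 d e f + bp 2 3) = V6 N 1 1 1 d e f := by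
  rw [tp hN 0 0 3 1 bo (fun n => by rw [add2]; rfl) (a' := 0) (b' := 2) (x' := 1) (by simp [h5]) fun _ => rfl,
    tp hN 0 2 1 0 bo (fun _ => rfl) (a' := 1) (b' := 1) (x' := 1) bs fun _ => rfl, neg_neg]; rfl
theorem t3' (hN : 5 ≤ N) : sN N (K6 N 0 0 0 d e 0 + bp 2 3) = V6 N 1 1 1 d e 0 := by
  by_cases h5 : N = 5
  · subst h5
    have w : ∀ g g' : ℕ → ℤ, (∀ n, g' n = if n = 1 then g 2 - 1 else if n = 2 then g 1 + 1 else g n) → sN 5 g = - sN 5 g' := fun g g' h =>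
      sN_swap 1 2 bo bo bo fun n _ => by rw [h]; split_ifs <;> push_cast <;> omega
    rw [w _ (K6 5 0 2 1 d e 0) fun n => by simp only [K6, bp, Pi.add_apply]; split_ifs <;> omega,
      tp hN 0 2 1 0 bo (fun _ => rfl) (a' := 1) (b' := 1) (x' := 1) bs fun _ => rfl, neg_neg]; rfl
  · exact t3 h5 hN
theorem u3a (hN : 5 ≤ N) : pA N 3 * V6 N 0 0 0 (-3) 0 0 = V6 N 3 0 0 (-3) 0 0 - V6 N 2 1 0 (-3) 0 0 + V6 N 1 1 1 (-3) 0 0 + V6 N 0 0 0 0 0 0 := by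
  rw [V6, p4 (c := 3) bs hN fun n hn h h' h'' _ => ⟨n-3, bo, bo, by
    simp only [K6, bp, ite_self]; split_ifs <;> omega⟩, sub_eq_add_neg, t3' hN]
  exact congrArg₂ _ (congrArg₂ _ (congrArg₂ _ (sN_eq fun n _ => by rw [add0]; rfl) (tp hN _ _ _ 0 bo (add1 _ _ _ _ _ _ _) bs fun _ => rfl))
    rfl) (sN_eq fun n _ => by rw [add5]; rfl)
theorem u3b (hN : 5 ≤ N) : pA N 3 * V6 N 0 0 0 (-2) mo 0 = V6 N 3 0 0 (-2) mo 0 - V6 N 2 1 0 (-2) mo 0 + V6 N 1 1 1 (-2) mo 0 - V6 N 0 0 0 0 0 0 := by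
  rw [V6, p4 (c := 3) bs hN fun n hn h h' h'' _ => by
    by_cases h2 : n = N - 2
    · exact ⟨N-4, bo, bo, by rw [h2]; simp only [K6, bp, ite_self]; split_ifs <;> omega⟩
    · exact ⟨n-3, bo, bo, by simp only [K6, bp, ite_self]; split_ifs <;> omega⟩, sub_eq_add_neg, sub_eq_add_neg, t3' hN]
  exact congrArg₂ _ (congrArg₂ _ (congrArg₂ _ (sN_eq fun n _ => by rw [add0]; rfl) (tp hN _ _ _ 0 bo (add1 _ _ _ _ _ _ _) bs fun _ => rfl))
    rfl) (bt6 hN 0 bo (add5 _ _ _ _ _ _ _) bs fun _ => rfl)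
theorem u3c (hN : 5 ≤ N) : pA N 3 * V6 N 0 0 0 mo mo mo = V6 N 3 0 0 mo mo mo - V6 N 2 1 0 mo mo mo + E6 N + V6 N 0 0 0 0 0 0 := by
  have hl : sN N (K6 N 0 0 0 mo mo mo + bp (N-1) 3) = V6 N 0 0 0 0 0 0 := by
    rw [bt6 hN 0 bo (add5 _ _ _ _ _ _ _) (d' := 0) (e' := 1) (f' := -1) bs fun _ => rfl,
      bt6 hN 1 bo (fun _ => rfl) (d' := 0) (e' := 0) (f' := 0) bs fun _ => rfl, neg_neg]; rfl
  rw [V6, p4 (c := 3) bs hN fun n hn h h' h'' _ => by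
    by_cases h2 : n = N - 2
    · exact ⟨N-4, bo, bo, by rw [h2]; simp only [K6, bp, ite_self]; split_ifs <;> omega⟩
    · by_cases h3 : n = N - 3
      · exact ⟨N-5, bo, bo, by rw [h3]; simp only [K6, bp, ite_self]; split_ifs <;> first | omega | contradiction⟩
      · exact ⟨n-3, bo, bo, by simp only [K6, bp, ite_self]; split_ifs <;> first | omega | contradiction⟩, sub_eq_add_neg, hl]
  refine congrArg₂ _ (congrArg₂ _ (congrArg₂ _ (sN_eq fun n _ => by rw [add0]; rfl) (tp hN _ _ _ 0 bo (add1 _ _ _ _ _ _ _) bs fun _ => rfl)) ?_) rfl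
  rw [E6]
  split_ifs with h5
  · exact sN_zero 0 2 bo bo bo (by subst h5; simp [K6, bp])
  · exact t3 h5 hN
theorem u1E (hN : 5 ≤ N) : pA N 1 * V6 N 1 1 0 mo mo mo = V6 N 2 1 0 mo mo mo + E6 N + V6 N 1 1 0 mo mo 0 := by
  rw [E6]
  split_ifs with h5
  · rw [V6, p2 (c := 1) bs 0 2 bo bo bo fun n hn h h' => ⟨n-1, bo, bo, by
      subst h5; simp only [K6, bp, ite_self]; split_ifs <;> omega⟩, add_zero]
    exact congrArg₂ _ (sN_eq fun n _ => by rw [add0]; rfl) (sN_eq fun n _ => by subst h5; simp [K6, bp]; split_ifs <;> omega)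
  · rw [up1 hN bo bo bo bo bo bo]
    norm_num
    ring
end
end

section
section
variable {N : ℕ}
theorem up1' (hN : 5 ≤ N) {a b d e f : ℤ} (h : b ≤ a ∧ 0 ≤ b ∧ d ≤ e ∧ e ≤ f ∧ f ≤ 0 ∧ (b = 0 ∨ f = 0)) :
    pA N 1 * V6 N a b 0 d e f = V6 N (a+1) b 0 d e f + ((if b < a then V6 N a (b+1) 0 d e f else 0)
      + ((if 0 < b then V6 N a b 1 d e f else 0) + ((if d < e then V6 N a b 0 (d+1) e f else 0)
      + ((if e < f then V6 N a b 0 d (e+1) f else 0) + if f < 0 then V6 N a b 0 d e (f+1) else 0)))) :=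
  up1 hN h.1 h.2.1 h.2.2.1 h.2.2.2.1 h.2.2.2.2.1 fun _ => h.2.2.2.2.2
abbrev T6 := ℤ × ℤ × ℤ × ℤ × ℤ × ℤ
def K6' (N : ℕ) (x : T6) : ℕ → ℤ := K6 N x.1 x.2.1 x.2.2.1 x.2.2.2.1 x.2.2.2.2.1 x.2.2.2.2.2
def sD : List T6 := [(2,0,0,-1,-1,0), (1,1,0,-2,0,0), (1,0,0,-1,0,0)]
def sS : List T6 := [(2,0,0,-2,0,0), (1,1,0,-1,-1,0), (1,0,0,-1,0,0)]
def sT : List T6 := [(3,0,0,-3,0,0), (2,1,0,-2,-1,0), (2,0,0,-2,0,0), (1,1,0,-1,-1,0), (2,0,0,-1,-1,0), (1,1,0,-2,0,0), (1,0,0,-1,0,0), (0,0,0,0,0,0)]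
def sU : List T6 := [(3,0,0,-1,-1,-1), (1,1,1,-3,0,0), (2,1,0,-2,-1,0), (2,0,0,-2,0,0), (1,1,0,-1,-1,0), (2,0,0,-1,-1,0), (1,1,0,-2,0,0), (1,0,0,-1,0,0), (0,0,0,0,0,0)]
def sT' (N : ℕ) : List T6 := if N = 5 then sT else (1,1,1,-1,-1,-1) :: sT
def S6 (N : ℕ) (s : List T6) : CharRing N := (s.map fun x => sN N (K6' N x)).sum
theorem six_cancel {x y : CharRing q} (h : 6 * x = 6 * y) : x = y := by
  have h' : x + x + x + x + x + x = y + y + y + y + y + y := by linear_combination h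
  exact AddMonoidAlgebra.ext <| Finsupp.ext fun v => by
    have := congrArg (fun z : CharRing q => z.coeff v) h'
    simp only [AddMonoidAlgebra.coeff_add, Finsupp.add_apply] at this
    omega
theorem Qs (hN : 5 ≤ N) {P : ℚ → CharRing N} (hP : pA N = P) {A R₁ R₂ R₃ : CharRing N} (hA : V6 N 0 0 0 0 0 0 = A)
    (h₁ : R₁ = P 1 * P mo - 1) (h₂ : R₂ = P 2 * P (-2) - 1) (h₃ : R₃ = P 3 * P (-3) - 1) :
    R₁ * A = S6 N [(1,0,0,-1,0,0)] ∧
    (∀ f, 2 * f = R₁ ^ 2 - R₂ → f * A = S6 N sD) ∧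
    (∀ f, 2 * f = R₁ ^ 2 + R₂ - 2 → f * A = S6 N sS) ∧
    (∀ f, 6 * f = R₁ ^ 3 + 3 * R₁ * R₂ + 2 * R₃ - 6 * R₁ → f * A = S6 N (sT' N)) ∧
    ∀ f, 6 * f = R₁ ^ 3 - 3 * R₁ * R₂ + 2 * R₃ → f * A = S6 N sU := by
  have h1 := up1' hN (a := 0) (b := 0) (d := -1) (e := 0) (f := 0) bd
  have h2 := up1' hN (a := 0) (b := 0) (d := -2) (e := 0) (f := 0) bd
  have h3 := up1' hN (a := 0) (b := 0) (d := -1) (e := -1) (f := 0) bd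
  have h4 := up1' hN (a := 1) (b := 0) (d := -2) (e := 0) (f := 0) bd
  have h5 := up1' hN (a := 1) (b := 0) (d := -1) (e := -1) (f := 0) bd
  have h6 := up1' hN (a := 0) (b := 0) (d := -3) (e := 0) (f := 0) bd
  have h7 := up1' hN (a := 1) (b := 0) (d := -3) (e := 0) (f := 0) bd
  have h8 := up1' hN (a := 2) (b := 0) (d := -3) (e := 0) (f := 0) bd
  have h9 := up1' hN (a := 1) (b := 1) (d := -3) (e := 0) (f := 0) bd
  have g1 := up1' hN (a := 0) (b := 0) (d := -2) (e := -1) (f := 0) bd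
  have g2 := up1' hN (a := 1) (b := 0) (d := -2) (e := -1) (f := 0) bd
  have g3 := up1' hN (a := 2) (b := 0) (d := -2) (e := -1) (f := 0) bd
  have g4 := up1' hN (a := 1) (b := 1) (d := -2) (e := -1) (f := 0) bd
  have g5 := up1' hN (a := 0) (b := 0) (d := -1) (e := -1) (f := -1) bd
  have g6 := up1' hN (a := 1) (b := 0) (d := -1) (e := -1) (f := -1) bd
  have g7 := up1' hN (a := 2) (b := 0) (d := -1) (e := -1) (f := -1) bd
  have g8 := u1E hN
  have i1 := u2a hN (d := -2) bd
  have i2 := u2a hN (d := -3) bd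
  have i3 := u2b hN
  have i4 := u2c hN
  have i5 := u3a hN
  have i6 := u3b hN
  have i7 := u3c hN
  have j1 := dn1 hN
  have j2 := dn2 hN
  have j3 := dn3 hN
  have j4 := dn4 hN
  have j5 := dn5 hN
  have j6 := dn6 hN
  have j7 := dn7 hN
  norm_num at h1 h2 h3 h4 h5 h6 h7 h8 h9 g1 g2 g3 g4 g5 g6 g7 i1 i2
  have hT : S6 N (sT' N) = E6 N + S6 N sT := by
    simp only [sT', E6]; split_ifs
    · rw [zero_add]
    · simp only [S6, List.map_cons, List.sum_cons]; rfl
  simp only [hT]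
  simp only [S6, sD, sS, sT, sU, List.map_cons, List.sum_cons, List.map_nil, List.sum_nil]
  simp only [K6', ← V6.eq_1]
  rw [hP] at *
  rw [hA] at *
  have q1 : P 1 * (P mo * A) = V6 N 1 0 0 mo 0 0 + A := by rw [j1, h1]
  have q11 : P 1 * (P 1 * (P mo * (P mo * A))) = P 1 * (P 1 * (P mo * (P mo * A))) := rfl
  conv at q11 => rhs; simp only [h1, h2, h3, h4, h5, j1, j2, mul_add]
  have q2 : P 2 * (P (-2) * A) = P 2 * (P (-2) * A) := rfl
  conv at q2 => rhs; simp only [j5, i1, i3, mul_sub]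
  have q111 : P 1 * (P 1 * (P 1 * (P mo * (P mo * (P mo * A))))) = P 1 * (P 1 * (P 1 * (P mo * (P mo * (P mo * A))))) := rfl
  conv at q111 => rhs; simp only [h1, h2, h3, h4, h5, h6, h7, h8, h9, g1, g2, g3, g4, g5, g6, g7, g8, j1, j2, j3, j4, mul_add]
  have q12 : P 1 * (P 2 * (P (-2) * (P mo * A))) = P 1 * (P 2 * (P (-2) * (P mo * A))) := rfl
  conv at q12 => rhs; simp only [h1, h8, h9, g7, g8, i2, i4, j1, j6, mul_add, mul_sub]
  have q3 : P 3 * (P (-3) * A) = P 3 * (P (-3) * A) := rfl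
  conv at q3 => rhs; simp only [j7, i5, i6, i7, mul_add, mul_sub]
  subst h₁ h₂ h₃
  refine ⟨?_, fun f hf => two_cancel ?_, fun f hf => two_cancel ?_, fun f hf => six_cancel ?_, fun f hf => six_cancel ?_⟩
  · linear_combination q1
  · linear_combination A * hf + q11 - q2 - 2 * q1
  · linear_combination A * hf + q11 + q2 - 2 * q1
  · linear_combination A * hf + q111 + 3 * q12 + 2 * q3 - 3 * q11 - 3 * q2 - 6 * q1
  · linear_combination A * hf + q111 - 3 * q12 + 2 * q3 - 3 * q11 + 3 * q2 + 6 * q1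
end
end

section
theorem tel1 (g : ℕ → ℚ) (r i : ℕ) (h : i ≤ r) : ∑ j ∈ range r, (if i ≤ j then g j - g (j+1) else 0) = g i - g r := by
  induction r with
  | zero => simp [show i = 0 by omega]
  | succ r ih =>
    rw [sum_range_succ]
    rcases Nat.lt_or_ge r i with h1 | h1
    · rw [sum_eq_zero fun j hj => if_neg (by have := mem_range.1 hj; omega), if_neg bo, show i = r + 1 by omega]; ring
    · rw [ih h1, if_pos h1]; ring
theorem tel2 (g : ℕ → ℚ) (r : ℕ) : ∑ j ∈ range r, ((j:ℚ) + 1) * (g j - g (j+1)) = ∑ j ∈ range (r+1), g j - (r+1) * g r := by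
  induction r with
  | zero => simp
  | succ r ih => rw [sum_range_succ, ih, sum_range_succ _ (r+1)]; push_cast; ring
theorem rho_rA (r : ℕ) : rhoA r = rA (r+1) := by ext i; simp [rhoA, rA]
def muK (r : ℕ) (κ : ℕ → ℤ) : Fin r → ℕ := fun j => (κ j.val - κ (j.val+1)).toNat
theorem slK (r : ℕ) (κ : ℕ → ℤ) (hd : ∀ j < r, κ (j+1) ≤ κ j) (hs : ∑ i ∈ range (r+1), κ i = 0) :
    slWt r (muK r κ) = fun i => (κ i.val : ℚ) := by
  have hm : ∀ j : Fin r, ((muK r κ j : ℕ) : ℚ) = (κ j.val : ℚ) - κ (j.val+1) := fun j => by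
    have : ((muK r κ j : ℕ) : ℤ) = κ j.val - κ (j.val+1) := Int.toNat_of_nonneg (by have := hd j j.2; omega)
    rw [← Int.cast_natCast, this]; push_cast; ring
  ext i
  have hs' : ∑ i ∈ range (r+1), (κ i : ℚ) = 0 := by exact_mod_cast hs
  rw [slWt, partLift, sum_filter]
  simp only [hm]
  rw [Fin.sum_univ_eq_sum_range (fun j => if i.val ≤ j then (κ j : ℚ) - κ (j+1) else 0) r, tel1 (fun j => (κ j : ℚ)) r i bo,
    Fin.sum_univ_eq_sum_range (fun j => ((j:ℚ) + 1) * ((κ j : ℚ) - κ (j+1))) r, tel2 (fun j => (κ j : ℚ)) r, hs']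
  have : (r:ℚ) + 1 ≠ 0 := by positivity
  field_simp; ring
def D6 (x : T6) : Prop := x.2.2.1 ≤ x.2.1 ∧ x.2.1 ≤ x.1 ∧ 0 ≤ x.2.2.1 ∧ x.2.2.2.1 ≤ x.2.2.2.2.1 ∧ x.2.2.2.2.1 ≤ x.2.2.2.2.2 ∧ x.2.2.2.2.2 ≤ 0 ∧
  x.1 + x.2.1 + x.2.2.1 + x.2.2.2.1 + x.2.2.2.2.1 + x.2.2.2.2.2 = 0
instance (x : T6) : Decidable (D6 x) := by unfold D6; infer_instance
theorem D6.sum (hN : 5 ≤ N) {x : T6} (h : D6 x) : ∑ i ∈ range N, K6' N x i = 0 := by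
  have : ∀ i y, i < N → ∑ n ∈ range N, bp i y n = y := fun i y hi => by simp only [bp]; rw [sum_ite_eq', if_pos (mem_range.2 hi)]
  simp only [K6', K6, sum_add_distrib]
  rw [this _ _ bo, this _ _ bo, this _ _ bo, this _ _ bo, this _ _ bo, this _ _ bo]
  exact h.2.2.2.2.2.2
theorem D6.dom (hN : 5 ≤ N) {x : T6} (h : D6 x) (j : ℕ) (hj : j + 1 < N) : K6' N x (j+1) ≤ K6' N x j := by
  obtain ⟨a, b, c, d, e, f⟩ := x
  simp only [D6] at h
  obtain ⟨h1, h2, h3, h4, h5, h6, -⟩ := h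
  simp only [K6']
  by_cases hc : N = 5
  · have hj4 : j < 4 := by omega
    subst hc
    interval_cases j <;> simp [K6, bp] <;> omega
  have e2 : K6 N a b c d e f 2 = c := by rw [k2 hN, bp_ne bo, add_zero]
  have e3 : K6 N a b c d e f (N-3) = f := by rw [k3 hN, bp_ne bo, zero_add]
  have e0 := k0 (a := a) (b := b) (c := c) (d := d) (e := e) (f := f) hN
  have e1 := k1 (a := a) (b := b) (c := c) (d := d) (e := e) (f := f) hN
  have e4 := k4 (a := a) (b := b) (c := c) (d := d) (e := e) (f := f) hN
  have e5 := k5 (a := a) (b := b) (c := c) (d := d) (e := e) (f := f) hN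
  by_cases c0 : j = 0
  · rw [c0, e0, e1]; exact h2
  by_cases c1 : j = 1
  · rw [c1, e1, e2]; exact h1
  by_cases c2 : j = N - 2
  · rw [c2, e4, show N - 2 + 1 = N - 1 by omega, e5]; exact h4
  by_cases c3 : j = N - 3
  · rw [c3, e3, show N - 3 + 1 = N - 2 by omega, e4]; exact h5
  refine le_trans (b := 0) ?_ ?_
  · by_cases c4 : j + 1 = N - 3
    · rw [c4, e3]; exact h6
    · rw [km _ bo bo]
  · by_cases c4 : j = 2
    · rw [c4, e2]; exact h3
    · rw [km _ bo bo]
theorem dec (hN : 5 ≤ r+1) {F : CharRing (r+1)} {s : List T6} (hn : s.Nodup) (hs : ∀ x ∈ s, D6 x)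
    (hi : r + 1 = 5 → ∀ x ∈ s, ∀ y ∈ s, x.1 = y.1 → x.2.1 = y.2.1 → x.2.2.2.1 = y.2.2.2.1 → x.2.2.2.2.1 = y.2.2.2.2.1 → x = y)
    (hF : F * V6 (r+1) 0 0 0 0 0 0 = S6 (r+1) s) : ∃ c : (Fin r → ℕ) →₀ ℕ, Decomp r F c ∧ ∀ μ, c μ ≤ 1 := by
  have hsl : ∀ x ∈ s.toFinset, slWt r (muK r (K6' (r+1) x)) = fun i => (K6' (r+1) x i.val : ℚ) := fun x hx =>
    slK r _ (fun j hj => (hs x (List.mem_toFinset.1 hx)).dom hN j bo) ((hs x (List.mem_toFinset.1 hx)).sum hN)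
  have hinj : ∀ x ∈ s.toFinset, ∀ y ∈ s.toFinset, muK r (K6' (r+1) x) = muK r (K6' (r+1) y) → x = y := fun x hx y hy h => by
    have h1 := hsl x hx
    rw [h, hsl y hy] at h1
    have h2 : ∀ n < r+1, K6' (r+1) x n = K6' (r+1) y n := fun n hn => by
      have := congrFun h1 ⟨n, hn⟩; exact_mod_cast this.symm
    have a0 := h2 0 bo
    have a1 := h2 1 bo
    have a2 := h2 2 bo
    have a4 := h2 (r+1-2) bo
    have a5 := h2 (r+1-1) bo
    simp only [K6'] at a0 a1 a2 a4 a5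
    rw [k0 hN, k0 hN] at a0
    rw [k1 hN, k1 hN] at a1
    rw [k4 hN, k4 hN] at a4
    rw [k5 hN, k5 hN] at a5
    rw [List.mem_toFinset] at hx hy
    by_cases h5 : r + 1 = 5
    · exact hi h5 x hx y hy a0 a1 a5 a4
    · rw [k2 hN, k2 hN, bp_ne bo, bp_ne bo] at a2
      have b := (hs x hx).2.2.2.2.2.2
      have b' := (hs y hy).2.2.2.2.2.2
      obtain ⟨_, _, _, _, _, _⟩ := x
      obtain ⟨_, _, _, _, _, _⟩ := y
      simp only [Prod.mk.injEq] at *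
      refine ⟨a0, a1, bo, a5, a4, bo⟩
  refine ⟨∑ x ∈ s.toFinset, Finsupp.single (muK r (K6' (r+1) x)) 1, ?_, fun μ => ?_⟩
  · rw [Decomp, ← Finsupp.sum_finsetSum_index bs (by intros; rw [Nat.cast_add, add_smul])]
    have e0 : altA r (rhoA r) = mono (fun _ => ((r+1:ℕ):ℚ) - 1) * V6 (r+1) 0 0 0 0 0 0 := by
      rw [V6, ← rA_sN, altA_eq, rho_rA]
      congr 1; ext i; simp [K6, bp]
    rw [e0, mul_left_comm, hF, S6, ← List.sum_toFinset _ hn, mul_sum]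
    refine sum_congr rfl fun x hx => ?_
    rw [← rA_sN, Finsupp.sum_single_index bs, Nat.cast_one, one_smul, hsl x hx, altA_eq, rho_rA, add_comm (rA (r+1))]
  · rw [Finsupp.finsetSum_apply]
    simp only [Finsupp.single_apply]
    rw [← card_filter]
    exact card_le_one.2 fun x hx y hy => hinj x (mem_filter.1 hx).1 y (mem_filter.1 hy).1 ((mem_filter.1 hx).2.trans (mem_filter.1 hy).2.symm)
end

section
def TT (c : Fin n → ℕ) (i : ℕ) : ℚ := ∑ k ∈ univ.filter (fun k : Fin n => i ≤ k.val), (c k : ℚ)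
theorem TT_step (c : Fin n → ℕ) (i : ℕ) (h : i < n) : TT c i = c ⟨i, h⟩ + TT c (i+1) := by
  have : univ.filter (fun k : Fin n => i ≤ k.val) = insert ⟨i, h⟩ (univ.filter (fun k : Fin n => i + 1 ≤ k.val)) := by
    ext k; simp [Fin.ext_iff]; omega
  rw [TT, this, sum_insert bs, TT]
theorem TT_end (c : Fin n → ℕ) (i : ℕ) (h : n ≤ i) : TT c i = 0 := sum_eq_zero fun k hk => by
  have := (mem_filter.1 hk).2; omega
theorem TT_anti (c : Fin n → ℕ) {i j : ℕ} (h : i ≤ j) : TT c j ≤ TT c i :=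
  sum_le_sum_of_subset_of_nonneg (fun k hk => by simp at *; omega) fun _ _ _ => Nat.cast_nonneg _
theorem TT_nonneg (c : Fin n → ℕ) (i : ℕ) : 0 ≤ TT c i := sum_nonneg fun _ _ => Nat.cast_nonneg _
theorem TT_int (c : Fin n → ℕ) (i : ℕ) : ∃ m : ℤ, TT c i = m :=
  ⟨∑ k ∈ univ.filter (fun k : Fin n => i ≤ k.val), (c k : ℤ), by rw [TT]; push_cast; rfl⟩
theorem slWt_inj {c d : Fin r → ℕ} (h : slWt r c = slWt r d) : c = d := by
  ext ⟨i, hi⟩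
  have h1 := congrFun h ⟨i, bo⟩
  have h2 := congrFun h ⟨i+1, bo⟩
  have h3 := TT_step c i hi
  have h4 := TT_step d i hi
  change TT c i - _ = TT d i - _ at h1
  change TT c (i+1) - _ = TT d (i+1) - _ at h2
  have : (c ⟨i, hi⟩ : ℚ) = d ⟨i, hi⟩ := by linarith
  exact_mod_cast this
theorem slWt_sa (c : Fin r → ℕ) : StrictAnti (slWt r c + rhoA r) := fun i j h => by
  have h1 := TT_anti c (i := i.val) (j := j.val) (le_of_lt h)
  have h2 : (i.val : ℚ) < j.val := by exact_mod_cast h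
  change TT c j - _ + ((r:ℚ) - j.val) < TT c i - _ + ((r:ℚ) - i.val)
  linarith
theorem dec_Bd {F : CharRing (r+1)} {c : (Fin r → ℕ) →₀ ℕ} (hd : Decomp r F c) (hc : ∀ μ, c μ ≤ 1) :
    Bd (F * al (r+1) (rA (r+1))) := by
  intro u
  rw [Decomp, altA_eq, rho_rA, Finsupp.sum] at hd
  rw [hd, ← cf_apply, map_sum]
  by_cases hu : ∃ μ ∈ c.support, (altA r (slWt r μ + rA (r+1))).coeff u ≠ 0
  · obtain ⟨μ, hμ, hn⟩ := hu
    rw [sum_eq_single_of_mem μ hμ, map_zsmul, cf_apply, altA_eq, smul_eq_mul, abs_mul]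
    · have h1 := al_coeff_abs (slWt r μ + rA (r+1)) u
      have h2 : |((c μ : ℕ) : ℤ)| ≤ 1 := by rw [Nat.abs_cast]; exact_mod_cast hc μ
      exact mul_le_one₀ h2 (abs_nonneg _) h1
    · intro ν _ hν
      by_contra h0
      have h0' : (al (r+1) (slWt r ν + rA (r+1))).coeff u ≠ 0 := fun h => h0 (by
        rw [map_zsmul, cf_apply, altA_eq, h, smul_zero])
      have e1 : ∃ σ, pre σ (slWt r μ + rA (r+1)) = u := by
        by_contra h; push Not at h; exact hn (al_coeff_of_not _ _ h)
      have e2 : ∃ σ, pre σ (slWt r ν + rA (r+1)) = u := by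
        by_contra h; push Not at h; exact h0' (al_coeff_of_not _ _ h)
      obtain ⟨σ, hσ⟩ := e1
      obtain ⟨τ, hτ⟩ := e2
      have a1 := slWt_sa (r := r) μ
      have a2 := slWt_sa (r := r) ν
      rw [rho_rA] at a1 a2
      have h3 := anti_unique _ _ a2.antitone a1.antitone (τ.symm.trans σ) (by
        ext i
        have h1 := congrFun hσ (τ.symm i)
        have h2 := congrFun hτ (τ.symm i)
        change (slWt r ν + rA (r+1)) (τ (τ.symm i)) = _ at h2
        rw [Equiv.apply_symm_apply] at h2
        exact h1.trans h2.symm)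
      exact hν (slWt_inj (add_right_cancel h3))
  · push Not at hu
    rw [sum_eq_zero fun μ hμ => by rw [map_zsmul, cf_apply, hu μ hμ, smul_zero]]
    simp
variable {t : CType} {n : ℕ}
def sh (t : CType) (n : ℕ) (c : Fin n → ℕ) : ℚ := match t with
      | .C => 0
      | .B => cval c (n - 1) / 2
      | .D => (cval c (n - 2) + cval c (n - 1)) / 2
theorem eps_eq (c : Fin n → ℕ) (i) : epsWt t n c i = TT c i.val - sh t n c := rfl
theorem eps_inj (ht : t ≠ CType.C) (hn : 2 ≤ n) {c d : Fin n → ℕ} (h : epsWt t n c = epsWt t n d) : c = d := by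
  have e : ∀ i (hi : i < n), TT c i - sh t n c = TT d i - sh t n d := fun i hi => congrFun h ⟨i, hi⟩
  have st : ∀ i (hi : i + 1 < n), c ⟨i, bo⟩ = d ⟨i, bo⟩ := fun i hi => by
    have h1 := e i bo
    have h2 := e (i+1) hi
    rw [TT_step c i bo] at h1
    rw [TT_step d i bo] at h1
    have : (c ⟨i, bo⟩ : ℚ) = d ⟨i, bo⟩ := by linarith
    exact_mod_cast this
  have h1 := e (n-1) bo
  rw [TT_step c (n-1) bo, TT_step d (n-1) bo, TT_end c _ bo, TT_end d _ bo] at h1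
  have h2 := st (n-2) bo
  have hl : (c ⟨n-1, bo⟩ : ℚ) = d ⟨n-1, bo⟩ := by
    cases t with
    | B => simp only [sh, cval, show n - 1 < n by omega, dite_true] at h1; linarith
    | C => exact absurd rfl ht
    | D => simp only [sh, cval, show n - 1 < n by omega, show n - 2 < n by omega, dite_true, h2] at h1; linarith
  ext ⟨i, hi⟩
  by_cases hi' : i + 1 < n
  · exact st i hi'
  · have : i = n - 1 := by omega
    subst this; exact_mod_cast hl
theorem eps_dom (ht : t ≠ CType.C) (hn : 2 ≤ n) (c : Fin n → ℕ) : DomY t (epsWt t n c) := by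
  have hB : ∀ i, i < n → (c ⟨n-1, bo⟩ : ℚ) ≤ TT c i := fun i hi => by
    have := TT_step c (n-1) bo
    have h1 := TT_anti c (show i ≤ n-1 by omega)
    have h2 := TT_nonneg c (n-1+1)
    linarith
  have hD : ∀ i, i + 1 < n → (c ⟨n-2, bo⟩ : ℚ) + c ⟨n-1, bo⟩ ≤ TT c i := fun i hi => by
    have := TT_step c (n-2) bo
    have h1 := TT_anti c (show i ≤ n-2 by omega)
    have h2 := hB (n-2+1) bo
    linarith
  have v1 : cval c (n-1) = c ⟨n-1, bo⟩ := by simp only [cval, show n - 1 < n by omega, dite_true]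
  have v2 : cval c (n-2) = c ⟨n-2, bo⟩ := by simp only [cval, show n - 2 < n by omega, dite_true]
  refine ⟨?_, fun i j hij => ?_, fun hD' i => ?_⟩
  · refine ⟨match t with | .C => 0 | .B => - (c ⟨n-1, bo⟩ : ℤ) | .D => - ((c ⟨n-2, bo⟩ : ℤ) + c ⟨n-1, bo⟩), fun i => ?_⟩
    obtain ⟨m, hm⟩ := TT_int c i.val
    refine ⟨m, ?_⟩
    rw [eps_eq, hm]
    cases t <;> simp only [sh, v1, v2] <;> push_cast <;> ring
  · have a := TT_anti c (show i.val ≤ j.val from le_of_lt hij)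
    have b := TT_nonneg c i.val
    have b' := TT_nonneg c j.val
    have h1 := hB j.val j.2
    have h2 := hD i.val (by have : i.val < j.val := hij; omega)
    rw [eps_eq, eps_eq, abs_le]
    refine ⟨?_, by linarith⟩
    cases t with
    | B => simp only [sh, v1]; linarith
    | C => exact absurd rfl ht
    | D => simp only [sh, v1, v2]; linarith
  · have h1 := hB i.val i.2
    have b := TT_nonneg c i.val
    rw [eps_eq]
    cases t with
    | B => simp only [sh, v1]; linarith
    | C => exact absurd rfl ht
    | D => exact absurd rfl hD'
theorem eps_s (hn : 5 ≤ n) (c : Fin n → ℕ) (x y z : ℕ) (hc : ∀ i : Fin n, c i = if i.val = 0 then x else if i.val = 1 then y else if i.val = 2 then z else 0) :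
    epsWt t n c = sY n (x+y+z) (y+z) z := by
  have h0 : ∀ i, 3 ≤ i → TT c i = 0 := fun i hi => sum_eq_zero fun k hk => by
    have := (mem_filter.1 hk).2
    rw [hc, if_neg bo, if_neg bo, if_neg bo, Nat.cast_zero]
  have t2 := TT_step c 2 bo
  have t1 := TT_step c 1 bo
  have t0 := TT_step c 0 bo
  rw [h0 _ le_rfl, hc] at t2
  rw [hc] at t1 t0
  norm_num at t2 t1 t0
  have v1 : cval c (n-1) = 0 := by simp only [cval, show n - 1 < n by omega, dite_true, hc]; rw [if_neg bo, if_neg bo, if_neg bo, Nat.cast_zero]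
  have v2 : cval c (n-2) = 0 := by simp only [cval, show n - 2 < n by omega, dite_true, hc]; rw [if_neg bo, if_neg bo, if_neg bo, Nat.cast_zero]
  have hs : sh t n c = 0 := by cases t <;> simp [sh, v1, v2]
  ext i
  rw [eps_eq, hs, sub_zero, sY]
  split_ifs with a b d
  · rw [a, t0, t1, t2]; ring
  · rw [b, t1, t2]
  · rw [d, t2]
  · exact h0 _ bo
end

section
variable {t : CType} {n r : ℕ}
theorem altA_V (r : ℕ) : altA r (rhoA r) = mono (fun _ => ((r+1:ℕ):ℚ) - 1) * V6 (r+1) 0 0 0 0 0 0 := by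
  rw [V6, ← rA_sN, altA_eq, rho_rA]
  congr 1; ext i; simp [K6, bp]
theorem chW (hr : 4 ≤ r) (w : Fin n → Fin (r+1) → ℚ) : WtSys t n r (e r 1 + e r r) w ↔
    mp (resH w) (ZY t n 1) = pA (r+1) 1 * pA (r+1) mo - 1 := by
  have hd : D6 (1,0,0,-1,0,0) := by decide
  have hδ : e r 1 + e r r = muK r (K6' (r+1) (1,0,0,-1,0,0)) := by
    ext ⟨j, hj⟩
    simp only [muK, K6', K6, bp, e, Pi.add_apply, ite_self]
    split_ifs <;> first | omega | contradiction
  have h1 : altA r (slWt r (e r 1 + e r r) + rhoA r) = mono (fun _ => ((r+1:ℕ):ℚ) - 1) * S6 (r+1) [(1,0,0,-1,0,0)] := by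
    rw [hδ, slK r _ (fun j hj => hd.dom bo j bo) (hd.sum bo), altA_eq, rho_rA, add_comm (fun i => _) (rA (r+1)), rA_sN, S6]
    simp
  have h2 := (Qs (N := r+1) bo rfl rfl rfl rfl rfl).1
  have hZ : mp (resH w) (ZY t n 1) = (∑ i : Fin n, (mono (w i) + mono (-(w i)))) + (if t = CType.B then mono (0 : Fin (r + 1) → ℚ) else 0) := by
    rw [res_ZY]
    simp only [one_smul, neg_smul]
    rfl
  rw [WtSys, h1, ← h2, ← hZ, mul_left_comm, ← altA_V]
  refine ⟨fun h => mul_right_cancel₀ ?_ h, fun h => by rw [h]⟩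
  rw [altA_eq, rho_rA]
  exact al_ne_zero _ (rA_SD _).sa.injective
def scH (k : ℕ) (c : ℚ) : (Fin k → ℚ) →+ (Fin k → ℚ) where
  toFun v := c • v
  map_zero' := smul_zero _
  map_add' := smul_add _
theorem mp_pA (k : ℕ) (c x : ℚ) : mp (scH k c) (pA k x) = pA k (c * x) := by
  rw [pA, map_sum, pA]
  refine sum_congr rfl fun i _ => ?_
  rw [mp_mono]
  change mono (c • Pi.single i x) = _
  rw [← Pi.single_smul, smul_eq_mul]
theorem chWc {w : Fin n → Fin (r+1) → ℚ} (h : mp (resH w) (ZY t n 1) = pA (r+1) 1 * pA (r+1) mo - 1) (c : ℚ) :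
    mp (resH w) (ZY t n c) = pA (r+1) c * pA (r+1) (-c) - 1 := by
  have h1 := congrArg (mp (scH (r+1) c)) h
  rw [map_sub, map_mul, mp_pA, mp_pA, map_one, mul_one, mul_neg_one] at h1
  rw [← h1, res_ZY, res_ZY, map_add, map_sum]
  congr 1
  · refine sum_congr rfl fun i _ => ?_
    rw [map_add, mp_mono, mp_mono]
    change _ = mono (c • (1:ℚ) • w i) + mono (c • (-1:ℚ) • w i)
    rw [one_smul, smul_smul, mul_neg_one]
  · split_ifs <;> simp
theorem MFok (ht : t ≠ CType.C) (hr : 4 ≤ r) (hn : 5 ≤ n) {lam : Fin n → ℕ}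
    (h : epsWt t n lam = sY n 1 1 0 ∨ epsWt t n lam = sY n 2 0 0 ∨ epsWt t n lam = sY n 3 0 0 ∨ epsWt t n lam = sY n 1 1 1) :
    IsMFRes t n r (e r 1 + e r r) lam := by
  intro w hw f hf
  rw [chW hr] at hw
  obtain ⟨-, q1, q2, q3, q4⟩ := Qs (N := r+1) bo rfl rfl (chWc hw 1) (chWc hw 2) (chWc hw 3)
  rw [IsCharY, altY_eq, altY_eq, add_comm (epsWt t n lam)] at hf
  have y1 := Yrel1 ht (n := n) bo
  have y2 := Yrel2 ht (n := n) bo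
  have y3 := Yrel3 ht (n := n) bo
  have y4 := Yrel4 ht (n := n) bo
  have y5 := Yrel5 ht (n := n) bo
  have y6 := Yrel6 ht (n := n) bo
  have hD := den_ne t n
  rw [← BY_0] at hD hf
  have fin2 : ∀ c : ℕ, ∀ {k A : CharRing n}, BY t n 0 0 0 * f = A → BY t n 0 0 0 * k = c * A → c * f = k := fun c {k A} h1 h2 =>
    mul_left_cancel₀ hD (by rw [h2, ← h1]; ring)
  rcases h with h | h | h | h <;> rw [h, ← BY.eq_1] at hf
  · have e := congrArg (mp (resH w)) (fin2 2 (k := ZY t n 1 ^ 2 - ZY t n 2) hf (by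
      push_cast; linear_combination ZY t n 1 * y1 + y2 - y3))
    simp only [map_mul, map_sub, map_pow, map_natCast] at e
    exact dec bo bd bd (fun _ => by decide) (q1 _ e)
  · have e := congrArg (mp (resH w)) (fin2 2 (k := ZY t n 1 ^ 2 + ZY t n 2 - 2) hf (by
      push_cast; linear_combination ZY t n 1 * y1 + y2 + y3))
    simp only [map_mul, map_sub, map_add, map_pow, map_natCast, map_ofNat] at e
    exact dec bo bd bd (fun _ => by decide) (q2 _ e)
  · have e := congrArg (mp (resH w)) (fin2 6 (k := ZY t n 1 ^ 3 + 3 * ZY t n 1 * ZY t n 2 + 2 * ZY t n 3 - 6 * ZY t n 1) hf (by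
      push_cast; linear_combination (ZY t n 1 ^ 2 - 2) * y1 + ZY t n 1 * y2 + y4 + y5 + 3 * (ZY t n 1 * y3 + y4 - y5) + 2 * y6))
    simp only [map_mul, map_sub, map_add, map_pow, map_natCast, map_ofNat] at e
    have e' := q3 _ e
    rw [sT'] at e'
    split_ifs at e' with h5
    · exact dec bo bd bd (fun _ => by decide) e'
    · exact dec bo bd bd (fun h => absurd h h5) e'
  · have e := congrArg (mp (resH w)) (fin2 6 (k := ZY t n 1 ^ 3 - 3 * ZY t n 1 * ZY t n 2 + 2 * ZY t n 3) hf (by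
      push_cast; linear_combination (ZY t n 1 ^ 2 - 2) * y1 + ZY t n 1 * y2 + y4 + y5 - 3 * (ZY t n 1 * y3 + y4 - y5) + 2 * y6))
    simp only [map_mul, map_sub, map_add, map_pow, map_natCast, map_ofNat] at e
    exact dec bo bd bd (fun _ => by decide) (q4 _ e)
theorem two_nn (z q : ℕ) : 2 * nn z q = 2 * z + q * (q - 1) := by
  induction q with
  | zero => simp [nn]
  | succ q ih =>
    rw [nn, mul_add, ih]
    rcases q with _ | q
    · simp
    · simp only [Nat.add_sub_cancel]; ring
theorem MFno (ht : t ≠ CType.C) (hz : 2 ≤ z) (hm2 : 2 ≤ m) (hm : mult t z = m + 2) {lam : Fin (m + 2 + nn z (m+2)) → ℕ}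
    (h : IsMFRes t (m + 2 + nn z (m+2)) (m+2) (e (m+2) 1 + e (m+2) (m+2)) lam) {μ : Fin (m + 2 + nn z (m+2)) → ℚ}
    (he : epsWt t (m + 2 + nn z (m+2)) lam = μ) :
    μ = 0 ∨ μ = sY _ 1 0 0 ∨ μ = sY _ 2 0 0 ∨ μ = sY _ 3 0 0 ∨ μ = sY _ 1 1 0 ∨ μ = sY _ 1 1 1 := by
  have hd := eps_dom ht bo lam
  obtain ⟨g, hg⟩ := exY ht hd
  obtain ⟨c, h1, h2⟩ := h (wext (wq z (m+2))) ((chW bo _).2 (by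
    have := Zq t z (m+2+1) 1
    rw [hm] at this
    push_cast at this
    have h' : mp (resH (wq z (m+2+1))) (ZY t (nn z (m+2+1)) 1) = pA (m+2+1) 1 * pA (m+2+1) mo - 1 := by linear_combination this
    exact h')) g (by rw [IsCharY, altY_eq, altY_eq]; exact hg.trans (congrArg _ (add_comm _ _)))
  rw [he] at hg hd
  exact notMF ht hz hm2 hm hd hg (dec_Bd h1 h2)
end

section
theorem main_aux
    (l n : ℕ) (t : CType) (δ : Fin (l + 1) → ℕ) (lam : Fin n → ℕ)
    (hl : 3 ≤ l)
    (hδ : δ = e (l + 1) 1 + e (l + 1) (l + 1))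
    (ht : t ≠ CType.C)
    (hdim : 2 * (n : ℚ) + (if t = CType.B then 1 else 0) = ((l : ℚ) + 2) ^ 2 - 1)
    (hlam0 : lam ≠ 0) (hlam1 : lam ≠ e n 1) :
    IsMFRes t n (l + 1) δ lam ↔
      (lam = e n 2 ∨ lam = 2 • e n 1 ∨ lam = 3 • e n 1 ∨ lam = e n 3) := by
  subst hδ
  obtain ⟨m, rfl⟩ : ∃ m, l = m + 1 := ⟨l - 1, bo⟩
  have hN : 2 * n + (if t = CType.B then 1 else 0) = (m + 2) * (m + 4) := by
    have : ((2 * n + (if t = CType.B then 1 else 0) : ℕ) : ℚ) = ((m + 2) * (m + 4) : ℕ) := by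
      push_cast
      rw [hdim]; push_cast; ring
    exact_mod_cast this
  obtain ⟨z, hz⟩ : ∃ z, mult t z = m + 2 := by
    refine ⟨(m+2)/2, ?_⟩
    unfold mult
    rcases Nat.even_or_odd' m with ⟨k, rfl | rfl⟩
    · have : (2 * k + 2) * (2 * k + 4) = 2 * ((k+1) * (2*k+4)) := by ring
      split_ifs at hN ⊢ <;> omega
    · have : (2 * k + 1 + 2) * (2 * k + 1 + 4) = 2 * (2 * k * k + 8 * k + 7) + 1 := by ring
      split_ifs at hN ⊢ <;> omega
  have h2 := two_nn z (m+2+1)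
  have hz' := hz
  unfold mult at hz'
  have hn : n = m + 2 + nn z (m+2) := by
    have : nn z (m+2+1) = m + 2 + nn z (m+2) := rfl
    rw [this] at h2
    have h3 : (m+2+1) * (m+2+1-1) + (m + 2) = (m+2)*(m+4) := by
      simp only [Nat.add_sub_cancel]; ring
    omega
  have hz2 : 2 ≤ z := by split_ifs at hz' <;> omega
  have h5 : 5 ≤ n := by nlinarith [hN, (show (if t = CType.B then 1 else 0) ≤ 1 by split_ifs <;> omega)]
  have E0 : epsWt t n 0 = 0 := by
    rw [eps_s h5 0 0 0 0 (fun i => by simp)]; simp [sYz]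
  have E1 : epsWt t n (e n 1) = sY n 1 0 0 := by
    rw [eps_s h5 _ 1 0 0 (fun i => by simp [e])]; simp
  have E2 : epsWt t n (2 • e n 1) = sY n 2 0 0 := by
    rw [eps_s h5 _ 2 0 0 (fun i => by simp [e])]; simp
  have E3 : epsWt t n (3 • e n 1) = sY n 3 0 0 := by
    rw [eps_s h5 _ 3 0 0 (fun i => by simp [e])]; simp
  have E4 : epsWt t n (e n 2) = sY n 1 1 0 := by
    rw [eps_s h5 _ 0 1 0 (fun i => by simp only [e]; split_ifs <;> omega)]; simp
  have E5 : epsWt t n (e n 3) = sY n 1 1 1 := by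
    rw [eps_s h5 _ 0 0 1 (fun i => by simp only [e]; split_ifs <;> omega)]; simp
  constructor
  · intro h
    have key : ∀ c, epsWt t n lam = epsWt t n c → lam = c := fun c => eps_inj ht bo
    subst hn
    rcases MFno ht hz2 bo hz h rfl with h | h | h | h | h | h
    · exact absurd (key _ (h.trans E0.symm)) hlam0
    · exact absurd (key _ (h.trans E1.symm)) hlam1
    · exact .inr (.inl (key _ (h.trans E2.symm)))
    · exact .inr (.inr (.inl (key _ (h.trans E3.symm))))
    · exact .inl (key _ (h.trans E4.symm))
    · exact .inr (.inr (.inr (key _ (h.trans E5.symm))))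
  · intro h
    refine MFok ht bo h5 ?_
    rcases h with rfl | rfl | rfl | rfl <;> simp only [E2, E3, E4, E5, true_or, or_true]
end
end MFAux
end


theorem thm_adjoint_general
    (l n : ℕ) (t : CType) (δ : Fin (l + 1) → ℕ) (lam : Fin n → ℕ)
    (hl : 3 ≤ l)
    (hδ : δ = e (l + 1) 1 + e (l + 1) (l + 1))
    (ht : t ≠ CType.C)
    (hdim : 2 * (n : ℚ) + (if t = CType.B then 1 else 0) = ((l : ℚ) + 2) ^ 2 - 1)
    (hlam0 : lam ≠ 0) (hlam1 : lam ≠ e n 1) :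
    IsMFRes t n (l + 1) δ lam ↔
      (lam = e n 2 ∨ lam = 2 • e n 1 ∨ lam = 3 • e n 1 ∨ lam = e n 3) := by
  exact MFAux.main_aux l n t δ lam hl hδ ht hdim hlam0 hlam1
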